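/- Let F be a Minkowski norm on ℝⁿ, let Ω ⊆ ℝⁿ be an open set with smooth boundary such that Ω^c is bounded and nonempty, and let 1 < p < n. Then there exists a unique positive function v_p on the closure of Ω, of class C¹ with locally Hölder continuous gradient, which is a weak solution of the anisotropic p-Laplace problem div(F(∇v)^{p−1} F_ξ(∇v)) = 0 in Ω, v = 1 on ∂Ω, and v(x) → 0 as |x| → +∞. -/

import Mathlib

open MeasureTheory Filter Topology Metric Set
open scoped RealInnerProductSpace NNReal

noncomputable section

abbrev En (n : ℕ) := EuclideanSpace ℝ (Fin n)

/-- A Minkowski norm on ℝⁿ: a norm (convex, even, 1-homogeneous, positive away from 0)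
which is smooth away from the origin and whose Hessian of `F²/2` is positive definite
on `ℝⁿ \ {0}`. -/
structure MinkowskiNorm (n : ℕ) where
  F : En n → ℝ
  convexOn : ConvexOn ℝ Set.univ F
  even : ∀ ξ, F (-ξ) = F ξ
  homog : ∀ c : ℝ, 0 ≤ c → ∀ ξ, F (c • ξ) = c * F ξ
  pos : ∀ ξ : En n, ξ ≠ 0 → 0 < F ξ
  smooth : ContDiffOn ℝ (⊤ : ℕ∞) F {(0 : En n)}ᶜ
  elliptic : ∀ ξ : En n, ξ ≠ 0 → ∀ v : En n, v ≠ 0 →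
    0 < fderiv ℝ (fun x => fderiv ℝ (fun y => F y ^ 2 / 2) x) ξ v v

/-- Locally Lipschitz on a set (i.e. `C^{0,1}_loc`). -/
def LocLipOn {n : ℕ} (f : En n → ℝ) (s : Set (En n)) : Prop :=
  ∀ x ∈ s, ∃ (K : ℝ≥0) (t : Set (En n)), t ∈ nhdsWithin x s ∧ LipschitzOnWith K f t

/-- Weak solution of `div(F_ξ(∇u)) = F(∇u)` in `Ω` in the sense of Huisken–Ilmanen's
minimization principle. -/
def IsWeakSolIAMCF {n : ℕ} (N : MinkowskiNorm n) (Ω : Set (En n)) (u : En n → ℝ) : Prop :=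
  LocLipOn u Ω ∧
  ∀ K : Set (En n), IsCompact (closure K) → closure K ⊆ Ω →
    ∀ φ : En n → ℝ, LocLipOn φ Ω → (∀ x ∈ Ω \ K, φ x = u x) →
      (∫ x in K, (N.F (gradient u x) + u x * N.F (gradient u x))) ≤
        ∫ x in K, (N.F (gradient φ x) + φ x * N.F (gradient u x))

/-- Weak subsolution: the minimization inequality holds for competitors `φ ≤ u`. -/
def IsWeakSubSolIAMCF {n : ℕ} (N : MinkowskiNorm n) (Ω : Set (En n)) (u : En n → ℝ) : Prop :=
  LocLipOn u Ω ∧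
  ∀ K : Set (En n), IsCompact (closure K) → closure K ⊆ Ω →
    ∀ φ : En n → ℝ, LocLipOn φ Ω → (∀ x ∈ Ω \ K, φ x = u x) → (∀ x ∈ Ω, φ x ≤ u x) →
      (∫ x in K, (N.F (gradient u x) + u x * N.F (gradient u x))) ≤
        ∫ x in K, (N.F (gradient φ x) + φ x * N.F (gradient u x))

/-- Weak supersolution: the minimization inequality holds for competitors `φ ≥ u`. -/
def IsWeakSuperSolIAMCF {n : ℕ} (N : MinkowskiNorm n) (Ω : Set (En n)) (u : En n → ℝ) : Prop :=
  LocLipOn u Ω ∧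
  ∀ K : Set (En n), IsCompact (closure K) → closure K ⊆ Ω →
    ∀ φ : En n → ℝ, LocLipOn φ Ω → (∀ x ∈ Ω \ K, φ x = u x) → (∀ x ∈ Ω, u x ≤ φ x) →
      (∫ x in K, (N.F (gradient u x) + u x * N.F (gradient u x))) ≤
        ∫ x in K, (N.F (gradient φ x) + φ x * N.F (gradient u x))

/-- A smooth compactly supported test function on `Ω`. -/
def IsTestFun {n : ℕ} (Ω : Set (En n)) (ψ : En n → ℝ) : Prop :=
  ContDiff ℝ (⊤ : ℕ∞) ψ ∧ HasCompactSupport ψ ∧ tsupport ψ ⊆ Ω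

/-- Weak solution of the Finsler `p`-Laplace equation `div(F(∇v)^{p-1} F_ξ(∇v)) = 0` in `Ω`. -/
def IsWeakPHarmonic {n : ℕ} (N : MinkowskiNorm n) (Ω : Set (En n)) (p : ℝ)
    (v : En n → ℝ) : Prop :=
  ∀ ψ : En n → ℝ, IsTestFun Ω ψ →
    (∫ x in Ω, N.F (gradient v x) ^ (p - 1) *
      ⟪gradient N.F (gradient v x), gradient ψ x⟫) = 0

/-- Weak solution of `div(F(∇u)^{p-1} F_ξ(∇u)) = F(∇u)^p` in `Ω`. -/
def IsWeakPSol {n : ℕ} (N : MinkowskiNorm n) (Ω : Set (En n)) (p : ℝ)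
    (u : En n → ℝ) : Prop :=
  ∀ ψ : En n → ℝ, IsTestFun Ω ψ →
    (∫ x in Ω, N.F (gradient u x) ^ (p - 1) *
      ⟪gradient N.F (gradient u x), gradient ψ x⟫) =
      - ∫ x in Ω, N.F (gradient u x) ^ p * ψ x

/-- The polar (dual) norm `F^o(x) = sup_{ξ ≠ 0} ⟨ξ, x⟩ / F(ξ)`. -/
def polarF {n : ℕ} (N : MinkowskiNorm n) (x : En n) : ℝ :=
  sSup {c : ℝ | ∃ ξ : En n, ξ ≠ 0 ∧ c = ⟪ξ, x⟫ / N.F ξ}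

/-- The Wulff shape of radius `r` centered at `x₀`: `{x : F^o(x - x₀) < r}`. -/
def Wulff {n : ℕ} (N : MinkowskiNorm n) (r : ℝ) (x₀ : En n) : Set (En n) :=
  {x | polarF N (x - x₀) < r}

/-- `Ω` is an open set with smooth boundary: it is a smooth sublevel set of a smooth
function with nonvanishing gradient on the boundary. -/
def HasSmoothBoundary {n : ℕ} (Ω : Set (En n)) : Prop :=
  ∃ f : En n → ℝ, ContDiff ℝ (⊤ : ℕ∞) f ∧ Ω = {x | f x < 0} ∧
    ∀ x ∈ frontier Ω, fderiv ℝ f x ≠ 0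

/-- `C¹` on `s` with locally Hölder continuous gradient (i.e. `C^{1,α}_loc`). -/
def C1LocHolderOn {n : ℕ} (v : En n → ℝ) (s : Set (En n)) : Prop :=
  ContDiffOn ℝ 1 v s ∧
  ∀ x ∈ s, ∃ (α C : ℝ≥0), 0 < α ∧ (α : ℝ) ≤ 1 ∧
    ∃ t ∈ nhdsWithin x s, HolderOnWith C α (fun y => gradient v y) t

/-- Divergence of a vector field on `ℝⁿ`. -/
def divg {n : ℕ} (V : En n → En n) (x : En n) : ℝ :=
  ∑ i : Fin n, fderiv ℝ V x (EuclideanSpace.single i 1) i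

namespace PCapacity

section GradientCalculus

variable {n : ℕ} {f g : En n → ℝ} {x : En n} {K K' : ℝ≥0}

theorem norm_gradient_eq (f : En n → ℝ) (x : En n) : ‖gradient f x‖ = ‖fderiv ℝ f x‖ := by
  simp [gradient]

theorem norm_gradient_le (hf : LipschitzWith K f) (x : En n) : ‖gradient f x‖ ≤ K := by
  rw [norm_gradient_eq]
  exact norm_fderiv_le_of_lipschitz ℝ hf

theorem measurable_gradient (f : En n → ℝ) : Measurable (gradient f) :=
  (InnerProductSpace.toDual ℝ (En n)).symm.continuous.measurable.comp (measurable_fderiv ℝ f)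

theorem gradient_add (hf : DifferentiableAt ℝ f x) (hg : DifferentiableAt ℝ g x) :
    gradient (fun y => f y + g y) x = gradient f x + gradient g x := by
  simp [gradient, fderiv_fun_add hf hg]

theorem gradient_sub (hf : DifferentiableAt ℝ f x) (hg : DifferentiableAt ℝ g x) :
    gradient (fun y => f y - g y) x = gradient f x - gradient g x := by
  simp [gradient, fderiv_fun_sub hf hg]

theorem gradient_neg (f : En n → ℝ) (x : En n) :
    gradient (fun y => -f y) x = -gradient f x := by
  simp [gradient, fderiv_fun_neg]

theorem gradient_sub_const (f : En n → ℝ) (c : ℝ) (x : En n) :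
    gradient (fun y => f y - c) x = gradient f x := by
  simp [gradient, fderiv_sub_const]

theorem gradient_const_sub (f : En n → ℝ) (c : ℝ) (x : En n) :
    gradient (fun y => c - f y) x = -gradient f x := by
  simp [gradient, fderiv_const_sub]

theorem gradient_const_mul (f : En n → ℝ) (c : ℝ) (x : En n) :
    gradient (fun y => c * f y) x = c • gradient f x := by
  have : fderiv ℝ (fun y => c * f y) x = c • fderiv ℝ f x := 
    congrFun (fderiv_const_smul_field (𝕜 := ℝ) (f := f) c) x
  simp [gradient, this]

theorem gradient_mul (hf : DifferentiableAt ℝ f x) (hg : DifferentiableAt ℝ g x) :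
    gradient (fun y => f y * g y) x = f x • gradient g x + g x • gradient f x := by
  simp [gradient, fderiv_fun_mul hf hg]

theorem gradient_comp_add_right (f : En n → ℝ) (h x : En n) :
    gradient (fun y => f (y + h)) x = gradient f (x + h) := by
  simp [gradient, fderiv_comp_add_right]

theorem gradient_comp_smul (f : En n → ℝ) (r : ℝ) (h x : En n) :
    gradient (fun y => f (h + r • y)) x = r • gradient f (h + r • x) := by
  have h1 : fderiv ℝ (fun y => f (h + r • y)) x = r • fderiv ℝ (fun y => f (h + y)) (r • x) :=
    fderiv_comp_smul (f := fun y => f (h + y)) (c := r) (x := x)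
  simp [gradient, h1, fderiv_comp_add_left]

theorem differentiableAt_ae (hf : LipschitzWith K f) : ∀ᵐ x, DifferentiableAt ℝ f x :=
  hf.ae_differentiableAt

theorem lipschitz_posPart (hf : LipschitzWith K f) :
    LipschitzWith K (fun y => max (f y) 0) := hf.max_const 0

theorem gradient_eq_zero_of_isMin (h : ∀ y, f x ≤ f y) : gradient f x = 0 := by
  have : fderiv ℝ f x = 0 := IsLocalMin.fderiv_eq_zero (Eventually.of_forall h)
  simp [gradient, this]

theorem ae_gradient_posPart (hf : LipschitzWith K f) :
    ∀ᵐ x, gradient (fun y => max (f y) 0) x = (if 0 < f x then gradient f x else 0) ∧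
      (f x = 0 → gradient f x = 0) := by
  have h1 := differentiableAt_ae (lipschitz_posPart hf)
  have h2 := differentiableAt_ae (lipschitz_posPart hf.neg)
  filter_upwards [h1, h2] with x h1 h2
  have key : f x ≤ 0 → gradient (fun y => max (f y) 0) x = 0 := fun h =>
    gradient_eq_zero_of_isMin fun y => by simp [h]
  refine ⟨?_, fun h0 => ?_⟩
  · split_ifs with hpos
    · apply Filter.EventuallyEq.gradient_eq
      filter_upwards [hf.continuous.continuousAt.eventually (lt_mem_nhds hpos)] with y hy
      exact max_eq_left hy.le
    · exact key (not_lt.mp hpos)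
  · have key' : gradient (fun y => max ((-f) y) 0) x = 0 :=
      gradient_eq_zero_of_isMin fun y => by simp [h0]
    have e : f = fun y => max (f y) 0 - max ((-f) y) 0 := by
      funext y
      simp only [Pi.neg_apply]
      rcases le_total (f y) 0 with h | h
      · rw [max_eq_right h, max_eq_left (by linarith)]; ring
      · rw [max_eq_left h, max_eq_right (by linarith)]; ring
    rw [e, gradient_sub h1 h2, key h0.le, key', sub_zero]

theorem ae_gradient_max_const (hf : LipschitzWith K f) (c : ℝ) :
    ∀ᵐ x, gradient (fun y => max (f y - c) 0) x = (if c < f x then gradient f x else 0) := by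
  have h : LipschitzWith K (fun y => f y - c) := by
    simpa using hf.sub (LipschitzWith.const c)
  filter_upwards [ae_gradient_posPart h] with x hx
  rw [hx.1, gradient_sub_const]
  simp [sub_pos]

end GradientCalculus

section Mollify

open ContinuousLinearMap Convolution

variable {n : ℕ} {f : En n → ℝ} {K : ℝ≥0}

/-- A standard bump function with support of radius `1 / (k + 1)`. -/
def bump (n k : ℕ) : ContDiffBump (0 : En n) where
  rIn := 1 / (2 * ((k : ℝ) + 1))
  rOut := 1 / ((k : ℝ) + 1)
  rIn_pos := by positivity
  rIn_lt_rOut := by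
    apply one_div_lt_one_div_of_lt <;> [positivity; linarith [(Nat.cast_nonneg k : (0 : ℝ) ≤ k)]]

/-- Mollification at scale `1 / (k + 1)`. -/
def mollify (f : En n → ℝ) (k : ℕ) : En n → ℝ :=
  (bump n k).normed volume ⋆[lsmul ℝ ℝ, volume] f

theorem contDiff_mollify (hf : Continuous f) (k : ℕ) : ContDiff ℝ (⊤ : ℕ∞) (mollify f k) :=
  (bump n k).hasCompactSupport_normed.contDiff_convolution_left _
    (bump n k).contDiff_normed hf.locallyIntegrable

theorem abs_mollify_sub_le (hf : LipschitzWith K f) (k : ℕ) (x : En n) :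
    |mollify f k x - f x| ≤ K * (1 / ((k : ℝ) + 1)) := by
  have := (bump n k).dist_normed_convolution_le (μ := volume) (x₀ := x) (g := f)
    (ε := K * (1 / ((k : ℝ) + 1))) hf.continuous.aestronglyMeasurable (fun y hy => by
      refine (hf.dist_le_mul y x).trans ?_
      gcongr
      exact (mem_ball.mp hy).le)
  simpa [mollify, Real.dist_eq] using this

theorem hasFDerivAt_mollify (hf : LipschitzWith K f) (k : ℕ) (x : En n) :
    HasFDerivAt (mollify f k)
      (((bump n k).normed volume ⋆[lsmul ℝ ℝ, volume] (fderiv ℝ f)) x) x := by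
  set ρ := (bump n k).normed volume with hρ
  have hρc : Continuous ρ := (bump n k).continuous_normed
  have hρs : HasCompactSupport ρ := (bump n k).hasCompactSupport_normed
  have hρi : Integrable ρ := hρc.integrable_of_hasCompactSupport hρs
  have := (hasFDerivAt_integral_of_dominated_loc_of_lip (μ := (volume : Measure (En n))) (𝕜 := ℝ)
    (F := fun x t => ρ t * f (x - t)) (F' := fun t => ρ t • fderiv ℝ f (x - t))
    (bound := fun t => ρ t * K) (x₀ := x) (s := univ) Filter.univ_mem ?_ ?_ ?_ ?_ ?_ ?_).2
  · exact this
  · exact Eventually.of_forall fun y =>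
      (hρc.mul (hf.continuous.comp (by fun_prop))).aestronglyMeasurable
  · exact (hρc.mul (hf.continuous.comp (by fun_prop))).integrable_of_hasCompactSupport hρs.mul_right
  · exact (hρc.measurable.smul ((measurable_fderiv ℝ f).comp
      (measurable_const.sub measurable_id))).aestronglyMeasurable
  · refine Eventually.of_forall fun t => LipschitzOnWith.of_dist_le_mul fun y _ z _ => ?_
    have h0 : 0 ≤ ρ t := (bump n k).nonneg_normed t
    have h1 := hf.dist_le_mul (y - t) (z - t)
    rw [dist_sub_right, Real.dist_eq] at h1
    rw [Real.dist_eq, ← mul_sub, abs_mul, abs_of_nonneg h0]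
    have e : |ρ t * (K : ℝ)| = ρ t * K := abs_of_nonneg (mul_nonneg h0 K.coe_nonneg)
    rw [Real.coe_nnabs, e, mul_assoc]
    exact mul_le_mul_of_nonneg_left h1 h0
  · exact hρi.mul_const _
  · have hd : ∀ᵐ t : En n, DifferentiableAt ℝ f (x - t) :=
      (quasiMeasurePreserving_sub_left volume x).ae (differentiableAt_ae hf)
    filter_upwards [hd] with t ht
    have h2 : HasFDerivAt (fun y => f (y - t)) (fderiv ℝ f (x - t)) x := by
      have := ht.hasFDerivAt.comp x ((hasFDerivAt_id x).sub_const t)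
      rwa [ContinuousLinearMap.comp_id] at this
    exact h2.const_mul (ρ t)

theorem norm_gradient_mollify_le (hf : LipschitzWith K f) {M : ℝ}
    (hM : ∀ᵐ x, ‖gradient f x‖ ≤ M) (k : ℕ) (x : En n) : ‖gradient (mollify f k) x‖ ≤ M := by
  rw [norm_gradient_eq, (hasFDerivAt_mollify hf k x).fderiv]
  set ρ := (bump n k).normed volume with hρ
  have hρi : Integrable ρ := (bump n k).continuous_normed.integrable_of_hasCompactSupport
    (bump n k).hasCompactSupport_normed
  have h1 : ‖(ρ ⋆[lsmul ℝ ℝ, volume] (fderiv ℝ f)) x‖ ≤ ∫ t, ρ t * M := by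
    apply norm_integral_le_of_norm_le (hρi.mul_const M)
    have hd : ∀ᵐ t : En n, ‖gradient f (x - t)‖ ≤ M :=
      (quasiMeasurePreserving_sub_left volume x).ae hM
    filter_upwards [hd] with t ht
    rw [norm_gradient_eq] at ht
    have h0 : 0 ≤ ρ t := (bump n k).nonneg_normed t
    simp only [lsmul_apply, norm_smul, Real.norm_eq_abs, abs_of_nonneg h0]
    gcongr
  rwa [integral_mul_const, (bump n k).integral_normed, one_mul] at h1

theorem lipschitz_mollify (hf : LipschitzWith K f) (k : ℕ) : LipschitzWith K (mollify f k) := by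
  apply lipschitzWith_of_nnnorm_fderiv_le (𝕜 := ℝ)
    ((contDiff_mollify hf.continuous k).differentiable (by simp))
  intro x
  have := norm_gradient_mollify_le hf (Eventually.of_forall (norm_gradient_le hf)) k x
  rw [norm_gradient_eq] at this
  exact this

theorem ae_tendsto_gradient_mollify (hf : LipschitzWith K f) :
    ∀ᵐ x, Tendsto (fun k => gradient (mollify f k) x) atTop (𝓝 (gradient f x)) := by
  have hloc : LocallyIntegrable (fderiv ℝ f) (volume : Measure (En n)) := by
    refine (locallyIntegrable_const (K : ℝ)).mono
      (measurable_fderiv ℝ f).aestronglyMeasurable (Eventually.of_forall fun x => ?_)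
    simpa using norm_fderiv_le_of_lipschitz ℝ hf
  have h := ContDiffBump.ae_convolution_tendsto_right_of_locallyIntegrable (μ := volume)
    (φ := bump n) (l := atTop) (K := 2) tendsto_one_div_add_atTop_nhds_zero_nat
    (Eventually.of_forall fun k => by
      change 1 / ((k : ℝ) + 1) ≤ 2 * (1 / (2 * ((k : ℝ) + 1)))
      apply le_of_eq; field_simp) hloc
  filter_upwards [h] with x hx
  have h2 := ((InnerProductSpace.toDual ℝ (En n)).symm.continuous.tendsto _).comp hx
  refine h2.congr fun k => ?_
  simp only [Function.comp, gradient, (hasFDerivAt_mollify hf k x).fderiv]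

theorem tsupport_mollify (f : En n → ℝ) (k : ℕ) :
    tsupport (mollify f k) ⊆ cthickening (1 / ((k : ℝ) + 1)) (tsupport f) := by
  refine closure_minimal (fun x hx => ?_) isClosed_cthickening
  by_contra hcon
  apply hx
  have hz : ∀ y ∈ ball x (1 / ((k : ℝ) + 1)), f y = 0 := by
    intro y hy
    by_contra hy0
    exact hcon (mem_cthickening_of_dist_le x y _ _ (subset_tsupport f hy0)
      (by rw [dist_comm]; exact (mem_ball.mp hy).le))
  have hx0 : f x = 0 := hz x (mem_ball_self (by positivity))
  have := (bump n k).normed_convolution_eq_right (μ := volume) (x₀ := x) (g := f)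
    (fun y hy => by rw [hz y hy, hx0])
  rw [mollify, this, hx0]

theorem tendsto_mollify (hf : LipschitzWith K f) (x : En n) :
    Tendsto (fun k => mollify f k x) atTop (𝓝 (f x)) := by
  rw [tendsto_iff_dist_tendsto_zero]
  refine squeeze_zero (fun _ => dist_nonneg) (fun k => abs_mollify_sub_le hf k x) ?_
  simpa using (tendsto_one_div_add_atTop_nhds_zero_nat (𝕜 := ℝ)).const_mul (K : ℝ)

theorem lipschitz_of_ae_gradient_le (hf : LipschitzWith K f) {M : ℝ≥0}
    (hM : ∀ᵐ x, ‖gradient f x‖ ≤ M) : LipschitzWith M f := by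
  refine LipschitzWith.of_dist_le_mul fun x y => ?_
  have hk : ∀ k, LipschitzWith M (mollify f k) := fun k => by
    apply lipschitzWith_of_nnnorm_fderiv_le (𝕜 := ℝ)
      ((contDiff_mollify hf.continuous k).differentiable (by simp))
    intro x
    have := norm_gradient_mollify_le hf hM k x
    rw [norm_gradient_eq] at this
    exact this
  exact le_of_tendsto ((tendsto_mollify hf x).dist (tendsto_mollify hf y))
    (Eventually.of_forall fun k => (hk k).dist_le_mul x y)

theorem eq_zero_of_gradient_eq_zero (hf : LipschitzWith K f) (h0 : ∀ᵐ x, gradient f x = 0)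
    {z : En n} (hz : f z = 0) (x : En n) : f x = 0 := by
  have := lipschitz_of_ae_gradient_le hf (M := 0) (by filter_upwards [h0] with x hx; simp [hx])
  have h := this.dist_le_mul x z
  simpa [hz] using h

end Mollify


section Sobolev

open Module

variable {n : ℕ} {f : En n → ℝ} {K : ℝ≥0}

theorem tendsto_setIntegral_norm_gradient_mollify (hf : LipschitzWith K f) {S : Set (En n)}
    (hS : volume S ≠ ⊤) :
    Tendsto (fun k => ∫ x in S, ‖gradient (mollify f k) x‖) atTop
      (𝓝 (∫ x in S, ‖gradient f x‖)) := by
  apply tendsto_integral_of_dominated_convergence (fun _ => (K : ℝ))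
  · exact fun k => (measurable_gradient _).norm.aestronglyMeasurable
  · exact integrableOn_const hS
  · intro k
    refine Eventually.of_forall fun x => ?_
    rw [norm_norm]
    exact norm_gradient_le (lipschitz_mollify hf k) x
  · exact (ae_restrict_of_ae (ae_tendsto_gradient_mollify hf)).mono fun x hx => hx.norm

theorem gradient_eq_zero_of_notMem_tsupport {x : En n} (hx : x ∉ tsupport f) :
    gradient f x = 0 := by
  have : fderiv ℝ f x = 0 := by
    by_contra h
    exact hx (support_fderiv_subset ℝ h)
  simp [gradient, this]

theorem integrable_norm_gradient (hf : LipschitzWith K f) (hc : HasCompactSupport f) :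
    Integrable (fun x => ‖gradient f x‖) := by
  have : IntegrableOn (fun x => ‖gradient f x‖) (tsupport f) := by
    refine Measure.integrableOn_of_bounded (M := K) hc.measure_lt_top.ne
      (measurable_gradient f).norm.aestronglyMeasurable (Eventually.of_forall fun x => ?_)
    rw [norm_norm]
    exact norm_gradient_le hf x
  refine (integrableOn_iff_integrable_of_support_subset fun x hx => ?_).mp this
  by_contra h
  exact hx (by simp [gradient_eq_zero_of_notMem_tsupport h])

theorem weak_sobolev_smooth (hn : 2 ≤ n) : ∃ C : ℝ, 0 ≤ C ∧ ∀ f : En n → ℝ, ContDiff ℝ 1 f →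
    HasCompactSupport f → ∀ t : ℝ, 0 < t →
      t ^ n * volume.real {x | t ≤ |f x|} ^ (n - 1) ≤ C * (∫ x, ‖gradient f x‖) ^ n := by
  have hn1 : (1 : ℝ) < n := by exact_mod_cast hn
  set q : ℝ := Real.conjExponent n with hq
  have hc : Real.HolderConjugate (finrank ℝ (En n)) q := by
    rw [finrank_euclideanSpace, Fintype.card_fin]
    exact Real.HolderConjugate.conjExponent hn1
  have hqe : q * ((n - 1 : ℕ) : ℝ) = n := by
    rw [hq, Real.conjExponent, Nat.cast_sub (by omega)]
    push_cast
    field_simp [sub_ne_zero.mpr hn1.ne']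
  have hq0 : 0 ≤ q := hc.symm.nonneg
  set C : ℝ≥0 := lintegralPowLePowLIntegralFDerivConst (volume : Measure (En n)) q
  refine ⟨(C : ℝ) ^ (n - 1), by positivity, fun f hf hfc t ht => ?_⟩
  have h1 := lintegral_pow_le_pow_lintegral_fderiv volume hf hfc hc
  have h2 := mul_meas_ge_le_lintegral (μ := volume)
    (f := fun x => ‖f x‖ₑ ^ q) (hf.continuous.measurable.enorm.pow_const q) (ENNReal.ofReal t ^ q)
  have hset : {x | ENNReal.ofReal t ^ q ≤ ‖f x‖ₑ ^ q} = {x | t ≤ |f x|} := by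
    ext x
    simp only [mem_ofPred_eq]
    rw [ENNReal.rpow_le_rpow_iff hc.symm.pos, ← ofReal_norm, ENNReal.ofReal_le_ofReal_iff
      (norm_nonneg _), Real.norm_eq_abs]
  rw [hset] at h2
  obtain ⟨L, hL⟩ := hf.lipschitzWith_of_hasCompactSupport hfc one_ne_zero
  have hint := integrable_norm_gradient hL hfc
  have hgrad : ∫⁻ x, ‖fderiv ℝ f x‖ₑ = ENNReal.ofReal (∫ x, ‖gradient f x‖) := by
    rw [ofReal_integral_eq_lintegral_ofReal hint (Eventually.of_forall fun x => norm_nonneg _)]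
    congr 1 with x
    rw [norm_gradient_eq, ofReal_norm]
  have hmeas : volume {x | t ≤ |f x|} = ENNReal.ofReal (volume.real {x | t ≤ |f x|}) := by
    rw [Measure.real, ENNReal.ofReal_toReal]
    refine ((measure_mono fun x hx => ?_).trans_lt hfc.measure_lt_top).ne
    apply subset_tsupport
    intro h0
    rw [mem_ofPred_eq, h0, abs_zero] at hx
    linarith
  have hI : 0 ≤ ∫ x, ‖gradient f x‖ := integral_nonneg fun x => norm_nonneg _
  have h3 := h2.trans h1
  rw [hgrad, hmeas] at h3
  have h4 := pow_le_pow_left' h3 (n - 1)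
  rw [mul_pow, mul_pow, ← ENNReal.rpow_natCast, ← ENNReal.rpow_mul, hqe, ENNReal.rpow_natCast,
    ← ENNReal.rpow_natCast (ENNReal.ofReal _ ^ q), ← ENNReal.rpow_mul, hqe, ENNReal.rpow_natCast,
    ← ENNReal.ofReal_pow ht.le, ← ENNReal.ofReal_pow measureReal_nonneg, ← ENNReal.ofReal_pow hI,
    ← ENNReal.ofReal_mul (by positivity), ← ENNReal.ofReal_coe_nnreal,
    ← ENNReal.ofReal_pow (by positivity), ← ENNReal.ofReal_mul (by positivity)] at h4
  exact (ENNReal.ofReal_le_ofReal_iff (by positivity)).mp h4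

theorem hasCompactSupport_mollify (hc : HasCompactSupport f) (k : ℕ) :
    HasCompactSupport (mollify f k) :=
  (hc.isCompact.cthickening).of_isClosed_subset (isClosed_tsupport _) (tsupport_mollify f k)

/-- Weak-type form of the Sobolev inequality for compactly supported Lipschitz functions. -/
theorem weak_sobolev (hn : 2 ≤ n) : ∃ C : ℝ, 0 ≤ C ∧ ∀ f : En n → ℝ, ∀ K, LipschitzWith K f →
    HasCompactSupport f → ∀ t : ℝ, 0 < t →
      t ^ n * volume.real {x | t ≤ |f x|} ^ (n - 1) ≤ C * (∫ x, ‖gradient f x‖) ^ n := by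
  obtain ⟨C, hC, h⟩ := weak_sobolev_smooth hn
  refine ⟨C, hC, fun f K hf hc t ht => ?_⟩
  set S := cthickening 1 (tsupport f) with hS
  have hScomp : IsCompact S := hc.isCompact.cthickening
  have hsub : tsupport f ⊆ S := self_subset_cthickening _
  have hsubk : ∀ k, tsupport (mollify f k) ⊆ S := fun k =>
    (tsupport_mollify f k).trans (cthickening_mono (by
      rw [div_le_one (by positivity)]; linarith [(Nat.cast_nonneg k : (0 : ℝ) ≤ k)]) _)
  have hlim := tendsto_setIntegral_norm_gradient_mollify hf (S := S) hScomp.measure_lt_top.ne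
  have e : ∀ g : En n → ℝ, tsupport g ⊆ S → ∫ x in S, ‖gradient g x‖ = ∫ x, ‖gradient g x‖ :=
    fun g hg => setIntegral_eq_integral_of_forall_compl_eq_zero fun x hx => by
      simp [gradient_eq_zero_of_notMem_tsupport fun h => hx (hg h)]
  rw [e f hsub] at hlim
  simp_rw [e _ (hsubk _)] at hlim
  have hl : Tendsto (fun k : ℕ => (t - K * (1 / ((k : ℝ) + 1))) ^ n *
      volume.real {x | t ≤ |f x|} ^ (n - 1)) atTop
      (𝓝 ((t - K * 0) ^ n * volume.real {x | t ≤ |f x|} ^ (n - 1))) :=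
    ((tendsto_const_nhds.sub ((tendsto_one_div_add_atTop_nhds_zero_nat (𝕜 := ℝ)).const_mul
      (K : ℝ))).pow n).mul_const _
  rw [mul_zero, sub_zero] at hl
  refine le_of_tendsto_of_tendsto hl ((hlim.pow n).const_mul C) ?_
  have hev : ∀ᶠ k : ℕ in atTop, 0 < t - K * (1 / ((k : ℝ) + 1)) := by
    have h0 := (tendsto_const_nhds (x := t)).sub
      ((tendsto_one_div_add_atTop_nhds_zero_nat (𝕜 := ℝ)).const_mul (K : ℝ))
    rw [mul_zero, sub_zero] at h0
    exact h0.eventually (lt_mem_nhds ht)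
  filter_upwards [hev] with k hk
  refine le_trans ?_ (h (mollify f k) ((contDiff_mollify hf.continuous k).of_le (by
    exact_mod_cast le_top)) (hasCompactSupport_mollify hc k) _ hk)
  refine mul_le_mul_of_nonneg_left (pow_le_pow_left₀ measureReal_nonneg
    (measureReal_mono ?_ ?_) _) (pow_nonneg hk.le n)
  rotate_left
  · refine ((measure_mono fun x hx => ?_).trans_lt
      (hasCompactSupport_mollify hc k).measure_lt_top).ne
    apply subset_tsupport
    intro h0
    rw [mem_ofPred_eq, h0, abs_zero] at hx
    linarith
  · intro x hx
    rw [mem_ofPred_eq] at hx ⊢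
    have h1 := abs_mollify_sub_le hf k x
    have h2 : |f x| ≤ |mollify f k x| + |mollify f k x - f x| := by
      have := abs_sub (mollify f k x) (mollify f k x - f x)
      simpa using this
    linarith

/-- Change of variables under a homothety with centre `z` and ratio at least `1 / 2`. -/
theorem lintegral_homothety_le {g : En n → ENNReal} (hg : Measurable g) {t : ℝ} (ht : 1 / 2 ≤ t)
    (z : En n) : ∫⁻ x, g (z + t • (x - z)) ≤ 2 ^ n * ∫⁻ x, g x := by
  have ht0 : 0 < t := by linarith
  have e : ∀ x : En n, z + t • (x - z) = t • x + (z - t • z) := fun x => by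
    rw [smul_sub]; abel
  have h1 : ∫⁻ x, g (t • x + (z - t • z)) =
      ∫⁻ y, g (y + (z - t • z)) ∂(Measure.map (t • ·) (volume : Measure (En n))) :=
    (lintegral_map (hg.comp (measurable_id.add_const _)) (measurable_const_smul t)).symm
  simp_rw [e]
  rw [h1, Measure.map_addHaar_smul _ ht0.ne', lintegral_smul_measure,
    lintegral_add_right_eq_self (μ := (volume : Measure (En n))) g, smul_eq_mul]
  gcongr
  rw [finrank_euclideanSpace, Fintype.card_fin, abs_of_pos (by positivity)]
  refine ENNReal.ofReal_le_of_le_toReal ?_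
  rw [ENNReal.toReal_pow, ENNReal.toReal_ofNat, ← inv_pow]
  refine pow_le_pow_left₀ (by positivity) ?_ n
  rw [inv_le_comm₀ ht0 two_pos]
  linarith

theorem enorm_sub_midpoint_le (hf : ContDiff ℝ 1 f) (x z : En n) :
    ‖f x - f (z + (1 / 2 : ℝ) • (x - z))‖ₑ ≤
      ∫⁻ t in Ioc (1 / 2 : ℝ) 1, ‖fderiv ℝ f (z + t • (x - z))‖ₑ * ‖x - z‖ₑ := by
  have hd : ∀ t : ℝ, HasDerivAt (fun t : ℝ => f (z + t • (x - z)))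
      (fderiv ℝ f (z + t • (x - z)) (x - z)) t := fun t => by
    have h1 : HasDerivAt (fun t : ℝ => z + t • (x - z)) (x - z) t := by
      simpa using ((hasDerivAt_id t).smul_const (x - z)).const_add z
    exact ((hf.differentiable one_ne_zero) _).hasFDerivAt.comp_hasDerivAt t h1
  have hcont : Continuous fun t : ℝ => fderiv ℝ f (z + t • (x - z)) (x - z) :=
    ((hf.continuous_fderiv one_ne_zero).comp (by fun_prop)).clm_apply continuous_const
  have h := intervalIntegral.integral_eq_sub_of_hasDerivAt (fun t _ => hd t)
    (hcont.intervalIntegrable (1 / 2) 1)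
  rw [one_smul, add_sub_cancel] at h
  rw [← h, intervalIntegral.integral_of_le (by norm_num)]
  refine (enorm_integral_le_lintegral_enorm _).trans (lintegral_mono fun t => ?_)
  exact ContinuousLinearMap.le_opENorm _ _

theorem lintegral_sub_midpoint_le (hf : ContDiff ℝ 1 f) {r : ℝ} (hr : r ≤ 1) :
    ∫⁻ z in ball (0 : En n) r, ∫⁻ x in ball (0 : En n) r,
      ‖f x - f (z + (1 / 2 : ℝ) • (x - z))‖ₑ ≤
      volume (ball (0 : En n) r) * 2 ^ n * ∫⁻ x in ball (0 : En n) r, ‖fderiv ℝ f x‖ₑ := by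
  set B := ball (0 : En n) r with hB
  have hBm : MeasurableSet B := measurableSet_ball
  set g : En n → ENNReal := B.indicator fun x => ‖fderiv ℝ f x‖ₑ with hg
  have hcf := hf.continuous_fderiv one_ne_zero
  have hgm : Measurable g := (hcf.enorm.measurable).indicator hBm
  have key : ∀ z ∈ B, ∫⁻ x in B, ‖f x - f (z + (1 / 2 : ℝ) • (x - z))‖ₑ ≤
      2 ^ n * ∫⁻ x in B, ‖fderiv ℝ f x‖ₑ := by
    intro z hz
    calc ∫⁻ x in B, ‖f x - f (z + (1 / 2 : ℝ) • (x - z))‖ₑ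
        ≤ ∫⁻ x in B, ∫⁻ t in Ioc (1 / 2 : ℝ) 1, 2 * g (z + t • (x - z)) := by
          refine setLIntegral_mono' hBm fun x hx => (enorm_sub_midpoint_le hf x z).trans ?_
          refine setLIntegral_mono' measurableSet_Ioc fun t ht => ?_
          have hmem : z + t • (x - z) ∈ B :=
            (convex_ball (0 : En n) r).add_smul_sub_mem hz hx ⟨by linarith [ht.1], ht.2⟩
          rw [hg, indicator_of_mem hmem, mul_comm]
          gcongr
          rw [← ofReal_norm]
          refine ENNReal.ofReal_le_of_le_toReal ?_
          rw [ENNReal.toReal_ofNat]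
          have h1 := norm_sub_le x z
          have h2 := mem_ball_zero_iff.mp hx
          have h3 := mem_ball_zero_iff.mp hz
          linarith
      _ = ∫⁻ t in Ioc (1 / 2 : ℝ) 1, ∫⁻ x in B, 2 * g (z + t • (x - z)) := by
          refine lintegral_lintegral_swap ?_
          exact ((hgm.comp (by fun_prop)).const_mul 2).aemeasurable
      _ ≤ ∫⁻ t in Ioc (1 / 2 : ℝ) 1, 2 * (2 ^ n * ∫⁻ x, g x) := by
          refine setLIntegral_mono' measurableSet_Ioc fun t ht => ?_
          rw [lintegral_const_mul (f := fun x => g (z + t • (x - z))) _ (hgm.comp (by fun_prop))]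
          gcongr
          exact (setLIntegral_le_lintegral _ _).trans (lintegral_homothety_le hgm ht.1.le z)
      _ = 2 ^ n * ∫⁻ x in B, ‖fderiv ℝ f x‖ₑ := by
          rw [setLIntegral_const, Real.volume_Ioc, hg, lintegral_indicator hBm,
            mul_comm (2 : ENNReal), mul_assoc]
          have : (2 : ENNReal) * ENNReal.ofReal (1 - 1 / 2) = 1 := by
            rw [← ENNReal.ofReal_ofNat, ← ENNReal.ofReal_mul (by norm_num)]
            norm_num
          rw [this, mul_one]
  calc _ ≤ ∫⁻ z in B, 2 ^ n * ∫⁻ x in B, ‖fderiv ℝ f x‖ₑ := setLIntegral_mono' hBm key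
    _ = _ := by rw [setLIntegral_const]; ring

theorem lintegral_sub_le (hf : ContDiff ℝ 1 f) {r : ℝ} (hr : r ≤ 1) :
    ∫⁻ z in ball (0 : En n) r, ∫⁻ x in ball (0 : En n) r, ‖f x - f z‖ₑ ≤
      2 * (volume (ball (0 : En n) r) * 2 ^ n * ∫⁻ x in ball (0 : En n) r, ‖fderiv ℝ f x‖ₑ) := by
  set B := ball (0 : En n) r with hB
  have h := lintegral_sub_midpoint_le hf hr
  have hfc := hf.continuous
  have hm : Measurable fun q : En n × En n => ‖f q.2 - f (q.1 + (1 / 2 : ℝ) • (q.2 - q.1))‖ₑ :=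
    Continuous.measurable (by fun_prop)
  calc ∫⁻ z in B, ∫⁻ x in B, ‖f x - f z‖ₑ
      ≤ ∫⁻ z in B, ∫⁻ x in B, (‖f x - f (z + (1 / 2 : ℝ) • (x - z))‖ₑ +
          ‖f z - f (x + (1 / 2 : ℝ) • (z - x))‖ₑ) := by
        refine lintegral_mono fun z => lintegral_mono fun x => ?_
        have e : x + (1 / 2 : ℝ) • (z - x) = z + (1 / 2 : ℝ) • (x - z) := by
          rw [smul_sub, smul_sub]
          have h1 : x = (1 / 2 : ℝ) • x + (1 / 2 : ℝ) • x := by rw [← add_smul]; norm_num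
          have h2 : z = (1 / 2 : ℝ) • z + (1 / 2 : ℝ) • z := by rw [← add_smul]; norm_num
          nth_rw 1 [h1]
          nth_rw 2 [h2]
          abel
        rw [e]
        have := edist_triangle_right (f x) (f z) (f (z + (1 / 2 : ℝ) • (x - z)))
        simpa [edist_eq_enorm_sub] using this
    _ = (∫⁻ z in B, ∫⁻ x in B, ‖f x - f (z + (1 / 2 : ℝ) • (x - z))‖ₑ) +
        ∫⁻ z in B, ∫⁻ x in B, ‖f z - f (x + (1 / 2 : ℝ) • (z - x))‖ₑ := by
        rw [← lintegral_add_left (Measurable.lintegral_prod_right' hm)]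
        congr 1 with z
        exact lintegral_add_left (hm.comp measurable_prodMk_left) _
    _ = (∫⁻ z in B, ∫⁻ x in B, ‖f x - f (z + (1 / 2 : ℝ) • (x - z))‖ₑ) +
        ∫⁻ x in B, ∫⁻ z in B, ‖f z - f (x + (1 / 2 : ℝ) • (z - x))‖ₑ := by
        congr 1
        exact lintegral_lintegral_swap (Measurable.aemeasurable (hm.comp measurable_swap))
    _ ≤ _ := by rw [two_mul]; exact add_le_add h h

/-- A relative isoperimetric inequality on balls, for Lipschitz functions. -/
theorem isoperimetric (n : ℕ) : ∃ C : ℝ, 0 ≤ C ∧ ∀ f : En n → ℝ, ∀ K, LipschitzWith K f →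
    ∀ r : ℝ, r ≤ 1 → ∀ t : ℝ, 0 < t →
      t * volume.real {x ∈ ball (0 : En n) r | f x ≤ 0} *
        volume.real {x ∈ ball (0 : En n) r | t ≤ f x} ≤
          C * ∫ x in ball (0 : En n) r, ‖gradient f x‖ := by
  set V := volume.real (ball (0 : En n) 1) with hV
  refine ⟨2 * (V * 2 ^ n), by positivity, fun f K hf r hr t ht => ?_⟩
  set B := ball (0 : En n) r with hB
  have hBf : volume B ≠ ⊤ := measure_ball_lt_top.ne
  have hlim := tendsto_setIntegral_norm_gradient_mollify hf (S := B) hBf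
  set P := {x ∈ B | f x ≤ 0} with hP
  set Q := {x ∈ B | t ≤ f x} with hQ
  have hPB : P ⊆ B := fun x hx => hx.1
  have hQB : Q ⊆ B := fun x hx => hx.1
  have hPm : MeasurableSet P :=
    measurableSet_ball.inter (measurableSet_le hf.continuous.measurable measurable_const)
  have hQm : MeasurableSet Q :=
    measurableSet_ball.inter (measurableSet_le measurable_const hf.continuous.measurable)
  have hPf : volume P ≠ ⊤ := ((measure_mono hPB).trans_lt measure_ball_lt_top).ne
  have hQf : volume Q ≠ ⊤ := ((measure_mono hQB).trans_lt measure_ball_lt_top).ne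
  have hl : Tendsto (fun k : ℕ => (t - 2 * (K * (1 / ((k : ℝ) + 1)))) *
      volume.real P * volume.real Q) atTop
      (𝓝 ((t - 2 * (K * 0)) * volume.real P * volume.real Q)) :=
    ((tendsto_const_nhds.sub (((tendsto_one_div_add_atTop_nhds_zero_nat (𝕜 := ℝ)).const_mul
      (K : ℝ)).const_mul 2)).mul_const _).mul_const _
  rw [mul_zero, mul_zero, sub_zero] at hl
  refine le_of_tendsto_of_tendsto' hl (hlim.const_mul _) fun k => ?_
  set g := mollify f k
  have hg : ContDiff ℝ 1 g := (contDiff_mollify hf.continuous k).of_le (by exact_mod_cast le_top)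
  set s := t - 2 * (K * (1 / ((k : ℝ) + 1))) with hs
  have h1 := lintegral_sub_le hg hr
  have hgi : IntegrableOn (fun x => ‖gradient g x‖) B := by
    refine Measure.integrableOn_of_bounded (M := K) hBf
      (measurable_gradient g).norm.aestronglyMeasurable (Eventually.of_forall fun x => ?_)
    rw [norm_norm]
    exact norm_gradient_le (lipschitz_mollify hf k) x
  have hgrad : ∫⁻ x in B, ‖fderiv ℝ g x‖ₑ = ENNReal.ofReal (∫ x in B, ‖gradient g x‖) := by
    rw [ofReal_integral_eq_lintegral_ofReal hgi (Eventually.of_forall fun x => norm_nonneg _)]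
    congr 1 with x
    rw [norm_gradient_eq, ofReal_norm]
  have hI : 0 ≤ ∫ x in B, ‖gradient g x‖ := integral_nonneg fun x => norm_nonneg _
  have h2 : ENNReal.ofReal s * volume Q * volume P ≤
      ∫⁻ z in B, ∫⁻ x in B, ‖g x - g z‖ₑ := by
    have h3 : ∀ z ∈ P, ENNReal.ofReal s * volume Q ≤ ∫⁻ x in B, ‖g x - g z‖ₑ := by
      intro z hz
      refine le_trans ?_ (lintegral_mono_set hQB)
      rw [← setLIntegral_const]
      refine setLIntegral_mono' hQm fun x hx => ?_
      rw [← ofReal_norm]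
      refine ENNReal.ofReal_le_ofReal ((le_abs_self _).trans' ?_)
      have h4 := abs_le.mp (abs_mollify_sub_le hf k x)
      have h5 := abs_le.mp (abs_mollify_sub_le hf k z)
      have h6 := hx.2
      have h7 := hz.2
      change s ≤ mollify f k x - mollify f k z
      rw [hs]
      linarith [h4.1, h5.2]
    refine le_trans ?_ (lintegral_mono_set hPB)
    rw [← setLIntegral_const]
    exact setLIntegral_mono' hPm h3
  have h3 := h2.trans h1
  have hVB : volume B ≤ ENNReal.ofReal V := by
    rw [hV, Measure.real, ENNReal.ofReal_toReal measure_ball_lt_top.ne]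
    exact measure_mono (ball_subset_ball hr)
  have h4 : ENNReal.ofReal (s * volume.real Q * volume.real P) ≤
      ENNReal.ofReal (2 * (V * 2 ^ n * ∫ x in B, ‖gradient g x‖)) := by
    rcases le_or_gt s 0 with hs0 | hs0
    · rw [ENNReal.ofReal_eq_zero.mpr]
      · exact zero_le
      · exact mul_nonpos_of_nonpos_of_nonneg (mul_nonpos_of_nonpos_of_nonneg hs0
          measureReal_nonneg) measureReal_nonneg
    rw [ENNReal.ofReal_mul (by positivity), ENNReal.ofReal_mul hs0.le, Measure.real, Measure.real,
      ENNReal.ofReal_toReal hQf, ENNReal.ofReal_toReal hPf]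
    refine h3.trans ?_
    rw [hgrad, ENNReal.ofReal_mul (by norm_num), ENNReal.ofReal_mul (by positivity),
      ENNReal.ofReal_mul (by positivity), ENNReal.ofReal_pow (by norm_num), ENNReal.ofReal_ofNat]
    gcongr
  have h5 := (ENNReal.ofReal_le_ofReal_iff (by positivity)).mp h4
  calc _ = s * volume.real Q * volume.real P := by ring
    _ ≤ _ := h5
    _ = _ := by ring

end Sobolev


section DeGiorgi

variable {n : ℕ} {w : En n → ℝ} {K : ℝ≥0}

theorem integrableOn_of_le {E : Type*} [NormedAddCommGroup E] {F : En n → E}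
    {S : Set (En n)} (hS : volume S ≠ ⊤)
    (hF : AEStronglyMeasurable F volume) {M : ℝ} (hM : ∀ x, ‖F x‖ ≤ M) : IntegrableOn F S :=
  Measure.integrableOn_of_bounded hS hF (Eventually.of_forall hM)

/-- Energy bound on superlevel sets, of the type used in De Giorgi's first lemma. -/
def WeakCacc (γ : ℝ) (w : En n → ℝ) : Prop :=
  ∀ k r R : ℝ, 0 ≤ k → k < 1 → 1 / 2 ≤ r → r < R → R < 1 →
    ∫ x in ball (0 : En n) r ∩ {x | k < w x}, ‖gradient w x‖ ^ 2 ≤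
      γ / (R - r) ^ 2 * volume.real (ball (0 : En n) R ∩ {x | k < w x})

theorem volume_ball_inter_ne_top (r : ℝ) (S : Set (En n)) : volume (ball (0 : En n) r ∩ S) ≠ ⊤ :=
  ((measure_mono inter_subset_left).trans_lt measure_ball_lt_top).ne

/-- A cutoff function equal to one on `ball 0 r` and supported in `closedBall 0 s`. -/
def cutoff (r s : ℝ) (x : En n) : ℝ := max (min ((s - ‖x‖) / (s - r)) 1) 0

theorem lipschitz_cutoff {r s : ℝ} (h : r < s) :
    LipschitzWith (Real.toNNReal (1 / (s - r))) (cutoff r s : En n → ℝ) := by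
  have h0 : 0 < s - r := sub_pos.mpr h
  have h1 : LipschitzWith (Real.toNNReal (1 / (s - r))) (fun x : En n => (s - ‖x‖) / (s - r)) := by
    refine LipschitzWith.of_dist_le_mul fun x y => ?_
    rw [Real.coe_toNNReal _ (by positivity), Real.dist_eq, ← sub_div, abs_div, abs_of_pos h0,
      one_div, inv_mul_eq_div]
    gcongr
    have := abs_norm_sub_norm_le y x
    rw [dist_comm, dist_eq_norm]
    rwa [show s - ‖x‖ - (s - ‖y‖) = ‖y‖ - ‖x‖ by ring]
  exact (h1.min_const 1).max_const 0

theorem cutoff_nonneg (r s : ℝ) (x : En n) : 0 ≤ cutoff r s x := le_max_right _ _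

theorem cutoff_le_one (r s : ℝ) (x : En n) : cutoff r s x ≤ 1 :=
  max_le (min_le_right _ _) zero_le_one

theorem cutoff_eq_one {r s : ℝ} (h : r < s) {x : En n} (hx : ‖x‖ ≤ r) : cutoff r s x = 1 := by
  have : 1 ≤ (s - ‖x‖) / (s - r) := by
    rw [le_div_iff₀ (sub_pos.mpr h)]; linarith
  simp [cutoff, this]

theorem cutoff_eq_zero {r s : ℝ} (h : r < s) {x : En n} (hx : s ≤ ‖x‖) : cutoff r s x = 0 := by
  have : (s - ‖x‖) / (s - r) ≤ 0 := div_nonpos_of_nonpos_of_nonneg (by linarith) (by linarith)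
  rw [cutoff, max_eq_right]
  exact (min_le_left _ _).trans this

theorem abs_cutoff_le_one (r s : ℝ) (x : En n) : |cutoff r s x| ≤ 1 := by
  rw [abs_of_nonneg (cutoff_nonneg r s x)]; exact cutoff_le_one r s x

theorem lipschitz_mul_of_bounded {f g : En n → ℝ} {Kf Kg Mf Mg : ℝ≥0} (hf : LipschitzWith Kf f)
    (hg : LipschitzWith Kg g) (hfM : ∀ x, |f x| ≤ Mf) (hgM : ∀ x, |g x| ≤ Mg) :
    LipschitzWith (Mf * Kg + Mg * Kf) (fun x => f x * g x) := by
  refine LipschitzWith.of_dist_le_mul fun x y => ?_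
  have h1 := hf.dist_le_mul x y
  have h2 := hg.dist_le_mul x y
  rw [Real.dist_eq] at h1 h2 ⊢
  have e : f x * g x - f y * g y = f x * (g x - g y) + g y * (f x - f y) := by ring
  rw [e]
  refine (abs_add_le _ _).trans ?_
  rw [abs_mul, abs_mul]
  push_cast
  rw [add_mul, mul_assoc, mul_assoc]
  gcongr
  · exact hfM x
  · exact hgM y

/-- One step of the De Giorgi iteration. -/
theorem deGiorgi_step (hn : 2 ≤ n) : ∃ C : ℝ, 0 < C ∧ ∀ γ : ℝ, 1 ≤ γ → ∀ w : En n → ℝ, ∀ K,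
    LipschitzWith K w → WeakCacc γ w → (∀ x ∈ ball (0 : En n) 1, w x ≤ 1) →
    ∀ k l r s R : ℝ, 0 ≤ k → k < 1 → k < l → 1 / 2 ≤ r → r < s → s < R → R < 1 →
      ((l - k) ^ n * volume.real (ball (0 : En n) r ∩ {x | l < w x}) ^ (n - 1)) ≤
        C * ((γ / (R - s) + 1 / (s - r)) *
          volume.real (ball (0 : En n) R ∩ {x | k < w x})) ^ n := by
  obtain ⟨C, hC, h⟩ := weak_sobolev hn
  refine ⟨C + 1, by positivity, fun γ hγ w K hw hcacc hw1 k l r s R hk hk1 hkl hr hrs hsR hR => ?_⟩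
  have hs0 : 0 < s - r := sub_pos.mpr hrs
  have hR0 : 0 < R - s := sub_pos.mpr hsR
  set Y := volume.real (ball (0 : En n) R ∩ {x | k < w x}) with hY
  set g : En n → ℝ := fun x => max (min (w x) 1 - k) 0 with hg
  have hgL : LipschitzWith K g := by
    have := ((hw.min_const 1).sub (LipschitzWith.const k)).max_const 0
    rwa [add_zero] at this
  have hg0 : ∀ x, 0 ≤ g x := fun x => le_max_right _ _
  have hg1 : ∀ x, g x ≤ 1 := fun x =>
    max_le (by linarith [min_le_right (w x) 1]) zero_le_one
  have hga : ∀ x, |g x| ≤ (1 : ℝ≥0) := fun x => by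
    rw [abs_of_nonneg (hg0 x)]; exact hg1 x
  set ψ : En n → ℝ := fun x => cutoff r s x * g x with hψ
  have hψL := lipschitz_mul_of_bounded (lipschitz_cutoff (n := n) hrs) hgL
    (Mf := 1) (fun x => abs_cutoff_le_one r s x) hga
  have hψc : HasCompactSupport ψ := by
    refine HasCompactSupport.of_support_subset_isCompact (isCompact_closedBall (0 : En n) s) ?_
    intro x hx
    rw [mem_closedBall_zero_iff]
    by_contra hcon
    exact hx (by simp [hψ, cutoff_eq_zero hrs (not_le.mp hcon).le])
  have h1 := h ψ _ hψL hψc (l - k) (sub_pos.mpr hkl)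
  set S := ball (0 : En n) s ∩ {x | k < w x} with hS
  have hSm : MeasurableSet S :=
    measurableSet_ball.inter (measurableSet_lt measurable_const hw.continuous.measurable)
  have hSf : volume S ≠ ⊤ := volume_ball_inter_ne_top _ _
  have hSY : volume.real S ≤ Y :=
    measureReal_mono (inter_subset_inter_left _ (ball_subset_ball hsR.le))
      (volume_ball_inter_ne_top _ _)
  have hgrad : ∀ᵐ x, ‖gradient ψ x‖ ≤ S.indicator (fun x => ‖gradient w x‖ + 1 / (s - r)) x := by
    have hsph : ∀ᵐ x : En n, x ∉ sphere (0 : En n) s := by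
      rw [ae_iff]
      simp only [not_not]
      exact Measure.addHaar_sphere_of_ne_zero volume (0 : En n) (by linarith : s ≠ 0)
    filter_upwards [ae_gradient_max_const hw k, differentiableAt_ae (lipschitz_cutoff (n := n) hrs),
      hsph, differentiableAt_ae hgL, differentiableAt_ae hw] with x hx1 hx2 hx3 hx4 hx5
    rcases lt_trichotomy ‖x‖ s with hxs | hxs | hxs
    · have hball : ball (0 : En n) s ∈ 𝓝 x := isOpen_ball.mem_nhds (mem_ball_zero_iff.mpr hxs)
      have hgw : g =ᶠ[𝓝 x] fun y => max (w y - k) 0 := by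
        filter_upwards [hball] with y hy
        have : w y ≤ 1 := hw1 y (ball_subset_ball (by linarith) hy)
        simp [hg, this]
      by_cases hkw : k < w x
      · have hmem : x ∈ S := ⟨mem_ball_zero_iff.mpr hxs, hkw⟩
        rw [indicator_of_mem hmem, hψ, gradient_mul hx2 hx4]
        refine (norm_add_le _ _).trans (add_le_add ?_ ?_)
        · rw [norm_smul, hgw.gradient_eq, hx1, if_pos hkw]
          exact mul_le_of_le_one_left (norm_nonneg _) (abs_cutoff_le_one r s x)
        · rw [norm_smul]
          refine (mul_le_of_le_one_left (norm_nonneg _) (hga x)).trans ?_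
          have := norm_gradient_le (lipschitz_cutoff (n := n) hrs) x
          rwa [Real.coe_toNNReal _ (by positivity)] at this
      · have hmem : x ∉ S := fun hx => hkw hx.2
        rw [indicator_of_notMem hmem, gradient_eq_zero_of_isMin, norm_zero]
        intro y
        have : g x = 0 := by
          rw [hgw.eq_of_nhds]
          exact max_eq_right (by linarith [not_lt.mp hkw])
        rw [hψ]
        simp only [this, mul_zero]
        exact mul_nonneg (cutoff_nonneg _ _ _) (hg0 y)
    · exact absurd (mem_sphere_zero_iff_norm.mpr hxs) hx3
    · have hmem : x ∉ S := fun hx => by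
        have := mem_ball_zero_iff.mp hx.1
        linarith
      rw [indicator_of_notMem hmem, gradient_eq_zero_of_isMin, norm_zero]
      intro y
      rw [hψ]
      simp only [cutoff_eq_zero hrs hxs.le, zero_mul]
      exact mul_nonneg (cutoff_nonneg _ _ _) (hg0 y)
  have hwi : IntegrableOn (fun x => ‖gradient w x‖) S :=
    integrableOn_of_le hSf (measurable_gradient w).norm.aestronglyMeasurable fun x => by
      rw [norm_norm]; exact norm_gradient_le hw x
  have hwi2 : IntegrableOn (fun x => ‖gradient w x‖ ^ 2) S :=
    integrableOn_of_le hSf ((measurable_gradient w).norm.pow_const 2).aestronglyMeasurable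
      (M := (K : ℝ) ^ 2) fun x => by
      rw [norm_pow, norm_norm]
      exact pow_le_pow_left₀ (norm_nonneg _) (norm_gradient_le hw x) 2
  have hci : ∀ c : ℝ, IntegrableOn (fun _ : En n => c) S := fun c => integrableOn_const hSf
  have h2 : ∫ x, ‖gradient ψ x‖ ≤ (γ / (R - s) + 1 / (s - r)) * Y := by
    calc ∫ x, ‖gradient ψ x‖
        ≤ ∫ x, S.indicator (fun x => ‖gradient w x‖ + 1 / (s - r)) x :=
          integral_mono_ae (integrable_norm_gradient hψL hψc)
            ((hwi.add (hci _)).integrable_indicator hSm) hgrad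
      _ = ∫ x in S, (‖gradient w x‖ + 1 / (s - r)) := integral_indicator hSm
      _ ≤ ∫ x in S, ((R - s) / (2 * γ) * ‖gradient w x‖ ^ 2 +
            (γ / (2 * (R - s)) + 1 / (s - r))) := by
          refine integral_mono (hwi.add (hci _)) ((hwi2.const_mul _).add (hci _)) fun x => ?_
          set a := ‖gradient w x‖
          have : a ≤ (R - s) / (2 * γ) * a ^ 2 + γ / (2 * (R - s)) := by
            have hγ0 : 0 < γ := by linarith
            have h3 : (R - s) / (2 * γ) * a ^ 2 + γ / (2 * (R - s)) - a =
              ((R - s) * a - γ) ^ 2 / (2 * γ * (R - s)) := by field_simp; ring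
            have h4 : 0 ≤ ((R - s) * a - γ) ^ 2 / (2 * γ * (R - s)) := by positivity
            linarith
          change a + 1 / (s - r) ≤ (R - s) / (2 * γ) * a ^ 2 + (γ / (2 * (R - s)) + 1 / (s - r))
          linarith
      _ = (R - s) / (2 * γ) * (∫ x in S, ‖gradient w x‖ ^ 2) +
            (γ / (2 * (R - s)) + 1 / (s - r)) * volume.real S := by
          rw [integral_add (hwi2.const_mul _) (hci _), integral_const_mul, setIntegral_const,
            smul_eq_mul, mul_comm (volume.real S)]
      _ ≤ (R - s) / (2 * γ) * (γ / (R - s) ^ 2 * Y) +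
            (γ / (2 * (R - s)) + 1 / (s - r)) * Y := by
          have := hcacc k s R hk hk1 (by linarith) hsR hR
          gcongr
      _ = (1 / (2 * (R - s)) + γ / (2 * (R - s)) + 1 / (s - r)) * Y := by field_simp; ring
      _ ≤ (γ / (R - s) + 1 / (s - r)) * Y := by
          gcongr
          rw [← add_div, div_le_div_iff₀ (by positivity) hR0]
          nlinarith
  refine le_trans ?_ (h1.trans ?_)
  · refine mul_le_mul_of_nonneg_left (pow_le_pow_left₀ measureReal_nonneg
      (measureReal_mono ?_ ?_) _) (pow_nonneg (sub_pos.mpr hkl).le n)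
    rotate_left
    · refine ((measure_mono fun x hx => ?_).trans_lt hψc.measure_lt_top).ne
      apply subset_tsupport
      intro h0
      rw [mem_ofPred_eq, h0, abs_zero] at hx
      linarith
    · intro x hx
      have hxr := mem_ball_zero_iff.mp hx.1
      have hxl : l < w x := hx.2
      have hx1 : w x ≤ 1 := hw1 x (mem_ball_zero_iff.mpr (by linarith))
      rw [mem_ofPred_eq, hψ]
      simp only
      rw [cutoff_eq_one hrs hxr.le, one_mul, abs_of_nonneg (hg0 x)]
      refine le_max_of_le_left ?_
      rw [min_eq_left hx1]
      linarith
  · have hI : 0 ≤ ∫ x, ‖gradient ψ x‖ := integral_nonneg fun x => norm_nonneg _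
    gcongr
    linarith

/-- De Giorgi's first lemma. -/
theorem deGiorgi_first (hn : 2 ≤ n) {γ : ℝ} (hγ : 1 ≤ γ) : ∃ ν : ℝ, 0 < ν ∧
    ∀ w : En n → ℝ, ∀ K, LipschitzWith K w → WeakCacc γ w →
      (∀ x ∈ ball (0 : En n) 1, w x ≤ 1) →
      volume.real (ball (0 : En n) (3 / 4) ∩ {x | 0 < w x}) ≤ ν →
      ∀ x ∈ ball (0 : En n) (1 / 2), w x ≤ 1 / 2 := by
  obtain ⟨C, hC, hstep⟩ := deGiorgi_step hn
  obtain ⟨m, rfl⟩ : ∃ m, n = m + 1 := ⟨n - 1, by omega⟩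
  have hm : m ≠ 0 := by omega
  set D : ℝ := 64 * (γ + 1) * (C + 1) with hD
  have hD0 : 0 < D := by positivity
  set q : ℝ := (1 / 4) ^ (m + 1) with hq
  have hq0 : 0 < q := by positivity
  set ν : ℝ := q ^ m / D ^ (m + 1) with hν
  have hν0 : 0 < ν := by positivity
  refine ⟨ν, hν0, fun w K hw hcacc hw1 hY0 => ?_⟩
  set Y : ℕ → ℝ := fun j => volume.real (ball (0 : En (m + 1)) (1 / 2 + (1 / 2) ^ j / 4) ∩
    {x | (1 - (1 / 2) ^ j) / 2 < w x}) with hYdef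
  have hYn : ∀ j, 0 ≤ Y j := fun j => measureReal_nonneg
  have hrec : ∀ j, Y (j + 1) ^ m ≤ (D * 4 ^ j * Y j) ^ (m + 1) := by
    intro j
    set a : ℝ := (1 / 2) ^ j with ha
    have ha0 : 0 < a := by positivity
    have ha1 : a ≤ 1 := pow_le_one₀ (by norm_num) (by norm_num)
    have e : (1 / 2 : ℝ) ^ (j + 1) = a / 2 := by rw [pow_succ, ← ha]; ring
    have h := hstep γ hγ w K hw hcacc hw1 ((1 - a) / 2) ((1 - a / 2) / 2) (1 / 2 + a / 2 / 4)
      (1 / 2 + a / 2 / 4 + a / 16) (1 / 2 + a / 4) (by linarith) (by linarith) (by linarith)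
      (by linarith) (by linarith) (by linarith) (by linarith)
    have h' : (a / 4) ^ (m + 1) * Y (j + 1) ^ m ≤ C * ((γ + 1) * 16 / a * Y j) ^ (m + 1) := by
      convert h using 2
      · ring
      · rw [hYdef]
        simp only [e, Nat.add_sub_cancel]
      · rw [hYdef]
        congr 2
        rw [show 1 / 2 + a / 4 - (1 / 2 + a / 2 / 4 + a / 16) = a / 16 by ring,
          show 1 / 2 + a / 2 / 4 + a / 16 - (1 / 2 + a / 2 / 4) = a / 16 by ring]
        field_simp
    have h4 : (4 : ℝ) ^ j = (1 / a) * (1 / a) := by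
      rw [ha, one_div_pow, one_div_one_div, ← mul_pow]; norm_num
    have hC1 : C ≤ (C + 1) ^ (m + 1) :=
      le_trans (by linarith) (le_self_pow₀ (by linarith) (Nat.succ_ne_zero m))
    have h5 : (a / 4) ^ (m + 1) * Y (j + 1) ^ m ≤
        (a / 4) ^ (m + 1) * (D * 4 ^ j * Y j) ^ (m + 1) := by
      refine h'.trans ?_
      rw [← mul_pow]
      have e2 : a / 4 * (D * 4 ^ j * Y j) = (C + 1) * ((γ + 1) * 16 / a * Y j) := by
        rw [h4, hD]; field_simp; ring
      rw [e2, mul_pow (C + 1)]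
      have := hYn j
      gcongr
    exact le_of_mul_le_mul_left h5 (by positivity)
  have hind : ∀ j, Y j ≤ ν * q ^ j := by
    intro j
    induction j with
    | zero =>
      simp only [hYdef, pow_zero, mul_one, sub_self, zero_div]
      convert hY0 using 4
      norm_num
    | succ j ih =>
      refine le_of_pow_le_pow_left₀ hm (by positivity) ((hrec j).trans ?_)
      have h0 := hYn j
      calc (D * 4 ^ j * Y j) ^ (m + 1) ≤ (D * 4 ^ j * (ν * q ^ j)) ^ (m + 1) := by gcongr
        _ = (D ^ (m + 1) * ν) * ((4 ^ (m + 1)) ^ j * q ^ j) * ν ^ m * (q ^ j) ^ m := by ring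
        _ = q ^ m * ν ^ m * (q ^ j) ^ m := by
          have e1 : D ^ (m + 1) * ν = q ^ m := by rw [hν]; field_simp
          have e2 : ((4 : ℝ) ^ (m + 1)) ^ j * q ^ j = 1 := by
            rw [← mul_pow, hq, ← mul_pow]; norm_num
          rw [e1, e2, mul_one]
        _ = (ν * q ^ (j + 1)) ^ m := by ring
  have hzero : volume.real (ball (0 : En (m + 1)) (1 / 2) ∩ {x | 1 / 2 < w x}) = 0 := by
    refine le_antisymm ?_ measureReal_nonneg
    have hq1 : q < 1 := pow_lt_one₀ (by norm_num) (by norm_num) (Nat.succ_ne_zero m)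
    have hl : Tendsto (fun j => ν * q ^ j) atTop (𝓝 (ν * 0)) :=
      (tendsto_pow_atTop_nhds_zero_of_lt_one hq0.le hq1).const_mul ν
    rw [mul_zero] at hl
    refine ge_of_tendsto' hl fun j => le_trans ?_ (hind j)
    have ha0 : (0 : ℝ) < (1 / 2) ^ j := by positivity
    refine measureReal_mono (inter_subset_inter (ball_subset_ball (by linarith)) fun x hx => ?_)
      (volume_ball_inter_ne_top _ _)
    have hx' : 1 / 2 < w x := hx
    change (1 - (1 / 2) ^ j) / 2 < w x
    linarith
  intro x hx
  by_contra hcon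
  have ho : IsOpen (ball (0 : En (m + 1)) (1 / 2) ∩ {x | 1 / 2 < w x}) :=
    isOpen_ball.inter (isOpen_lt continuous_const hw.continuous)
  have hpos := ho.measure_pos volume ⟨x, hx, not_le.mp hcon⟩
  rw [measureReal_eq_zero_iff (volume_ball_inter_ne_top _ _)] at hzero
  exact hpos.ne' hzero

/-- The gradient of a two-sided truncation. -/
theorem ae_norm_gradient_clamp_le (hw : LipschitzWith K w) :
    ∀ᵐ x, ‖gradient (fun y => max (min (w y) (1 / 2)) 0) x‖ ≤
      {x | 0 < w x ∧ w x < 1 / 2}.indicator (fun x => ‖gradient w x‖) x := by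
  have h1 : LipschitzWith K (fun y => 1 / 2 - w y) := by
    simpa using (LipschitzWith.const (1 / 2 : ℝ)).sub hw
  filter_upwards [ae_gradient_posPart h1, ae_gradient_posPart (hw.min_const (1 / 2))]
    with x hx1 hx2
  have e : (fun y => min (w y) (1 / 2)) = fun y => 1 / 2 - max (1 / 2 - w y) 0 := by
    funext y
    rcases le_total (w y) (1 / 2) with h | h
    · rw [min_eq_left h, max_eq_left (by linarith)]; ring
    · rw [min_eq_right h, max_eq_right (by linarith)]; ring
  rw [hx2.1]
  split_ifs with h0
  · rw [e, gradient_const_sub, hx1.1, norm_neg]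
    split_ifs with h3
    · rw [gradient_const_sub, norm_neg, indicator_of_mem]
      exact ⟨lt_of_lt_of_le h0 (min_le_left _ _), by linarith⟩
    · rw [norm_zero]
      exact indicator_nonneg (fun _ _ => norm_nonneg _) x
  · rw [norm_zero]
    exact indicator_nonneg (fun _ _ => norm_nonneg _) x

/-- De Giorgi's second lemma (measure-to-pointwise growth estimate). -/
theorem deGiorgi_second (hn : 2 ≤ n) {γ ν : ℝ} (hγ : 1 ≤ γ) (hν : 0 < ν) :
    ∃ δ : ℝ, 0 < δ ∧ δ ≤ 1 / 2 ∧
    ∀ w : En n → ℝ, ∀ K, LipschitzWith K w →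
      (∀ i : ℕ, WeakCacc γ (fun x => 2 ^ i * (w x - 1) + 1)) →
      (∀ x ∈ ball (0 : En n) 1, w x ≤ 1) →
      ν ≤ volume.real {x ∈ ball (0 : En n) (3 / 4) | w x ≤ 0} →
      ∀ x ∈ ball (0 : En n) (1 / 2), w x ≤ 1 - δ := by
  obtain ⟨ν₁, hν₁, hfirst⟩ := deGiorgi_first hn hγ
  obtain ⟨C, hC, hiso⟩ := isoperimetric n
  set V := volume.real (ball (0 : En n) 1) with hV
  have hV0 : 0 ≤ V := measureReal_nonneg
  set ε := ν * ν₁ / (4 * (32 * C * γ * V + 1)) with hε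
  have hγ0 : 0 < γ := by linarith
  have hε0 : 0 < ε := by positivity
  set d := ε * (ν * ν₁) / (2 * (C + 1)) with hd
  have hd0 : 0 < d := by positivity
  obtain ⟨N, hN⟩ := exists_nat_gt (V / d)
  refine ⟨(1 / 2) ^ N / 2, by positivity, ?_, fun w K hw hcacc hw1 hmeas => ?_⟩
  · have : (1 / 2 : ℝ) ^ N ≤ 1 := pow_le_one₀ (by norm_num) (by norm_num)
    linarith
  set W : ℕ → En n → ℝ := fun i x => 2 ^ i * (w x - 1) + 1 with hW
  have hWL : ∀ i, ∃ L, LipschitzWith L (W i) := fun i => by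
    refine ⟨2 ^ i * K, LipschitzWith.of_dist_le_mul fun x y => ?_⟩
    have := hw.dist_le_mul x y
    rw [Real.dist_eq] at this ⊢
    rw [hW]
    have e : (2 : ℝ) ^ i * (w x - 1) + 1 - (2 ^ i * (w y - 1) + 1) = 2 ^ i * (w x - w y) := by ring
    simp only [e, abs_mul, abs_pow, abs_two]
    push_cast
    rw [mul_assoc]
    gcongr
  have hW1 : ∀ i, ∀ x ∈ ball (0 : En n) 1, W i x ≤ 1 := fun i x hx => by
    have h1 := hw1 x hx
    have h2 : (0 : ℝ) < 2 ^ i := by positivity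
    simp only [hW]
    nlinarith
  set B := ball (0 : En n) (3 / 4) with hB
  have hsucc : ∀ i x, W (i + 1) x = 2 * W i x - 1 := fun i x => by simp only [hW]; ring
  obtain ⟨i, hiN, hi⟩ : ∃ i ≤ N, volume.real (B ∩ {x | 0 < W i x}) ≤ ν₁ := by
    by_contra! hcon
    set Dset : ℕ → Set (En n) := fun i => B ∩ {x | 0 < W i x ∧ W i x < 1 / 2} with hDs
    have hWm : ∀ i, Measurable (W i) := fun i =>
      (hWL i).choose_spec.continuous.measurable
    have hDm : ∀ i, MeasurableSet (Dset i) := fun i =>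
      measurableSet_ball.inter ((measurableSet_lt measurable_const (hWm i)).inter
        (measurableSet_lt (hWm i) measurable_const))
    have hDf : ∀ i, volume (Dset i) ≠ ⊤ := fun i => volume_ball_inter_ne_top _ _
    have hDd : ∀ i < N, d ≤ volume.real (Dset i) := by
      intro i hi
      obtain ⟨L, hL⟩ := hWL i
      have hclL : LipschitzWith L (fun y => max (min (W i y) (1 / 2)) 0) :=
        (hL.min_const (1 / 2)).max_const 0
      have h1 := hiso _ L hclL (3 / 4) (by norm_num) (1 / 2) (by norm_num)
      have hlow : ν ≤ volume.real {x ∈ B | max (min (W i x) (1 / 2)) 0 ≤ 0} := by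
        refine hmeas.trans (measureReal_mono (fun x hx => ⟨hx.1, ?_⟩)
          (volume_ball_inter_ne_top _ _))
        have hx2 := hx.2
        have : W i x ≤ 0 := by
          simp only [hW]
          have h2 : (1 : ℝ) ≤ 2 ^ i := one_le_pow₀ (by norm_num)
          nlinarith
        exact max_le ((min_le_left _ _).trans this) le_rfl
      have hup : ν₁ ≤ volume.real {x ∈ B | 1 / 2 ≤ max (min (W i x) (1 / 2)) 0} := by
        refine (hcon (i + 1) hi).le.trans (measureReal_mono (fun x hx => ⟨hx.1, ?_⟩)
          (volume_ball_inter_ne_top _ _))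
        have hx2 : 0 < W (i + 1) x := hx.2
        rw [hsucc] at hx2
        exact le_max_of_le_left (le_min (by linarith) le_rfl)
      have hgi : IntegrableOn (fun x => ‖gradient (W i) x‖) (Dset i) :=
        integrableOn_of_le (hDf i) (measurable_gradient _).norm.aestronglyMeasurable fun x => by
          rw [norm_norm]; exact norm_gradient_le hL x
      have hg2 : ∀ S, volume S ≠ ⊤ → IntegrableOn (fun x => ‖gradient (W i) x‖ ^ 2) S :=
        fun S hS => integrableOn_of_le hS
          ((measurable_gradient _).norm.pow_const 2).aestronglyMeasurable
          (M := (L : ℝ) ^ 2) fun x => by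
            rw [norm_pow, norm_norm]
            exact pow_le_pow_left₀ (norm_nonneg _) (norm_gradient_le hL x) 2
      have hen : ∫ x in Dset i, ‖gradient (W i) x‖ ^ 2 ≤ 64 * γ * V := by
        have h2 := hcacc i 0 (3 / 4) (7 / 8) le_rfl one_pos (by norm_num) (by norm_num)
          (by norm_num)
        refine (setIntegral_mono_set (hg2 _ (volume_ball_inter_ne_top _ _))
          (Eventually.of_forall fun x => by positivity) (LE.le.eventuallyLE
            (show Dset i ⊆ B ∩ {x | 0 < W i x} from fun x hx => ⟨hx.1, hx.2.1⟩))).trans (h2.trans ?_)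
        have h3 : volume.real (ball (0 : En n) (7 / 8) ∩ {x | 0 < 2 ^ i * (w x - 1) + 1}) ≤ V :=
          measureReal_mono (inter_subset_left.trans (ball_subset_ball (by norm_num)))
            measure_ball_lt_top.ne
        calc _ ≤ γ / (7 / 8 - 3 / 4) ^ 2 * V := by gcongr
          _ = 64 * γ * V := by ring
      have hint : ∫ x in B, ‖gradient (fun y => max (min (W i y) (1 / 2)) 0) x‖ ≤
          ε * 32 * γ * V + volume.real (Dset i) / (2 * ε) := by
        calc _ ≤ ∫ x in B, {x | 0 < W i x ∧ W i x < 1 / 2}.indicator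
                (fun x => ‖gradient (W i) x‖) x := by
              refine integral_mono_ae ?_ ?_ (ae_restrict_of_ae (ae_norm_gradient_clamp_le hL))
              · exact integrableOn_of_le measure_ball_lt_top.ne
                  (measurable_gradient _).norm.aestronglyMeasurable fun x => by
                    rw [norm_norm]; exact norm_gradient_le hclL x
              · refine integrableOn_of_le measure_ball_lt_top.ne (M := L)
                  (((measurable_gradient _).norm.indicator
                    ((measurableSet_lt measurable_const (hWm i)).inter
                    (measurableSet_lt (hWm i) measurable_const))).aestronglyMeasurable) fun x => ?_
                refine (norm_indicator_le_norm_self _ x).trans ?_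
                rw [norm_norm]; exact norm_gradient_le hL x
          _ = ∫ x in Dset i, ‖gradient (W i) x‖ := by
              exact setIntegral_indicator ((measurableSet_lt measurable_const (hWm i)).inter
                    (measurableSet_lt (hWm i) measurable_const))
          _ ≤ ∫ x in Dset i, (ε / 2 * ‖gradient (W i) x‖ ^ 2 + 1 / (2 * ε)) := by
              refine integral_mono hgi (((hg2 _ (hDf i)).const_mul _).add
                (integrableOn_const (hDf i))) fun x => ?_
              set a := ‖gradient (W i) x‖
              have h3 : ε / 2 * a ^ 2 + 1 / (2 * ε) - a = (ε * a - 1) ^ 2 / (2 * ε) := by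
                field_simp; ring
              have h4 : 0 ≤ (ε * a - 1) ^ 2 / (2 * ε) := by positivity
              change a ≤ ε / 2 * a ^ 2 + 1 / (2 * ε)
              linarith
          _ = ε / 2 * (∫ x in Dset i, ‖gradient (W i) x‖ ^ 2) +
                volume.real (Dset i) / (2 * ε) := by
              rw [integral_add ((hg2 _ (hDf i)).const_mul _) (integrableOn_const (hDf i)),
                integral_const_mul, setIntegral_const, smul_eq_mul]
              ring
          _ ≤ ε / 2 * (64 * γ * V) + volume.real (Dset i) / (2 * ε) := by gcongr
          _ = _ := by ring
      have h5 : 1 / 2 * ν * ν₁ ≤ C * (ε * 32 * γ * V + volume.real (Dset i) / (2 * ε)) := by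
        refine le_trans ?_ (h1.trans (mul_le_mul_of_nonneg_left hint hC))
        gcongr
      have h6 : C * (ε * 32 * γ * V) ≤ ν * ν₁ / 4 := by
        have e : ε * (4 * (32 * C * γ * V + 1)) = ν * ν₁ := by rw [hε]; field_simp
        nlinarith
      have h7 : ν * ν₁ / 4 ≤ C * (volume.real (Dset i) / (2 * ε)) := by linarith
      have hDn : 0 ≤ volume.real (Dset i) := measureReal_nonneg
      have h8 : C * (volume.real (Dset i) / (2 * ε)) ≤
          (C + 1) * (volume.real (Dset i) / (2 * ε)) := by gcongr; linarith
      rw [hd, div_le_iff₀ (by positivity)]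
      have h9 := h7.trans h8
      rw [← mul_div_assoc, le_div_iff₀ (by positivity)] at h9
      linarith
    have hdisj : Set.PairwiseDisjoint (↑(Finset.range N)) Dset := by
      have hlt : ∀ i j, i < j → Disjoint (Dset i) (Dset j) := by
        intro i j hij
        rw [Set.disjoint_left]
        intro x hxi hxj
        have h1 : W i x < 1 / 2 := hxi.2.2
        have h2 : 0 < W j x := hxj.2.1
        obtain ⟨m, rfl⟩ := Nat.exists_eq_add_of_lt hij
        have e : W (i + m + 1) x = 2 ^ (m + 1) * (W i x - 1) + 1 := by
          simp only [hW]; ring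
        rw [e] at h2
        have h3 : (2 : ℝ) ≤ 2 ^ (m + 1) := by
          rw [pow_succ]; linarith [one_le_pow₀ (M₀ := ℝ) (by norm_num : (1 : ℝ) ≤ 2) (n := m)]
        nlinarith
      intro i _ j _ hij
      rcases lt_or_gt_of_ne hij with h | h
      · exact hlt i j h
      · exact (hlt j i h).symm
    have hsum : ∑ i ∈ Finset.range N, volume.real (Dset i) ≤ V := by
      rw [← measureReal_biUnion_finset hdisj (fun i _ => hDm i) (fun i _ => hDf i)]
      refine measureReal_mono (iUnion₂_subset fun i _ => ?_) measure_ball_lt_top.ne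
      exact inter_subset_left.trans (ball_subset_ball (by norm_num))
    have hsum2 : (N : ℝ) * d ≤ ∑ i ∈ Finset.range N, volume.real (Dset i) := by
      have := Finset.card_nsmul_le_sum (Finset.range N) (fun i => volume.real (Dset i)) d
        (fun i hi => hDd i (Finset.mem_range.mp hi))
      simpa using this
    rw [div_lt_iff₀ hd0] at hN
    linarith
  obtain ⟨L, hL⟩ := hWL i
  intro x hx
  have h1 := hfirst (W i) L hL (hcacc i) (hW1 i) hi x hx
  simp only [hW] at h1
  have h2 : (1 / 2 : ℝ) ^ N ≤ (1 / 2) ^ i := pow_le_pow_of_le_one (by norm_num) (by norm_num) hiN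
  have h3 : (1 / 2 : ℝ) ^ i * 2 ^ i = 1 := by rw [← mul_pow]; norm_num
  have h4 : (0 : ℝ) < (1 / 2) ^ i := by positivity
  nlinarith

end DeGiorgi


section LinearEquations

variable {n : ℕ} {w : En n → ℝ} {V : En n → En n} {K : ℝ≥0} {lam Lam : ℝ}

theorem lipschitz_mul_of_support {f g : En n → ℝ} {Kf Kg Mf Mg : ℝ≥0} {S : Set (En n)}
    (hf : LipschitzWith Kf f) (hg : LipschitzWith Kg g) (hfM : ∀ x, |f x| ≤ Mf)
    (hfS : ∀ x ∉ S, f x = 0) (hgM : ∀ x ∈ S, |g x| ≤ Mg) :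
    LipschitzWith (Mf * Kg + Mg * Kf) (fun x => f x * g x) := by
  refine LipschitzWith.of_dist_le_mul fun x y => ?_
  have h1 := hf.dist_le_mul x y
  have h2 := hg.dist_le_mul x y
  rw [Real.dist_eq] at h1 h2 ⊢
  push_cast
  rw [add_mul, mul_assoc, mul_assoc]
  by_cases hy : y ∈ S
  · have e : f x * g x - f y * g y = f x * (g x - g y) + g y * (f x - f y) := by ring
    rw [e]
    refine (abs_add_le _ _).trans ?_
    rw [abs_mul, abs_mul]
    gcongr
    · exact hfM x
    · exact hgM y hy
  · rw [hfS y hy, sub_zero] at h1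
    rw [hfS y hy, zero_mul, sub_zero]
    refine le_add_of_nonneg_of_le (by positivity) ?_
    by_cases hx : x ∈ S
    · rw [abs_mul, mul_comm]
      gcongr
      exact hgM x hx
    · rw [hfS x hx]
      simp only [zero_mul, abs_zero]
      positivity

/-- `w` is a subsolution of `div V = 0` in the unit ball, where `V` is comparable to `∇ w`
on the set `{0 < w}`. -/
structure SubSol (lam Lam : ℝ) (w : En n → ℝ) (V : En n → En n) : Prop where
  lip : ∃ K, LipschitzWith K w
  meas : Measurable V
  bdd : ∃ M, ∀ x, ‖V x‖ ≤ M
  ell : ∀ᵐ x, x ∈ ball (0 : En n) 1 → 0 < w x →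
    lam * ‖gradient w x‖ ^ 2 ≤ ⟪V x, gradient w x⟫ ∧ ‖V x‖ ≤ Lam * ‖gradient w x‖
  test : ∀ φ : En n → ℝ, ∀ L, LipschitzWith L φ → (∀ x, 0 ≤ φ x) → ∀ r < 1,
    (∀ x, r ≤ ‖x‖ → φ x = 0) → ∫ x, ⟪V x, gradient φ x⟫ ≤ 0

theorem hasCompactSupport_of_zero {φ : En n → ℝ} {r : ℝ} (h : ∀ x, r ≤ ‖x‖ → φ x = 0) :
    HasCompactSupport φ := by
  refine HasCompactSupport.of_support_subset_isCompact (isCompact_closedBall (0 : En n) r) ?_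
  intro x hx
  rw [mem_closedBall_zero_iff]
  by_contra hcon
  exact hx (h x (not_le.mp hcon).le)

theorem integrable_inner_gradient {φ : En n → ℝ} (hφ : LipschitzWith K φ)
    (hc : HasCompactSupport φ) (hV : Measurable V) {M : ℝ} (hM : ∀ x, ‖V x‖ ≤ M) :
    Integrable (fun x => ⟪V x, gradient φ x⟫) := by
  refine ((integrable_norm_gradient hφ hc).const_mul M).mono'
    (hV.inner (measurable_gradient φ)).aestronglyMeasurable (Eventually.of_forall fun x => ?_)
  refine (norm_inner_le_norm _ _).trans ?_
  gcongr
  exact hM x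

/-- The Caccioppoli inequality. -/
theorem SubSol.energy (h : SubSol lam Lam w V) (hlam : 0 < lam) (hLam : 0 ≤ Lam) {k r R : ℝ}
    (hk : 0 ≤ k) (hr : 0 ≤ r) (hrR : r < R) (hR : R < 1) :
    ∫ x in ball (0 : En n) r ∩ {x | k < w x}, ‖gradient w x‖ ^ 2 ≤
      4 * Lam ^ 2 / lam ^ 2 / (R - r) ^ 2 * ∫ x in ball (0 : En n) R, max (w x - k) 0 ^ 2 := by
  obtain ⟨K, hw⟩ := h.lip
  obtain ⟨M, hM⟩ := h.bdd
  have hd0 : 0 < R - r := sub_pos.mpr hrR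
  set g : En n → ℝ := fun x => max (w x - k) 0 with hg
  have hgL : LipschitzWith K g := by
    have := (hw.sub (LipschitzWith.const k)).max_const 0
    rwa [add_zero] at this
  have hg0 : ∀ x, 0 ≤ g x := fun x => le_max_right _ _
  set η : En n → ℝ := cutoff r R with hη
  have hηL : LipschitzWith _ η := lipschitz_cutoff hrR
  have hηz : ∀ x ∉ closedBall (0 : En n) R, η x = 0 := fun x hx =>
    cutoff_eq_zero hrR (by rw [mem_closedBall_zero_iff] at hx; linarith)
  obtain ⟨Mg, hMg⟩ : ∃ Mg : ℝ≥0, ∀ x ∈ closedBall (0 : En n) R, |g x| ≤ Mg := by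
    obtain ⟨C, hC⟩ := (isCompact_closedBall (0 : En n) R).exists_bound_of_continuousOn
      hgL.continuous.continuousOn
    exact ⟨C.toNNReal, fun x hx => (hC x hx).trans (Real.le_coe_toNNReal C)⟩
  have hηg := lipschitz_mul_of_support hηL hgL (Mf := 1) (fun x => abs_cutoff_le_one r R x) hηz hMg
  have hηgM : ∀ x ∈ closedBall (0 : En n) R, |η x * g x| ≤ Mg := fun x hx => by
    rw [abs_mul]
    exact (mul_le_of_le_one_left (abs_nonneg _) (abs_cutoff_le_one r R x)).trans (hMg x hx)
  have hφL := lipschitz_mul_of_support hηL hηg (Mf := 1) (fun x => abs_cutoff_le_one r R x) hηz hηgM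
  set φ : En n → ℝ := fun x => η x * (η x * g x) with hφ
  have hφ0 : ∀ x, 0 ≤ φ x := fun x => mul_nonneg (cutoff_nonneg _ _ _)
    (mul_nonneg (cutoff_nonneg _ _ _) (hg0 x))
  have hφz : ∀ x, R ≤ ‖x‖ → φ x = 0 := fun x hx => by
    simp [hφ, hη, cutoff_eq_zero hrR hx]
  have htest := h.test φ _ hφL hφ0 R hR hφz
  have hφc := hasCompactSupport_of_zero hφz
  set S := ball (0 : En n) r ∩ {x | k < w x} with hS
  have hSm : MeasurableSet S :=
    measurableSet_ball.inter (measurableSet_lt measurable_const hw.continuous.measurable)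
  have hSf : volume S ≠ ⊤ := volume_ball_inter_ne_top _ _
  set c : ℝ := 2 * Lam ^ 2 / lam / (R - r) ^ 2 with hc
  have hc0 : 0 ≤ c := by positivity
  have hpt : ∀ᵐ x, S.indicator (fun x => lam / 2 * ‖gradient w x‖ ^ 2) x ≤
      ⟪V x, gradient φ x⟫ + (ball (0 : En n) R).indicator (fun x => c * g x ^ 2) x := by
    filter_upwards [h.ell, ae_gradient_max_const hw k, differentiableAt_ae hηL,
      differentiableAt_ae hgL, differentiableAt_ae hηg] with x hx1 hx2 hx3 hx4 hx5
    by_cases hz : ‖x‖ < R ∧ k < w x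
    · obtain ⟨hxR, hkw⟩ := hz
      obtain ⟨hx6, hx7⟩ := hx1 (mem_ball_zero_iff.mpr (hxR.trans hR)) (hk.trans_lt hkw)
      rw [if_pos hkw] at hx2
      rw [indicator_of_mem (mem_ball_zero_iff.mpr hxR), hφ, gradient_mul hx3 hx5,
        gradient_mul hx3 hx4, hx2]
      simp only [inner_add_right, inner_smul_right]
      have hη1 : ‖gradient η x‖ ≤ 1 / (R - r) := by
        have := norm_gradient_le hηL x
        rwa [Real.coe_toNNReal _ (by positivity)] at this
      have hin : -(Lam * ‖gradient w x‖ * (1 / (R - r))) ≤ ⟪V x, gradient η x⟫ := by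
        have h1 := abs_le.mp (abs_real_inner_le_norm (V x) (gradient η x))
        refine le_trans (neg_le_neg ?_) h1.1
        gcongr
      have hη0 : 0 ≤ η x := cutoff_nonneg _ _ _
      set a := ‖gradient w x‖ with ha
      have ha0 : 0 ≤ a := norm_nonneg _
      have hkey : lam / 2 * (η x * a) ^ 2 ≤ η x * (η x * (lam * a ^ 2) +
          g x * -(Lam * a * (1 / (R - r)))) +
          η x * g x * -(Lam * a * (1 / (R - r))) + c * g x ^ 2 := by
        have e : η x * (η x * (lam * a ^ 2) + g x * -(Lam * a * (1 / (R - r)))) +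
          η x * g x * -(Lam * a * (1 / (R - r))) + c * g x ^ 2 - lam / 2 * (η x * a) ^ 2 =
          lam / 2 * (η x * a - 2 * Lam / (lam * (R - r)) * g x) ^ 2 := by
          rw [hc]; field_simp; ring
        have : 0 ≤ lam / 2 * (η x * a - 2 * Lam / (lam * (R - r)) * g x) ^ 2 := by positivity
        linarith
      have hstep : η x * (η x * (lam * a ^ 2) +
          g x * -(Lam * a * (1 / (R - r)))) +
          η x * g x * -(Lam * a * (1 / (R - r))) ≤ η x * (η x * ⟪V x, gradient w x⟫ +
          g x * ⟪V x, gradient η x⟫) + η x * g x * ⟪V x, gradient η x⟫ := by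
        have := hg0 x
        gcongr
      refine le_trans ?_ (hkey.trans (by linarith))
      by_cases hxS : x ∈ S
      · rw [indicator_of_mem hxS, hη, cutoff_eq_one hrR (mem_ball_zero_iff.mp hxS.1).le, one_mul]
      · rw [indicator_of_notMem hxS]
        positivity
    · have hφx : φ x = 0 := by
        by_cases hxR : ‖x‖ < R
        · have : w x ≤ k := by
            by_contra hcon
            exact hz ⟨hxR, not_le.mp hcon⟩
          have : g x = 0 := max_eq_right (by linarith)
          simp [hφ, this]
        · exact hφz x (not_lt.mp hxR)
      rw [gradient_eq_zero_of_isMin (f := φ) (fun y => by rw [hφx]; exact hφ0 y), inner_zero_right,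
        zero_add, indicator_of_notMem]
      · exact indicator_nonneg (fun y _ => by positivity) x
      · exact fun hx => hz ⟨(mem_ball_zero_iff.mp hx.1).trans hrR, hx.2⟩
  have hw2 : IntegrableOn (fun x => lam / 2 * ‖gradient w x‖ ^ 2) S := by
    refine Integrable.const_mul (integrableOn_of_le hSf
      ((measurable_gradient w).norm.pow_const 2).aestronglyMeasurable
      (M := (K : ℝ) ^ 2) fun x => ?_) _
    rw [norm_pow, norm_norm]
    exact pow_le_pow_left₀ (norm_nonneg _) (norm_gradient_le hw x) 2
  have hg2 : IntegrableOn (fun x => c * g x ^ 2) (ball (0 : En n) R) :=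
    ((continuous_const.mul (hgL.continuous.pow 2)).continuousOn.integrableOn_compact
      (isCompact_closedBall (0 : En n) R)).mono_set ball_subset_closedBall
  have hVi := integrable_inner_gradient hφL hφc h.meas hM
  have hint := integral_mono_ae (hw2.integrable_indicator hSm)
    (hVi.add (hg2.integrable_indicator measurableSet_ball)) hpt
  rw [integral_add' hVi (hg2.integrable_indicator measurableSet_ball), integral_indicator hSm,
    integral_indicator measurableSet_ball, integral_const_mul, integral_const_mul] at hint
  have hfin : lam / 2 * (∫ x in S, ‖gradient w x‖ ^ 2) ≤
      c * ∫ x in ball (0 : En n) R, g x ^ 2 := by linarith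
  have : ∫ x in S, ‖gradient w x‖ ^ 2 ≤ 2 / lam * (c * ∫ x in ball (0 : En n) R, g x ^ 2) := by
    rw [div_mul_eq_mul_div, le_div_iff₀ hlam]
    linarith
  refine this.trans (le_of_eq ?_)
  rw [hc]
  field_simp
  ring

theorem SubSol.weakCacc (h : SubSol lam Lam w V) (hlam : 0 < lam) (hLam : 0 ≤ Lam)
    (hw1 : ∀ x ∈ ball (0 : En n) 1, w x ≤ 1) (i : ℕ) :
    WeakCacc (4 * Lam ^ 2 / lam ^ 2) (fun x => 2 ^ i * (w x - 1) + 1) := by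
  intro k r R hk hk1 hr hrR hR
  obtain ⟨K, hw⟩ := h.lip
  have hp : (1 : ℝ) ≤ 2 ^ i := one_le_pow₀ (by norm_num)
  have hp0 : (0 : ℝ) < 2 ^ i := by positivity
  set l := 1 - (1 - k) / 2 ^ i with hl
  have hl0 : 0 ≤ l := by
    have : (1 - k) / 2 ^ i ≤ 1 := by rw [div_le_one hp0]; linarith
    linarith
  have hiff : ∀ x, k < 2 ^ i * (w x - 1) + 1 ↔ l < w x := fun x => by
    rw [hl, sub_lt_comm, lt_div_iff₀ hp0]
    constructor <;> intro h <;> nlinarith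
  have hgr : ∀ x, gradient (fun x => 2 ^ i * (w x - 1) + 1) x = (2 ^ i : ℝ) • gradient w x := by
    intro x
    have e : (fun x => 2 ^ i * (w x - 1) + 1) = fun x => 2 ^ i * w x - (2 ^ i - 1) := by
      funext x; ring
    rw [e, gradient_sub_const, gradient_const_mul]
  simp only [hiff, hgr, norm_smul, mul_pow, norm_pow, Real.norm_ofNat]
  rw [integral_const_mul]
  have hen := h.energy hlam hLam hl0 (by linarith) hrR hR
  have hup : ∫ x in ball (0 : En n) R, max (w x - l) 0 ^ 2 ≤
      (1 / (2 ^ i) ^ 2) * volume.real (ball (0 : En n) R ∩ {x | l < w x}) := by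
    set T := ball (0 : En n) R ∩ {x | l < w x} with hT
    have hTm : MeasurableSet {x | l < w x} :=
      measurableSet_lt measurable_const hw.continuous.measurable
    have : ∫ x in ball (0 : En n) R, max (w x - l) 0 ^ 2 ≤
        ∫ x in ball (0 : En n) R, {x | l < w x}.indicator (fun _ => 1 / ((2 : ℝ) ^ i) ^ 2) x := by
      refine setIntegral_mono_on ?_ ?_ measurableSet_ball fun x hx => ?_
      · exact (((hw.continuous.sub continuous_const).max continuous_const).pow 2
          |>.continuousOn.integrableOn_compact (isCompact_closedBall (0 : En n) R)).mono_set
            ball_subset_closedBall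
      · exact (integrableOn_const measure_ball_lt_top.ne).indicator hTm
      · by_cases hxl : l < w x
        · rw [indicator_of_mem (show x ∈ {x | l < w x} from hxl), max_eq_left (by linarith),
            one_div, ← inv_pow]
          have h1 := hw1 x (ball_subset_ball hR.le hx)
          refine pow_le_pow_left₀ (by linarith) ?_ 2
          have h2 : (1 - k) / 2 ^ i ≤ (2 ^ i)⁻¹ := by
            rw [inv_eq_one_div]; gcongr; linarith
          linarith
        · rw [indicator_of_notMem (show x ∉ {x | l < w x} from hxl), max_eq_right (by linarith)]
          norm_num
    refine this.trans (le_of_eq ?_)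
    rw [setIntegral_indicator hTm, setIntegral_const, smul_eq_mul, mul_comm]
  calc _ ≤ (2 ^ i) ^ 2 * (4 * Lam ^ 2 / lam ^ 2 / (R - r) ^ 2 *
        ((1 / (2 ^ i) ^ 2) * volume.real (ball (0 : En n) R ∩ {x | l < w x}))) := by
        refine mul_le_mul_of_nonneg_left (hen.trans ?_) (by positivity)
        exact mul_le_mul_of_nonneg_left hup (by positivity)
    _ = _ := by field_simp

/-- Growth lemma for subsolutions. -/
theorem growth (hn : 2 ≤ n) (hlam : 0 < lam) (hLam : lam ≤ Lam) {ν : ℝ} (hν : 0 < ν) :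
    ∃ δ : ℝ, 0 < δ ∧ δ ≤ 1 / 2 ∧ ∀ (w : En n → ℝ) (V : En n → En n), SubSol lam Lam w V →
      (∀ x ∈ ball (0 : En n) 1, w x ≤ 1) →
      ν ≤ volume.real {x ∈ ball (0 : En n) (3 / 4) | w x ≤ 0} →
      ∀ x ∈ ball (0 : En n) (1 / 2), w x ≤ 1 - δ := by
  have hγ : 1 ≤ 4 * Lam ^ 2 / lam ^ 2 := by
    rw [le_div_iff₀ (by positivity)]; nlinarith
  obtain ⟨δ, hδ, hδ1, h⟩ := deGiorgi_second hn hγ hν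
  refine ⟨δ, hδ, hδ1, fun w V hw hw1 hm => ?_⟩
  obtain ⟨K, hK⟩ := hw.lip
  exact h w K hK (hw.weakCacc hlam (hlam.le.trans hLam) hw1) hw1 hm

end LinearEquations


section Oscillation

variable {n : ℕ} {w : En n → ℝ} {V : En n → En n} {K : ℝ≥0} {lam Lam : ℝ}

theorem ae_comp_homothety {P : En n → Prop} (h : ∀ᵐ x, P x) (z : En n) {r : ℝ} (hr : r ≠ 0) :
    ∀ᵐ x, P (z + r • x) := by
  have h1 : ∀ᵐ x : En n, P (z + x) :=
    (measurePreserving_add_left volume z).quasiMeasurePreserving.ae h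
  have hq : Measure.QuasiMeasurePreserving (fun x : En n => r • x) volume volume := by
    refine ⟨measurable_const_smul r, ?_⟩
    rw [Measure.map_addHaar_smul _ hr]
    exact Measure.smul_absolutelyContinuous
  exact hq.ae h1

theorem integral_comp_homothety (f : En n → ℝ) (z : En n) {r : ℝ} :
    ∫ x, f (z + r • x) = |(r ^ n)⁻¹| * ∫ x, f x := by
  have := Measure.integral_comp_smul (volume : Measure (En n)) (fun x => f (z + x)) r
  rw [this, integral_add_left_eq_self (fun x => f x) z]
  simp

/-- `w` solves `div V = 0` in the unit ball, where `V` is comparable to `∇ w`. -/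
structure LinSol (lam Lam : ℝ) (w : En n → ℝ) (V : En n → En n) : Prop where
  lip : ∃ K, LipschitzWith K w
  meas : Measurable V
  bdd : ∃ M, ∀ x, ‖V x‖ ≤ M
  ell : ∀ᵐ x, x ∈ ball (0 : En n) 1 →
    lam * ‖gradient w x‖ ^ 2 ≤ ⟪V x, gradient w x⟫ ∧ ‖V x‖ ≤ Lam * ‖gradient w x‖
  test : ∀ φ : En n → ℝ, ∀ L, LipschitzWith L φ → ∀ r < 1,
    (∀ x, r ≤ ‖x‖ → φ x = 0) → ∫ x, ⟪V x, gradient φ x⟫ = 0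

theorem LinSol.subSol (h : LinSol lam Lam w V) : SubSol lam Lam w V where
  lip := h.lip
  meas := h.meas
  bdd := h.bdd
  ell := h.ell.mono fun _ hx hb _ => hx hb
  test := fun φ L hL _ r hr hz => (h.test φ L hL r hr hz).le

theorem lipschitz_comp_homothety {f : En n → ℝ} (hf : LipschitzWith K f) (z : En n) (r : ℝ) :
    LipschitzWith (K * ‖r‖₊) (fun x => f (z + r • x)) := by
  have h1 : LipschitzWith ‖r‖₊ (fun x : En n => z + r • x) := by
    have := (LipschitzWith.const z).add (lipschitzWith_smul r (β := En n))
    rwa [zero_add] at this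
  exact hf.comp h1

/-- A test function for a rescaled equation transforms into a test function for the original
equation. -/
theorem integral_inner_rescale {V : En n → En n} {φ : En n → ℝ} (z : En n) {r : ℝ} (hr : r ≠ 0) :
    ∫ x, ⟪V (z + r • x), gradient φ x⟫ =
      |(r ^ n)⁻¹| * (r * ∫ x, ⟪V x, gradient (fun y => φ (-(r⁻¹ • z) + r⁻¹ • y)) x⟫) := by
  rw [← integral_const_mul, ← integral_comp_homothety _ z]
  congr 1
  ext x
  rw [gradient_comp_smul, real_inner_smul_right]
  have : -(r⁻¹ • z) + r⁻¹ • (z + r • x) = x := by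
    rw [smul_add, smul_smul, inv_mul_cancel₀ hr, one_smul]; abel
  rw [this, ← mul_assoc, mul_inv_cancel₀ hr, one_mul]

theorem LinSol.rescale (h : LinSol lam Lam w V) {z : En n} {r : ℝ} (hr : 0 < r)
    (hz : ‖z‖ + r ≤ 1) (a b : ℝ) :
    LinSol lam Lam (fun x => a * w (z + r • x) + b) (fun x => (a * r) • V (z + r • x)) where
  lip := by
    obtain ⟨K, hK⟩ := h.lip
    have h1 := (lipschitzWith_smul a (β := ℝ)).comp (lipschitz_comp_homothety hK z r)
    have h2 := h1.add (LipschitzWith.const b)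
    exact ⟨_, h2⟩
  meas := (h.meas.comp (by fun_prop : Measurable fun x : En n => z + r • x)).const_smul (a * r)
  bdd := by
    obtain ⟨M, hM⟩ := h.bdd
    refine ⟨|a * r| * M, fun x => ?_⟩
    rw [norm_smul, Real.norm_eq_abs]
    gcongr
    exact hM _
  ell := by
    filter_upwards [ae_comp_homothety h.ell z hr.ne'] with x hx hxb
    have hb : z + r • x ∈ ball (0 : En n) 1 := by
      rw [mem_ball_zero_iff] at hxb ⊢
      calc ‖z + r • x‖ ≤ ‖z‖ + r * ‖x‖ := by
            refine (norm_add_le _ _).trans ?_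
            rw [norm_smul, Real.norm_of_nonneg hr.le]
        _ < ‖z‖ + r * 1 := by gcongr
        _ ≤ 1 := by linarith
    obtain ⟨h1, h2⟩ := hx hb
    have hg : gradient (fun x => a * w (z + r • x) + b) x = (a * r) • gradient w (z + r • x) := by
      have e1 : gradient (fun x => a * w (z + r • x) + b) x =
          gradient (fun x => a * w (z + r • x)) x := by
        unfold gradient
        rw [fderiv_add_const]
      rw [e1, gradient_const_mul, gradient_comp_smul, smul_smul]
    rw [hg, norm_smul, norm_smul, real_inner_smul_left, real_inner_smul_right, Real.norm_eq_abs,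
      mul_pow, sq_abs]
    constructor
    · calc lam * ((a * r) ^ 2 * ‖gradient w (z + r • x)‖ ^ 2) =
            (a * r) ^ 2 * (lam * ‖gradient w (z + r • x)‖ ^ 2) := by ring
        _ ≤ (a * r) ^ 2 * ⟪V (z + r • x), gradient w (z + r • x)⟫ := by gcongr
        _ = _ := by ring
    · calc |a * r| * ‖V (z + r • x)‖ ≤ |a * r| * (Lam * ‖gradient w (z + r • x)‖) := by gcongr
        _ = _ := by ring
  test := fun φ L hL s hs hφ => by
    simp only [real_inner_smul_left]
    rw [integral_const_mul, integral_inner_rescale z hr.ne']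
    have := h.test (fun y => φ (-(r⁻¹ • z) + r⁻¹ • y)) _ (lipschitz_comp_homothety hL _ _)
      (‖z‖ + r * max s 0) (by
        calc ‖z‖ + r * max s 0 < ‖z‖ + r * 1 := by
              gcongr; exact max_lt hs one_pos
          _ ≤ 1 := by linarith) (fun x hx => hφ _ (by
        refine (le_max_left s 0).trans ?_
        rw [← smul_neg, ← smul_add, norm_smul, norm_inv, Real.norm_of_nonneg hr.le,
          le_inv_mul_iff₀ hr, neg_add_eq_sub]
        have := norm_sub_norm_le x z
        linarith))
    rw [this]
    simp

/-- One step of the reduction of oscillation. -/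
theorem oscillation_step (hn : 2 ≤ n) (hlam : 0 < lam) (hLam : lam ≤ Lam) :
    ∃ δ, 0 < δ ∧ δ ≤ 1 / 2 ∧ ∀ (w : En n → ℝ) (V : En n → En n), LinSol lam Lam w V →
      (∀ x ∈ ball (0 : En n) 1, |w x| ≤ 1) →
      ∃ c, ∀ x ∈ ball (0 : En n) (1 / 2), |w x - c| ≤ 1 - δ / 2 := by
  have hB : 0 < volume.real (ball (0 : En n) (3 / 4)) :=
    ENNReal.toReal_pos (measure_ball_pos _ _ (by norm_num)).ne' measure_ball_lt_top.ne
  obtain ⟨δ, hδ0, hδ1, hδ⟩ := growth hn hlam hLam (half_pos hB)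
  refine ⟨δ, hδ0, hδ1, fun w V h hw => ?_⟩
  have hsub : ∀ x ∈ ball (0 : En n) (1 / 2), x ∈ ball (0 : En n) 1 := fun x hx =>
    ball_subset_ball (by norm_num) hx
  by_cases hc : volume.real (ball (0 : En n) (3 / 4)) / 2 ≤
      volume.real {x ∈ ball (0 : En n) (3 / 4) | w x ≤ 0}
  · refine ⟨-(δ / 2), fun x hx => ?_⟩
    have h1 := hδ w V h.subSol (fun x hx => (abs_le.mp (hw x hx)).2) hc x hx
    have h2 := abs_le.mp (hw x (hsub x hx))
    rw [abs_le]
    constructor <;> linarith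
  · have h' := h.rescale (z := 0) (r := 1) one_pos (by simp) (-1) 0
    simp only [one_smul, zero_add, add_zero, neg_mul, one_mul, mul_one] at h'
    refine ⟨δ / 2, fun x hx => ?_⟩
    have hc' : volume.real (ball (0 : En n) (3 / 4)) / 2 ≤
        volume.real {x ∈ ball (0 : En n) (3 / 4) | -w x ≤ 0} := by
      have hle : volume.real (ball (0 : En n) (3 / 4)) ≤
          volume.real {x ∈ ball (0 : En n) (3 / 4) | w x ≤ 0} +
          volume.real {x ∈ ball (0 : En n) (3 / 4) | -w x ≤ 0} := by
        refine le_trans (measureReal_mono ?_ ?_) (measureReal_union_le _ _)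
        · intro y hy
          rcases le_total (w y) 0 with h0 | h0
          · exact Or.inl ⟨hy, h0⟩
          · exact Or.inr ⟨hy, by linarith⟩
        · exact ((measure_mono (t := ball (0 : En n) (3 / 4)) (by
            rintro y (hy | hy) <;> exact hy.1)).trans_lt measure_ball_lt_top).ne
      linarith
    have h1 := hδ _ _ h'.subSol (fun x hx => by linarith [(abs_le.mp (hw x hx)).1]) hc' x hx
    have h2 := abs_le.mp (hw x (hsub x hx))
    rw [abs_le]
    constructor <;> linarith

/-- Interior Hölder estimate for solutions of linear equations. -/
theorem holder_estimate (hn : 2 ≤ n) (hlam : 0 < lam) (hLam : lam ≤ Lam) :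
    ∃ α : ℝ, 0 < α ∧ α ≤ 1 ∧ ∀ (w : En n → ℝ) (V : En n → En n), LinSol lam Lam w V →
      (∀ x ∈ ball (0 : En n) 1, |w x| ≤ 1) →
      ∀ x ∈ ball (0 : En n) 1, |w x - w 0| ≤ 4 * ‖x‖ ^ α := by
  obtain ⟨δ, hδ0, hδ1, hδ⟩ := oscillation_step (lam := lam) (Lam := Lam) hn hlam hLam
  set θ := 1 - δ / 2 with hθ
  have hθ0 : 3 / 4 ≤ θ := by linarith
  have hθ1 : θ < 1 := by linarith
  have hθp : 0 < θ := by linarith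
  have key : ∀ j : ℕ, ∀ (w : En n → ℝ) (V : En n → En n), LinSol lam Lam w V →
      (∀ x ∈ ball (0 : En n) 1, |w x| ≤ 1) →
      ∃ c, ∀ x ∈ ball (0 : En n) ((1 / 2) ^ j), |w x - c| ≤ θ ^ j := by
    intro j
    induction j with
    | zero => intro w V _ hw; exact ⟨0, fun x hx => by simpa using hw x (by simpa using hx)⟩
    | succ j ih =>
      intro w V h hw
      obtain ⟨c, hc⟩ := hδ w V h hw
      have h' := h.rescale (z := 0) (r := 1 / 2) (by norm_num) (by norm_num) θ⁻¹ (-(θ⁻¹ * c))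
      obtain ⟨c', hc'⟩ := ih _ _ h' (fun x hx => by
        have h2 := hc (0 + (1 / 2 : ℝ) • x) (by
          rw [mem_ball_zero_iff] at hx ⊢
          rw [zero_add, norm_smul, Real.norm_of_nonneg (by norm_num)]
          linarith)
        rw [← sub_eq_add_neg, ← mul_sub, abs_mul, abs_of_pos (inv_pos.mpr hθp),
          inv_mul_le_iff₀ hθp]
        linarith)
      refine ⟨c + θ * c', fun x hx => ?_⟩
      have h3 := hc' ((2 : ℝ) • x) (by
        rw [mem_ball_zero_iff] at hx ⊢
        rw [norm_smul, Real.norm_of_nonneg (by norm_num)]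
        rw [pow_succ] at hx
        linarith)
      rw [zero_add, smul_smul] at h3
      norm_num at h3
      calc |w x - (c + θ * c')| = |θ * (θ⁻¹ * w x + -(θ⁻¹ * c) - c')| := by
            congr 1; field_simp; ring
        _ ≤ θ * θ ^ j := by
            rw [abs_mul, abs_of_pos hθp]
            gcongr
        _ = θ ^ (j + 1) := by ring
  refine ⟨Real.logb (1 / 2) θ, ?_, ?_, fun w V h hw x hx => ?_⟩
  · exact Real.logb_pos_of_base_lt_one (by norm_num) (by norm_num) hθp hθ1
  · rw [Real.logb_le_iff_le_rpow_of_base_lt_one (by norm_num) (by norm_num) hθp, Real.rpow_one]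
    linarith
  · rcases eq_or_ne x 0 with rfl | hx0
    · simp; positivity
    rw [mem_ball_zero_iff] at hx
    have hxp := norm_pos_iff.mpr hx0
    obtain ⟨m, hm1, hm2⟩ := exists_nat_pow_near_of_lt_one hxp hx.le
      (by norm_num : (0 : ℝ) < 1 / 2) (by norm_num)
    obtain ⟨k, hk1, hk2⟩ : ∃ k : ℕ, (1 / 2 : ℝ) ^ (k + 2) < ‖x‖ ∧ ‖x‖ < (1 / 2) ^ k := by
      cases m with
      | zero =>
        refine ⟨0, lt_of_le_of_lt ?_ hm1, by simpa using hx⟩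
        norm_num
      | succ k =>
        refine ⟨k, hm1, hm2.trans_lt ?_⟩
        exact pow_lt_pow_right_of_lt_one₀ (by norm_num) (by norm_num) (Nat.lt_succ_self k)
    obtain ⟨c, hc⟩ := key k w V h hw
    have h1 := hc x (by rwa [mem_ball_zero_iff])
    have h2 := hc 0 (by rw [mem_ball_zero_iff, norm_zero]; positivity)
    have h3 : |w x - w 0| ≤ 2 * θ ^ k := by
      calc |w x - w 0| = |(w x - c) - (w 0 - c)| := by congr 1; ring
        _ ≤ |w x - c| + |w 0 - c| := abs_sub _ _
        _ ≤ _ := by linarith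
    have h4 : θ ^ (k + 2) ≤ ‖x‖ ^ Real.logb (1 / 2) θ := by
      have e : θ ^ (k + 2) = ((1 / 2 : ℝ) ^ (k + 2)) ^ Real.logb (1 / 2) θ := by
        rw [← Real.rpow_natCast (1 / 2 : ℝ), ← Real.rpow_mul (by norm_num), mul_comm,
          Real.rpow_mul (by norm_num), Real.rpow_logb (by norm_num) (by norm_num) hθp,
          Real.rpow_natCast]
      rw [e]
      exact Real.rpow_le_rpow (by positivity) hk1.le
        (Real.logb_pos_of_base_lt_one (by norm_num) (by norm_num) hθp hθ1).le
    have h5 : 2 * θ ^ k ≤ 4 * θ ^ (k + 2) := by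
      rw [pow_add]
      nlinarith [pow_pos hθp k, mul_pos (pow_pos hθp k) hθp]
    linarith

end Oscillation


section MinkowskiStructure

variable {n : ℕ} (N : MinkowskiNorm n)

theorem F_zero : N.F 0 = 0 := by simpa using N.homog 0 le_rfl 0

theorem F_nonneg (ξ : En n) : 0 ≤ N.F ξ := by
  rcases eq_or_ne ξ 0 with rfl | h
  · rw [F_zero]
  · exact (N.pos ξ h).le

theorem F_smul (c : ℝ) (ξ : En n) : N.F (c • ξ) = |c| * N.F ξ := by
  rcases le_total 0 c with h | h
  · rw [N.homog c h, abs_of_nonneg h]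
  · rw [← N.even, ← neg_smul, N.homog (-c) (by linarith), abs_of_nonpos h]

theorem continuous_F : Continuous N.F := by
  have := N.convexOn.continuousOn_interior
  rwa [interior_univ, continuousOn_univ] at this

theorem F_bounds : ∃ m M : ℝ, 0 < m ∧ 0 < M ∧ ∀ ξ, m * ‖ξ‖ ≤ N.F ξ ∧ N.F ξ ≤ M * ‖ξ‖ := by
  rcases (sphere (0 : En n) 1).eq_empty_or_nonempty with h | h
  · refine ⟨1, 1, one_pos, one_pos, fun ξ => ?_⟩
    have : ξ = 0 := by
      by_contra h0
      have : (‖ξ‖⁻¹ • ξ) ∈ sphere (0 : En n) 1 := by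
        rw [mem_sphere_zero_iff_norm, norm_smul, norm_inv, norm_norm,
          inv_mul_cancel₀ (norm_ne_zero_iff.mpr h0)]
      rw [h] at this
      exact this
    simp [this, F_zero]
  · obtain ⟨a, ha, hmin⟩ := (isCompact_sphere (0 : En n) 1).exists_isMinOn h
      (continuous_F N).continuousOn
    obtain ⟨b, hb, hmax⟩ := (isCompact_sphere (0 : En n) 1).exists_isMaxOn h
      (continuous_F N).continuousOn
    have ha0 : a ≠ 0 := fun h0 => by simp [h0] at ha
    have hb0 : b ≠ 0 := fun h0 => by simp [h0] at hb
    refine ⟨N.F a, N.F b, N.pos a ha0, N.pos b hb0, fun ξ => ?_⟩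
    rcases eq_or_ne ξ 0 with rfl | h0
    · simp [F_zero]
    have hs : (‖ξ‖⁻¹ • ξ) ∈ sphere (0 : En n) 1 := by
      rw [mem_sphere_zero_iff_norm, norm_smul, norm_inv, norm_norm,
        inv_mul_cancel₀ (norm_ne_zero_iff.mpr h0)]
    have e : N.F ξ = ‖ξ‖ * N.F (‖ξ‖⁻¹ • ξ) := by
      rw [F_smul, abs_inv, abs_norm, ← mul_assoc, mul_inv_cancel₀ (norm_ne_zero_iff.mpr h0),
        one_mul]
    rw [e, mul_comm (N.F a), mul_comm (N.F b)]
    exact ⟨mul_le_mul_of_nonneg_left (hmin hs) (norm_nonneg _),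
      mul_le_mul_of_nonneg_left (hmax hs) (norm_nonneg _)⟩

/-- The gradient of `F² / 2`. -/
def legendre (ξ : En n) : En n := gradient (fun y => N.F y ^ 2 / 2) ξ

theorem contDiffAt_halfSq {ξ : En n} (h : ξ ≠ 0) :
    ContDiffAt ℝ (⊤ : ℕ∞) (fun y => N.F y ^ 2 / 2) ξ := by
  have : ContDiffAt ℝ (⊤ : ℕ∞) N.F ξ := N.smooth.contDiffAt (isOpen_compl_singleton.mem_nhds h)
  exact (this.pow 2).div_const 2

theorem legendre_smul {c : ℝ} (hc : c ≠ 0) (ξ : En n) : legendre N (c • ξ) = c • legendre N ξ := by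
  have h1 := gradient_comp_smul (fun y => N.F y ^ 2 / 2) c 0 ξ
  have h2 : (fun y : En n => N.F (0 + c • y) ^ 2 / 2) = fun y => c ^ 2 * (N.F y ^ 2 / 2) := by
    ext y
    rw [zero_add, F_smul, mul_pow, sq_abs]; ring
  rw [h2, gradient_const_mul, zero_add, pow_two, mul_smul] at h1
  exact (smul_right_injective _ hc h1).symm

theorem legendre_zero : legendre N 0 = 0 := by
  have h := legendre_smul N two_ne_zero 0
  rw [smul_zero, two_smul] at h
  simpa using h

theorem legendre_neg (ξ : En n) : legendre N (-ξ) = -legendre N ξ := by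
  simpa using legendre_smul N (c := -1) (by norm_num) ξ

theorem contDiffAt_legendre {ξ : En n} (h : ξ ≠ 0) :
    ContDiffAt ℝ (⊤ : ℕ∞) (legendre N) ξ := by
  have h1 : ContDiffAt ℝ (⊤ : ℕ∞) (fderiv ℝ (fun y => N.F y ^ 2 / 2)) ξ :=
    (contDiffAt_halfSq N h).fderiv_right (by norm_cast)
  exact (InnerProductSpace.toDual ℝ (En n)).symm.toContinuousLinearEquiv.contDiff.contDiffAt.comp ξ h1

theorem hasFDerivAt_legendre {ξ : En n} (h : ξ ≠ 0) :
    HasFDerivAt (legendre N) (fderiv ℝ (legendre N) ξ) ξ :=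
  ((contDiffAt_legendre N h).differentiableAt (by simp)).hasFDerivAt

theorem inner_fderiv_legendre {ξ : En n} (h : ξ ≠ 0) (v y : En n) :
    ⟪fderiv ℝ (legendre N) ξ v, y⟫ =
      fderiv ℝ (fun x => fderiv ℝ (fun y => N.F y ^ 2 / 2) x) ξ v y := by
  have h1 : DifferentiableAt ℝ (fderiv ℝ (fun y => N.F y ^ 2 / 2)) ξ :=
    ((contDiffAt_halfSq N h).fderiv_right (m := 1) (by norm_cast)).differentiableAt (by simp)
  have h2 : (fun x => ⟪legendre N x, y⟫) = fun x => fderiv ℝ (fun y => N.F y ^ 2 / 2) x y := by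
    ext x
    exact inner_gradient_left
  have h3 := fderiv_inner_apply ℝ (hasFDerivAt_legendre N h).differentiableAt
    (differentiableAt_const y) v
  rw [h2, fderiv_clm_apply h1 (differentiableAt_const y)] at h3
  simpa using h3.symm

theorem inner_fderiv_legendre_symm {ξ : En n} (h : ξ ≠ 0) (v y : En n) :
    ⟪fderiv ℝ (legendre N) ξ v, y⟫ = ⟪fderiv ℝ (legendre N) ξ y, v⟫ := by
  rw [inner_fderiv_legendre N h, inner_fderiv_legendre N h]
  exact (contDiffAt_halfSq N h).isSymmSndFDerivAt (by
    simp only [minSmoothness_of_isRCLikeNormedField]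
    exact WithTop.coe_le_coe.mpr (le_top : (2 : ℕ∞) ≤ ⊤)) v y

theorem fderiv_legendre_self {ξ : En n} (h : ξ ≠ 0) :
    fderiv ℝ (legendre N) ξ ξ = legendre N ξ := by
  have h1 : HasDerivAt (fun t : ℝ => t • ξ) ξ 1 := by
    simpa using (hasDerivAt_id (1 : ℝ)).smul_const ξ
  have h2 : HasDerivAt (fun t : ℝ => legendre N (t • ξ)) (fderiv ℝ (legendre N) ξ ξ) 1 := by
    have := hasFDerivAt_legendre N h
    rw [← one_smul ℝ ξ] at this
    have h3 := this.comp_hasDerivAt (1 : ℝ) h1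
    rw [one_smul] at h3
    exact h3
  have h3 : HasDerivAt (fun t : ℝ => t • legendre N ξ) (legendre N ξ) 1 := by
    simpa using (hasDerivAt_id (1 : ℝ)).smul_const (legendre N ξ)
  refine h2.unique (h3.congr_of_eventuallyEq ?_)
  filter_upwards [isOpen_ne.mem_nhds (one_ne_zero : (1 : ℝ) ≠ 0)] with t ht
  exact legendre_smul N ht ξ

theorem inner_legendre_self (ξ : En n) : ⟪legendre N ξ, ξ⟫ = N.F ξ ^ 2 := by
  rcases eq_or_ne ξ 0 with rfl | h
  · simp [F_zero]
  have h1 : HasDerivAt (fun t : ℝ => t • ξ) ξ 1 := by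
    simpa using (hasDerivAt_id (1 : ℝ)).smul_const ξ
  have hd := ((contDiffAt_halfSq N h).differentiableAt (by simp)).hasFDerivAt
  have h2 : HasDerivAt (fun t : ℝ => N.F (t • ξ) ^ 2 / 2)
      (fderiv ℝ (fun y => N.F y ^ 2 / 2) ξ ξ) 1 := by
    have h0 := hd
    rw [← one_smul ℝ ξ] at h0
    have h3 := h0.comp_hasDerivAt (1 : ℝ) h1
    rw [one_smul] at h3
    exact h3
  have h3 : HasDerivAt (fun t : ℝ => t ^ 2 * (N.F ξ ^ 2 / 2)) (N.F ξ ^ 2) 1 := by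
    have := (hasDerivAt_pow 2 (1 : ℝ)).mul_const (N.F ξ ^ 2 / 2)
    have e : ((2 : ℕ) : ℝ) * 1 ^ (2 - 1) * (N.F ξ ^ 2 / 2) = N.F ξ ^ 2 := by norm_num; ring
    rwa [e] at this
  have h4 : (fun t : ℝ => N.F (t • ξ) ^ 2 / 2) = fun t : ℝ => t ^ 2 * (N.F ξ ^ 2 / 2) := by
    ext t; rw [F_smul, mul_pow, sq_abs]; ring
  rw [h4] at h2
  rw [legendre, inner_gradient_left]
  exact h2.unique h3

theorem fderiv_legendre_smul {c : ℝ} (hc : c ≠ 0) (ξ : En n) :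
    fderiv ℝ (legendre N) (c • ξ) = fderiv ℝ (legendre N) ξ := by
  have h1 : fderiv ℝ (fun x => legendre N (c • x)) ξ = c • fderiv ℝ (legendre N) (c • ξ) :=
    fderiv_comp_smul (𝕜 := ℝ) c
  have h2 : (fun x => legendre N (c • x)) = fun x => c • legendre N x := by
    ext1 x; exact legendre_smul N hc x
  have h3 : fderiv ℝ (fun x => c • legendre N x) ξ = c • fderiv ℝ (legendre N) ξ :=
    congrFun (fderiv_const_smul_field (𝕜 := ℝ) (f := legendre N) c) ξ
  rw [h2, h3] at h1
  exact (smul_right_injective _ hc h1).symm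

/-- Uniform ellipticity of the Hessian of `F² / 2`. -/
theorem fderiv_legendre_bounds : ∃ l L : ℝ, 0 < l ∧ 0 < L ∧ ∀ ξ : En n, ξ ≠ 0 → ∀ v,
    l * ‖v‖ ^ 2 ≤ ⟪fderiv ℝ (legendre N) ξ v, v⟫ ∧ ‖fderiv ℝ (legendre N) ξ v‖ ≤ L * ‖v‖ := by
  have hcont : ContinuousOn (fun ξ => fderiv ℝ (legendre N) ξ) {(0 : En n)}ᶜ := fun ξ hξ =>
    (((contDiffAt_legendre N hξ).fderiv_right (m := 0) (by norm_cast)).continuousAt).continuousWithinAt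
  have hsp : sphere (0 : En n) 1 ⊆ {(0 : En n)}ᶜ := fun x hx h0 => by
    rw [mem_singleton_iff] at h0; simp [h0] at hx
  have hnorm : ∀ ξ : En n, ξ ≠ 0 → ‖ξ‖⁻¹ • ξ ∈ sphere (0 : En n) 1 := fun ξ h0 => by
    rw [mem_sphere_zero_iff_norm, norm_smul, norm_inv, norm_norm,
          inv_mul_cancel₀ (norm_ne_zero_iff.mpr h0)]
  obtain ⟨L, hL⟩ := (isCompact_sphere (0 : En n) 1).exists_bound_of_continuousOn (hcont.mono hsp)
  have hcont2 : ContinuousOn (fun z : En n × En n => ⟪fderiv ℝ (legendre N) z.1 z.2, z.2⟫)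
      (sphere (0 : En n) 1 ×ˢ sphere (0 : En n) 1) := by
    refine ContinuousOn.inner (𝕜 := ℝ) ?_ continuousOn_snd
    exact ((hcont.mono hsp).comp continuousOn_fst (fun z hz => hz.1)).clm_apply continuousOn_snd
  obtain ⟨l, hl0, hl⟩ : ∃ l > 0, ∀ z ∈ (sphere (0 : En n) 1 ×ˢ sphere (0 : En n) 1),
      l ≤ ⟪fderiv ℝ (legendre N) z.1 z.2, z.2⟫ := by
    rcases (sphere (0 : En n) 1 ×ˢ sphere (0 : En n) 1).eq_empty_or_nonempty with h | h
    · exact ⟨1, one_pos, fun z hz => by rw [h] at hz; exact hz.elim⟩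
    · obtain ⟨z, hz, hmin⟩ := ((isCompact_sphere (0 : En n) 1).prod
        (isCompact_sphere (0 : En n) 1)).exists_isMinOn h hcont2
      refine ⟨_, ?_, fun y hy => hmin hy⟩
      have e := inner_fderiv_legendre N (hsp hz.1) z.2 z.2
      refine lt_of_lt_of_eq ?_ e.symm
      exact N.elliptic _ (hsp hz.1) _ (hsp hz.2)
  refine ⟨l, max L 1, hl0, lt_max_of_lt_right one_pos, fun ξ hξ v => ?_⟩
  have hξ' : ‖ξ‖⁻¹ ≠ 0 := inv_ne_zero (norm_ne_zero_iff.mpr hξ)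
  rw [← fderiv_legendre_smul N hξ' ξ]
  constructor
  · rcases eq_or_ne v 0 with rfl | hv
    · simp
    have h1 := hl (‖ξ‖⁻¹ • ξ, ‖v‖⁻¹ • v) ⟨hnorm ξ hξ, hnorm v hv⟩
    simp only [map_smul, real_inner_smul_left, real_inner_smul_right] at h1
    have hv' := norm_pos_iff.mpr hv
    calc l * ‖v‖ ^ 2 ≤ (‖v‖⁻¹ * (‖v‖⁻¹ * ⟪fderiv ℝ (legendre N) (‖ξ‖⁻¹ • ξ) v, v⟫)) * ‖v‖ ^ 2 := by
          gcongr
      _ = _ := by field_simp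
  · refine (ContinuousLinearMap.le_opNorm _ _).trans ?_
    gcongr
    exact (hL _ (hnorm ξ hξ)).trans (le_max_left _ _)

theorem inner_legendre_sq_le {ξ : En n} (h : ξ ≠ 0) (v : En n) :
    ⟪legendre N ξ, v⟫ ^ 2 ≤ N.F ξ ^ 2 * ⟪fderiv ℝ (legendre N) ξ v, v⟫ := by
  obtain ⟨l, L, hl, -, hb⟩ := fderiv_legendre_bounds N
  rcases eq_or_ne v 0 with rfl | hv
  · simp
  set q := ⟪fderiv ℝ (legendre N) ξ v, v⟫ with hq
  have hq0 : 0 < q := lt_of_lt_of_le (by have := norm_pos_iff.mpr hv; positivity) (hb ξ h v).1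
  set b := ⟪legendre N ξ, v⟫ with hbdef
  have h1 := (hb ξ h (q • ξ - b • v)).1
  have h2 : ⟪fderiv ℝ (legendre N) ξ (q • ξ - b • v), q • ξ - b • v⟫ =
      q * (q * N.F ξ ^ 2 - b ^ 2) := by
    have e1 : ⟪fderiv ℝ (legendre N) ξ v, ξ⟫ = b := by
      rw [inner_fderiv_legendre_symm N h, fderiv_legendre_self N h]
    simp only [map_sub, map_smul, inner_sub_left, inner_sub_right, real_inner_smul_left,
      real_inner_smul_right, fderiv_legendre_self N h, e1, ← hbdef, ← hq, inner_legendre_self]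
    ring
  rw [h2] at h1
  have h3 : 0 ≤ q * (q * N.F ξ ^ 2 - b ^ 2) := le_trans (by positivity) h1
  have := nonneg_of_mul_nonneg_right h3 hq0
  linarith

theorem continuous_legendre : Continuous (legendre N) := by
  obtain ⟨l, L, hl, hL0, hb⟩ := fderiv_legendre_bounds N
  rw [continuous_iff_continuousAt]
  intro ξ
  rcases eq_or_ne ξ 0 with rfl | h
  · rw [ContinuousAt, legendre_zero]
    refine squeeze_zero_norm (a := fun ξ => L * ‖ξ‖) (fun ξ => ?_) ?_
    · rcases eq_or_ne ξ 0 with rfl | h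
      · simp [legendre_zero]
      · rw [← fderiv_legendre_self N h]; exact (hb ξ h ξ).2
    · have : Continuous fun ξ : En n => L * ‖ξ‖ := by fun_prop
      simpa using this.tendsto 0
  · exact (contDiffAt_legendre N h).continuousAt

theorem legendre_norm_le : ∃ L : ℝ, 0 < L ∧ ∀ ξ, ‖legendre N ξ‖ ≤ L * ‖ξ‖ := by
  obtain ⟨l, L, hl, hL0, hb⟩ := fderiv_legendre_bounds N
  refine ⟨L, hL0, fun ξ => ?_⟩
  rcases eq_or_ne ξ 0 with rfl | h
  · simp [legendre_zero]
  · rw [← fderiv_legendre_self N h]; exact (hb ξ h ξ).2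

end MinkowskiStructure


section Flux

variable {n : ℕ}

theorem lt_of_deriv_pos_off {f f' : ℝ → ℝ} (t₀ : ℝ) (hc : ContinuousOn f (Icc 0 1))
    (hd : ∀ t ∈ Ioo (0 : ℝ) 1, t ≠ t₀ → HasDerivAt f (f' t) t ∧ 0 < f' t) : f 0 < f 1 := by
  have mono : ∀ a b : ℝ, 0 ≤ a → a < b → b ≤ 1 → t₀ ∉ Ioo a b → f a < f b := by
    intro a b ha hab hb ht
    refine strictMonoOn_of_deriv_pos (convex_Icc a b) (hc.mono (Icc_subset_Icc ha hb)) ?_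
      (left_mem_Icc.mpr hab.le) (right_mem_Icc.mpr hab.le) hab
    intro t htI
    rw [interior_Icc] at htI
    obtain ⟨h1, h2⟩ := hd t ⟨ha.trans_lt htI.1, htI.2.trans_le hb⟩ (fun h => ht (h ▸ htI))
    rwa [h1.deriv]
  by_cases h : t₀ ∈ Ioo (0 : ℝ) 1
  · exact (mono 0 t₀ le_rfl h.1 h.2.le (fun h => lt_irrefl _ h.2)).trans
      (mono t₀ 1 h.1.le h.2 le_rfl (fun h => lt_irrefl _ h.1))
  · exact mono 0 1 le_rfl one_pos le_rfl h

theorem exists_segment_zero {ξ η : En n} (hne : ξ ≠ η) :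
    ∃ t₀ : ℝ, ∀ t, t ≠ t₀ → η + t • (ξ - η) ≠ 0 := by
  by_cases h : ∃ t : ℝ, η + t • (ξ - η) = 0
  · obtain ⟨t₀, h0⟩ := h
    refine ⟨t₀, fun t ht h1 => ht ?_⟩
    have : (t - t₀) • (ξ - η) = 0 := by
      rw [sub_smul, sub_eq_zero]
      exact add_left_cancel (h1.trans h0.symm)
    rcases smul_eq_zero.mp this with h2 | h2
    · linarith
    · exact (hne (sub_eq_zero.mp h2)).elim
  · push Not at h
    exact ⟨0, fun t _ => h t⟩

theorem segment_lt {b : En n → En n} (hb : Continuous b) {B : En n → En n →L[ℝ] En n}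
    (hB : ∀ ζ ≠ 0, HasFDerivAt b (B ζ) ζ) {ξ η y : En n} (hne : ξ ≠ η) {c : ℝ}
    (h : ∀ ζ ∈ segment ℝ η ξ, ζ ≠ 0 → c < ⟪B ζ (ξ - η), y⟫) : c < ⟪b ξ - b η, y⟫ := by
  obtain ⟨t₀, ht₀⟩ := exists_segment_zero hne
  have key := lt_of_deriv_pos_off (f := fun t => ⟪b (η + t • (ξ - η)), y⟫ - c * t)
    (f' := fun t => ⟪B (η + t • (ξ - η)) (ξ - η), y⟫ - c) t₀ (by fun_prop) (by
      intro t ht hne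
      refine ⟨?_, ?_⟩
      · have h1 : HasDerivAt (fun t : ℝ => η + t • (ξ - η)) (ξ - η) t := by
          have := ((hasDerivAt_id t).smul_const (ξ - η)).const_add η
          rwa [one_smul] at this
        have h2 := (hB _ (ht₀ t hne)).comp_hasDerivAt t h1
        have h3 := h2.inner ℝ (hasDerivAt_const t y)
        rw [inner_zero_right, zero_add] at h3
        have h4 := h3.sub ((hasDerivAt_id t).const_mul c)
        rw [mul_one] at h4
        exact h4
      · rw [sub_pos]
        refine h _ ?_ (ht₀ t hne)
        rw [segment_eq_image']
        exact ⟨t, ⟨ht.1.le, ht.2.le⟩, rfl⟩)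
  simp only [zero_smul, add_zero, mul_zero, sub_zero, one_smul, add_sub_cancel, mul_one] at key
  rw [inner_sub_left]
  linarith

theorem segment_le {b : En n → En n} (hb : Continuous b) {B : En n → En n →L[ℝ] En n}
    (hB : ∀ ζ ≠ 0, HasFDerivAt b (B ζ) ζ) {ξ η y : En n} (hne : ξ ≠ η) {c : ℝ}
    (h : ∀ ζ ∈ segment ℝ η ξ, ζ ≠ 0 → c ≤ ⟪B ζ (ξ - η), y⟫) : c ≤ ⟪b ξ - b η, y⟫ := by
  refine le_of_forall_lt fun c' hc' => segment_lt hb hB hne fun ζ h1 h2 => hc'.trans_le (h ζ h1 h2)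

/-- Ellipticity of a matrix with constants `l` and `L`. -/
def Ell (l L : ℝ) (B : En n →L[ℝ] En n) : Prop :=
  ∀ v, l * ‖v‖ ^ 2 ≤ ⟪B v, v⟫ ∧ ‖B v‖ ≤ L * ‖v‖

theorem pair_bounds {b : En n → En n} (hb : Continuous b) {B : En n → En n →L[ℝ] En n}
    (hB : ∀ ζ ≠ 0, HasFDerivAt b (B ζ) ζ) {l L : ℝ} {ξ η : En n}
    (h : ∀ ζ ∈ segment ℝ η ξ, ζ ≠ 0 → Ell l L (B ζ)) :
    l * ‖ξ - η‖ ^ 2 ≤ ⟪b ξ - b η, ξ - η⟫ ∧ ‖b ξ - b η‖ ≤ L * ‖ξ - η‖ := by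
  rcases eq_or_ne ξ η with rfl | hne
  · simp
  refine ⟨segment_le hb hB hne fun ζ h1 h2 => (h ζ h1 h2 _).1, ?_⟩
  have h1 : -(L * ‖ξ - η‖ * ‖b ξ - b η‖) ≤ ⟪b ξ - b η, -(b ξ - b η)⟫ := by
    refine segment_le hb hB hne fun ζ h1 h2 => ?_
    rw [inner_neg_right, neg_le_neg_iff]
    exact (real_inner_le_norm _ _).trans (by gcongr; exact (h ζ h1 h2 _).2)
  rw [inner_neg_right, neg_le_neg_iff, real_inner_self_eq_norm_sq, pow_two] at h1
  rcases eq_or_ne (b ξ - b η) 0 with h0 | h0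
  · rw [h0, norm_zero]
    obtain ⟨ζ, hζ, hζ0⟩ : ∃ ζ ∈ segment ℝ η ξ, ζ ≠ 0 := by
      rcases eq_or_ne ξ 0 with rfl | hξ
      · exact ⟨η, left_mem_segment _ _ _, hne.symm⟩
      · exact ⟨ξ, right_mem_segment _ _ _, hξ⟩
    exact (norm_nonneg _).trans (h ζ hζ hζ0 (ξ - η)).2
  · exact le_of_mul_le_mul_right h1 (norm_pos_iff.mpr h0)

variable (N : MinkowskiNorm n) (p s : ℝ)

/-- The regularised flux `(F² + s²)^((p - 2) / 2) ∇(F² / 2)`. -/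
def flux (ξ : En n) : En n := (N.F ξ ^ 2 + s ^ 2) ^ ((p - 2) / 2) • legendre N ξ

/-- The normalised derivative of the flux. -/
def fluxMat (ξ : En n) : En n →L[ℝ] En n :=
  fderiv ℝ (legendre N) ξ +
    ((p - 2) / (N.F ξ ^ 2 + s ^ 2)) • (innerSL ℝ (legendre N ξ)).smulRight (legendre N ξ)

/-- The scalar weight in the derivative of the flux. -/
def fluxWeight (ξ : En n) : ℝ := (N.F ξ ^ 2 + s ^ 2) ^ ((p - 2) / 2)

theorem sq_add_sq_pos {ξ : En n} (h : ξ ≠ 0) : 0 < N.F ξ ^ 2 + s ^ 2 := by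
  have := N.pos ξ h
  positivity

theorem fluxWeight_pos {ξ : En n} (h : ξ ≠ 0) : 0 < fluxWeight N p s ξ :=
  Real.rpow_pos_of_pos (sq_add_sq_pos N s h) _

theorem hasFDerivAt_sq_add_sq {ξ : En n} (h : ξ ≠ 0) :
    HasFDerivAt (fun y => N.F y ^ 2 + s ^ 2) ((2 : ℝ) • innerSL ℝ (legendre N ξ)) ξ := by
  have hd := ((contDiffAt_halfSq N h).differentiableAt (by simp)).hasFDerivAt
  have h2 := (hd.const_smul (2 : ℝ)).add_const (s ^ 2)
  have e1 : (fun y => (2 : ℝ) • (N.F y ^ 2 / 2) + s ^ 2) = fun y => N.F y ^ 2 + s ^ 2 := by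
    ext y; rw [smul_eq_mul]; ring
  have e2 : fderiv ℝ (fun y => N.F y ^ 2 / 2) ξ = innerSL ℝ (legendre N ξ) := by
    ext v
    rw [innerSL_apply_apply]
    exact inner_gradient_left.symm
  rw [e2] at h2
  rw [← e1]
  exact h2

theorem hasFDerivAt_flux {ξ : En n} (h : ξ ≠ 0) :
    HasFDerivAt (flux N p s) (fluxWeight N p s ξ • fluxMat N p s ξ) ξ := by
  have hpos := sq_add_sq_pos N s h
  have h1 := ((hasFDerivAt_sq_add_sq N s h).rpow_const (p := (p - 2) / 2) (Or.inl hpos.ne')).smul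
    (hasFDerivAt_legendre N h)
  have h2 : HasFDerivAt (flux N p s) _ ξ := h1
  refine h2.congr_fderiv ?_
  ext1 v
  symm
  simp only [fluxMat, fluxWeight, add_apply, smul_apply,
    ContinuousLinearMap.smulRight_apply, innerSL_apply_apply, smul_add, smul_smul, smul_eq_mul]
  congr 2
  rw [Real.rpow_sub_one hpos.ne']
  field_simp

theorem fluxMat_bounds (hp : 1 < p) : ∃ l L : ℝ, 0 < l ∧ l ≤ L ∧ ∀ s, ∀ ξ : En n, ξ ≠ 0 →
    Ell l L (fluxMat N p s ξ) := by
  obtain ⟨l, L, hl, hL, hb⟩ := fderiv_legendre_bounds N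
  obtain ⟨m, M, hm, hM, hF⟩ := F_bounds N
  obtain ⟨L', hL', hA⟩ := legendre_norm_le N
  set l' := min 1 (p - 1) * l with hl'
  have hl'0 : 0 < l' := mul_pos (lt_min one_pos (by linarith)) hl
  refine ⟨l', max l' (L + |p - 2| * (L' / m) ^ 2), hl'0, le_max_left _ _, fun s ξ hξ v => ?_⟩
  have hpos := sq_add_sq_pos N s hξ
  set h := N.F ξ ^ 2 + s ^ 2 with hh
  have hFh : N.F ξ ^ 2 ≤ h := by rw [hh]; nlinarith [sq_nonneg s]
  have e : fluxMat N p s ξ v = fderiv ℝ (legendre N) ξ v +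
      ((p - 2) / h * ⟪legendre N ξ, v⟫) • legendre N ξ := by
    simp [fluxMat, smul_smul, ← hh]
  set q := ⟪fderiv ℝ (legendre N) ξ v, v⟫ with hq
  have hq0 : l * ‖v‖ ^ 2 ≤ q := (hb ξ hξ v).1
  have hq1 : 0 ≤ q := le_trans (by positivity) hq0
  rw [e]
  constructor
  · rw [inner_add_left, real_inner_smul_left, ← hq]
    have hcs := inner_legendre_sq_le N hξ v
    set b := ⟪legendre N ξ, v⟫
    have hbq : b ^ 2 / h ≤ q := by
      rw [div_le_iff₀ hpos, mul_comm]
      exact hcs.trans (by gcongr)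
    have hb0 : 0 ≤ b ^ 2 / h := by positivity
    have e2 : (p - 2) / h * b * b = (p - 2) * (b ^ 2 / h) := by ring
    rw [e2, hl']
    calc min 1 (p - 1) * l * ‖v‖ ^ 2 = min 1 (p - 1) * (l * ‖v‖ ^ 2) := by ring
      _ ≤ min 1 (p - 1) * q := by
          have : 0 ≤ min 1 (p - 1) := le_min zero_le_one (by linarith)
          gcongr
      _ ≤ q + (p - 2) * (b ^ 2 / h) := by
          rcases le_total 2 p with h2 | h2
          · have : min 1 (p - 1) ≤ 1 := min_le_left _ _
            nlinarith
          · have : min 1 (p - 1) ≤ p - 1 := min_le_right _ _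
            nlinarith
  · refine le_trans ?_ (mul_le_mul_of_nonneg_right (le_max_right _ _) (norm_nonneg _))
    refine (norm_add_le _ _).trans ?_
    rw [add_mul]
    refine add_le_add (hb ξ hξ v).2 ?_
    rw [norm_smul, Real.norm_eq_abs, abs_mul, abs_div, abs_of_pos hpos]
    have h1 : |⟪legendre N ξ, v⟫| ≤ L' * ‖ξ‖ * ‖v‖ :=
      (abs_real_inner_le_norm _ _).trans (by gcongr; exact hA ξ)
    have h2 : (m * ‖ξ‖) ^ 2 ≤ h := (by gcongr; exact (hF ξ).1 : (m * ‖ξ‖) ^ 2 ≤ N.F ξ ^ 2).trans hFh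
    calc |p - 2| / h * |⟪legendre N ξ, v⟫| * ‖legendre N ξ‖
        ≤ |p - 2| / h * (L' * ‖ξ‖ * ‖v‖) * (L' * ‖ξ‖) := by gcongr; exact hA ξ
      _ = |p - 2| * (L' / m) ^ 2 * ‖v‖ * ((m * ‖ξ‖) ^ 2 / h) := by field_simp
      _ ≤ |p - 2| * (L' / m) ^ 2 * ‖v‖ * 1 := by
          gcongr
          rwa [div_le_one hpos]
      _ = _ := by ring

theorem flux_zero : flux N p s 0 = 0 := by simp [flux, legendre_zero]

theorem flux_neg (ξ : En n) : flux N p s (-ξ) = -flux N p s ξ := by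
  simp [flux, legendre_neg, N.even]

theorem continuous_flux (hp : 1 < p) : Continuous (flux N p s) := by
  have hF := continuous_F N
  have hA := continuous_legendre N
  rcases eq_or_ne s 0 with rfl | hs
  · obtain ⟨m, M, hm, hM, hFb⟩ := F_bounds N
    obtain ⟨L, hL, hAb⟩ := legendre_norm_le N
    rw [continuous_iff_continuousAt]
    intro ξ
    rcases eq_or_ne ξ 0 with rfl | h
    · rw [ContinuousAt, flux_zero]
      refine squeeze_zero_norm (a := fun ξ => L / m * N.F ξ ^ (p - 1)) (fun ξ => ?_) ?_
      · rcases eq_or_ne ξ 0 with rfl | h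
        · rw [flux_zero, norm_zero, F_zero]; positivity
        have hFp := N.pos ξ h
        rw [flux, norm_smul, zero_pow two_ne_zero, add_zero, ← Real.rpow_natCast,
          ← Real.rpow_mul hFp.le, Real.norm_of_nonneg (by positivity)]
        have e : ((2 : ℕ) : ℝ) * ((p - 2) / 2) = (p - 1) - 1 := by push_cast; ring
        rw [e, Real.rpow_sub_one hFp.ne']
        have h1 : ‖legendre N ξ‖ ≤ L / m * N.F ξ := by
          refine (hAb ξ).trans ?_
          rw [div_mul_eq_mul_div, le_div_iff₀ hm, mul_assoc]
          gcongr
          rw [mul_comm]; exact (hFb ξ).1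
        calc N.F ξ ^ (p - 1) / N.F ξ * ‖legendre N ξ‖
            ≤ N.F ξ ^ (p - 1) / N.F ξ * (L / m * N.F ξ) := by gcongr
          _ = _ := by field_simp
      · have h1 : Continuous fun ξ => L / m * N.F ξ ^ (p - 1) :=
          continuous_const.mul (hF.rpow_const fun x => Or.inr (by linarith))
        have := h1.tendsto 0
        rwa [F_zero, Real.zero_rpow (by linarith), mul_zero] at this
    · exact (hasFDerivAt_flux N p 0 h).continuousAt
  · exact (((hF.pow 2).add continuous_const).rpow_const fun x => Or.inl
      (add_pos_of_nonneg_of_pos (sq_nonneg _) (by positivity)).ne').smul hA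

theorem flux_strictMono (hp : 1 < p) {ξ η : En n} (h : ξ ≠ η) :
    0 < ⟪flux N p s ξ - flux N p s η, ξ - η⟫ := by
  obtain ⟨l, L, hl, -, hb⟩ := fluxMat_bounds N p hp
  refine segment_lt (continuous_flux N p s hp) (fun ζ => hasFDerivAt_flux N p s) h
    fun ζ _ hζ => ?_
  rw [smul_apply, real_inner_smul_left]
  have := norm_pos_iff.mpr (sub_ne_zero.mpr h)
  exact mul_pos (fluxWeight_pos N p s hζ) (lt_of_lt_of_le (by positivity) (hb s ζ hζ _).1)

theorem flux_mono (hp : 1 < p) (ξ η : En n) :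
    0 ≤ ⟪flux N p s ξ - flux N p s η, ξ - η⟫ := by
  rcases eq_or_ne ξ η with rfl | h
  · simp
  · exact (flux_strictMono N p s hp h).le

/-- The energy density. -/
def energy (ξ : En n) : ℝ := (N.F ξ ^ 2 + s ^ 2) ^ (p / 2) / p

theorem continuous_energy (hp : 1 < p) : Continuous (energy N p s) :=
  ((((continuous_F N).pow 2).add continuous_const).rpow_const
    fun x => Or.inr (by linarith)).div_const _

theorem energy_nonneg (hp : 1 < p) (ξ : En n) : 0 ≤ energy N p s ξ := by
  unfold energy; positivity

theorem hasFDerivAt_energy (hp : 1 < p) {ξ : En n} (h : ξ ≠ 0) :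
    HasFDerivAt (energy N p s) (innerSL ℝ (flux N p s ξ)) ξ := by
  have hpos := sq_add_sq_pos N s h
  have h1 := (((hasFDerivAt_sq_add_sq N s h).rpow_const (p := p / 2)
    (Or.inl hpos.ne')).const_smul p⁻¹)
  have e1 : energy N p s = fun y => p⁻¹ • (N.F y ^ 2 + s ^ 2) ^ (p / 2) := by
    ext y; rw [energy, smul_eq_mul]; field_simp
  rw [e1]
  refine h1.congr_fderiv ?_
  ext v
  have e2 : p / 2 - 1 = (p - 2) / 2 := by ring
  simp only [e2, flux, smul_apply, innerSL_apply_apply, smul_eq_mul,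
    real_inner_smul_left]
  field_simp

theorem energy_ge (hp : 1 < p) (ξ η : En n) :
    energy N p s ξ + ⟪flux N p s ξ, η - ξ⟫ ≤ energy N p s η := by
  rcases eq_or_ne η ξ with rfl | hne
  · simp
  obtain ⟨t₀, ht₀⟩ := exists_segment_zero hne
  have hE := continuous_energy N p s hp
  have key := lt_of_deriv_pos_off
    (f := fun t => energy N p s (ξ + t • (η - ξ)) - t * ⟪flux N p s ξ, η - ξ⟫)
    (f' := fun t => ⟪flux N p s (ξ + t • (η - ξ)), η - ξ⟫ - ⟪flux N p s ξ, η - ξ⟫) t₀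
    (by fun_prop) (by
      intro t ht hne'
      refine ⟨?_, ?_⟩
      · have h1 : HasDerivAt (fun t : ℝ => ξ + t • (η - ξ)) (η - ξ) t := by
          have := ((hasDerivAt_id t).smul_const (η - ξ)).const_add ξ
          rwa [one_smul] at this
        have h2 := (hasFDerivAt_energy N p s hp (ht₀ t hne')).comp_hasDerivAt t h1
        have h4 := h2.sub ((hasDerivAt_id t).mul_const ⟪flux N p s ξ, η - ξ⟫)
        rw [one_mul] at h4
        exact h4
      · have h1 := flux_strictMono N p s hp (ξ := ξ + t • (η - ξ)) (η := ξ) (by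
          rw [ne_eq, add_eq_left, smul_eq_zero, not_or]
          exact ⟨ht.1.ne', sub_ne_zero.mpr hne⟩)
        rw [add_sub_cancel_left, real_inner_smul_right] at h1
        have := pos_of_mul_pos_right h1 ht.1.le
        rwa [inner_sub_left] at this)
  simp only [zero_smul, add_zero, zero_mul, sub_zero, one_smul, add_sub_cancel, one_mul] at key
  linarith

theorem flux_smul {μ : ℝ} (hμ : 0 < μ) (ξ : En n) :
    flux N p s (μ • ξ) = μ ^ (p - 1) • flux N p (s / μ) ξ := by
  rw [flux, flux, legendre_smul N hμ.ne', smul_smul, smul_smul, N.homog μ hμ.le]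
  congr 1
  have e : (μ * N.F ξ) ^ 2 + s ^ 2 = μ ^ 2 * (N.F ξ ^ 2 + (s / μ) ^ 2) := by field_simp
  rw [e, Real.mul_rpow (by positivity) (by positivity), ← Real.rpow_natCast μ 2,
    ← Real.rpow_mul hμ.le]
  have e2 : p - 1 = ((2 : ℕ) : ℝ) * ((p - 2) / 2) + 1 := by push_cast; ring
  rw [e2, Real.rpow_add_one hμ.ne']
  ring

theorem F_rpow_mul_gradient (hp : 1 < p) (ξ v : En n) :
    N.F ξ ^ (p - 1) * ⟪gradient N.F ξ, v⟫ = ⟪flux N p 0 ξ, v⟫ := by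
  rcases eq_or_ne ξ 0 with rfl | h
  · rw [flux_zero, F_zero, Real.zero_rpow (by linarith)]; simp
  have hFp := N.pos ξ h
  have hd : DifferentiableAt ℝ N.F ξ :=
    (N.smooth.contDiffAt (isOpen_compl_singleton.mem_nhds h)).differentiableAt (by simp)
  have hA : legendre N ξ = N.F ξ • gradient N.F ξ := by
    have e : (fun y => N.F y ^ 2 / 2) = fun y => (1 / 2) * (N.F y * N.F y) := by ext y; ring
    rw [legendre, e, gradient_const_mul, gradient_mul hd hd, ← two_smul ℝ, smul_smul, smul_smul]
    norm_num
  rw [flux, hA, zero_pow two_ne_zero, add_zero, ← Real.rpow_natCast, ← Real.rpow_mul hFp.le,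
    real_inner_smul_left, real_inner_smul_left]
  have e : ((2 : ℕ) : ℝ) * ((p - 2) / 2) = (p - 1) - 1 := by push_cast; ring
  rw [e, Real.rpow_sub_one hFp.ne' (p - 1)]
  field_simp

end Flux


section Ellipticity

variable {n : ℕ} (N : MinkowskiNorm n) (p s : ℝ)

theorem rpow_bounds {a b x q : ℝ} (ha : 0 < a) (hax : a ≤ x) (hxb : x ≤ b) :
    min (a ^ q) (b ^ q) ≤ x ^ q ∧ x ^ q ≤ max (a ^ q) (b ^ q) := by
  rcases le_total 0 q with hq | hq
  · exact ⟨(min_le_left _ _).trans (Real.rpow_le_rpow ha.le hax hq),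
      (Real.rpow_le_rpow (ha.le.trans hax) hxb hq).trans (le_max_right _ _)⟩
  · exact ⟨(min_le_right _ _).trans (Real.rpow_le_rpow_of_nonpos (ha.trans_le hax) hxb hq),
      (Real.rpow_le_rpow_of_nonpos ha hax hq).trans (le_max_left _ _)⟩

theorem Ell.smul {l L c₁ c₂ w : ℝ} {B : En n →L[ℝ] En n} (h : Ell l L B) (hl : 0 ≤ l)
    (hL : 0 ≤ L) (hw : 0 ≤ w) (h1 : c₁ ≤ w) (h2 : w ≤ c₂) : Ell (c₁ * l) (c₂ * L) (w • B) := by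
  intro v
  rw [smul_apply, real_inner_smul_left, norm_smul, Real.norm_of_nonneg hw]
  constructor
  · calc c₁ * l * ‖v‖ ^ 2 ≤ w * (l * ‖v‖ ^ 2) := by rw [mul_assoc]; gcongr
      _ ≤ _ := by gcongr; exact (h v).1
  · calc w * ‖B v‖ ≤ c₂ * (L * ‖v‖) := by
          have := hw.trans h2
          gcongr; exact (h v).2
      _ = _ := by ring

/-- Two-sided bounds for the increments of a vector field. -/
def PairEll (l L : ℝ) (b : En n → En n) (ξ η : En n) : Prop :=
  l * ‖ξ - η‖ ^ 2 ≤ ⟪b ξ - b η, ξ - η⟫ ∧ ‖b ξ - b η‖ ≤ L * ‖ξ - η‖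

theorem flux_pairEll (hp : 1 < p) {l L a b : ℝ} (hl : 0 < l) (hL : l ≤ L) (ha : 0 < a)
    (hB : ∀ s, ∀ ξ : En n, ξ ≠ 0 → Ell l L (fluxMat N p s ξ)) {ξ η : En n}
    (h : ∀ ζ ∈ segment ℝ η ξ, ζ ≠ 0 → a ≤ N.F ζ ^ 2 + s ^ 2 ∧ N.F ζ ^ 2 + s ^ 2 ≤ b) :
    PairEll (min (a ^ ((p - 2) / 2)) (b ^ ((p - 2) / 2)) * l)
      (max (a ^ ((p - 2) / 2)) (b ^ ((p - 2) / 2)) * L) (flux N p s) ξ η := by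
  refine pair_bounds (continuous_flux N p s hp) (fun ζ => hasFDerivAt_flux N p s)
    fun ζ h1 h2 => ?_
  obtain ⟨h3, h4⟩ := rpow_bounds (q := (p - 2) / 2) ha (h ζ h1 h2).1 (h ζ h1 h2).2
  exact (hB s ζ h2).smul hl.le (hl.le.trans hL) (fluxWeight_pos N p s h2).le h3 h4

theorem flux_ell_of_bounded (hp : 1 < p) (hs : s ≠ 0) (M : ℝ) : ∃ l L : ℝ, 0 < l ∧ l ≤ L ∧
    ∀ ξ η : En n, ‖ξ‖ ≤ M → ‖η‖ ≤ M → PairEll l L (flux N p s) ξ η := by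
  obtain ⟨l, L, hl, hL, hB⟩ := fluxMat_bounds N p hp
  obtain ⟨m, M', hm, hM, hF⟩ := F_bounds N
  have hs2 : 0 < s ^ 2 := by positivity
  have hb : 0 < (M' * M) ^ 2 + s ^ 2 := by positivity
  refine ⟨min ((s ^ 2) ^ ((p - 2) / 2)) (((M' * M) ^ 2 + s ^ 2) ^ ((p - 2) / 2)) * l,
    max ((s ^ 2) ^ ((p - 2) / 2)) (((M' * M) ^ 2 + s ^ 2) ^ ((p - 2) / 2)) * L, ?_, ?_,
    fun ξ η hξ hη => flux_pairEll N p s hp hl hL hs2 hB fun ζ hζ _ => ?_⟩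
  · exact mul_pos (lt_min (by positivity) (by positivity)) hl
  · exact mul_le_mul min_le_max hL hl.le (le_max_of_le_left (by positivity))
  · have h1 : ζ ∈ closedBall (0 : En n) M :=
      (convex_closedBall (0 : En n) M).segment_subset (by simpa using hη) (by simpa using hξ) hζ
    rw [mem_closedBall_zero_iff] at h1
    refine ⟨by nlinarith [sq_nonneg (N.F ζ)], ?_⟩
    have := F_nonneg N ζ
    gcongr
    exact (hF ζ).2.trans (by gcongr)

theorem flux_ell_cone (hp : 1 < p) : ∃ l L : ℝ, 0 < l ∧ l ≤ L ∧ ∀ s, ∃ c : ℝ, 0 < c ∧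
    (∀ e : En n, ‖e‖ = 1 → ∀ ξ η : En n, ‖ξ‖ ≤ 1 → ‖η‖ ≤ 1 → 1 / 8 ≤ ⟪ξ, e⟫ → 1 / 8 ≤ ⟪η, e⟫ →
      PairEll l L (fun ξ => c • flux N p s ξ) ξ η) ∧
    ∀ ξ : En n, ‖ξ‖ ≤ 1 → ‖c • flux N p s ξ‖ ≤ L := by
  obtain ⟨l, L, hl, hL, hB⟩ := fluxMat_bounds N p hp
  obtain ⟨m, M, hm, hM, hF⟩ := F_bounds N
  obtain ⟨L₁, hL₁, hA⟩ := legendre_norm_le N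
  set q := (p - 2) / 2 with hq
  set a := min ((m / 8) ^ 2) (1 / 2) with ha
  set b := max (M ^ 2) 1 with hb
  have ha0 : 0 < a := lt_min (by positivity) (by norm_num)
  have hb0 : 0 < b := lt_max_of_lt_right one_pos
  set l' := min (a ^ q) (b ^ q) * l with hl'
  set L' := max (a ^ q) (b ^ q) * L with hL'
  have hl'0 : 0 < l' := mul_pos (lt_min (by positivity) (by positivity)) hl
  have hl'L : l' ≤ L' := mul_le_mul min_le_max hL hl.le (le_max_of_le_left (by positivity))
  set L₂ := max (a ^ q) (b ^ q) * L₁ with hL₂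
  set L₃ := L₁ / m * 2 * b ^ (q + 1 / 2) with hL₃
  refine ⟨l', max L' (max L₂ L₃), hl'0, hl'L.trans (le_max_left _ _), fun s => ?_⟩
  have hs1 : 0 < 1 + s ^ 2 := by positivity
  have hc0 : 0 < ((1 + s ^ 2) ^ q)⁻¹ := by positivity
  have hup : ∀ ζ : En n, ‖ζ‖ ≤ 1 → N.F ζ ^ 2 + s ^ 2 ≤ b * (1 + s ^ 2) := fun ζ hζ => by
    have h1 : N.F ζ ≤ M * 1 := (hF ζ).2.trans (by gcongr)
    have h2 : N.F ζ ^ 2 ≤ M ^ 2 := by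
      have := F_nonneg N ζ
      rw [mul_one] at h1
      gcongr
    have h3 : M ^ 2 ≤ b := le_max_left _ _
    have h4 : 1 ≤ b := le_max_right _ _
    nlinarith [sq_nonneg s]
  have hmulr : ∀ t : ℝ, 0 ≤ t → ((1 + s ^ 2) ^ q)⁻¹ * (t * (1 + s ^ 2)) ^ q = t ^ q := fun t ht => by
    rw [Real.mul_rpow ht hs1.le]; field_simp
  refine ⟨((1 + s ^ 2) ^ q)⁻¹, hc0, fun e he ξ η hξ hη hξe hηe => ?_, fun ξ hξ => ?_⟩
  · have h := flux_pairEll N p s hp hl hL (a := a * (1 + s ^ 2)) (b := b * (1 + s ^ 2))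
      (by positivity) hB (ξ := ξ) (η := η) fun ζ hζ _ => ?_
    · have hmin : ((1 + s ^ 2) ^ q)⁻¹ * min ((a * (1 + s ^ 2)) ^ q) ((b * (1 + s ^ 2)) ^ q) =
          min (a ^ q) (b ^ q) := by
        rw [mul_min_of_nonneg _ _ hc0.le, hmulr a ha0.le, hmulr b hb0.le]
      have hmax : ((1 + s ^ 2) ^ q)⁻¹ * max ((a * (1 + s ^ 2)) ^ q) ((b * (1 + s ^ 2)) ^ q) =
          max (a ^ q) (b ^ q) := by
        rw [mul_max_of_nonneg _ _ hc0.le, hmulr a ha0.le, hmulr b hb0.le]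
      rw [← hq] at h
      constructor
      · simp only [← smul_sub]
        rw [real_inner_smul_left, hl', ← hmin, mul_assoc, mul_assoc, ← mul_assoc]
        rw [mul_assoc]
        exact mul_le_mul_of_nonneg_left (by simpa [mul_assoc] using h.1) hc0.le
      · simp only [← smul_sub]
        rw [norm_smul, Real.norm_of_nonneg hc0.le]
        refine le_trans (mul_le_mul_of_nonneg_left h.2 hc0.le) ?_
        rw [← mul_assoc, ← mul_assoc, hmax]
        gcongr
        exact le_max_left _ _
    · have h1 : ζ ∈ closedBall (0 : En n) 1 :=
        (convex_closedBall (0 : En n) 1).segment_subset (by simpa using hη) (by simpa using hξ) hζ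
      rw [mem_closedBall_zero_iff] at h1
      refine ⟨?_, hup ζ h1⟩
      have h2 : 1 / 8 ≤ ⟪ζ, e⟫ := by
        have hcv : Convex ℝ {x : En n | 1 / 8 ≤ ⟪x, e⟫} := by
          have : IsLinearMap ℝ fun x : En n => ⟪x, e⟫ :=
            ⟨fun x y => inner_add_left _ _ _, fun c x => real_inner_smul_left _ _ _⟩
          exact convex_halfSpace_ge this _
        exact hcv.segment_subset hηe hξe hζ
      have h3 : 1 / 8 ≤ ‖ζ‖ := by
        have := real_inner_le_norm ζ e
        rw [he, mul_one] at this
        linarith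
      have h4 : m / 8 ≤ N.F ζ := le_trans (by rw [div_eq_mul_one_div]; gcongr) (hF ζ).1
      have h5 : (m / 8) ^ 2 ≤ N.F ζ ^ 2 := by gcongr
      have h6 : a ≤ (m / 8) ^ 2 := min_le_left _ _
      have h7 : a ≤ 1 / 2 := min_le_right _ _
      nlinarith [sq_nonneg s]
  · refine le_trans ?_ (le_max_right _ _)
    rcases eq_or_ne ξ 0 with rfl | h0
    · rw [flux_zero, smul_zero, norm_zero]
      refine le_max_of_le_left ?_
      rw [hL₂]; positivity
    have hpos := sq_add_sq_pos N s h0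
    have hup' := hup ξ hξ
    set h := N.F ξ ^ 2 + s ^ 2 with hh
    rw [norm_smul, Real.norm_of_nonneg hc0.le, flux, norm_smul, ← hh, ← hq,
      Real.norm_of_nonneg (by positivity)]
    by_cases hs : 1 ≤ s ^ 2
    · refine le_max_of_le_left ?_
      have h1 : a * (1 + s ^ 2) ≤ h := by
        have h7 : a ≤ 1 / 2 := min_le_right _ _
        nlinarith [sq_nonneg (N.F ξ)]
      have h2 := (rpow_bounds (q := q) (by positivity : 0 < a * (1 + s ^ 2)) h1 hup').2
      have h3 := mul_le_mul_of_nonneg_left h2 hc0.le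
      rw [mul_max_of_nonneg _ _ hc0.le, hmulr a ha0.le, hmulr b hb0.le] at h3
      rw [hL₂, ← mul_assoc]
      gcongr
      exact (hA ξ).trans (mul_le_of_le_one_right hL₁.le hξ)
    · push Not at hs
      refine le_max_of_le_right ?_
      have h1 : ‖legendre N ξ‖ ≤ L₁ / m * h ^ (1 / 2 : ℝ) := by
        refine (hA ξ).trans ?_
        rw [div_mul_eq_mul_div, le_div_iff₀ hm, mul_assoc]
        gcongr
        rw [mul_comm, ← Real.sqrt_eq_rpow]
        refine (hF ξ).1.trans (Real.le_sqrt_of_sq_le ?_)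
        rw [hh]; nlinarith [sq_nonneg s]
      have hq2 : 0 ≤ q + 1 / 2 := by rw [hq]; linarith
      calc ((1 + s ^ 2) ^ q)⁻¹ * (h ^ q * ‖legendre N ξ‖)
          ≤ ((1 + s ^ 2) ^ q)⁻¹ * (h ^ q * (L₁ / m * h ^ (1 / 2 : ℝ))) := by gcongr
        _ = ((1 + s ^ 2) ^ q)⁻¹ * (L₁ / m) * h ^ (q + 1 / 2) := by
            rw [Real.rpow_add hpos]; ring
        _ ≤ ((1 + s ^ 2) ^ q)⁻¹ * (L₁ / m) * (b * (1 + s ^ 2)) ^ (q + 1 / 2) := by gcongr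
        _ = L₁ / m * b ^ (q + 1 / 2) * (1 + s ^ 2) ^ (1 / 2 : ℝ) := by
            rw [Real.mul_rpow hb0.le hs1.le, Real.rpow_add hs1]; field_simp
        _ ≤ L₁ / m * b ^ (q + 1 / 2) * 2 := by
            gcongr
            rw [← Real.sqrt_eq_rpow, Real.sqrt_le_left (by norm_num)]
            linarith
        _ = L₃ := by rw [hL₃]; ring

theorem flux_ell_of_norm_ge (hp : 1 < p) {c : ℝ} (hc : 0 < c) (M : ℝ) :
    ∃ l L : ℝ, 0 < l ∧ l ≤ L ∧
    ∀ ξ η : En n, ‖ξ‖ ≤ M → ‖η‖ ≤ M → c ≤ ‖η‖ → PairEll l L (flux N p 0) ξ η := by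
  obtain ⟨l, L, hl, hL, hB⟩ := fluxMat_bounds N p hp
  obtain ⟨m, M', hm, hM, hF⟩ := F_bounds N
  set a := (m * (c / 2)) ^ 2 with ha
  set b := (M' * M) ^ 2 with hb
  have hcont := continuous_flux N p 0 hp
  set S : Set (En n × En n) := {z | ‖z.1‖ ≤ M ∧ ‖z.2‖ ≤ M ∧ c / 2 ≤ ‖z.1 - z.2‖} with hS
  have hSc : IsCompact S := by
    refine ((isCompact_closedBall (0 : En n) M).prod
      (isCompact_closedBall (0 : En n) M)).of_isClosed_subset ?_ ?_
    · have h1 : IsClosed {z : En n × En n | ‖z.1‖ ≤ M} := isClosed_le (by fun_prop) (by fun_prop)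
      have h2 : IsClosed {z : En n × En n | ‖z.2‖ ≤ M} := isClosed_le (by fun_prop) (by fun_prop)
      have h3 : IsClosed {z : En n × En n | c / 2 ≤ ‖z.1 - z.2‖} :=
        isClosed_le (by fun_prop) (by fun_prop)
      exact h1.inter (h2.inter h3)
    · rintro z ⟨h1, h2, -⟩
      exact ⟨by simpa using h1, by simpa using h2⟩
  obtain ⟨L₂, hL₂⟩ := (isCompact_closedBall (0 : En n) M).exists_bound_of_continuousOn
    hcont.continuousOn
  obtain ⟨l₂, hl₂0, hl₂⟩ : ∃ l₂ > 0, ∀ z ∈ S,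
      l₂ ≤ ⟪flux N p 0 z.1 - flux N p 0 z.2, z.1 - z.2⟫ := by
    rcases S.eq_empty_or_nonempty with h | h
    · exact ⟨1, one_pos, fun z hz => by rw [h] at hz; exact hz.elim⟩
    · obtain ⟨z, hz, hmin⟩ := hSc.exists_isMinOn h
        (f := fun z => ⟪flux N p 0 z.1 - flux N p 0 z.2, z.1 - z.2⟫) (by fun_prop)
      refine ⟨_, flux_strictMono N p 0 hp (ξ := z.1) (η := z.2) ?_, fun y hy => hmin hy⟩
      intro h
      have := hz.2.2
      rw [h, sub_self, norm_zero] at this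
      linarith
  set l₃ := l₂ / (4 * M ^ 2 + 1) with hl₃
  set l₁ := min (a ^ ((p - 2) / 2)) (b ^ ((p - 2) / 2)) * l with hl₁
  set L₁ := max (a ^ ((p - 2) / 2)) (b ^ ((p - 2) / 2)) * L with hL₁
  rcases lt_or_ge M c with hMc | hMc
  · refine ⟨1, 1, one_pos, le_rfl, fun ξ η _ h1 h2 => ?_⟩
    linarith
  have hMp : 0 < M := hc.trans_le hMc
  have ha0 : 0 < a := by positivity
  have hb0 : 0 < b := by positivity
  have hl₁0 : 0 < l₁ := mul_pos (lt_min (by positivity) (by positivity)) hl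
  have hlL : l₁ ≤ L₁ := mul_le_mul min_le_max hL hl.le (le_max_of_le_left (by positivity))
  refine ⟨min l₁ l₃, max L₁ (2 * L₂ / (c / 2)), lt_min hl₁0 (by positivity),
    (min_le_left _ _).trans (hlL.trans (le_max_left _ _)), fun ξ η hξ hη hηc => ?_⟩
  rcases le_or_gt (c / 2) ‖ξ - η‖ with hd | hd
  · have h1 := hl₂ (ξ, η) ⟨hξ, hη, hd⟩
    constructor
    · refine le_trans ?_ h1
      have h2 : ‖ξ - η‖ ≤ 2 * M := (norm_sub_le _ _).trans (by linarith)
      calc min l₁ l₃ * ‖ξ - η‖ ^ 2 ≤ l₃ * (2 * M) ^ 2 := by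
            gcongr; exact min_le_right _ _
        _ ≤ l₂ := by
            rw [hl₃, div_mul_eq_mul_div, div_le_iff₀ (by positivity)]
            nlinarith
    · have h3 := hL₂ ξ (by simpa using hξ)
      have h4 := hL₂ η (by simpa using hη)
      have hL₂0 : 0 ≤ L₂ := (norm_nonneg _).trans h3
      calc ‖flux N p 0 ξ - flux N p 0 η‖ ≤ 2 * L₂ := (norm_sub_le _ _).trans (by linarith)
        _ = 2 * L₂ / (c / 2) * (c / 2) := by field_simp
        _ ≤ max L₁ (2 * L₂ / (c / 2)) * ‖ξ - η‖ := by
            gcongr; exact le_max_right _ _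
  · have h := flux_pairEll N p 0 hp hl hL ha0 (b := b) hB (ξ := ξ) (η := η) fun ζ hζ _ => ?_
    · refine ⟨le_trans ?_ h.1, h.2.trans ?_⟩
      · gcongr; exact min_le_left _ _
      · gcongr; exact le_max_left _ _
    · have h1 : ζ ∈ closedBall (0 : En n) M :=
        (convex_closedBall (0 : En n) M).segment_subset (by simpa using hη) (by simpa using hξ) hζ
      have h2 : ζ ∈ closedBall η (c / 2) :=
        (convex_closedBall η (c / 2)).segment_subset (by simp; positivity)
          (by rw [mem_closedBall, dist_eq_norm]; exact hd.le) hζ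
      rw [mem_closedBall_zero_iff] at h1
      rw [mem_closedBall, dist_eq_norm] at h2
      have h3 : c / 2 ≤ ‖ζ‖ := by
        have := norm_sub_norm_le η ζ
        rw [norm_sub_rev] at this
        linarith
      rw [zero_pow two_ne_zero, add_zero]
      have := F_nonneg N ζ
      constructor
      · rw [ha]
        gcongr
        exact le_trans (by gcongr) (hF ζ).1
      · rw [hb]
        gcongr
        exact (hF ζ).2.trans (by gcongr)

end Ellipticity


section Divergence

variable {n : ℕ} {K : ℝ≥0}

/-- The trace of an endomorphism. -/
def tr (B : En n →L[ℝ] En n) : ℝ := ∑ i, B (EuclideanSpace.single i 1) i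

theorem tr_add (B D : En n →L[ℝ] En n) : tr (B + D) = tr B + tr D := by
  simp [tr, Finset.sum_add_distrib]

theorem tr_smul (c : ℝ) (B : En n →L[ℝ] En n) : tr (c • B) = c * tr B := by
  simp [tr, Finset.mul_sum]

theorem abs_tr_comp_le {l L : ℝ} {B : En n →L[ℝ] En n} (hB : Ell l L B) (hL : 0 ≤ L)
    (D : En n →L[ℝ] En n) : |tr (B ∘L D)| ≤ n * (L * ‖D‖) := by
  refine (Finset.abs_sum_le_sum_abs _ _).trans ?_
  refine (Finset.sum_le_card_nsmul _ _ (L * ‖D‖) fun i _ => ?_).trans_eq (by simp)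
  calc |(B ∘L D) (EuclideanSpace.single i 1) i| ≤ ‖B (D (EuclideanSpace.single i 1))‖ := by
        simpa using PiLp.norm_apply_le (B (D (EuclideanSpace.single i (1 : ℝ)))) i
    _ ≤ L * ‖D (EuclideanSpace.single i 1)‖ := (hB _).2
    _ ≤ L * (‖D‖ * ‖(EuclideanSpace.single i 1 : En n)‖) := by gcongr; exact D.le_opNorm _
    _ = _ := by simp

theorem tr_comp_smulRight (B : En n →L[ℝ] En n) (v : En n) :
    tr (B ∘L (innerSL ℝ v).smulRight v) = ⟪B v, v⟫ := by
  simp only [tr, ContinuousLinearMap.comp_apply, ContinuousLinearMap.smulRight_apply,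
    innerSL_apply_apply, map_smul, PiLp.smul_apply, smul_eq_mul, PiLp.inner_apply]
  refine Finset.sum_congr rfl fun i _ => ?_
  simp

theorem exists_smooth_cutoff {A U : Set (En n)} (hA : IsCompact A) (hU : IsOpen U) (hAU : A ⊆ U) :
    ∃ χ : En n → ℝ, ContDiff ℝ 1 χ ∧ HasCompactSupport χ ∧ tsupport χ ⊆ U ∧
      (∀ x ∈ A, ∀ᶠ y in 𝓝 x, χ y = 1) ∧ ∀ x, χ x ∈ Icc 0 1 := by
  obtain ⟨K', hK', hAK, hKU⟩ := exists_compact_between hA hU hAU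
  obtain ⟨f, h1, h0, h01⟩ := exists_contMDiffMap_one_nhds_of_subset_interior
    (modelWithCornersSelf ℝ (En n)) (n := 1) hA.isClosed hAK
  have hsup : tsupport f ⊆ K' := closure_minimal (fun x hx => by
    by_contra h; exact hx (h0 x h)) hK'.isClosed
  refine ⟨f, f.contMDiff.contDiff, HasCompactSupport.of_support_subset_isCompact hK'
    ((subset_tsupport f).trans hsup), hsup.trans hKU, fun x hx => ?_, h01⟩
  rw [eventually_nhdsSet_iff_forall] at h1
  exact h1 x hx

theorem integral_inner_gradient_of_contDiff {Y : En n → En n} (hY : ContDiff ℝ 1 Y)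
    (hYc : HasCompactSupport Y) {φ : En n → ℝ} (hφ : LipschitzWith K φ) :
    ∫ x, ⟪Y x, gradient φ x⟫ = -∫ x, φ x * tr (fderiv ℝ Y x) := by
  have hYi : ∀ i, ContDiff ℝ 1 fun x => Y x i := fun i =>
    (EuclideanSpace.proj (𝕜 := ℝ) i).contDiff.comp hY
  have hYic : ∀ i, HasCompactSupport fun x => Y x i := fun i =>
    hYc.comp_left (g := fun v : En n => v i) rfl
  have hd : ∀ i x, fderiv ℝ (fun x => Y x i) x (EuclideanSpace.single i 1) =
      fderiv ℝ Y x (EuclideanSpace.single i 1) i := fun i x => by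
    have h1 := ((EuclideanSpace.proj (𝕜 := ℝ) i).hasFDerivAt.comp x
      ((hY.differentiable (by simp)) x).hasFDerivAt).fderiv
    have h2 := congrArg (fun T => T (EuclideanSpace.single i (1 : ℝ))) h1
    exact h2
  have key : ∀ i, ∫ x, Y x i * gradient φ x i =
      -∫ x, φ x * fderiv ℝ Y x (EuclideanSpace.single i 1) i := fun i => by
    obtain ⟨C, hC⟩ := (hYi i).lipschitzWith_of_hasCompactSupport (hYic i) (by simp)
    have h := LipschitzWith.integral_lineDeriv_mul_eq (μ := volume) hφ hC (hYic i)
      (EuclideanSpace.single i 1)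
    have e1 : ∀ x, lineDeriv ℝ (fun x => Y x i) x (-EuclideanSpace.single i 1) * φ x =
        -(φ x * fderiv ℝ Y x (EuclideanSpace.single i 1) i) := fun x => by
      rw [((hYi i).differentiable (by simp) x).lineDeriv_eq_fderiv, map_neg, hd]
      ring
    have e2 : ∀ᵐ x, lineDeriv ℝ φ x (EuclideanSpace.single i 1) * Y x i =
        Y x i * gradient φ x i := by
      filter_upwards [differentiableAt_ae hφ] with x hx
      rw [hx.lineDeriv_eq_fderiv, ← inner_gradient_left,
        EuclideanSpace.inner_single_right]
      simp; ring
    rw [integral_congr_ae e2] at h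
    simp_rw [e1, integral_neg] at h
    exact h
  have hint1 : ∀ i, Integrable fun x => Y x i * gradient φ x i := fun i => by
    refine (((hYi i).continuous.integrable_of_hasCompactSupport (hYic i)).norm.mul_const
      (K : ℝ)).mono'
      ((hYi i).continuous.measurable.mul ((EuclideanSpace.proj (𝕜 := ℝ) i).continuous.measurable.comp
        (measurable_gradient φ))).aestronglyMeasurable (Eventually.of_forall fun x => ?_)
    rw [norm_mul]
    gcongr
    exact (PiLp.norm_apply_le (gradient φ x) i).trans (norm_gradient_le hφ x)
  have hint2 : ∀ i, Integrable fun x => φ x * fderiv ℝ Y x (EuclideanSpace.single i 1) i :=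
    fun i => by
      refine Continuous.integrable_of_hasCompactSupport ?_ (HasCompactSupport.mul_left ?_)
      · have h2 := hY.continuous_fderiv (by simp)
        exact hφ.continuous.mul ((EuclideanSpace.proj (𝕜 := ℝ) i).continuous.comp
          (h2.clm_apply continuous_const))
      · exact (hYc.fderiv ℝ).comp_left (g := fun T : En n →L[ℝ] En n =>
          T (EuclideanSpace.single i 1) i) (by simp)
  simp_rw [tr, Finset.mul_sum]
  rw [integral_finsetSum _ fun i _ => hint2 i, ← Finset.sum_neg_distrib]
  simp_rw [← key]
  rw [← integral_finsetSum _ fun i _ => hint1 i]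
  congr 1 with x
  rw [PiLp.inner_apply]
  exact Finset.sum_congr rfl fun i _ => mul_comm _ _

theorem integral_inner_gradient_of_contDiffOn {Y : En n → En n} {U : Set (En n)} (hU : IsOpen U)
    (hY : ContDiffOn ℝ 1 Y U) {φ : En n → ℝ} (hφ : LipschitzWith K φ)
    (hc : HasCompactSupport φ) (hs : tsupport φ ⊆ U) :
    ∫ x, ⟪Y x, gradient φ x⟫ = -∫ x, φ x * tr (fderiv ℝ Y x) := by
  obtain ⟨χ, hχ, hχc, hχU, h1, -⟩ := exists_smooth_cutoff hc hU hs
  have hY' : ContDiff ℝ 1 fun x => χ x • Y x := by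
    rw [contDiff_iff_contDiffAt]
    intro x
    by_cases hx : x ∈ U
    · exact hχ.contDiffAt.smul (hY.contDiffAt (hU.mem_nhds hx))
    · have : (fun x => χ x • Y x) =ᶠ[𝓝 x] fun _ => 0 := by
        filter_upwards [(isClosed_tsupport χ).isOpen_compl.mem_nhds fun h => hx (hχU h)] with y hy
        simp [image_eq_zero_of_notMem_tsupport hy]
      exact contDiffAt_const.congr_of_eventuallyEq this
  have h := integral_inner_gradient_of_contDiff hY' hχc.smul_right hφ
  have e1 : ∀ x, ⟪χ x • Y x, gradient φ x⟫ = ⟪Y x, gradient φ x⟫ := fun x => by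
    by_cases hx : x ∈ tsupport φ
    · rw [(h1 x hx).self_of_nhds, one_smul]
    · simp [gradient_eq_zero_of_notMem_tsupport hx]
  have e2 : ∀ x, φ x * tr (fderiv ℝ (fun x => χ x • Y x) x) = φ x * tr (fderiv ℝ Y x) := fun x => by
    by_cases hx : x ∈ tsupport φ
    · have : (fun x => χ x • Y x) =ᶠ[𝓝 x] Y := by
        filter_upwards [h1 x hx] with y hy
        rw [hy, one_smul]
      rw [this.fderiv_eq]
    · simp [image_eq_zero_of_notMem_tsupport hx]
  simp_rw [e1, e2] at h
  exact h

end Divergence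


section Barrier

variable {n : ℕ} {K : ℝ≥0} {x : En n} {b g : En n → ℝ}

/-- The Hessian of a function, as an endomorphism. -/
def hess (b : En n → ℝ) (x : En n) : En n →L[ℝ] En n := fderiv ℝ (gradient b) x

/-- The Hessian is nonnegative when tested with every matrix with ellipticity constants `l`, `L`. -/
def InCone (l L : ℝ) (b : En n → ℝ) (x : En n) : Prop :=
  ∀ B : En n →L[ℝ] En n, Ell l L B → 0 ≤ tr (B ∘L hess b x)

theorem contDiffAt_gradient (hb : ContDiffAt ℝ 2 b x) : ContDiffAt ℝ 1 (gradient b) x :=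
  (InnerProductSpace.toDual ℝ (En n)).symm.toContinuousLinearEquiv.contDiff.contDiffAt.comp x
    (hb.fderiv_right (m := 1) (by norm_num))

theorem hasFDerivAt_gradient (hb : ContDiffAt ℝ 2 b x) : HasFDerivAt (gradient b) (hess b x) x :=
  ((contDiffAt_gradient hb).differentiableAt (by simp)).hasFDerivAt

theorem eventually_differentiableAt (hb : ContDiffAt ℝ 2 b x) :
    ∀ᶠ y in 𝓝 x, DifferentiableAt ℝ b y := by
  filter_upwards [hb.eventually (by simp)] with y hy using hy.differentiableAt (by simp)

theorem hess_add (hb : ContDiffAt ℝ 2 b x) (hg : ContDiffAt ℝ 2 g x) :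
    hess (fun y => b y + g y) x = hess b x + hess g x := by
  have : gradient (fun y => b y + g y) =ᶠ[𝓝 x] fun y => gradient b y + gradient g y := by
    filter_upwards [eventually_differentiableAt hb, eventually_differentiableAt hg] with y h1 h2
    exact gradient_add h1 h2
  rw [hess, this.fderiv_eq]
  exact ((hasFDerivAt_gradient hb).add (hasFDerivAt_gradient hg)).fderiv

theorem hess_const_mul (hb : ContDiffAt ℝ 2 b x) (c : ℝ) :
    hess (fun y => c * b y) x = c • hess b x := by
  have : gradient (fun y => c * b y) = fun y => c • gradient b y := by
    ext1 y; exact gradient_const_mul b c y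
  rw [hess, this]
  exact ((hasFDerivAt_gradient hb).const_smul c).fderiv

theorem hess_sub_const (b : En n → ℝ) (c : ℝ) (x : En n) :
    hess (fun y => b y - c) x = hess b x := by
  have : gradient (fun y => b y - c) = gradient b := by
    ext1 y; exact gradient_sub_const b c y
  rw [hess, this, hess]

theorem InCone.add {l L : ℝ} (h1 : InCone l L b x) (h2 : InCone l L g x)
    (hb : ContDiffAt ℝ 2 b x) (hg : ContDiffAt ℝ 2 g x) : InCone l L (fun y => b y + g y) x := by
  intro B hB
  rw [hess_add hb hg, ContinuousLinearMap.comp_add, tr_add]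
  exact add_nonneg (h1 B hB) (h2 B hB)

theorem InCone.const_mul {l L c : ℝ} (h1 : InCone l L b x) (hb : ContDiffAt ℝ 2 b x)
    (hc : 0 ≤ c) : InCone l L (fun y => c * b y) x := by
  intro B hB
  rw [hess_const_mul hb, ContinuousLinearMap.comp_smul, tr_smul]
  exact mul_nonneg hc (h1 B hB)

theorem inCone_zero (l L : ℝ) (x : En n) : InCone l L (fun _ => 0) x := by
  intro B _
  have : gradient (fun _ : En n => (0 : ℝ)) = fun _ => 0 := by
    ext1 y; simp [gradient]
  simp [hess, this, tr]

theorem gradient_comp {ω : ℝ → ℝ} {d : ℝ} (hg : DifferentiableAt ℝ g x)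
    (hω : HasDerivAt ω d (g x)) : gradient (fun y => ω (g y)) x = d • gradient g x := by
  have h := (hω.comp_hasFDerivAt x hg.hasFDerivAt).fderiv
  have h' : fderiv ℝ (fun y => ω (g y)) x = d • fderiv ℝ g x := h
  rw [gradient, h', map_smulₛₗ]
  rfl

theorem hess_comp {ω ω₁ : ℝ → ℝ} {ω₂ : ℝ} (hg : ContDiffAt ℝ 2 g x)
    (hω : ∀ᶠ t in 𝓝 (g x), HasDerivAt ω (ω₁ t) t) (hω₁ : HasDerivAt ω₁ ω₂ (g x)) :
    hess (fun y => ω (g y)) x =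
      ω₂ • (innerSL ℝ (gradient g x)).smulRight (gradient g x) + ω₁ (g x) • hess g x := by
  have : gradient (fun y => ω (g y)) =ᶠ[𝓝 x] fun y => ω₁ (g y) • gradient g y := by
    filter_upwards [eventually_differentiableAt hg, hg.continuousAt.eventually hω] with y h1 h2
    exact gradient_comp h1 h2
  rw [hess, this.fderiv_eq]
  have hd := hω₁.comp_hasFDerivAt x ((hg.differentiableAt (by simp)).hasFDerivAt)
  have h2 := hd.smul (hasFDerivAt_gradient hg)
  have h3 : HasFDerivAt (fun y => ω₁ (g y) • gradient g y) _ x := h2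
  rw [h3.fderiv, add_comm]
  congr 1
  ext1 v
  simp only [ContinuousLinearMap.smulRight_apply, smul_apply, innerSL_apply_apply,
    inner_gradient_left, smul_smul, smul_eq_mul]

theorem inCone_comp {ω ω₁ : ℝ → ℝ} {ω₂ l L : ℝ} (hL : 0 ≤ L) (hg : ContDiffAt ℝ 2 g x)
    (hω : ∀ᶠ t in 𝓝 (g x), HasDerivAt ω (ω₁ t) t) (hω₁ : HasDerivAt ω₁ ω₂ (g x)) (h0 : 0 ≤ ω₂)
    (h : |ω₁ (g x)| * (n * (L * ‖hess g x‖)) ≤ ω₂ * (l * ‖gradient g x‖ ^ 2)) :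
    InCone l L (fun y => ω (g y)) x := by
  intro B hB
  rw [hess_comp hg hω hω₁, ContinuousLinearMap.comp_add, tr_add, ContinuousLinearMap.comp_smul,
    ContinuousLinearMap.comp_smul, tr_smul, tr_smul, tr_comp_smulRight]
  have h1 : |ω₁ (g x) * tr (B ∘L hess g x)| ≤ |ω₁ (g x)| * (n * (L * ‖hess g x‖)) := by
    rw [abs_mul]
    gcongr
    exact abs_tr_comp_le hB hL _
  have h2 := mul_le_mul_of_nonneg_left (hB (gradient g x)).1 h0
  linarith [neg_abs_le (ω₁ (g x) * tr (B ∘L hess g x))]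

variable (N : MinkowskiNorm n) (p s : ℝ)

theorem contDiffAt_flux {ξ : En n} (h : ξ ≠ 0) : ContDiffAt ℝ 1 (flux N p s) ξ := by
  have h1 : ContDiffAt ℝ 1 (fun y => N.F y ^ 2 + s ^ 2) ξ := by
    have : ContDiffAt ℝ 1 N.F ξ := (N.smooth.contDiffAt
      (isOpen_compl_singleton.mem_nhds h)).of_le (by norm_cast)
    exact (this.pow 2).add contDiffAt_const
  exact (h1.rpow_const_of_ne (sq_add_sq_pos N s h).ne').smul
    ((contDiffAt_legendre N h).of_le (by norm_cast))

theorem integral_flux_gradient_nonpos {l L : ℝ} (hE : ∀ ξ : En n, ξ ≠ 0 → Ell l L (fluxMat N p s ξ))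
    {U : Set (En n)} (hU : IsOpen U) (hb : ContDiffOn ℝ 2 b U)
    (hne : ∀ x ∈ U, gradient b x ≠ 0) (hcone : ∀ x ∈ U, InCone l L b x)
    {φ : En n → ℝ} (hφ : LipschitzWith K φ)
    (hc : HasCompactSupport φ) (hs : tsupport φ ⊆ U) (h0 : ∀ x, 0 ≤ φ x) :
    ContinuousOn (fun y => flux N p s (gradient b y)) U ∧
      ∫ x, ⟪flux N p s (gradient b x), gradient φ x⟫ ≤ 0 := by
  have hbA : ∀ x ∈ U, ContDiffAt ℝ 2 b x := fun x hx => hb.contDiffAt (hU.mem_nhds hx)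
  have hYA : ∀ x ∈ U, ContDiffAt ℝ 1 (fun y => flux N p s (gradient b y)) x := fun x hx =>
    (contDiffAt_flux N p s (hne x hx)).comp x (contDiffAt_gradient (hbA x hx))
  have hY : ContDiffOn ℝ 1 (fun y => flux N p s (gradient b y)) U := fun x hx =>
    (hYA x hx).contDiffWithinAt
  refine ⟨hY.continuousOn, ?_⟩
  rw [integral_inner_gradient_of_contDiffOn hU hY hφ hc hs, neg_nonpos]
  refine integral_nonneg fun x => ?_
  by_cases hx : x ∈ tsupport φ
  · have hxU := hs hx
    have hd : fderiv ℝ (fun y => flux N p s (gradient b y)) x =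
        (fluxWeight N p s (gradient b x) • fluxMat N p s (gradient b x)) ∘L hess b x :=
      ((hasFDerivAt_flux N p s (hne x hxU)).comp x (hasFDerivAt_gradient (hbA x hxU))).fderiv
    simp only [Pi.zero_apply]
    rw [hd, ContinuousLinearMap.smul_comp, tr_smul]
    exact mul_nonneg (h0 x) (mul_nonneg (fluxWeight_pos N p s (hne x hxU)).le
      (hcone x hxU _ (hE _ (hne x hxU))))
  · simp [image_eq_zero_of_notMem_tsupport hx]

/-- Comparison with a classical strict-gradient subsolution. -/
theorem comparison (hp : 1 < p) {l L : ℝ} (hE : ∀ ξ : En n, ξ ≠ 0 → Ell l L (fluxMat N p s ξ))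
    {U : Set (En n)} (hU : IsOpen U) (hb : ContDiffOn ℝ 2 b U)
    (hne : ∀ x ∈ U, gradient b x ≠ 0) (hcone : ∀ x ∈ U, InCone l L b x)
    {W φ : En n → ℝ} {K' : ℝ≥0} (hW : LipschitzWith K' W) (hφ : LipschitzWith K φ)
    (hc : HasCompactSupport φ) (hs : tsupport φ ⊆ U) (h0 : ∀ x, 0 ≤ φ x)
    (hφb : ∀ x, 0 < φ x → φ x = b x - W x) {z : En n} (hz : φ z = 0)
    (h : 0 ≤ ∫ x, ⟪flux N p s (gradient W x), gradient φ x⟫) : ∀ x, φ x = 0 := by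
  have hbA : ∀ x ∈ U, ContDiffAt ℝ 2 b x := fun x hx => hb.contDiffAt (hU.mem_nhds hx)
  obtain ⟨hY, hneg⟩ := integral_flux_gradient_nonpos N p s hE hU hb hne hcone hφ hc hs h0
  have hgr : ∀ᵐ x, gradient φ x = 0 ∨ (gradient φ x = gradient b x - gradient W x) := by
    filter_upwards [differentiableAt_ae hW] with x hx
    rcases (h0 x).eq_or_lt with h1 | h1
    · left
      exact gradient_eq_zero_of_isMin fun y => h1 ▸ h0 y
    · right
      have hxU : x ∈ U := hs (subset_tsupport φ h1.ne')
      have : φ =ᶠ[𝓝 x] fun y => b y - W y := by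
        filter_upwards [hφ.continuous.continuousAt.eventually (lt_mem_nhds h1)] with y hy
        exact hφb y hy
      rw [this.gradient_eq]
      exact gradient_sub ((hbA x hxU).differentiableAt (by simp)) hx
  have hi1 : Integrable fun x => ⟪flux N p s (gradient W x), gradient φ x⟫ := by
    obtain ⟨C, hC⟩ := (isCompact_closedBall (0 : En n) K').exists_bound_of_continuousOn
      (continuous_flux N p s hp).continuousOn
    exact integrable_inner_gradient hφ hc
      ((continuous_flux N p s hp).measurable.comp (measurable_gradient W))
      fun x => hC _ (by simpa using norm_gradient_le hW x)
  have hi2 : Integrable fun x => ⟪flux N p s (gradient b x), gradient φ x⟫ := by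
    obtain ⟨C, hC⟩ := hc.exists_bound_of_continuousOn (hY.mono hs)
    refine ((integrable_norm_gradient hφ hc).const_mul C).mono'
      (((continuous_flux N p s hp).measurable.comp (measurable_gradient b)).inner
        (measurable_gradient φ)).aestronglyMeasurable (Eventually.of_forall fun x => ?_)
    by_cases hx : x ∈ tsupport φ
    · exact (norm_inner_le_norm _ _).trans (mul_le_mul_of_nonneg_right (hC x hx) (norm_nonneg _))
    · simp [gradient_eq_zero_of_notMem_tsupport hx]
  have hnn : ∀ᵐ x, 0 ≤ ⟪flux N p s (gradient b x), gradient φ x⟫ -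
      ⟪flux N p s (gradient W x), gradient φ x⟫ := by
    filter_upwards [hgr] with x hx
    rcases hx with hx | hx
    · simp [hx]
    · rw [← inner_sub_left, hx]
      exact flux_mono N p s hp _ _
  have hzero := (integral_eq_zero_iff_of_nonneg_ae hnn (hi2.sub hi1)).1 (le_antisymm (by
    rw [integral_sub hi2 hi1]; linarith) (integral_nonneg_of_ae hnn))
  refine eq_zero_of_gradient_eq_zero hφ ?_ hz
  filter_upwards [hgr, hzero] with x h1 h2
  rcases h1 with h1 | h1
  · exact h1
  · by_contra hcon
    have hn : gradient b x ≠ gradient W x := fun e => hcon (by rw [h1, e, sub_self])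
    have := flux_strictMono N p s hp hn
    rw [← h1, inner_sub_left] at this
    simp only [Pi.zero_apply] at h2
    linarith

end Barrier


section Annulus

variable {n : ℕ} {k : ℕ} {ρ₁ ρ₂ t t' : ℝ}

/-- The profile of the radial barrier, equal to `1` at `ρ₁` and to `0` at `ρ₂`. -/
def cap (k : ℕ) (ρ₁ ρ₂ t : ℝ) : ℝ := ((ρ₂ / t) ^ (2 * k) - 1) / ((ρ₂ / ρ₁) ^ (2 * k) - 1)

theorem cap_denom_pos (hk : 1 ≤ k) (h1 : 0 < ρ₁) (h2 : ρ₁ < ρ₂) :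
    0 < (ρ₂ / ρ₁) ^ (2 * k) - 1 := by
  have : 1 < (ρ₂ / ρ₁) ^ (2 * k) := one_lt_pow₀ ((one_lt_div h1).2 h2) (by omega)
  linarith

theorem cap_left (hk : 1 ≤ k) (h1 : 0 < ρ₁) (h2 : ρ₁ < ρ₂) : cap k ρ₁ ρ₂ ρ₁ = 1 :=
  div_self (cap_denom_pos hk h1 h2).ne'

theorem cap_nonpos (hk : 1 ≤ k) (h1 : 0 < ρ₁) (h2 : ρ₁ < ρ₂) (ht : ρ₂ ≤ t) :
    cap k ρ₁ ρ₂ t ≤ 0 := by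
  refine div_nonpos_of_nonpos_of_nonneg ?_ (cap_denom_pos hk h1 h2).le
  have h3 : ρ₂ / t ≤ 1 := (div_le_one (by linarith)).2 ht
  have h4 : 0 ≤ ρ₂ / t := div_nonneg (by linarith) (by linarith)
  linarith [pow_le_one₀ h4 h3 (n := 2 * k)]

theorem cap_le_one (hk : 1 ≤ k) (h1 : 0 < ρ₁) (h2 : ρ₁ < ρ₂) (ht : ρ₁ ≤ t) :
    cap k ρ₁ ρ₂ t ≤ 1 := by
  rw [← cap_left hk h1 h2, cap, cap]
  have := (cap_denom_pos hk h1 h2).le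
  have h4 : 0 ≤ ρ₂ / t := div_nonneg (by linarith) (by linarith)
  gcongr
  linarith

theorem cap_lower (hk : 1 ≤ k) (h1 : 0 < ρ₁) (h2 : ρ₁ < ρ₂) (ht : 0 < t) (ht2 : t ≤ ρ₂) :
    (ρ₂ - t) / ρ₂ / ((ρ₂ / ρ₁) ^ (2 * k) - 1) ≤ cap k ρ₁ ρ₂ t := by
  have := (cap_denom_pos hk h1 h2).le
  rw [cap]
  gcongr
  have h3 : 1 ≤ ρ₂ / t := (one_le_div ht).2 ht2
  have h4 : ρ₂ / t ≤ (ρ₂ / t) ^ (2 * k) := le_self_pow₀ h3 (by omega)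
  have h5 : (ρ₂ - t) / ρ₂ ≤ ρ₂ / t - 1 := by
    have e : ρ₂ / t - 1 = (ρ₂ - t) / t := by field_simp
    rw [e]
    gcongr
  linarith

theorem cap_lipschitz (hk : 1 ≤ k) (h1 : 0 < ρ₁) (h2 : ρ₁ < ρ₂) :
    ∃ C : ℝ≥0, ∀ t t', ρ₁ ≤ t → ρ₁ ≤ t' → |cap k ρ₁ ρ₂ t - cap k ρ₁ ρ₂ t'| ≤ C * |t - t'| := by
  have hD := cap_denom_pos hk h1 h2
  set D := (ρ₂ / ρ₁) ^ (2 * k) - 1 with hDd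
  have hC : 0 ≤ ρ₂ / ρ₁ ^ 2 * (2 * k) * (ρ₂ / ρ₁) ^ (2 * k - 1) / D := by
    have : 0 < ρ₂ := h1.trans h2
    positivity
  refine ⟨Real.toNNReal (ρ₂ / ρ₁ ^ 2 * (2 * k) * (ρ₂ / ρ₁) ^ (2 * k - 1) / D), fun t t' ht ht' => ?_⟩
  rw [Real.coe_toNNReal _ hC]
  have ht0 : 0 < t := by linarith
  have ht0' : 0 < t' := by linarith
  have hr : 0 < ρ₂ := h1.trans h2
  have e : cap k ρ₁ ρ₂ t - cap k ρ₁ ρ₂ t' = ((ρ₂ / t) ^ (2 * k) - (ρ₂ / t') ^ (2 * k)) / D := by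
    rw [cap, cap, ← hDd]; ring
  rw [e, abs_div, abs_of_pos hD]
  have h3 := abs_pow_sub_pow_le (ρ₂ / t) (ρ₂ / t') (2 * k)
  have h4 : |ρ₂ / t - ρ₂ / t'| ≤ ρ₂ / ρ₁ ^ 2 * |t - t'| := by
    have : ρ₂ / t - ρ₂ / t' = ρ₂ / (t * t') * (t' - t) := by field_simp
    rw [this, abs_mul, abs_of_pos (by positivity), abs_sub_comm t' t]
    gcongr
    nlinarith
  have h5 : max |ρ₂ / t| |ρ₂ / t'| ≤ ρ₂ / ρ₁ := by
    rw [abs_of_pos (by positivity), abs_of_pos (by positivity)]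
    exact max_le (by gcongr) (by gcongr)
  have h6 : |(ρ₂ / t) ^ (2 * k) - (ρ₂ / t') ^ (2 * k)| ≤
      ρ₂ / ρ₁ ^ 2 * |t - t'| * (2 * k) * (ρ₂ / ρ₁) ^ (2 * k - 1) := by
    refine h3.trans ?_
    push_cast
    gcongr
  calc _ ≤ (ρ₂ / ρ₁ ^ 2 * |t - t'| * (2 * k) * (ρ₂ / ρ₁) ^ (2 * k - 1)) / D := by gcongr
    _ = _ := by ring

/-- The truncated radial barrier. -/
def annB (k : ℕ) (ρ₁ ρ₂ : ℝ) (x : En n) : ℝ := max 0 (cap k ρ₁ ρ₂ (max ρ₁ ‖x‖))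

theorem lipschitz_annB (n : ℕ) (hk : 1 ≤ k) (h1 : 0 < ρ₁) (h2 : ρ₁ < ρ₂) :
    ∃ C : ℝ≥0, LipschitzWith C (annB (n := n) k ρ₁ ρ₂) := by
  obtain ⟨C, hC⟩ := cap_lipschitz hk h1 h2
  have h : LipschitzWith C fun x : En n => cap k ρ₁ ρ₂ (max ρ₁ ‖x‖) := by
    refine LipschitzWith.of_dist_le_mul fun x y => ?_
    rw [Real.dist_eq, dist_eq_norm]
    refine (hC _ _ (le_max_left _ _) (le_max_left _ _)).trans ?_
    gcongr
    exact (abs_max_sub_max_le_max _ _ _ _).trans (by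
      simpa using abs_norm_sub_norm_le x y)
  exact ⟨C, h.const_max 0⟩

theorem annB_nonneg (x : En n) : 0 ≤ annB k ρ₁ ρ₂ x := le_max_left _ _

theorem annB_le_one (hk : 1 ≤ k) (h1 : 0 < ρ₁) (h2 : ρ₁ < ρ₂) (x : En n) :
    annB k ρ₁ ρ₂ x ≤ 1 := max_le zero_le_one (cap_le_one hk h1 h2 (le_max_left _ _))

theorem annB_eq_zero (hk : 1 ≤ k) (h1 : 0 < ρ₁) (h2 : ρ₁ < ρ₂) {x : En n} (hx : ρ₂ ≤ ‖x‖) :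
    annB k ρ₁ ρ₂ x = 0 :=
  max_eq_left (cap_nonpos hk h1 h2 (hx.trans (le_max_right _ _)))

theorem annB_eq_one (hk : 1 ≤ k) (h1 : 0 < ρ₁) (h2 : ρ₁ < ρ₂) {x : En n} (hx : ‖x‖ ≤ ρ₁) :
    annB k ρ₁ ρ₂ x = 1 := by
  rw [annB, max_eq_left hx, cap_left hk h1 h2]
  simp

theorem le_annB (hk : 1 ≤ k) (h1 : 0 < ρ₁) (h2 : ρ₁ < ρ₂) (x : En n) :
    min 1 ((ρ₂ - ‖x‖) / ρ₂ / ((ρ₂ / ρ₁) ^ (2 * k) - 1)) ≤ annB k ρ₁ ρ₂ x := by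
  rcases le_total ‖x‖ ρ₁ with hx | hx
  · rw [annB_eq_one hk h1 h2 hx]
    exact min_le_left _ _
  · refine (min_le_right _ _).trans ?_
    rcases le_total ‖x‖ ρ₂ with hx2 | hx2
    · refine (cap_lower hk h1 h2 (by linarith) hx2).trans ?_
      rw [annB, max_eq_right hx]
      exact le_max_right _ _
    · refine le_trans ?_ (annB_nonneg x)
      have := (cap_denom_pos hk h1 h2).le
      refine div_nonpos_of_nonpos_of_nonneg (div_nonpos_of_nonpos_of_nonneg ?_ ?_) this <;> linarith

/-- The radial barrier centred at `y`. -/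
def radB (k : ℕ) (ρ₁ ρ₂ : ℝ) (y x : En n) : ℝ := cap k ρ₁ ρ₂ ‖x - y‖

theorem radB_eq (k : ℕ) (ρ₁ ρ₂ : ℝ) (y x : En n) :
    radB k ρ₁ ρ₂ y x = ρ₂ ^ (2 * k) / ((ρ₂ / ρ₁) ^ (2 * k) - 1) * (‖x - y‖ ^ 2) ^ (-(k : ℤ)) -
      1 / ((ρ₂ / ρ₁) ^ (2 * k) - 1) := by
  rw [radB, cap, zpow_neg, zpow_natCast, ← pow_mul, div_pow]
  ring

theorem gradient_normSq (y x : En n) :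
    gradient (fun x => ‖x - y‖ ^ 2) x = (2 : ℝ) • (x - y) := by
  have h := ((hasFDerivAt_id x).sub_const y).norm_sq
  refine HasGradientAt.gradient ?_
  rw [hasGradientAt_iff_hasFDerivAt]
  refine h.congr_fderiv ?_
  ext v
  simp [two_mul]

theorem contDiff_normSq (y : En n) : ContDiff ℝ 2 fun x : En n => ‖x - y‖ ^ 2 :=
  (contDiff_id.sub contDiff_const).norm_sq ℝ

theorem norm_hess_normSq (y x : En n) : ‖hess (fun x => ‖x - y‖ ^ 2) x‖ ≤ 2 := by
  have e : gradient (fun x => ‖x - y‖ ^ 2) = fun x => (2 : ℝ) • (x - y) := by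
    ext1 x; exact gradient_normSq y x
  have hd : HasFDerivAt (fun x : En n => (2 : ℝ) • (x - y))
      ((2 : ℝ) • ContinuousLinearMap.id ℝ (En n)) x :=
    ((hasFDerivAt_id x).sub_const y).const_smul (2 : ℝ)
  rw [hess, e, hd.fderiv, norm_smul]
  have := ContinuousLinearMap.norm_id_le (𝕜 := ℝ) (E := En n)
  simp only [Real.norm_ofNat]
  linarith

theorem normSq_pos {x y : En n} (h : x ≠ y) : 0 < ‖x - y‖ ^ 2 := by
  have := norm_pos_iff.2 (sub_ne_zero.2 h)
  positivity

theorem contDiffAt_radB {x y : En n} (h : x ≠ y) : ContDiffAt ℝ 2 (radB k ρ₁ ρ₂ y) x := by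
  have e : radB k ρ₁ ρ₂ y = fun x => ρ₂ ^ (2 * k) / ((ρ₂ / ρ₁) ^ (2 * k) - 1) *
      ((‖x - y‖ ^ 2) ^ k)⁻¹ - 1 / ((ρ₂ / ρ₁) ^ (2 * k) - 1) := by
    ext1 x; rw [radB_eq, zpow_neg, zpow_natCast]
  rw [e]
  exact (contDiffAt_const.mul (((contDiff_normSq y).contDiffAt.pow k).inv
    (pow_pos (normSq_pos h) k).ne')).sub contDiffAt_const

theorem gradient_radB {x y : En n} (h : x ≠ y) : gradient (radB k ρ₁ ρ₂ y) x =
    (-(2 * k * (ρ₂ / ‖x - y‖) ^ (2 * k) / ((ρ₂ / ρ₁) ^ (2 * k) - 1) / ‖x - y‖ ^ 2)) • (x - y) := by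
  have hpos := normSq_pos h
  have hd := hasDerivAt_zpow (-(k : ℤ)) (‖x - y‖ ^ 2) (Or.inl hpos.ne')
  have hg := gradient_comp (g := fun x => ‖x - y‖ ^ 2)
    ((contDiff_normSq y).differentiable (by simp) x) hd
  have e : radB k ρ₁ ρ₂ y = fun x => ρ₂ ^ (2 * k) / ((ρ₂ / ρ₁) ^ (2 * k) - 1) *
      (‖x - y‖ ^ 2) ^ (-(k : ℤ)) - 1 / ((ρ₂ / ρ₁) ^ (2 * k) - 1) := by
    ext1 x; rw [radB_eq]
  rw [e, gradient_sub_const, gradient_const_mul, hg, gradient_normSq, smul_smul, smul_smul]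
  congr 1
  rw [zpow_sub_one₀ hpos.ne', zpow_neg, zpow_natCast, div_pow, ← pow_mul]
  push_cast
  ring

theorem inCone_radB {l L : ℝ} (hL : 0 ≤ L) (hk : 1 ≤ k)
    (hkl : n * L ≤ 2 * (k + 1) * l) (h1 : 0 < ρ₁) (h2 : ρ₁ < ρ₂) {x y : En n} (h : x ≠ y) :
    InCone l L (radB k ρ₁ ρ₂ y) x := by
  have hpos := normSq_pos h
  have hω : ∀ t : ℝ, 0 < t → HasDerivAt (fun t : ℝ => t ^ (-(k : ℤ)))
      (((-(k : ℤ) : ℤ) : ℝ) * t ^ (-(k : ℤ) - 1)) t := fun t ht =>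
    hasDerivAt_zpow _ _ (Or.inl ht.ne')
  have hω1 : HasDerivAt (fun t : ℝ => ((-(k : ℤ) : ℤ) : ℝ) * t ^ (-(k : ℤ) - 1))
      (((-(k : ℤ) : ℤ) : ℝ) * (((-(k : ℤ) - 1 : ℤ) : ℝ) * (‖x - y‖ ^ 2) ^ (-(k : ℤ) - 1 - 1)))
      (‖x - y‖ ^ 2) :=
    (hasDerivAt_zpow _ _ (Or.inl hpos.ne')).const_mul _
  have hcone : InCone l L (fun x => (‖x - y‖ ^ 2) ^ (-(k : ℤ))) x := by
    refine inCone_comp (g := fun x => ‖x - y‖ ^ 2) (ω := fun t => t ^ (-(k : ℤ)))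
      (ω₁ := fun t => ((-(k : ℤ) : ℤ) : ℝ) * t ^ (-(k : ℤ) - 1)) hL (contDiff_normSq y).contDiffAt ?_ hω1 ?_ ?_
    · filter_upwards [lt_mem_nhds hpos] with t ht using hω t ht
    · push_cast
      have : 0 < (‖x - y‖ ^ 2) ^ (-(k : ℤ) - 1 - 1) := zpow_pos hpos _
      have hk0 : (0 : ℝ) ≤ k := Nat.cast_nonneg k
      nlinarith [mul_nonneg hk0 this.le, mul_nonneg hk0 (mul_nonneg hk0 this.le)]
    · have hz : 0 < (‖x - y‖ ^ 2) ^ (-(k : ℤ) - 1) := zpow_pos hpos _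
      rw [zpow_sub_one₀ hpos.ne' (-(k : ℤ) - 1), gradient_normSq, norm_smul, Real.norm_ofNat, abs_mul,
        abs_of_pos hz]
      push_cast
      rw [abs_neg, abs_of_nonneg (Nat.cast_nonneg k)]
      have hh := norm_hess_normSq y x
      set Z := (‖x - y‖ ^ 2) ^ (-(k : ℤ) - 1)
      have hx : ‖x - y‖ ≠ 0 := norm_ne_zero_iff.2 (sub_ne_zero.2 h)
      calc (k : ℝ) * Z * (n * (L * ‖hess (fun x => ‖x - y‖ ^ 2) x‖))
          ≤ k * Z * (n * (L * 2)) := by gcongr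
        _ = k * Z * 2 * (n * L) := by ring
        _ ≤ k * Z * 2 * (2 * (k + 1) * l) := by gcongr
        _ = _ := by field_simp; ring
  have e : radB k ρ₁ ρ₂ y = fun x => ρ₂ ^ (2 * k) / ((ρ₂ / ρ₁) ^ (2 * k) - 1) *
      (‖x - y‖ ^ 2) ^ (-(k : ℤ)) - 1 / ((ρ₂ / ρ₁) ^ (2 * k) - 1) := by
    ext1 x; rw [radB_eq]
  have hc : ContDiffAt ℝ 2 (fun x => (‖x - y‖ ^ 2) ^ (-(k : ℤ))) x := by
    simp_rw [zpow_neg, zpow_natCast]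
    exact ((contDiff_normSq y).contDiffAt.pow k).inv (pow_pos hpos k).ne'
  have hcc := hcone.const_mul hc (c := ρ₂ ^ (2 * k) / ((ρ₂ / ρ₁) ^ (2 * k) - 1))
    (div_nonneg (pow_nonneg (h1.trans h2).le _) (cap_denom_pos hk h1 h2).le)
  intro B hB
  rw [e, hess_sub_const]
  exact hcc B hB

variable (N : MinkowskiNorm n) (p s : ℝ)

/-- Propagation of a lower bound through an annulus. -/
theorem annulus_lower (hp : 1 < p) {l L : ℝ}
    (hE : ∀ ξ : En n, ξ ≠ 0 → Ell l L (fluxMat N p s ξ))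
    (hL : 0 ≤ L) (hk : 1 ≤ k) (hkl : n * L ≤ 2 * (k + 1) * l) (h1 : 0 < ρ₁) (h2 : ρ₁ < ρ₂)
    {y : En n} {τ : ℝ} (hτ : 0 ≤ τ) {b W : En n → ℝ} {K K' : ℝ≥0} (hbL : LipschitzWith K b)
    (hW : LipschitzWith K' W) {U : Set (En n)} (hU : IsOpen U)
    (hsub : ∀ x, ρ₁ ≤ ‖x - y‖ → ‖x - y‖ ≤ ρ₂ → x ∈ U) (hb : ContDiffOn ℝ 2 b U)
    (hcone : ∀ x ∈ U, InCone l L b x)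
    (hne : ∀ x ∈ U, x ≠ y → gradient b x + τ • gradient (radB k ρ₁ ρ₂ y) x ≠ 0)
    (h0 : ∀ x, ‖x - y‖ < ρ₂ → b x ≤ W x) (hin : ∀ x, ‖x - y‖ ≤ ρ₁ → b x + τ ≤ W x)
    (h : 0 ≤ ∫ x, ⟪flux N p s (gradient W x),
      gradient (fun x => max (τ * annB k ρ₁ ρ₂ (x - y) - max (W x - b x) 0) 0) x⟫) :
    ∀ x, ‖x - y‖ < ρ₂ → b x + τ * annB k ρ₁ ρ₂ (x - y) ≤ W x := by
  set φ : En n → ℝ := fun x => max (τ * annB k ρ₁ ρ₂ (x - y) - max (W x - b x) 0) 0 with hφ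
  obtain ⟨C, hC⟩ := lipschitz_annB n hk h1 h2
  have hA : LipschitzWith C fun x => annB k ρ₁ ρ₂ (x - y) := by
    refine LipschitzWith.of_dist_le_mul fun x x' => ?_
    have := hC.dist_le_mul (x - y) (x' - y)
    rwa [dist_sub_right] at this
  have hφL : ∃ C', LipschitzWith C' φ := by
    have h3 : LipschitzWith (‖τ‖₊ * C) fun x => τ * annB k ρ₁ ρ₂ (x - y) := by
      refine LipschitzWith.of_dist_le_mul fun x x' => ?_
      have := hA.dist_le_mul x x'
      rw [Real.dist_eq, ← mul_sub, abs_mul]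
      rw [Real.dist_eq] at this
      push_cast
      rw [Real.norm_eq_abs, mul_assoc]
      gcongr
    exact ⟨_, (h3.sub ((hW.sub hbL).max_const 0)).max_const 0⟩
  obtain ⟨C', hφL⟩ := hφL
  have hpos : ∀ x, 0 < φ x → ρ₁ < ‖x - y‖ ∧ ‖x - y‖ < ρ₂ := by
    intro x hx
    have hx1 : 0 < τ * annB k ρ₁ ρ₂ (x - y) - max (W x - b x) 0 := by
      by_contra hc
      exact hx.ne' (max_eq_right (not_lt.1 hc))
    constructor
    · by_contra hc
      have h3 := hin x (not_lt.1 hc)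
      rw [annB_eq_one hk h1 h2 (not_lt.1 hc)] at hx1
      linarith [le_max_left (W x - b x) 0]
    · by_contra hc
      rw [annB_eq_zero hk h1 h2 (not_lt.1 hc)] at hx1
      linarith [le_max_right (W x - b x) 0]
  have hsupp : tsupport φ ⊆ {x | ρ₁ ≤ ‖x - y‖ ∧ ‖x - y‖ ≤ ρ₂} := by
    refine closure_minimal (fun x hx => ?_) ?_
    · obtain ⟨h3, h4⟩ := hpos x ((le_max_right _ _).lt_of_ne' hx)
      exact ⟨h3.le, h4.le⟩
    · exact (isClosed_le continuous_const (continuous_id.sub continuous_const).norm).inter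
        (isClosed_le (continuous_id.sub continuous_const).norm continuous_const)
  have hcs : HasCompactSupport φ :=
    (isCompact_closedBall y ρ₂).of_isClosed_subset (isClosed_tsupport φ) fun x hx => by
      rw [mem_closedBall, dist_eq_norm]; exact (hsupp hx).2
  have hz : φ y = 0 := by
    by_contra hc
    have := (hpos y ((le_max_right _ _).lt_of_ne' hc)).1
    simp at this
    linarith
  have hU' : IsOpen (U \ {y}) := hU.sdiff isClosed_singleton
  have hcd : ∀ x ∈ U \ {y}, ContDiffAt ℝ 2 b x := fun x hx => hb.contDiffAt (hU.mem_nhds hx.1)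
  have hcr : ∀ x ∈ U \ {y}, ContDiffAt ℝ 2 (fun x => τ * radB k ρ₁ ρ₂ y x) x := fun x hx =>
    contDiffAt_const.mul (contDiffAt_radB hx.2)
  have key := comparison N p s hp hE (b := fun x => b x + τ * radB k ρ₁ ρ₂ y x) hU'
    (fun x hx => ((hcd x hx).add (hcr x hx)).contDiffWithinAt) (fun x hx => by
      rw [gradient_add ((hcd x hx).differentiableAt (by simp))
        ((hcr x hx).differentiableAt (by simp)), gradient_const_mul]
      exact hne x hx.1 hx.2) (fun x hx => (hcone x hx.1).add
        ((inCone_radB hL hk hkl h1 h2 hx.2).const_mul (contDiffAt_radB hx.2) hτ)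
        (hcd x hx) (hcr x hx)) hW hφL hcs (fun x hx => ⟨hsub x (hsupp hx).1 (hsupp hx).2, fun e => by
          have h3 := (hsupp hx).1
          rw [e, sub_self, norm_zero] at h3
          linarith⟩) (fun x => le_max_right _ _) (fun x hx => by
            obtain ⟨h3, h4⟩ := hpos x hx
            have h5 := h0 x h4
            have h6 : annB k ρ₁ ρ₂ (x - y) = max 0 (radB k ρ₁ ρ₂ y x) := by
              rw [annB, max_eq_right h3.le, radB]
            have h7 : 0 ≤ radB k ρ₁ ρ₂ y x := by
              refine le_trans ?_ (cap_lower hk h1 h2 (h1.trans h3) h4.le)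
              have := (cap_denom_pos hk h1 h2).le
              exact div_nonneg (div_nonneg (by linarith) (by linarith)) this
            have h8 : 0 < τ * annB k ρ₁ ρ₂ (x - y) - max (W x - b x) 0 := by
              by_contra hc
              exact hx.ne' (max_eq_right (not_lt.1 hc))
            simp only [hφ]
            rw [max_eq_left h8.le, max_eq_left (by linarith), h6, max_eq_right h7]
            ring) hz h
  intro x hx
  have h3 := key x
  have h4 : τ * annB k ρ₁ ρ₂ (x - y) - max (W x - b x) 0 ≤ 0 :=
    (le_max_left _ _).trans_eq h3
  rw [max_eq_left (by linarith [h0 x hx])] at h4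
  linarith

end Annulus


section Compactness

variable {n : ℕ} {K : ℝ≥0}

theorem lipschitz_compactness {u : ℕ → En n → ℝ} (hu : ∀ k, LipschitzWith K (u k)) {M : ℝ}
    (hM : ∀ k, |u k 0| ≤ M) : ∃ φ : ℕ → ℕ, StrictMono φ ∧ ∃ v : En n → ℝ, LipschitzWith K v ∧
      ∀ x, Tendsto (fun k => u (φ k) x) atTop (𝓝 (v x)) := by
  set d := TopologicalSpace.denseSeq (En n) with hd
  have hb : ∀ k x, |u k x| ≤ M + K * ‖x‖ := fun k x => by
    have h1 := (hu k).dist_le_mul x 0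
    rw [Real.dist_eq, dist_zero_right] at h1
    have h2 := abs_sub_abs_le_abs_sub (u k x) (u k 0)
    linarith [hM k]
  have hcomp : IsCompact (Set.pi univ fun j : ℕ => Icc (-(M + K * ‖d j‖)) (M + K * ‖d j‖)) :=
    isCompact_univ_pi fun j => isCompact_Icc
  obtain ⟨a, -, φ, hφ, ha⟩ := hcomp.tendsto_subseq (x := fun k j => u k (d j))
    fun k j _ => abs_le.1 (hb k (d j))
  rw [tendsto_pi_nhds] at ha
  have hc : ∀ x, ∃ y, Tendsto (fun k => u (φ k) x) atTop (𝓝 y) := fun x => by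
    refine cauchySeq_tendsto_of_complete (Metric.cauchySeq_iff'.2 fun ε hε => ?_)
    obtain ⟨j, hj⟩ := (TopologicalSpace.denseRange_denseSeq (En n)).exists_dist_lt x
      (ε := ε / (4 * (K + 1))) (by positivity)
    have hcs := (ha j).cauchySeq
    rw [Metric.cauchySeq_iff'] at hcs
    obtain ⟨k0, hk0⟩ := hcs (ε / 2) (by positivity)
    refine ⟨k0, fun k hk => ?_⟩
    have h1 : ∀ k, dist (u k x) (u k (d j)) ≤ ε / 4 := fun k => by
      refine ((hu k).dist_le_mul _ _).trans ?_
      calc (K : ℝ) * dist x (d j) ≤ (K + 1) * (ε / (4 * (K + 1))) := by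
            gcongr
            linarith
        _ = ε / 4 := by field_simp
    have h2 := hk0 k hk
    simp only [Function.comp_apply] at h2
    calc dist (u (φ k) x) (u (φ k0) x) ≤ dist (u (φ k) x) (u (φ k) (d j)) +
          dist (u (φ k) (d j)) (u (φ k0) (d j)) + dist (u (φ k0) (d j)) (u (φ k0) x) :=
          dist_triangle4 _ _ _ _
      _ < ε / 4 + ε / 2 + ε / 4 := by
          have h3 := h1 (φ k0)
          rw [dist_comm] at h3
          linarith [h1 (φ k)]
      _ = ε := by ring
  choose v hv using hc
  refine ⟨φ, hφ, v, LipschitzWith.of_dist_le_mul fun x y => ?_, hv⟩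
  exact le_of_tendsto ((hv x).dist (hv y)) (Eventually.of_forall fun k => (hu _).dist_le_mul x y)

theorem integrable_inner_gradient_of_integrable {u : En n → ℝ} (hu : LipschitzWith K u)
    {b : En n → En n} (hb : Integrable b) : Integrable fun x => ⟪b x, gradient u x⟫ := by
  refine (hb.norm.mul_const (K : ℝ)).mono' (hb.aestronglyMeasurable.inner
    (measurable_gradient u).aestronglyMeasurable) (Eventually.of_forall fun x => ?_)
  exact (norm_inner_le_norm _ _).trans (mul_le_mul_of_nonneg_left (norm_gradient_le hu x)
    (norm_nonneg _))

/-- Weak convergence of the gradients of a convergent sequence of Lipschitz functions. -/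
theorem tendsto_integral_inner_gradient {u : ℕ → En n → ℝ} {v : En n → ℝ}
    (hu : ∀ k, LipschitzWith K (u k)) (hv : LipschitzWith K v)
    (h : ∀ x, Tendsto (fun k => u k x) atTop (𝓝 (v x))) {b : En n → En n} (hb : Integrable b) :
    Tendsto (fun k => ∫ x, ⟪b x, gradient (u k) x⟫) atTop (𝓝 (∫ x, ⟪b x, gradient v x⟫)) := by
  have hsm : ∀ g : En n → En n, ContDiff ℝ 1 g → HasCompactSupport g →
      Tendsto (fun k => ∫ x, ⟪g x, gradient (u k) x⟫) atTop (𝓝 (∫ x, ⟪g x, gradient v x⟫)) := by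
    intro g hg hgc
    simp_rw [integral_inner_gradient_of_contDiff hg hgc (hu _)]
    rw [integral_inner_gradient_of_contDiff hg hgc hv]
    refine Tendsto.neg ?_
    have htr : Continuous fun x => tr (fderiv ℝ g x) := by
      have h2 := hg.continuous_fderiv (by simp)
      exact continuous_finsetSum _ fun i _ => (EuclideanSpace.proj (𝕜 := ℝ) i).continuous.comp
          (h2.clm_apply continuous_const)
    have htc : HasCompactSupport fun x => tr (fderiv ℝ g x) :=
      (hgc.fderiv ℝ).comp_left (g := tr) (by simp [tr])
    obtain ⟨M, hM⟩ : ∃ M, ∀ k, |u k 0| ≤ M := by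
      obtain ⟨M, hM⟩ := (h 0).abs.bddAbove_range
      exact ⟨M, fun k => hM ⟨k, rfl⟩⟩
    refine tendsto_integral_of_dominated_convergence
      (fun x => (M + K * ‖x‖) * |tr (fderiv ℝ g x)|)
      (fun k => ((hu k).continuous.mul htr).aestronglyMeasurable) ?_ (fun k => ?_) ?_
    · refine Continuous.integrable_of_hasCompactSupport (by fun_prop) ?_
      exact HasCompactSupport.mul_left (htc.comp_left (g := fun t : ℝ => |t|) (by simp))
    · refine Eventually.of_forall fun x => ?_
      rw [norm_mul, Real.norm_eq_abs, Real.norm_eq_abs]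
      gcongr
      have h1 := (hu k).dist_le_mul x 0
      rw [Real.dist_eq, dist_zero_right] at h1
      have h2 := abs_sub_abs_le_abs_sub (u k x) (u k 0)
      linarith [hM k]
    · exact Eventually.of_forall fun x => (h x).mul_const _
  rw [Metric.tendsto_atTop]
  intro ε hε
  obtain ⟨g, hgc, hg, hge⟩ := (memLp_one_iff_integrable.2 hb).exist_eLpNorm_sub_le (by simp) le_rfl
    (ε := ε / (4 * (K + 1))) (by positivity)
  have hg1 : ContDiff ℝ 1 g := hg.of_le (by norm_cast)
  have hgi : Integrable g := hg.continuous.integrable_of_hasCompactSupport hgc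
  have hdiff : ∀ w : En n → ℝ, LipschitzWith K w →
      |(∫ x, ⟪b x, gradient w x⟫) - ∫ x, ⟪g x, gradient w x⟫| ≤ ε / 4 := by
    intro w hw
    rw [← integral_sub (integrable_inner_gradient_of_integrable hw hb)
      (integrable_inner_gradient_of_integrable hw hgi)]
    have h1 : ∫ x, ‖(b - g) x‖ ≤ ε / (4 * (K + 1)) := by
      rw [eLpNorm_one_eq_lintegral_enorm] at hge
      rw [integral_norm_eq_lintegral_enorm (hb.sub hgi).aestronglyMeasurable]
      exact ENNReal.toReal_le_of_le_ofReal (by positivity) hge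
    rw [← Real.norm_eq_abs]
    calc ‖∫ x, ⟪b x, gradient w x⟫ - ⟪g x, gradient w x⟫‖ ≤ ∫ x, ‖(b - g) x‖ * K := by
          refine norm_integral_le_of_norm_le ((hb.sub hgi).norm.mul_const _)
            (Eventually.of_forall fun x => ?_)
          rw [← inner_sub_left]
          exact (norm_inner_le_norm _ _).trans (mul_le_mul_of_nonneg_left (norm_gradient_le hw x)
            (norm_nonneg _))
      _ = (∫ x, ‖(b - g) x‖) * K := integral_mul_const _ _
      _ ≤ ε / (4 * (K + 1)) * (K + 1) := by gcongr; linarith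
      _ = ε / 4 := by field_simp
  obtain ⟨k0, hk0⟩ := Metric.tendsto_atTop.1 (hsm g hg1 hgc) (ε / 2) (by positivity)
  refine ⟨k0, fun k hk => ?_⟩
  have h1 := hdiff (u k) (hu k)
  have h2 := hdiff v hv
  have h3 := hk0 k hk
  rw [Real.dist_eq] at h3 ⊢
  rw [abs_lt] at h3 ⊢
  rw [abs_le] at h1 h2
  constructor <;> linarith [h1.1, h1.2, h2.1, h2.2, h3.1, h3.2]

end Compactness


section Admissible

variable {n : ℕ} (N : MinkowskiNorm n) {p s : ℝ} {P Q : Set (En n)} {L : ℝ≥0} {u w : En n → ℝ}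

theorem exists_flux_bound (s : ℝ) (hp : 1 < p) (M : ℝ) :
    ∃ C : ℝ, 0 ≤ C ∧ ∀ ξ : En n, ‖ξ‖ ≤ M → ‖flux N p s ξ‖ ≤ C := by
  obtain ⟨C, hC⟩ := (isCompact_closedBall (0 : En n) M).exists_bound_of_continuousOn
    (continuous_flux N p s hp).continuousOn
  exact ⟨max C 0, le_max_right _ _, fun ξ hξ =>
    (hC ξ (mem_closedBall_zero_iff.2 hξ)).trans (le_max_left _ _)⟩

theorem measurable_flux_gradient (s : ℝ) (hp : 1 < p) (u : En n → ℝ) :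
    Measurable fun x => flux N p s (gradient u x) :=
  (continuous_flux N p s hp).measurable.comp (measurable_gradient u)

theorem integrable_flux_gradient (s : ℝ) (hp : 1 < p) {K K' : ℝ≥0} (hu : LipschitzWith K u)
    {φ : En n → ℝ} (hφ : LipschitzWith K' φ) (hc : HasCompactSupport φ) :
    Integrable fun x => ⟪flux N p s (gradient u x), gradient φ x⟫ := by
  obtain ⟨C, -, hC⟩ := exists_flux_bound N s hp K
  exact integrable_inner_gradient hφ hc (measurable_flux_gradient N s hp u)
    fun x => hC _ (norm_gradient_le hu x)

/-- Admissible competitors for the condenser `(P, Q)`. -/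
structure Adm (P Q : Set (En n)) (L : ℝ≥0) (u : En n → ℝ) : Prop where
  lip : LipschitzWith L u
  one : ∀ x ∈ P, u x = 1
  zero : ∀ x ∈ Q, u x = 0

theorem Adm.sub_eq_zero (hu : Adm P Q L u) (hw : Adm P Q L w) {x : En n} (hx : x ∈ P ∪ Q) :
    w x - u x = 0 := by
  rcases hx with hx | hx
  · rw [hu.one x hx, hw.one x hx, sub_self]
  · rw [hu.zero x hx, hw.zero x hx, sub_self]

theorem Adm.swap (hu : Adm P Q L u) : Adm Q P L fun x => 1 - u x where
  lip := by simpa using (LipschitzWith.const (1 : ℝ)).sub hu.lip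
  one x hx := by rw [hu.zero x hx, sub_zero]
  zero x hx := by rw [hu.one x hx, sub_self]

theorem Adm.convex (hu : Adm P Q L u) (hw : Adm P Q L w) {t : ℝ} (h0 : 0 ≤ t) (h1 : t ≤ 1) :
    Adm P Q L fun x => u x + t * (w x - u x) where
  lip := LipschitzWith.of_dist_le_mul fun x y => by
    have h2 := hu.lip.dist_le_mul x y
    have h3 := hw.lip.dist_le_mul x y
    rw [Real.dist_eq] at h2 h3 ⊢
    have e : u x + t * (w x - u x) - (u y + t * (w y - u y)) =
        (1 - t) * (u x - u y) + t * (w x - w y) := by ring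
    rw [e]
    refine (abs_add_le _ _).trans ?_
    rw [abs_mul, abs_mul, abs_of_nonneg h0, abs_of_nonneg (sub_nonneg.2 h1)]
    calc _ ≤ (1 - t) * (L * dist x y) + t * (L * dist x y) := by gcongr
      _ = _ := by ring
  one x hx := by rw [hu.sub_eq_zero hw (Or.inl hx), mul_zero, add_zero, hu.one x hx]
  zero x hx := by rw [hu.sub_eq_zero hw (Or.inr hx), mul_zero, add_zero, hu.zero x hx]

variable {R : ℝ}

theorem setIntegral_energy_integrable (s : ℝ) (hp : 1 < p) {K : ℝ≥0} (hu : LipschitzWith K u) :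
    IntegrableOn (fun x => energy N p s (gradient u x)) (ball 0 R) := by
  obtain ⟨C, hC⟩ := (isCompact_closedBall (0 : En n) K).exists_bound_of_continuousOn
    (continuous_energy N p s hp).continuousOn
  refine Measure.integrableOn_of_bounded (M := C) measure_ball_lt_top.ne
    ((continuous_energy N p s hp).measurable.comp (measurable_gradient u)).aestronglyMeasurable
    (Eventually.of_forall fun x => hC _ (mem_closedBall_zero_iff.2 (norm_gradient_le hu x)))

theorem setIntegral_energy_ge (s : ℝ) (hp : 1 < p) {K K' : ℝ≥0} (hu : LipschitzWith K u)
    (hw : LipschitzWith K' w) :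
    (∫ x in ball 0 R, energy N p s (gradient u x)) +
      ((∫ x, ⟪(ball 0 R).indicator (fun x => flux N p s (gradient u x)) x, gradient w x⟫) -
        ∫ x, ⟪(ball 0 R).indicator (fun x => flux N p s (gradient u x)) x, gradient u x⟫) ≤
      ∫ x in ball 0 R, energy N p s (gradient w x) := by
  obtain ⟨C, -, hC⟩ := exists_flux_bound N s hp K
  have hb : Integrable ((ball (0 : En n) R).indicator fun x => flux N p s (gradient u x)) := by
    rw [integrable_indicator_iff measurableSet_ball]
    exact Measure.integrableOn_of_bounded (M := C) measure_ball_lt_top.ne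
      (measurable_flux_gradient N s hp u).aestronglyMeasurable
      (Eventually.of_forall fun x => hC _ (norm_gradient_le hu x))
  have h1 := integrable_inner_gradient_of_integrable hu hb
  have h2 := integrable_inner_gradient_of_integrable hw hb
  have h3 := (setIntegral_energy_integrable N (R := R) s hp hu).integrable_indicator
    measurableSet_ball
  rw [← integral_sub h2 h1, ← integral_indicator measurableSet_ball,
    ← integral_indicator measurableSet_ball]
  refine (integral_add h3 (h2.sub h1)).symm.le.trans ?_
  refine integral_mono (h3.add (h2.sub h1))
    ((setIntegral_energy_integrable N s hp hw).integrable_indicator measurableSet_ball) fun x => ?_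
  simp only [Pi.sub_apply, ← inner_sub_right]
  by_cases hx : x ∈ ball (0 : En n) R
  · simp only [indicator_of_mem hx]
    exact energy_ge N p s hp _ _
  · simp only [indicator_of_notMem hx, inner_zero_left, add_zero, le_refl]

theorem exists_minimizer (s : ℝ) (hp : 1 < p) (hPQ : (P ∪ Q).Nonempty) (hex : ∃ w, Adm P Q L w) :
    ∃ u, Adm P Q L u ∧ ∀ w, Adm P Q L w →
      ∫ x in ball 0 R, energy N p s (gradient u x) ≤
        ∫ x in ball 0 R, energy N p s (gradient w x) := by
  set J : (En n → ℝ) → ℝ := fun u => ∫ x in ball 0 R, energy N p s (gradient u x) with hJ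
  have hJ0 : ∀ u, 0 ≤ J u := fun u => integral_nonneg fun x => energy_nonneg N p s hp _
  set S := J '' {w | Adm P Q L w} with hS
  have hSne : S.Nonempty := let ⟨w, hw⟩ := hex; ⟨_, w, hw, rfl⟩
  have hSb : BddBelow S := ⟨0, by rintro _ ⟨w, -, rfl⟩; exact hJ0 w⟩
  obtain ⟨a, -, ha, haS⟩ := exists_seq_tendsto_sInf hSne hSb
  choose u hu hua using haS
  obtain ⟨z, hz⟩ := hPQ
  obtain ⟨φ, hφ, v, hv, hφv⟩ := lipschitz_compactness (u := u) (fun k => (hu k).lip)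
    (M := 1 + L * ‖z‖) fun k => by
      have h1 := (hu k).lip.dist_le_mul 0 z
      rw [Real.dist_eq, dist_zero_left] at h1
      have h2 : |u k z| ≤ 1 := by
        rcases hz with hz | hz
        · simp [(hu k).one z hz]
        · simp [(hu k).zero z hz]
      linarith [abs_sub_abs_le_abs_sub (u k 0) (u k z)]
  have hvA : Adm P Q L v := ⟨hv, fun x hx => tendsto_nhds_unique (hφv x) (by
    simp_rw [(hu _).one x hx]; exact tendsto_const_nhds), fun x hx => tendsto_nhds_unique (hφv x) (by
    simp_rw [(hu _).zero x hx]; exact tendsto_const_nhds)⟩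
  refine ⟨v, hvA, fun w hw => ?_⟩
  have hle : J v ≤ sInf S := by
    have ha' : Tendsto (fun k => J (u (φ k))) atTop (𝓝 (sInf S)) := by
      simp_rw [hua]
      exact ha.comp hφ.tendsto_atTop
    obtain ⟨C, -, hC⟩ := exists_flux_bound N s hp L
    have hb : Integrable ((ball (0 : En n) R).indicator fun x => flux N p s (gradient v x)) := by
      rw [integrable_indicator_iff measurableSet_ball]
      exact Measure.integrableOn_of_bounded (M := C) measure_ball_lt_top.ne
        (measurable_flux_gradient N s hp v).aestronglyMeasurable
        (Eventually.of_forall fun x => hC _ (norm_gradient_le hv x))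
    have h1 := ((tendsto_integral_inner_gradient (fun k => (hu (φ k)).lip) hv hφv hb).sub_const
      (∫ x, ⟪(ball 0 R).indicator (fun x => flux N p s (gradient v x)) x, gradient v x⟫)).const_add
      (J v)
    rw [sub_self, add_zero] at h1
    exact le_of_tendsto_of_tendsto' h1 ha' fun k =>
      setIntegral_energy_ge N s hp hv (hu (φ k)).lip
  exact hle.trans (csInf_le hSb ⟨w, hw, rfl⟩)

/-- The variational inequality satisfied by a minimizer of the energy among admissible
functions. -/
structure HilbertHaar (p s : ℝ) (P Q : Set (En n)) (L : ℝ≥0) (u : En n → ℝ) : Prop where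
  adm : Adm P Q L u
  ineq : ∀ w, Adm P Q L w →
    0 ≤ ∫ x, ⟪flux N p s (gradient u x), gradient (fun x => w x - u x) x⟫

theorem gradient_ae_zero_of_eq_zero {K : ℝ≥0} {φ : En n → ℝ} (hφ : LipschitzWith K φ) :
    ∀ᵐ x, φ x = 0 → gradient φ x = 0 := by
  filter_upwards [ae_gradient_posPart hφ] with x hx using hx.2

theorem exists_hilbertHaar (s : ℝ) (hp : 1 < p) (hR : ∀ x, R ≤ ‖x‖ → x ∈ P ∪ Q)
    (hPQ : (P ∪ Q).Nonempty) (hex : ∃ w, Adm P Q L w) : ∃ u, HilbertHaar N p s P Q L u := by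
  obtain ⟨u, hu, hmin⟩ := exists_minimizer N (R := R) s hp hPQ hex
  refine ⟨u, hu, fun w hw => ?_⟩
  have hφL := hw.lip.sub hu.lip
  have hφc : HasCompactSupport fun x => w x - u x :=
    hasCompactSupport_of_zero fun x hx => hu.sub_eq_zero hw (hR x hx)
  obtain ⟨C, hC0, hC⟩ := exists_flux_bound N s hp L
  set t : ℕ → ℝ := fun k => 1 / (k + 1) with ht
  have ht0 : ∀ k, 0 < t k := fun k => by positivity
  have ht1 : ∀ k, t k ≤ 1 := fun k => by
    rw [ht]; simp only; rw [div_le_one (by positivity)]; linarith [(Nat.cast_nonneg k : (0:ℝ) ≤ k)]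
  set ut : ℕ → En n → ℝ := fun k x => u x + t k * (w x - u x) with hut
  have hA : ∀ k, Adm P Q L (ut k) := fun k => hu.convex hw (ht0 k).le (ht1 k)
  have hgr : ∀ᵐ x, ∀ k, gradient (ut k) x = gradient u x + t k • gradient (fun x => w x - u x) x := by
    filter_upwards [differentiableAt_ae hu.lip, differentiableAt_ae hφL] with x h1 h2 k
    rw [hut]; simp only
    rw [gradient_add h1 (h2.const_mul _), gradient_const_mul]
  have hlim : Tendsto (fun k => ∫ x, ⟪flux N p s (gradient (ut k) x), gradient (fun x => w x - u x) x⟫)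
      atTop (𝓝 (∫ x, ⟪flux N p s (gradient u x), gradient (fun x => w x - u x) x⟫)) := by
    refine tendsto_integral_of_dominated_convergence (fun x => C * ‖gradient (fun x => w x - u x) x‖)
      (fun k => ((measurable_flux_gradient N s hp _).inner
        (measurable_gradient _)).aestronglyMeasurable)
      ((integrable_norm_gradient hφL hφc).const_mul C) (fun k => Eventually.of_forall fun x => ?_) ?_
    · exact (norm_inner_le_norm _ _).trans (mul_le_mul_of_nonneg_right
        (hC _ (norm_gradient_le (hA k).lip x)) (norm_nonneg _))
    · filter_upwards [hgr] with x hx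
      simp_rw [hx]
      refine Tendsto.inner ?_ tendsto_const_nhds
      refine ((continuous_flux N p s hp).tendsto _).comp ?_
      simpa [ht] using (tendsto_const_nhds (x := gradient u x)).add
        ((tendsto_one_div_add_atTop_nhds_zero_nat (𝕜 := ℝ)).smul_const (gradient (fun x => w x - u x) x))
  refine ge_of_tendsto hlim (Eventually.of_forall fun k => ?_)
  have h1 := setIntegral_energy_ge N (R := R) s hp (hA k).lip hu.lip
  have h2 := hmin _ (hA k)
  obtain ⟨C, -, hC⟩ := exists_flux_bound N s hp L
  have hb : Integrable ((ball (0 : En n) R).indicator fun x => flux N p s (gradient (ut k) x)) := by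
    rw [integrable_indicator_iff measurableSet_ball]
    exact Measure.integrableOn_of_bounded (M := C) measure_ball_lt_top.ne
      (measurable_flux_gradient N s hp _).aestronglyMeasurable
      (Eventually.of_forall fun x => hC _ (norm_gradient_le (hA k).lip x))
  rw [← integral_sub (integrable_inner_gradient_of_integrable hu.lip hb)
    (integrable_inner_gradient_of_integrable (hA k).lip hb)] at h1
  have h3 : ∫ x, (⟪(ball 0 R).indicator (fun x => flux N p s (gradient (ut k) x)) x, gradient u x⟫ -
      ⟪(ball 0 R).indicator (fun x => flux N p s (gradient (ut k) x)) x, gradient (ut k) x⟫) =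
      ∫ x, -t k * ⟪flux N p s (gradient (ut k) x), gradient (fun x => w x - u x) x⟫ := by
    refine integral_congr_ae ?_
    filter_upwards [hgr, gradient_ae_zero_of_eq_zero hφL] with x hx hx0
    rw [hx k, ← inner_sub_right]
    by_cases hxB : x ∈ ball (0 : En n) R
    · rw [indicator_of_mem hxB, hx k]
      simp [inner_smul_right]
    · rw [indicator_of_notMem hxB, hx0 (hu.sub_eq_zero hw (hR x (by simpa using hxB)))]
      simp
  rw [h3, integral_const_mul] at h1
  nlinarith [ht0 k]

end Admissible


section HilbertHaar

variable {n : ℕ} (N : MinkowskiNorm n) {p s : ℝ} {P Q : Set (En n)} {L : ℝ≥0} {u w : En n → ℝ}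
  {R : ℝ}

theorem posPart_eq_zero (s : ℝ) (hp : 1 < p) {K K' : ℝ≥0} {f g : En n → ℝ} (hf : LipschitzWith K f)
    (hg : LipschitzWith K' g) {c : ℝ} {φ : En n → ℝ} (hφ : ∀ x, φ x = max (f x - g x - c) 0)
    (hc : HasCompactSupport φ) {z : En n} (hz : φ z = 0)
    (h1 : 0 ≤ ∫ x, ⟪flux N p s (gradient g x), gradient φ x⟫)
    (h2 : ∫ x, ⟪flux N p s (gradient f x), gradient φ x⟫ ≤ 0) (x : En n) : φ x = 0 := by
  obtain rfl : φ = fun x => max (f x - g x - c) 0 := funext hφ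
  have hφL : LipschitzWith (K + K') fun x => max (f x - g x - c) 0 :=
    (by simpa using (hf.sub hg).sub (LipschitzWith.const c) :
      LipschitzWith (K + K') fun x => f x - g x - c).max_const 0
  refine eq_zero_of_gradient_eq_zero hφL ?_ hz x
  have hi1 := integrable_flux_gradient N s hp hg hφL hc
  have hi2 := integrable_flux_gradient N s hp hf hφL hc
  have hgr : ∀ᵐ x, gradient (fun x => max (f x - g x - c) 0) x =
      if c < f x - g x then gradient f x - gradient g x else 0 := by
    filter_upwards [ae_gradient_max_const (hf.sub hg) c, differentiableAt_ae hf,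
      differentiableAt_ae hg] with x hx hf hg
    rw [hx, gradient_sub hf hg]
  set q : En n → ℝ := fun x => ⟪flux N p s (gradient f x), gradient (fun x => max (f x - g x - c) 0) x⟫
    - ⟪flux N p s (gradient g x), gradient (fun x => max (f x - g x - c) 0) x⟫ with hq
  have hq0 : ∀ᵐ x, 0 ≤ q x := by
    filter_upwards [hgr] with x hx
    rw [hq]
    simp only
    rw [hx, ← inner_sub_left]
    split_ifs
    · exact flux_mono N p s hp _ _
    · simp
  have hqi : ∫ x, q x = 0 := by
    refine le_antisymm ?_ (integral_nonneg_of_ae hq0)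
    rw [hq, integral_sub hi2 hi1]
    linarith
  rw [integral_eq_zero_iff_of_nonneg_ae hq0 (hi2.sub hi1)] at hqi
  filter_upwards [hgr, hqi] with x hx hq'
  rw [hx]
  split_ifs with h
  · by_contra hne
    have h3 := flux_strictMono N p s hp (sub_ne_zero.1 hne)
    simp only [hq, Pi.zero_apply] at hq'
    rw [hx, if_pos h, ← inner_sub_left] at hq'
    exact h3.ne' hq'
  · rfl

variable {N}

theorem HilbertHaar.hasCompactSupport (hu : HilbertHaar N p s P Q L u)
    (hR : ∀ x, R ≤ ‖x‖ → x ∈ P ∪ Q) {w : En n → ℝ} (hw : Adm P Q L w) :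
    HasCompactSupport fun x => w x - u x :=
  hasCompactSupport_of_zero fun x hx => hu.adm.sub_eq_zero hw (hR x hx)

theorem HilbertHaar.swap (hu : HilbertHaar N p s P Q L u) :
    HilbertHaar N p s Q P L fun x => 1 - u x where
  adm := hu.adm.swap
  ineq w hw := by
    refine (hu.ineq _ hw.swap).trans_eq (integral_congr_ae (Eventually.of_forall fun x => ?_))
    have e : (fun x => w x - (1 - u x)) = fun x => -(1 - w x - u x) := by ext; ring
    simp only
    rw [e, gradient_neg, gradient_const_sub, flux_neg, inner_neg_neg]

theorem HilbertHaar.nonneg (hp : 1 < p) (hR : ∀ x, R ≤ ‖x‖ → x ∈ P ∪ Q) (hPQ : (P ∪ Q).Nonempty)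
    (hu : HilbertHaar N p s P Q L u) (x : En n) : 0 ≤ u x := by
  have hw : Adm P Q L fun x => max (u x) 0 := ⟨hu.adm.lip.max_const 0, fun x hx => by
    simp [hu.adm.one x hx], fun x hx => by simp [hu.adm.zero x hx]⟩
  have e : ∀ x, max (u x) 0 - u x = max ((fun _ => (0 : ℝ)) x - u x - 0) 0 := fun x => by
    rcases le_total (u x) 0 with h | h
    · rw [max_eq_right h, max_eq_left (by simpa using h), sub_zero]
    · rw [max_eq_left h, max_eq_right (by simpa using h), sub_self]
  obtain ⟨z, hz⟩ := hPQ
  have := posPart_eq_zero N s hp (LipschitzWith.const (0 : ℝ)) hu.adm.lip e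
    (hu.hasCompactSupport hR hw) (hu.adm.sub_eq_zero hw hz) (hu.ineq _ hw) (by
      have h0 : ∀ x : En n, gradient (fun _ : En n => (0 : ℝ)) x = 0 := fun x => by
        simp [gradient]
      simp [h0, flux_zero]) x
  linarith [le_max_right (u x) 0]

theorem exists_frontier_norm_sub_le {P : Set (En n)} {x x₀ : En n} (h0 : x₀ ∈ P) (hx : x ∉ P) :
    ∃ y ∈ frontier P, ‖x - y‖ ≤ ‖x - x₀‖ := by
  by_contra! hc
  have hsub : closedBall x ‖x - x₀‖ ⊆ interior P ∪ (closure P)ᶜ := fun y hy => by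
    by_contra hy'
    rw [mem_union, not_or, mem_compl_iff, not_not] at hy'
    refine absurd (hc y ⟨hy'.2, hy'.1⟩) (not_lt.2 ?_)
    rwa [mem_closedBall, dist_comm, dist_eq_norm] at hy
  have hx0 : x₀ ∈ closedBall x ‖x - x₀‖ := by rw [mem_closedBall, dist_comm, dist_eq_norm]
  have hxx : x ∈ closedBall x ‖x - x₀‖ := mem_closedBall_self (norm_nonneg _)
  rcases (convex_closedBall x ‖x - x₀‖).isPreconnected.subset_or_subset isOpen_interior
    isClosed_closure.isOpen_compl (disjoint_compl_right.mono_left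
      (interior_subset.trans subset_closure)) hsub with h | h
  · exact hx (interior_subset (h hxx))
  · exact h hx0 (subset_closure h0)

theorem HilbertHaar.barrier (hp : 1 < p) {l Λ : ℝ} {k : ℕ}
    (hE : ∀ ξ : En n, ξ ≠ 0 → Ell l Λ (fluxMat N p s ξ))
    (hΛ : 0 ≤ Λ) (hk : 1 ≤ k) (hkl : n * Λ ≤ 2 * (k + 1) * l) {ρ₁ ρ₂ : ℝ} (h1 : 0 < ρ₁)
    (h2 : ρ₁ < ρ₂) {C : ℝ≥0} (hC : LipschitzWith C (annB (n := n) k ρ₁ ρ₂)) (hCL : C ≤ L)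
    (hR : ∀ x, R ≤ ‖x‖ → x ∈ P ∪ Q) (hPQ : (P ∪ Q).Nonempty)
    (hball : ∀ x ∈ frontier P, ∃ y, ‖x - y‖ ≤ ρ₁ ∧ closedBall y ρ₁ ⊆ P ∧ ∀ z ∈ Q, ρ₂ ≤ ‖z - y‖)
    (hu : HilbertHaar N p s P Q L u) {x x₀ : En n} (hx₀ : x₀ ∈ P) : 1 - u x ≤ C * ‖x - x₀‖ := by
  by_cases hx : x ∈ P
  · rw [hu.adm.one x hx, sub_self]; positivity
  obtain ⟨x₁, hx₁, hle⟩ := exists_frontier_norm_sub_le hx₀ hx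
  refine le_trans ?_ (mul_le_mul_of_nonneg_left hle C.2)
  obtain ⟨y, hy, hyP, hyQ⟩ := hball x₁ hx₁
  have hA : LipschitzWith L fun x => annB k ρ₁ ρ₂ (x - y) := by
    refine LipschitzWith.of_dist_le_mul fun x x' => ?_
    have := (hC.weaken hCL).dist_le_mul (x - y) (x' - y)
    rwa [dist_sub_right] at this
  have hw : Adm P Q L fun x => max (u x) (annB k ρ₁ ρ₂ (x - y)) := by
    refine ⟨by simpa using hu.adm.lip.max hA, fun x hx => ?_, fun x hx => ?_⟩
    · rw [hu.adm.one x hx, max_eq_left (annB_le_one hk h1 h2 _)]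
    · rw [hu.adm.zero x hx, annB_eq_zero hk h1 h2 (hyQ x hx), max_self]
  have hu0 := hu.nonneg hp hR hPQ
  have h0 : ∀ x : En n, gradient (fun _ : En n => (0 : ℝ)) x = 0 := fun x => by simp [gradient]
  have hlow : annB k ρ₁ ρ₂ (x - y) ≤ u x := by
    by_cases hxy : ‖x - y‖ < ρ₂
    · have := annulus_lower N p s hp hE hΛ hk hkl h1 h2 (y := y) (τ := 1) zero_le_one
        (b := fun _ => 0) (LipschitzWith.const (0 : ℝ)) hu.adm.lip isOpen_univ (fun x _ _ => mem_univ x)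
        contDiffOn_const (fun x _ => inCone_zero l Λ x) (fun x _ hxy => by
          rw [h0, zero_add, one_smul, gradient_radB hxy]
          refine smul_ne_zero ?_ (sub_ne_zero.2 hxy)
          have := cap_denom_pos hk h1 h2
          have := norm_pos_iff.2 (sub_ne_zero.2 hxy)
          have : 0 < ρ₂ := h1.trans h2
          have : (0 : ℝ) < k := by exact_mod_cast hk
          exact neg_ne_zero.2 (by positivity)) (fun x _ => hu0 x) (fun x hx => by
            rw [zero_add, hu.adm.one x (hyP (by rwa [mem_closedBall, dist_eq_norm]))]) (by
            refine (hu.ineq _ hw).trans_eq ?_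
            congr! 5 with x z
            rw [one_mul, sub_zero, max_eq_left (hu0 z), ← max_sub_sub_right, sub_self, max_comm]) x hxy
      simpa using this
    · rw [annB_eq_zero hk h1 h2 (not_lt.1 hxy)]
      exact hu0 x
  have h3 := hC.dist_le_mul (x₁ - y) (x - y)
  rw [Real.dist_eq, dist_sub_right, annB_eq_one hk h1 h2 hy, dist_comm, dist_eq_norm] at h3
  linarith [le_abs_self (1 - annB k ρ₁ ρ₂ (x - y))]

theorem HilbertHaar.sub_le (hp : 1 < p) {C : ℝ≥0} (hPQ : (P ∪ Q).Nonempty)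
    (hR : ∀ x, R ≤ ‖x‖ → x ∈ P ∪ Q)
    (hu : HilbertHaar N p s P Q L u) (hP : ∀ x, ∀ y ∈ P, 1 - u x ≤ C * ‖x - y‖)
    (hQ : ∀ x, ∀ y ∈ Q, u x ≤ C * ‖x - y‖) (h0 : ∀ x, 0 ≤ u x) (h1 : ∀ x, u x ≤ 1) (x h : En n) :
    u (x + h) - u x ≤ C * ‖h‖ := by
  set c : ℝ := C * ‖h‖ with hc
  have hc0 : 0 ≤ c := by positivity
  have hul : LipschitzWith L fun x => u (x + h) := LipschitzWith.of_dist_le_mul fun x y => by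
    simpa using hu.adm.lip.dist_le_mul (x + h) (y + h)
  have hul' : LipschitzWith L fun x => u (x - h) := LipschitzWith.of_dist_le_mul fun x y => by
    simpa using hu.adm.lip.dist_le_mul (x - h) (y - h)
  set φ : En n → ℝ := fun x => max (u (x + h) - u x - c) 0 with hφ
  have hw1 : Adm P Q L fun x => max (u x) (u (x + h) - c) := by
    refine ⟨?_, fun x hx => ?_, fun x hx => ?_⟩
    · simpa using hu.adm.lip.max (by simpa using hul.sub (LipschitzWith.const c) :
        LipschitzWith L fun x => u (x + h) - c)
    · rw [hu.adm.one x hx, max_eq_left]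
      linarith [h1 (x + h)]
    · have := hQ (x + h) x hx
      rw [add_sub_cancel_left] at this
      rw [hu.adm.zero x hx, max_eq_left (by linarith)]
  have hw2 : Adm P Q L fun x => min (u x) (u (x - h) + c) := by
    refine ⟨?_, fun x hx => ?_, fun x hx => ?_⟩
    · simpa using hu.adm.lip.min (by simpa using hul'.add (LipschitzWith.const c) :
        LipschitzWith L fun x => u (x - h) + c)
    · have := hP (x - h) x hx
      rw [sub_sub_cancel_left, norm_neg] at this
      rw [hu.adm.one x hx, min_eq_left (by linarith)]
    · rw [hu.adm.zero x hx, min_eq_left]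
      linarith [h0 (x - h)]
  have e1 : φ = fun x => max (u x) (u (x + h) - c) - u x := by
    ext x
    simp only [hφ]
    rw [← max_sub_sub_right, sub_self, max_comm]
    congr 1
    ring
  have e2 : (fun x => min (u x) (u (x - h) + c) - u x) = fun x => -φ (x - h) := by
    ext x
    simp only [hφ]
    rw [sub_add_cancel, ← min_sub_sub_right, sub_self, ← min_neg_neg, neg_zero, min_comm]
    congr 1
    ring
  obtain ⟨z, hz⟩ := hPQ
  have h3 := posPart_eq_zero N s hp hul hu.adm.lip (φ := φ) (fun x => rfl)
    (e1 ▸ hu.hasCompactSupport hR hw1) (by rw [e1]; exact hu.adm.sub_eq_zero hw1 hz)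
    (by rw [e1]; exact hu.ineq _ hw1) (by
      have h4 := hu.ineq _ hw2
      rw [e2] at h4
      have e3 : ∀ x, gradient (fun x => -φ (x - h)) x = -gradient φ (x - h) := fun x => by
        rw [gradient_neg]
        simp_rw [sub_eq_add_neg]
        rw [gradient_comp_add_right]
      simp_rw [e3, inner_neg_right] at h4
      rw [integral_neg, ← integral_add_right_eq_self _ h] at h4
      simp_rw [add_sub_cancel_right, ← gradient_comp_add_right u h] at h4
      linarith) x
  linarith [le_max_left (u (x + h) - u x - c) 0]

variable (N)

/-- Solvability of the Dirichlet problem for the regularized equation in a condenser satisfying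
uniform exterior ball conditions, with a Lipschitz bound independent of the regularization. -/
theorem exists_lipschitz_solution (hp : 1 < p) {ρ₁ ρ₂ : ℝ} (h1 : 0 < ρ₁) (h2 : ρ₁ < ρ₂) :
    ∃ C : ℝ≥0, ∀ (s : ℝ) (P Q : Set (En n)) (R : ℝ), (∀ x, R ≤ ‖x‖ → x ∈ P ∪ Q) → P.Nonempty →
      (∀ x ∈ P, ∀ y ∈ Q, ρ₂ - ρ₁ ≤ ‖x - y‖) →
      (∀ x ∈ frontier P, ∃ y, ‖x - y‖ ≤ ρ₁ ∧ closedBall y ρ₁ ⊆ P ∧ ∀ z ∈ Q, ρ₂ ≤ ‖z - y‖) →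
      (∀ x ∈ frontier Q, ∃ y, ‖x - y‖ ≤ ρ₁ ∧ closedBall y ρ₁ ⊆ Q ∧ ∀ z ∈ P, ρ₂ ≤ ‖z - y‖) →
      ∃ u, Adm P Q C u ∧ (∀ x, 0 ≤ u x) ∧ (∀ x, u x ≤ 1) ∧
        ∀ (K : ℝ≥0) (φ : En n → ℝ), LipschitzWith K φ → (∀ x ∈ P ∪ Q, φ x = 0) →
          ∫ x, ⟪flux N p s (gradient u x), gradient φ x⟫ = 0 := by
  obtain ⟨l, Λ, hl, hlΛ, hE⟩ := fluxMat_bounds N p hp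
  obtain ⟨k, hk, hkl⟩ : ∃ k : ℕ, 1 ≤ k ∧ n * Λ ≤ 2 * (k + 1) * l := by
    obtain ⟨k, hk⟩ := exists_nat_ge (n * Λ / l)
    refine ⟨k + 1, by omega, ?_⟩
    rw [div_le_iff₀ hl] at hk
    push_cast
    have : (0 : ℝ) ≤ k := Nat.cast_nonneg k
    nlinarith
  obtain ⟨C₀, hC₀⟩ := lipschitz_annB n hk h1 h2
  set C : ℝ≥0 := C₀ + Real.toNNReal (1 / (ρ₂ - ρ₁)) with hC
  have hCC : C₀ ≤ C + 1 := by rw [hC, add_assoc]; exact le_self_add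
  have hC₀C : C₀ ≤ C := le_self_add
  refine ⟨C, fun s P Q R hR hP hPQ hbP hbQ => ?_⟩
  have hne : (P ∪ Q).Nonempty := hP.inl
  have hex : ∃ w, Adm P Q (C + 1) w := by
    have hCr : ((Real.toNNReal (1 / (ρ₂ - ρ₁)) : ℝ≥0) : ℝ) = 1 / (ρ₂ - ρ₁) :=
      Real.coe_toNNReal _ (by have := sub_pos.2 h2; positivity)
    refine ⟨fun x => max (1 - 1 / (ρ₂ - ρ₁) * infDist x P) 0, ?_, fun x hx => ?_, fun x hx => ?_⟩
    · refine LipschitzWith.max_const (LipschitzWith.of_dist_le_mul fun x y => ?_) 0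
      have h3 := (lipschitz_infDist_pt P).dist_le_mul x y
      rw [Real.dist_eq] at h3 ⊢
      have e : 1 - 1 / (ρ₂ - ρ₁) * infDist x P - (1 - 1 / (ρ₂ - ρ₁) * infDist y P) =
        -(1 / (ρ₂ - ρ₁) * (infDist x P - infDist y P)) := by ring
      rw [e, abs_neg, abs_mul, ← hCr, abs_of_nonneg (NNReal.coe_nonneg _)]
      rw [NNReal.coe_one, one_mul] at h3
      calc _ ≤ ((Real.toNNReal (1 / (ρ₂ - ρ₁)) : ℝ≥0) : ℝ) * dist x y := by gcongr
        _ ≤ _ := by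
          gcongr
          rw [hC, add_right_comm]
          exact le_add_self
    · simp [infDist_zero_of_mem hx]
    · have h3 : ρ₂ - ρ₁ ≤ infDist x P := (le_infDist hP).2 fun y hy => by
        rw [dist_comm, dist_eq_norm]
        exact hPQ y hy x hx
      rw [max_eq_right]
      have := mul_le_mul_of_nonneg_left h3 (by have := sub_pos.2 h2; positivity :
        0 ≤ 1 / (ρ₂ - ρ₁))
      rw [one_div_mul_cancel (sub_pos.2 h2).ne'] at this
      linarith
  obtain ⟨u, hu⟩ := exists_hilbertHaar N s hp hR hne hex
  have hsw := hu.swap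
  have hR' : ∀ x, R ≤ ‖x‖ → x ∈ Q ∪ P := fun x hx => (hR x hx).symm
  have h0 := hu.nonneg hp hR hne
  have h01 : ∀ x, u x ≤ 1 := fun x => by
    linarith [hsw.nonneg hp hR' (union_comm P Q ▸ hne) x]
  have hbP' : ∀ x, ∀ y ∈ P, 1 - u x ≤ C * ‖x - y‖ := fun x y hy =>
    (hu.barrier hp (hE s) (hl.le.trans hlΛ) hk hkl h1 h2 hC₀ hCC hR hne hbP hy).trans
      (by gcongr)
  have hbQ' : ∀ x, ∀ y ∈ Q, u x ≤ C * ‖x - y‖ := fun x y hy => by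
    have h3 := (hsw.barrier hp (hE s) (hl.le.trans hlΛ) hk hkl h1 h2 hC₀ hCC hR'
      (union_comm P Q ▸ hne) hbQ hy (x := x)).trans (mul_le_mul_of_nonneg_right
        (NNReal.coe_le_coe.2 hC₀C) (norm_nonneg _))
    linarith
  have huC : LipschitzWith C u := LipschitzWith.of_le_add_mul C fun x y => by
    have h3 := hu.sub_le hp hne hR hbP' hbQ' h0 h01 y (x - y)
    rw [add_sub_cancel, ← dist_eq_norm] at h3
    linarith
  have hle : ∀ (K : ℝ≥0) (φ : En n → ℝ), LipschitzWith K φ → (∀ x ∈ P ∪ Q, φ x = 0) →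
      0 ≤ ∫ x, ⟪flux N p s (gradient u x), gradient φ x⟫ := by
    intro K φ hφ hφ0
    have hw : Adm P Q (C + 1) fun x => u x + 1 / (K + 1) * φ x := by
      refine ⟨huC.add (LipschitzWith.of_dist_le_mul fun x y => ?_), fun x hx => ?_, fun x hx => ?_⟩
      · rw [Real.dist_eq, ← mul_sub, abs_mul, abs_of_nonneg (by positivity), ← Real.dist_eq,
          NNReal.coe_one]
        calc _ ≤ 1 / ((K : ℝ) + 1) * ((K + 1) * dist x y) := by
              gcongr
              exact (hφ.dist_le_mul x y).trans (by gcongr; linarith)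
          _ = _ := by field_simp
      · rw [hφ0 x (Or.inl hx), mul_zero, add_zero, hu.adm.one x hx]
      · rw [hφ0 x (Or.inr hx), mul_zero, add_zero, hu.adm.zero x hx]
    have h3 := hu.ineq _ hw
    simp_rw [add_sub_cancel_left, gradient_const_mul, inner_smul_right] at h3
    rw [integral_const_mul] at h3
    exact nonneg_of_mul_nonneg_right h3 (by positivity)
  refine ⟨u, ⟨huC, hu.adm.one, hu.adm.zero⟩, h0, h01, fun K φ hφ hφ0 => le_antisymm ?_ (hle K φ hφ hφ0)⟩
  have h3 := hle K (fun x => -φ x) hφ.neg fun x hx => by rw [hφ0 x hx, neg_zero]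
  simp_rw [gradient_neg, inner_neg_right] at h3
  rw [integral_neg] at h3
  linarith

end HilbertHaar


section DifferenceQuotients

variable {n : ℕ} (N : MinkowskiNorm n) {p s : ℝ} {u : En n → ℝ} {K : ℝ≥0}

/-- `u` is a weak solution of the regularized equation in the ball of center `z` and
radius `R`. -/
def WSol (p s : ℝ) (u : En n → ℝ) (z : En n) (R : ℝ) : Prop :=
  ∀ (K : ℝ≥0) (φ : En n → ℝ), LipschitzWith K φ → ∀ r < R, (∀ x, r ≤ ‖x - z‖ → φ x = 0) →
    ∫ x, ⟪flux N p s (gradient u x), gradient φ x⟫ = 0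

variable {N}

theorem WSol.congr {z : En n} {R : ℝ} (h : WSol N p s u z R) {v : En n → ℝ}
    (hv : ∀ x, ‖x - z‖ < R → v x = u x) : WSol N p s v z R := by
  intro K φ hφ r hr hz
  rw [← h K φ hφ r hr hz]
  refine integral_congr_ae ?_
  filter_upwards [gradient_ae_zero_of_eq_zero hφ] with x hx
  by_cases hxr : ‖x - z‖ < R
  · have : v =ᶠ[𝓝 x] u := by
      filter_upwards [(isOpen_lt (continuous_id.sub continuous_const).norm
        continuous_const).mem_nhds hxr] with y hy using hv y hy
    simp only [this.gradient_eq]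
  · simp only [hx (hz x (by linarith)), inner_zero_right]

theorem WSol.rescale {z : En n} {R : ℝ} (h : WSol N p s u z R) {z' : En n} {ρ μ R' : ℝ} (hρ : 0 < ρ)
    (hμ : 0 < μ) (hR : ‖z' - z‖ + ρ * R' ≤ R) :
    WSol N p (s / μ) (fun x => (μ * ρ)⁻¹ * u (z' + ρ • x)) 0 R' := by
  intro K φ hφ r hr hz
  have h1 := h _ _ (lipschitz_comp_homothety hφ (-(ρ⁻¹ • z')) ρ⁻¹) (‖z' - z‖ + ρ * r)
    (by nlinarith) fun x hx => hz _ (by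
      have e : -(ρ⁻¹ • z') + ρ⁻¹ • x = ρ⁻¹ • (x - z') := by module
      rw [e, sub_zero, norm_smul, Real.norm_of_nonneg (inv_nonneg.2 hρ.le), inv_mul_eq_div,
        le_div_iff₀ hρ]
      have := norm_add_le (x - z') (z' - z)
      rw [sub_add_sub_cancel] at this
      linarith)
  have h2 := integral_inner_rescale (V := fun x => flux N p s (gradient u x)) (φ := φ) z' hρ.ne'
  rw [h1, mul_zero, mul_zero] at h2
  have e : ∀ x, flux N p s (gradient u (z' + ρ • x)) = μ ^ (p - 1) •
      flux N p (s / μ) (gradient (fun x => (μ * ρ)⁻¹ * u (z' + ρ • x)) x) := fun x => by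
    rw [← flux_smul N p s hμ, gradient_const_mul, gradient_comp_smul, smul_smul, smul_smul,
      show μ * (μ * ρ)⁻¹ * ρ = 1 by field_simp, one_smul]
  simp_rw [e, inner_smul_left] at h2
  rw [integral_const_mul] at h2
  exact (mul_eq_zero.1 h2).resolve_left (Real.rpow_pos_of_pos hμ _).ne'

/-- The difference quotient of `u` in the direction `e`. -/
def dq (u : En n → ℝ) (t : ℝ) (e x : En n) : ℝ := t⁻¹ * (u (x + t • e) - u x)

theorem lipschitz_comp_add_right (hu : LipschitzWith K u) (h : En n) :
    LipschitzWith K fun x => u (x + h) := LipschitzWith.of_dist_le_mul fun x y => by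
  simpa using hu.dist_le_mul (x + h) (y + h)

theorem ae_comp_add_right {P : En n → Prop} (h : ∀ᵐ x, P x) (z : En n) : ∀ᵐ x, P (x + z) :=
  (measurePreserving_add_right volume z).quasiMeasurePreserving.ae h

theorem lipschitz_dq (hu : LipschitzWith K u) (t : ℝ) (e : En n) :
    ∃ K', LipschitzWith K' (dq u t e) :=
  ⟨_, (lipschitzWith_smul t⁻¹ (β := ℝ)).comp ((lipschitz_comp_add_right hu (t • e)).sub hu)⟩

theorem abs_dq_le (hu : LipschitzWith 1 u) {t : ℝ} (ht : 0 < t) {e : En n} (he : ‖e‖ = 1)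
    (x : En n) : |dq u t e x| ≤ 1 := by
  have h := hu.dist_le_mul (x + t • e) x
  rw [Real.dist_eq, dist_eq_norm, add_sub_cancel_left, norm_smul, he, Real.norm_of_nonneg ht.le] at h
  rw [dq, abs_mul, abs_of_pos (inv_pos.2 ht), inv_mul_le_iff₀ ht]
  simpa using h

theorem ae_gradient_dq (hu : LipschitzWith K u) (t : ℝ) (e : En n) :
    ∀ᵐ x, gradient (dq u t e) x = t⁻¹ • (gradient u (x + t • e) - gradient u x) := by
  filter_upwards [differentiableAt_ae hu, differentiableAt_ae (lipschitz_comp_add_right hu (t • e))]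
    with x h1 h2
  have : dq u t e = fun x => t⁻¹ * (u (x + t • e) - u x) := rfl
  rw [this, gradient_const_mul, gradient_sub h2 h1, gradient_comp_add_right]

theorem WSol.integral_sub_eq_zero (hp : 1 < p) (hu : LipschitzWith K u) {R : ℝ}
    (h : WSol N p s u 0 R) {v : En n} {φ : En n → ℝ} {K' : ℝ≥0} (hφ : LipschitzWith K' φ) {r : ℝ}
    (hr : r + ‖v‖ < R) (hz : ∀ x, r ≤ ‖x‖ → φ x = 0) :
    ∫ x, ⟪flux N p s (gradient u (x + v)) - flux N p s (gradient u x), gradient φ x⟫ = 0 := by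
  have hc := hasCompactSupport_of_zero hz
  have h1 := h K' φ hφ r (by linarith [norm_nonneg v]) (by simpa using hz)
  have h2 := h K' (fun x => φ (x - v)) (by
    simpa [sub_eq_add_neg] using lipschitz_comp_add_right hφ (-v)) (r + ‖v‖) hr fun x hx => hz _ (by
      have := norm_sub_norm_le x v
      rw [sub_zero] at hx
      linarith)
  rw [← integral_add_right_eq_self _ v] at h2
  have e : ∀ x, gradient (fun y => φ (y - v)) (x + v) = gradient φ x := fun x => by
    rw [← gradient_comp_add_right (fun y => φ (y - v)) v x]
    simp only [add_sub_cancel_right]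
  simp_rw [e] at h2
  simp_rw [inner_sub_left]
  rw [integral_sub, h1, h2, sub_zero]
  · simpa only [gradient_comp_add_right] using
      (by
        have := integrable_flux_gradient N s hp (lipschitz_comp_add_right hu v) hφ hc
        simpa only [gradient_comp_add_right] using this :
        Integrable fun x => ⟪flux N p s (gradient u (x + v)), gradient φ x⟫)
  · exact integrable_flux_gradient N s hp hu hφ hc

theorem PairEll.scale {l L c τ : ℝ} {b : En n → En n} {ξ η : En n} (hτ : 0 ≤ τ)
    (h : PairEll l L (fun ξ => c • b ξ) ξ η) :
    l * ‖τ • (ξ - η)‖ ^ 2 ≤ ⟪(τ * c) • (b ξ - b η), τ • (ξ - η)⟫ ∧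
      ‖(τ * c) • (b ξ - b η)‖ ≤ L * ‖τ • (ξ - η)‖ := by
  obtain ⟨h1, h2⟩ := h
  simp only [← smul_sub] at h1 h2
  rw [mul_smul, inner_smul_left, inner_smul_right, norm_smul, norm_smul, Real.norm_of_nonneg hτ]
  constructor
  · calc _ = τ * τ * (l * ‖ξ - η‖ ^ 2) := by ring
      _ ≤ τ * τ * _ := mul_le_mul_of_nonneg_left h1 (by positivity)
      _ = _ := by simp only [conj_trivial]; ring
  · calc _ ≤ τ * _ := mul_le_mul_of_nonneg_left h2 hτ
      _ = _ := by ring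

theorem linSol_dq (hp : 1 < p) (hu : LipschitzWith 1 u) (h : WSol N p s u 0 2) {t : ℝ} (ht : 0 < t)
    (ht1 : t ≤ 1) {e : En n} (he : ‖e‖ = 1) {l L c : ℝ}
    (hE : ∀ᵐ x, x ∈ ball (0 : En n) 1 → PairEll l L (fun ξ => c • flux N p s ξ)
      (gradient u (x + t • e)) (gradient u x)) :
    LinSol l L (dq u t e) fun x => (t⁻¹ * c) • (flux N p s (gradient u (x + t • e)) -
      flux N p s (gradient u x)) where
  lip := lipschitz_dq hu t e
  meas := by
    have := (((measurable_flux_gradient N s hp u).comp (by fun_prop : Measurable fun x => x + t • e)).sub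
      (measurable_flux_gradient N s hp u)).const_smul (t⁻¹ * c)
    exact this
  bdd := by
    obtain ⟨C, -, hC⟩ := exists_flux_bound N s hp 1
    refine ⟨|t⁻¹ * c| * (C + C), fun x => ?_⟩
    rw [norm_smul, Real.norm_eq_abs]
    have := fun x => hC _ (norm_gradient_le hu x)
    exact mul_le_mul_of_nonneg_left ((norm_sub_le _ _).trans (add_le_add (this _) (this _)))
      (abs_nonneg _)
  ell := by
    filter_upwards [hE, ae_gradient_dq hu t e] with x hx hg hb
    rw [hg]
    exact (hx hb).scale (inv_nonneg.2 ht.le)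
  test φ K' hφ r hr hz := by
    simp_rw [inner_smul_left]
    rw [integral_const_mul, h.integral_sub_eq_zero hp hu hφ (v := t • e) (r := r) (by
      rw [norm_smul, he, Real.norm_of_nonneg ht.le]; linarith) hz, mul_zero]

theorem dq_half (u : En n → ℝ) (t : ℝ) (e x : En n) :
    dq u t e x = (dq u (t / 2) e x + dq u (t / 2) e (x + (t / 2) • e)) / 2 := by
  rw [dq, dq, dq, add_assoc, ← add_smul, add_halves]
  rw [inv_div]
  ring

theorem tendsto_dq {x : En n} (hd : DifferentiableAt ℝ u x) {t : ℝ} (ht : 0 < t) (e : En n) :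
    Tendsto (fun m : ℕ => dq u (t * (1 / 2) ^ m) e x) atTop (𝓝 ⟪gradient u x, e⟫) := by
  have h1 : HasLineDerivAt ℝ u (fderiv ℝ u x e) x e := hd.hasFDerivAt.hasLineDerivAt e
  rw [inner_gradient_left]
  have h2 := hasDerivAt_iff_tendsto_slope_zero.1 h1
  have h3 : Tendsto (fun m : ℕ => t * (1 / 2) ^ m) atTop (𝓝[≠] 0) := by
    refine tendsto_nhdsWithin_iff.2 ⟨?_, Eventually.of_forall fun m => ?_⟩
    · simpa using (tendsto_pow_atTop_nhds_zero_of_lt_one (r := (1 / 2 : ℝ)) (by norm_num)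
        (by norm_num)).const_mul t
    · exact (by positivity : t * (1 / 2 : ℝ) ^ m ≠ 0)
  refine (h2.comp h3).congr fun m => ?_
  simp [dq]

theorem abs_dq_sub_gradient_le {α A t : ℝ} (hα : 0 < α) (hA : 0 ≤ A) (ht : 0 < t) {e x : En n}
    (h : ∀ τ : ℝ, 0 < τ → τ ≤ t → |dq u τ e (x + τ • e) - dq u τ e x| ≤ A * τ ^ α)
    (hd : DifferentiableAt ℝ u x) :
    |dq u t e x - ⟪gradient u x, e⟫| ≤ A / (1 - (1 / 2) ^ α) * t ^ α := by
  set θ : ℝ := (1 / 2) ^ α with hθ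
  have hθ0 : 0 < θ := by positivity
  have hθ1 : θ < 1 := Real.rpow_lt_one (by norm_num) (by norm_num) hα
  have key : ∀ m : ℕ, |dq u t e x - dq u (t * (1 / 2) ^ m) e x| ≤
      A / (1 - θ) * t ^ α * (1 - θ ^ m) := by
    intro m
    induction m with
    | zero => simp
    | succ m ih =>
      have h1 := h (t * (1 / 2) ^ (m + 1)) (by positivity)
        (mul_le_of_le_one_right ht.le (pow_le_one₀ (by norm_num) (by norm_num)))
      have h2 := dq_half u (t * (1 / 2) ^ m) e x
      have e1 : t * (1 / 2) ^ m / 2 = t * (1 / 2) ^ (m + 1) := by ring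
      rw [e1] at h2
      rw [Real.mul_rpow ht.le (by positivity), ← Real.rpow_natCast, ← Real.rpow_mul (by norm_num),
        mul_comm ((m + 1 : ℕ) : ℝ), Real.rpow_mul (by norm_num), ← hθ] at h1
      simp only [Real.rpow_natCast] at h1
      have h3 : |dq u (t * (1 / 2) ^ m) e x - dq u (t * (1 / 2) ^ (m + 1)) e x| ≤
          A * (t ^ α * θ ^ m) := by
        have h4 : dq u (t * (1 / 2) ^ m) e x - dq u (t * (1 / 2) ^ (m + 1)) e x =
          1 / 2 * (dq u (t * (1 / 2) ^ (m + 1)) e (x + (t * (1 / 2) ^ (m + 1)) • e) -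
            dq u (t * (1 / 2) ^ (m + 1)) e x) := by rw [h2]; ring
        rw [h4, abs_mul, abs_of_pos (by norm_num : (0 : ℝ) < 1 / 2)]
        have h5 : A * (t ^ α * θ ^ (m + 1)) ≤ A * (t ^ α * θ ^ m) := by
          gcongr A * (t ^ α * ?_)
          exact pow_le_pow_of_le_one hθ0.le hθ1.le (Nat.le_succ m)
        have := abs_nonneg (dq u (t * (1 / 2) ^ (m + 1)) e (x + (t * (1 / 2) ^ (m + 1)) • e) -
            dq u (t * (1 / 2) ^ (m + 1)) e x)
        linarith
      refine (abs_sub_le _ (dq u (t * (1 / 2) ^ m) e x) _).trans ((add_le_add ih h3).trans_eq ?_)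
      have : 1 - θ ≠ 0 := by linarith
      field_simp
      ring
  refine le_of_tendsto (tendsto_const_nhds.sub (tendsto_dq hd ht e)).abs (Eventually.of_forall fun m => ?_)
  refine (key m).trans (mul_le_of_le_one_right ?_ ?_)
  · have : 0 < 1 - θ := by linarith
    positivity
  · linarith [pow_pos hθ0 m]

theorem exists_dq_expansion (hn : 2 ≤ n) (hp : 1 < p) {l L : ℝ} (hl : 0 < l) (hL : l ≤ L) :
    ∃ C α : ℝ, 0 ≤ C ∧ 0 < α ∧ α ≤ 1 ∧ ∀ (s c : ℝ) (u : En n → ℝ), LipschitzWith 1 u →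
      WSol N p s u 0 2 → (∀ e : En n, ‖e‖ = 1 → ∀ t : ℝ, 0 < t → t ≤ 1 / 2 → ∀ᵐ x, x ∈ ball (0 : En n) 1 →
        PairEll l L (fun ξ => c • flux N p s ξ) (gradient u (x + t • e)) (gradient u x)) →
      DifferentiableAt ℝ u 0 → ∀ e : En n, ‖e‖ = 1 → ∀ t : ℝ, 0 < t → t ≤ 1 / 2 →
        |dq u t e 0 - ⟪gradient u 0, e⟫| ≤ C * t ^ α := by
  obtain ⟨α, hα, hα1, h⟩ := holder_estimate hn hl hL
  have hθ1 : (1 / 2 : ℝ) ^ α < 1 := Real.rpow_lt_one (by norm_num) (by norm_num) hα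
  refine ⟨4 / (1 - (1 / 2) ^ α), α, div_nonneg (by norm_num) (by linarith), hα, hα1,
    fun s c u hu hw hE hd e he t ht ht1 => ?_⟩
  refine abs_dq_sub_gradient_le hα (by norm_num) ht (fun τ hτ hτt => ?_) hd
  have hn : ‖τ • e‖ = τ := by rw [norm_smul, he, Real.norm_of_nonneg hτ.le, mul_one]
  have h1 := h _ _ (linSol_dq hp hu hw hτ (by linarith) he (hE e he τ hτ (by linarith)))
    (fun x _ => abs_dq_le hu hτ he x) (τ • e) (by rw [mem_ball_zero_iff, hn]; linarith)
  rwa [hn, ← zero_add (τ • e)] at h1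

end DifferenceQuotients


section Dichotomy

variable {n : ℕ} {N : MinkowskiNorm n} {p s : ℝ} {u : En n → ℝ} {K : ℝ≥0}

theorem lipschitz_rescale (hu : LipschitzWith 1 u) (z : En n) {ρ : ℝ} (hρ : 0 < ρ) :
    LipschitzWith 1 fun x => ρ⁻¹ * u (z + ρ • x) := LipschitzWith.of_dist_le_mul fun x y => by
  have := (lipschitz_comp_homothety hu z ρ).dist_le_mul x y
  rw [one_mul, coe_nnnorm, Real.norm_of_nonneg hρ.le] at this
  rw [Real.dist_eq, ← mul_sub, abs_mul, abs_of_pos (inv_pos.2 hρ), inv_mul_le_iff₀ hρ]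
  simpa [Real.dist_eq] using this

theorem gradient_rescale (u : En n → ℝ) (z : En n) {ρ : ℝ} (hρ : 0 < ρ) (x : En n) :
    gradient (fun x => ρ⁻¹ * u (z + ρ • x)) x = gradient u (z + ρ • x) := by
  rw [gradient_const_mul, gradient_comp_smul, smul_smul, inv_mul_cancel₀ hρ.ne', one_smul]

theorem exists_dq_expansion_at (hn : 2 ≤ n) (hp : 1 < p) {l L : ℝ} (hl : 0 < l) (hL : l ≤ L) :
    ∃ C α : ℝ, 0 ≤ C ∧ 0 < α ∧ α ≤ 1 ∧ ∀ (s c R ρ : ℝ) (u : En n → ℝ) (G : Set (En n)) (z : En n),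
      0 < ρ → LipschitzWith 1 u → WSol N p s u 0 R → ‖z‖ + 2 * ρ ≤ R →
      (∀ ξ ∈ G, ∀ η ∈ G, PairEll l L (fun ξ => c • flux N p s ξ) ξ η) →
      (∀ᵐ x, ‖x - z‖ < 2 * ρ → gradient u x ∈ G) → DifferentiableAt ℝ u z →
      ∀ e : En n, ‖e‖ = 1 → ∀ t : ℝ, 0 < t → t ≤ ρ / 2 →
        |dq u t e z - ⟪gradient u z, e⟫| ≤ C * (t / ρ) ^ α := by
  obtain ⟨C, α, hC, hα, hα1, h⟩ := exists_dq_expansion (N := N) hn hp hl hL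
  refine ⟨C, α, hC, hα, hα1, fun s c R ρ u G z hρ hu hw hR hG hae hd e he t ht ht1 => ?_⟩
  have hw' := hw.rescale (z' := z) (R' := 2) hρ one_pos (by rw [sub_zero]; linarith)
  simp only [div_one, one_mul] at hw'
  have hg := gradient_rescale u z hρ
  have key := h s c _ (lipschitz_rescale hu z hρ) hw' (fun e he t ht ht1 => ?_) ?_ e he (t / ρ)
    (by positivity) (by rw [div_le_iff₀ hρ]; linarith)
  · rw [hg, smul_zero, add_zero] at key
    convert key using 3
    rw [dq, dq, zero_add, smul_zero, add_zero, smul_smul, mul_div_cancel₀ _ hρ.ne']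
    field_simp
  · have h1 := ae_comp_homothety hae z hρ.ne'
    filter_upwards [h1, ae_comp_add_right h1 (t • e)] with x h2 h3 hx
    rw [mem_ball_zero_iff] at hx
    rw [hg, hg]
    have hte : ‖t • e‖ = t := by rw [norm_smul, he, Real.norm_of_nonneg ht.le, mul_one]
    refine hG _ (h3 ?_) _ (h2 ?_)
    · rw [add_sub_cancel_left, norm_smul, Real.norm_of_nonneg hρ.le]
      have := norm_add_le x (t • e)
      nlinarith
    · rw [add_sub_cancel_left, norm_smul, Real.norm_of_nonneg hρ.le]
      nlinarith
  · refine DifferentiableAt.const_mul ?_ _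
    refine DifferentiableAt.comp (g := u) (0 : En n) ?_ (by fun_prop)
    simpa using hd

/-- For the nondegenerate equation the difference quotients converge uniformly to the
derivative. -/
theorem WSol.dq_approx (hn : 2 ≤ n) (hp : 1 < p) (hs : s ≠ 0) (hu : LipschitzWith 1 u)
    (h : WSol N p s u 0 4) {ε : ℝ} (hε : 0 < ε) : ∃ t₀ : ℝ, 0 < t₀ ∧ t₀ ≤ 1 / 2 ∧
      ∀ e : En n, ‖e‖ = 1 → ∀ t : ℝ, 0 < t → t ≤ t₀ → ∀ᵐ x, x ∈ ball (0 : En n) 1 →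
        |dq u t e x - ⟪gradient u x, e⟫| ≤ ε ∧ |dq u t e x - ⟪gradient u (x + t • e), e⟫| ≤ ε := by
  obtain ⟨l, L, hl, hL, hE⟩ := flux_ell_of_bounded N p s hp hs 1
  obtain ⟨C, α, hC, hα, -, hX⟩ := exists_dq_expansion_at (N := N) hn hp hl hL
  have hlim : Tendsto (fun t : ℝ => C * (t / 1) ^ α) (𝓝 0) (𝓝 0) := by
    have : ContinuousAt (fun t : ℝ => C * (t / 1) ^ α) 0 := by
      refine ContinuousAt.mul continuousAt_const ?_
      exact (continuousAt_id.div_const 1).rpow_const (Or.inr hα.le)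
    simpa [ContinuousAt, Real.zero_rpow hα.ne'] using this
  obtain ⟨r, hr, hr'⟩ := Metric.eventually_nhds_iff.1 (hlim.eventually (gt_mem_nhds hε))
  refine ⟨min (r / 2) (1 / 2), by positivity, min_le_right _ _, fun e he t ht ht1 => ?_⟩
  have htr := ht1.trans (min_le_left _ _)
  have ht2 := ht1.trans (min_le_right _ _)
  have hte : ‖t • e‖ = t := by rw [norm_smul, he, Real.norm_of_nonneg ht.le, mul_one]
  have key : ∀ z : En n, ‖z‖ < 2 → DifferentiableAt ℝ u z → ∀ e : En n, ‖e‖ = 1 →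
      |dq u t e z - ⟪gradient u z, e⟫| ≤ ε := fun z hz hd e he =>
    (hX s 1 4 1 u {ξ | ‖ξ‖ ≤ 1} z one_pos hu h (by linarith)
      (fun ξ hξ η hη => by simpa using hE ξ η hξ hη)
      (Eventually.of_forall fun x _ => by simpa using norm_gradient_le hu x) hd e he t ht
      ht2).trans (hr' (by rw [dist_zero_right, Real.norm_of_nonneg ht.le]; linarith)).le
  filter_upwards [differentiableAt_ae hu, ae_comp_add_right (differentiableAt_ae hu) (t • e)]
    with x h1 h2 hx
  rw [mem_ball_zero_iff] at hx
  refine ⟨key x (by linarith) h1 e he, ?_⟩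
  have h3 := key (x + t • e) ((norm_add_le _ _).trans_lt (by linarith)) h2 (-e) (by rwa [norm_neg])
  have e1 : dq u t (-e) (x + t • e) = -dq u t e x := by
    rw [dq, dq, smul_neg, add_neg_cancel_right]; ring
  rwa [e1, inner_neg_right, ← neg_sub', abs_neg] at h3

theorem subSol_dq (hp : 1 < p) (hu : LipschitzWith 1 u) (h : WSol N p s u 0 2) {t : ℝ} (ht : 0 < t)
    (ht1 : t ≤ 1) {e : En n} (he : ‖e‖ = 1) {l L c a k : ℝ} (ha : 0 < a)
    (hE : ∀ᵐ x, x ∈ ball (0 : En n) 1 → k < dq u t e x → PairEll l L (fun ξ => c • flux N p s ξ)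
      (gradient u (x + t • e)) (gradient u x)) :
    SubSol l L (fun x => a * (dq u t e x - k)) fun x => (a * t⁻¹ * c) •
      (flux N p s (gradient u (x + t • e)) - flux N p s (gradient u x)) where
  lip := by
    obtain ⟨K', hK⟩ := lipschitz_dq hu t e
    exact ⟨_, (lipschitzWith_smul a (β := ℝ)).comp (hK.sub (LipschitzWith.const k))⟩
  meas := by
    have := (((measurable_flux_gradient N s hp u).comp (by fun_prop : Measurable fun x =>
      x + t • e)).sub (measurable_flux_gradient N s hp u)).const_smul (a * t⁻¹ * c)
    exact this
  bdd := by
    obtain ⟨C, -, hC⟩ := exists_flux_bound N s hp 1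
    refine ⟨|a * t⁻¹ * c| * (C + C), fun x => ?_⟩
    rw [norm_smul, Real.norm_eq_abs]
    have := fun x => hC _ (norm_gradient_le hu x)
    exact mul_le_mul_of_nonneg_left ((norm_sub_le _ _).trans (add_le_add (this _) (this _)))
      (abs_nonneg _)
  ell := by
    filter_upwards [hE, ae_gradient_dq hu t e] with x hx hg hb hk
    rw [gradient_const_mul, gradient_sub_const, hg, smul_smul]
    refine (hx hb ?_).scale (by positivity)
    linarith [(pos_iff_pos_of_mul_pos hk).1 ha]
  test φ K' hφ _ r hr hz := by
    simp_rw [inner_smul_left]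
    rw [integral_const_mul, h.integral_sub_eq_zero hp hu hφ (v := t • e) (r := r) (by
      rw [norm_smul, he, Real.norm_of_nonneg ht.le]; linarith) hz, mul_zero]

theorem integral_abs_dq_le {f : En n → ℝ} (hf : LipschitzWith K f) (hc : HasCompactSupport f)
    {t : ℝ} (ht : 0 < t) {e : En n} (he : ‖e‖ = 1) :
    ∫ x, |dq f t e x| ≤ ∫ x, ‖gradient f x‖ := by
  have hi : ∀ t, Integrable (dq f t e) := fun t => by
    have h1 : Integrable f := hf.continuous.integrable_of_hasCompactSupport hc
    exact ((h1.comp_add_right (t • e)).sub h1).const_mul _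
  have h1 : ∀ t, ∫ x, |dq f t e x| ≤ ∫ x, |dq f (t / 2) e x| := fun t => by
    have h2 : ∀ x, |dq f t e x| ≤ |dq f (t / 2) e x| / 2 + |dq f (t / 2) e (x + (t / 2) • e)| / 2 :=
      fun x => by
        rw [dq_half, abs_div, abs_of_pos (two_pos : (0 : ℝ) < 2), ← add_div]
        gcongr
        exact abs_add_le _ _
    have h3 := ((hi (t / 2)).comp_add_right ((t / 2) • e)).abs.div_const 2
    refine (integral_mono (hi t).abs (((hi (t / 2)).abs.div_const 2).add h3) h2).trans_eq ?_
    simp only [Pi.add_apply]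
    rw [integral_add ((hi (t / 2)).abs.div_const 2) h3, integral_div, integral_div,
      integral_add_right_eq_self (fun x => |dq f (t / 2) e x|)]
    ring
  have h2 : ∀ m : ℕ, ∫ x, |dq f t e x| ≤ ∫ x, |dq f (t * (1 / 2) ^ m) e x| := fun m => by
    induction m with
    | zero => simp
    | succ m ih =>
      refine ih.trans ((h1 _).trans_eq ?_)
      rw [show t * (1 / 2) ^ m / 2 = t * (1 / 2) ^ (m + 1) by ring]
  obtain ⟨R, hR⟩ := hc.isCompact.isBounded.subset_closedBall 0
  have h3 : Tendsto (fun m : ℕ => ∫ x, |dq f (t * (1 / 2) ^ m) e x|) atTop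
      (𝓝 (∫ x, |⟪gradient f x, e⟫|)) := by
    refine tendsto_integral_of_dominated_convergence
      (fun x => (closedBall (0 : En n) (R + t)).indicator (fun _ => (K : ℝ)) x)
      (fun m => (hi _).abs.aestronglyMeasurable) ?_ (fun m => Eventually.of_forall fun x => ?_) ?_
    · rw [integrable_indicator_iff measurableSet_closedBall]
      exact integrableOn_const measure_closedBall_lt_top.ne
    · have hτ : 0 < t * (1 / 2) ^ m := by positivity
      have hτt : t * (1 / 2) ^ m ≤ t :=
        mul_le_of_le_one_right ht.le (pow_le_one₀ (by norm_num) (by norm_num))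
      rw [norm_abs_eq_norm, Real.norm_eq_abs]
      by_cases hx : x ∈ closedBall (0 : En n) (R + t)
      · rw [indicator_of_mem hx]
        rw [dq, abs_mul, abs_of_pos (inv_pos.2 hτ), inv_mul_le_iff₀ hτ]
        have := hf.dist_le_mul (x + (t * (1 / 2) ^ m) • e) x
        rwa [dist_eq_norm, dist_eq_norm, add_sub_cancel_left, norm_smul, he,
          Real.norm_of_nonneg hτ.le, mul_one, Real.norm_eq_abs, mul_comm (K : ℝ)] at this
      · rw [indicator_of_notMem hx]
        rw [mem_closedBall_zero_iff, not_le] at hx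
        have h0 : ∀ y : En n, R < ‖y‖ → f y = 0 := fun y hy => image_eq_zero_of_notMem_tsupport
          fun h => by simpa using (mem_closedBall_zero_iff.1 (hR h)).trans_lt hy
        have : R < ‖x + (t * (1 / 2) ^ m) • e‖ := by
          have h4 := norm_sub_le (x + (t * (1 / 2) ^ m) • e) ((t * (1 / 2) ^ m) • e)
          rw [add_sub_cancel_right, norm_smul ((t * (1 / 2) ^ m)) e, he,
            Real.norm_of_nonneg hτ.le] at h4
          linarith
        rw [dq, h0 _ this, h0 x (by linarith), sub_zero, mul_zero, abs_zero]
    · filter_upwards [differentiableAt_ae hf] with x hx using (tendsto_dq hx ht e).abs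
  refine (ge_of_tendsto' h3 h2).trans (integral_mono_of_nonneg
    (Eventually.of_forall fun _ => abs_nonneg _) (integrable_norm_gradient hf hc)
    (Eventually.of_forall fun x => ?_))
  simpa [he] using abs_real_inner_le_norm (gradient f x) e

end Dichotomy


section LowerDichotomy

variable {n : ℕ} {N : MinkowskiNorm n} {p s : ℝ} {u : En n → ℝ} {K : ℝ≥0}

theorem abs_integral_inner_sub_le {B : En n → En n} {L : ℝ} (hB : Measurable B)
    (hL : ∀ x, ‖B x‖ ≤ L) {f : En n → ℝ} (hf : LipschitzWith K f) (h0 : ∀ x, 0 ≤ f x)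
    (hz : ∀ x, 1 ≤ ‖x‖ → f x = 0) {t : ℝ} (ht : 0 < t) (ht1 : t ≤ 1) {e : En n} (he : ‖e‖ = 1) :
    |∫ x, ⟪B (x + t • e) - B x, f x • x⟫| ≤
      t * (L * (2 * (∫ x, ‖gradient f x‖) + ∫ x, f x)) := by
  have hc := hasCompactSupport_of_zero hz
  have hfi : Integrable f := hf.continuous.integrable_of_hasCompactSupport hc
  have hL0 : 0 ≤ L := (norm_nonneg _).trans (hL 0)
  have hte : ‖t • e‖ = t := by rw [norm_smul, he, Real.norm_of_nonneg ht.le, mul_one]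
  have hi : ∀ B' : En n → En n, Measurable B' → (∀ x, ‖B' x‖ ≤ L) →
      Integrable fun x => ⟪B' x, f x • x⟫ := fun B' hm hb => by
    refine (hfi.const_mul L).mono' ((hm.inner (hf.continuous.measurable.smul
      measurable_id)).aestronglyMeasurable) (Eventually.of_forall fun x => ?_)
    refine (norm_inner_le_norm _ _).trans ?_
    rw [norm_smul, Real.norm_of_nonneg (h0 x)]
    rcases le_or_gt 1 ‖x‖ with h | h
    · simp [hz x h]
    · exact mul_le_mul (hb x) (mul_le_of_le_one_right (h0 x) h.le)
        (mul_nonneg (h0 x) (norm_nonneg _)) hL0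
  have hm : Measurable fun x => B (x + t • e) := hB.comp (by fun_prop)
  have h1 := hi _ hm fun x => hL _
  have h2 := (hi B hB hL).comp_add_right (t • e)
  have hd : Integrable fun x => |dq f t e x| := by
    have := ((hfi.comp_add_right (t • e)).sub hfi).const_mul t⁻¹
    exact this.abs
  have e1 : ∫ x, ⟪B (x + t • e) - B x, f x • x⟫ =
      ∫ x, ⟪B (x + t • e), f x • x - f (x + t • e) • (x + t • e)⟫ := by
    simp_rw [inner_sub_left, inner_sub_right]
    rw [integral_sub h1 (hi B hB hL), integral_sub h1 h2,
      integral_add_right_eq_self (fun x => ⟪B x, f x • x⟫)]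
  rw [e1, ← Real.norm_eq_abs]
  have h3 : ∀ x, ‖⟪B (x + t • e), f x • x - f (x + t • e) • (x + t • e)⟫‖ ≤
      t * (L * (2 * |dq f t e x| + f x)) := fun x => by
    refine (norm_inner_le_norm _ _).trans ?_
    have e2 : f x • x - f (x + t • e) • (x + t • e) =
        (f x - f (x + t • e)) • (x + t • e) - f x • (t • e) := by module
    have e3 : t * |dq f t e x| = |f x - f (x + t • e)| := by
      rw [dq, abs_mul, abs_of_pos (inv_pos.2 ht), mul_inv_cancel_left₀ ht.ne', abs_sub_comm]
    have h4 : |f x - f (x + t • e)| * ‖x + t • e‖ ≤ |f x - f (x + t • e)| * 2 := by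
      rcases le_or_gt ‖x + t • e‖ 2 with h | h
      · gcongr
      · have := norm_add_le x (t • e)
        simp [hz (x + t • e) (by linarith), hz x (by linarith)]
    calc _ ≤ L * ‖f x • x - f (x + t • e) • (x + t • e)‖ := by gcongr; exact hL _
      _ ≤ L * (|f x - f (x + t • e)| * ‖x + t • e‖ + f x * t) := by
          rw [e2]
          refine mul_le_mul_of_nonneg_left ((norm_sub_le _ _).trans_eq ?_) hL0
          rw [norm_smul, norm_smul (f x), hte, Real.norm_eq_abs, Real.norm_of_nonneg (h0 x)]
      _ ≤ L * (|f x - f (x + t • e)| * 2 + f x * t) := by gcongr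
      _ = _ := by rw [← e3]; ring
  refine (norm_integral_le_of_norm_le ((((hd.const_mul 2).add hfi).const_mul L).const_mul t)
    (Eventually.of_forall h3)).trans ?_
  simp only [Pi.add_apply]
  rw [integral_const_mul, integral_const_mul, integral_add (hd.const_mul 2) hfi, integral_const_mul]
  have := integral_abs_dq_le hf hc ht he
  gcongr

set_option maxHeartbeats 1000000 in
/-- The Caccioppoli inequality for the truncated difference quotient, near a point where the
equation may degenerate below the truncation level. -/
theorem weakCacc_dq (hp : 1 < p) (hu : LipschitzWith 1 u) (h : WSol N p s u 0 2) {t : ℝ}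
    (ht : 0 < t) (ht1 : t ≤ 1) {e : En n} (he : ‖e‖ = 1) {l L c : ℝ} (hl : 0 < l) (hlL : l ≤ L)
    (hE : ∀ᵐ x, x ∈ ball (0 : En n) 1 → 1 / 2 < dq u t e x →
      PairEll l L (fun ξ => c • flux N p s ξ) (gradient u (x + t • e)) (gradient u x))
    (hB : ∀ ξ : En n, ‖ξ‖ ≤ 1 → ‖c • flux N p s ξ‖ ≤ L) :
    WeakCacc (600 * (L / l) ^ 2) fun x => 8 / 3 * (7 / 8 - max (dq u t e x) (1 / 2)) := by
  intro k r R hk _ hr hrR hR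
  obtain ⟨KD, hD⟩ := lipschitz_dq hu t e
  set w : En n → ℝ := fun x => 8 / 3 * (7 / 8 - max (dq u t e x) (1 / 2)) with hw
  have hL0 : 0 < L := hl.trans_le hlL
  obtain ⟨Kw, hwL⟩ : ∃ Kw, LipschitzWith Kw w :=
    ⟨_, (lipschitzWith_smul (8 / 3 : ℝ) (β := ℝ)).comp
      ((LipschitzWith.const (7 / 8 : ℝ)).sub (hD.max_const (1 / 2)))⟩
  have hw1 : ∀ x, w x ≤ 1 := fun x => by
    have := le_max_right (dq u t e x) (1 / 2)
    simp only [hw]; linarith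
  have hgw : ∀ᵐ x, gradient w x =
      (-(8 / 3) : ℝ) • if 1 / 2 < dq u t e x then gradient (dq u t e) x else 0 := by
    filter_upwards [ae_gradient_max_const hD (1 / 2)] with x hx
    have e1 : w = fun x => 8 / 3 * (3 / 8 - max (dq u t e x - 1 / 2) 0) := by
      funext x
      have := max_sub_sub_right (dq u t e x) (1 / 2) (1 / 2)
      rw [sub_self] at this
      simp only [hw, this]; ring
    rw [e1, gradient_const_mul, gradient_const_sub, hx, smul_neg, neg_smul]
  set ψ : En n → ℝ := fun x => max (w x - k) 0 with hψ
  have hψL : LipschitzWith Kw ψ := by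
    have := (hwL.sub (LipschitzWith.const k)).max_const 0
    rwa [add_zero] at this
  have hψ0 : ∀ x, 0 ≤ ψ x := fun x => le_max_right _ _
  have hψ1 : ∀ x, ψ x ≤ 1 := fun x => max_le (by linarith [hw1 x]) zero_le_one
  set Q : En n → ℝ := fun x => R ^ 2 - ‖x‖ ^ 2 with hQ
  have hR0 : 0 < R := by linarith
  set η : En n → ℝ := fun x => max (Q x) 0 with hη
  have hQr : ∀ x, η x = R ^ 2 - min ‖x‖ R ^ 2 := fun x => by
    simp only [hη]
    rcases le_total ‖x‖ R with h | h
    · rw [min_eq_left h, max_eq_left]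
      exact sub_nonneg.2 (pow_le_pow_left₀ (norm_nonneg _) h 2)
    · rw [min_eq_right h, sub_self, max_eq_right]
      exact sub_nonpos.2 (pow_le_pow_left₀ hR0.le h 2)
  have hηL : LipschitzWith 2 η := LipschitzWith.of_dist_le_mul fun x y => by
    rw [Real.dist_eq, hQr, hQr, dist_eq_norm]
    have h1 : |min ‖x‖ R - min ‖y‖ R| ≤ ‖x - y‖ :=
      (abs_min_sub_min_le_max _ _ _ _).trans (by simpa using abs_norm_sub_norm_le x y)
    have h2 : |min ‖x‖ R + min ‖y‖ R| ≤ 2 := by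
      have h3 := min_le_right ‖x‖ R
      have h4 := min_le_right ‖y‖ R
      have h5 : 0 ≤ min ‖x‖ R := le_min (norm_nonneg _) hR0.le
      have h6 : 0 ≤ min ‖y‖ R := le_min (norm_nonneg _) hR0.le
      rw [abs_of_nonneg (by linarith)]; linarith
    rw [show R ^ 2 - min ‖x‖ R ^ 2 - (R ^ 2 - min ‖y‖ R ^ 2) =
      -((min ‖x‖ R + min ‖y‖ R) * (min ‖x‖ R - min ‖y‖ R)) by ring, abs_neg, abs_mul]
    exact mul_le_mul h2 h1 (abs_nonneg _) (by norm_num)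
  have hη0 : ∀ x, 0 ≤ η x := fun x => le_max_right _ _
  have hη1 : ∀ x, η x ≤ 1 := fun x => by
    simp only [hQr]
    nlinarith [sq_nonneg (min ‖x‖ R)]
  have hηz : ∀ x, R ≤ ‖x‖ → η x = 0 := fun x hx => by
    simp only [hQr, min_eq_right hx, sub_self]
  have hgη : ∀ᵐ x, gradient η x = if ‖x‖ < R then (-2 : ℝ) • x else 0 := by
    filter_upwards [gradient_ae_zero_of_eq_zero hηL] with x hx
    split_ifs with hxR
    · have e1 : η =ᶠ[𝓝 x] Q := by
        filter_upwards [(isOpen_lt continuous_norm continuous_const).mem_nhds hxR] with y hy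
        exact max_eq_left (sub_nonneg.2 (pow_le_pow_left₀ (norm_nonneg _) (le_of_lt hy) 2))
      rw [e1.gradient_eq]
      have := gradient_normSq (0 : En n) x
      simp only [sub_zero] at this
      rw [hQ, gradient_const_sub, this, neg_smul]
    · exact hx (hηz x (not_lt.1 hxR))
  have hfL := lipschitz_mul_of_bounded hηL hψL (Mf := 1) (Mg := 1)
    (fun x => by rw [abs_of_nonneg (hη0 x)]; exact hη1 x)
    (fun x => by rw [abs_of_nonneg (hψ0 x)]; exact hψ1 x)
  set f : En n → ℝ := fun x => η x * ψ x with hf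
  have hf0 : ∀ x, 0 ≤ f x := fun x => mul_nonneg (hη0 x) (hψ0 x)
  have hf1 : ∀ x, f x ≤ 1 := fun x => mul_le_one₀ (hη1 x) (hψ0 x) (hψ1 x)
  have hfz : ∀ x, R ≤ ‖x‖ → f x = 0 := fun x hx => by simp [hf, hηz x hx]
  have hφL := lipschitz_mul_of_bounded hηL hfL (Mf := 1) (Mg := 1)
    (fun x => by rw [abs_of_nonneg (hη0 x)]; exact hη1 x)
    (fun x => by rw [abs_of_nonneg (hf0 x)]; exact hf1 x)
  have hφz : ∀ x, R ≤ ‖x‖ → η x * f x = 0 := fun x hx => by simp [hfz x hx]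
  set T := ball (0 : En n) R ∩ {x | k < w x} with hT
  have hTm : MeasurableSet T :=
    measurableSet_ball.inter (measurableSet_lt measurable_const hwL.continuous.measurable)
  have hTf : volume T ≠ ⊤ := volume_ball_inter_ne_top _ _
  set B : En n → En n := fun x => c • flux N p s (gradient u x) with hBdef
  have hBm : Measurable B := (measurable_flux_gradient N s hp u).const_smul c
  have hBL : ∀ x, ‖B x‖ ≤ L := fun x => hB _ (by simpa using norm_gradient_le hu x)
  set V : En n → En n := fun x => (t⁻¹ * c) • (flux N p s (gradient u (x + t • e)) -
    flux N p s (gradient u x)) with hV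
  have hVB : ∀ x, V x = t⁻¹ • (B (x + t • e) - B x) := fun x => by
    simp only [hV, hBdef, mul_smul, smul_sub]
  have hVm : Measurable V := by
    have := (((hBm.comp (by fun_prop : Measurable fun x => x + t • e)).sub hBm)).const_smul t⁻¹
    exact (funext hVB : V = _) ▸ this
  have hVb : ∀ x, ‖V x‖ ≤ t⁻¹ * (L + L) := fun x => by
    rw [hVB, norm_smul, Real.norm_of_nonneg (inv_nonneg.2 ht.le)]
    gcongr
    exact (norm_sub_le _ _).trans (add_le_add (hBL _) (hBL _))
  have htest : ∫ x, ⟪V x, gradient (fun x => η x * f x) x⟫ = 0 := by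
    simp_rw [hV, inner_smul_left]
    rw [integral_const_mul, h.integral_sub_eq_zero hp hu hφL (v := t • e) (r := R) (by
      rw [norm_smul, he, Real.norm_of_nonneg ht.le]; linarith) hφz, mul_zero]
  have hX := abs_integral_inner_sub_le hBm hBL hfL hf0 (fun x hx => hfz x (by linarith)) ht ht1 he
  have hfi : Integrable f := hfL.continuous.integrable_of_hasCompactSupport
    (hasCompactSupport_of_zero hfz)
  have hXi : Integrable fun x => ⟪V x, f x • x⟫ := by
    refine (hfi.const_mul (t⁻¹ * (L + L))).mono' ((hVm.inner (hfL.continuous.measurable.smul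
      measurable_id)).aestronglyMeasurable) (Eventually.of_forall fun x => ?_)
    refine (norm_inner_le_norm _ _).trans ?_
    rw [norm_smul (f x), Real.norm_of_nonneg (hf0 x)]
    rcases le_or_gt R ‖x‖ with h | h
    · simp [hfz x h]
    · exact mul_le_mul (hVb x) (mul_le_of_le_one_right (hf0 x) (by linarith))
        (mul_nonneg (hf0 x) (norm_nonneg _)) ((norm_nonneg _).trans (hVb x))
  have hX' : -(4 * ∫ x, ⟪V x, f x • x⟫) ≤ 4 * (L * (2 * (∫ x, ‖gradient f x‖) + ∫ x, f x)) := by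
    have e1 : ∫ x, ⟪V x, f x • x⟫ = t⁻¹ * ∫ x, ⟪B (x + t • e) - B x, f x • x⟫ := by
      rw [← integral_const_mul]
      simp_rw [hVB, real_inner_smul_left]
    have h1 := (abs_le.1 hX).1
    have h2 : -(L * (2 * (∫ x, ‖gradient f x‖) + ∫ x, f x)) ≤ ∫ x, ⟪V x, f x • x⟫ := by
      rw [e1, inv_mul_eq_div, le_div_iff₀ ht]
      linarith
    linarith
  set G : En n → ℝ := fun x => η x ^ 2 * ‖gradient w x‖ ^ 2 with hG
  have hGi : Integrable (T.indicator G) := by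
    rw [integrable_indicator_iff hTm]
    refine Measure.integrableOn_of_bounded (M := (Kw : ℝ) ^ 2) hTf
      ((hηL.continuous.measurable.pow_const 2).mul
        ((measurable_gradient w).norm.pow_const 2)).aestronglyMeasurable
      (Eventually.of_forall fun x => ?_)
    rw [Real.norm_of_nonneg (by positivity)]
    have h1 : ‖gradient w x‖ ^ 2 ≤ (Kw : ℝ) ^ 2 :=
      pow_le_pow_left₀ (norm_nonneg _) (norm_gradient_le hwL x) 2
    have h2 : η x ^ 2 ≤ 1 := pow_le_one₀ (hη0 x) (hη1 x)
    nlinarith [sq_nonneg (η x), sq_nonneg ‖gradient w x‖]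
  have hcalc : ∀ᵐ x, 3 / 8 * l * T.indicator G x ≤
      -⟪V x, gradient (fun x => η x * f x) x⟫ - 4 * ⟪V x, f x • x⟫ ∧
      4 * (L * (2 * ‖gradient f x‖ + f x)) ≤
        3 / 16 * l * T.indicator G x + T.indicator (fun _ => 110 * (L ^ 2 / l)) x := by
    filter_upwards [hE, hgw, hgη, ae_gradient_dq hu t e, ae_gradient_max_const hwL k,
      differentiableAt_ae hηL, differentiableAt_ae hψL, differentiableAt_ae hfL]
      with x hx1 hx2 hx3 hx4 hx5 hx6 hx7 hx8
    have hgf : gradient f x = η x • gradient ψ x + ψ x • gradient η x := gradient_mul hx6 hx7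
    have hgφ : gradient (fun x => η x * f x) x = η x • gradient f x + f x • gradient η x :=
      gradient_mul hx6 hx8
    rw [hgφ, hgf, hx3]
    by_cases hxR : ‖x‖ < R
    · rw [if_pos hxR]
      by_cases hkw : k < w x
      · have hxT : x ∈ T := ⟨mem_ball_zero_iff.2 hxR, hkw⟩
        rw [indicator_of_mem hxT, indicator_of_mem hxT]
        rw [if_pos hkw] at hx5
        have hVw : 3 / 8 * l * ‖gradient w x‖ ^ 2 ≤ -⟪V x, gradient w x⟫ := by
          rw [hx2]
          split_ifs with hd
          · have h1 : l * ‖gradient (dq u t e) x‖ ^ 2 ≤ ⟪V x, gradient (dq u t e) x⟫ := by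
              rw [hx4]
              exact ((hx1 (mem_ball_zero_iff.2 (hxR.trans hR)) hd).scale (inv_nonneg.2 ht.le)).1
            rw [norm_smul, real_inner_smul_right, mul_pow, Real.norm_eq_abs, sq_abs]
            linarith
          · simp
        rw [hx5]
        refine ⟨?_, ?_⟩
        · simp only [hG, hf, inner_add_right, real_inner_smul_right, smul_add]
          nlinarith [mul_le_mul_of_nonneg_left hVw (sq_nonneg (η x))]
        · have h1 : ‖η x • gradient w x + ψ x • (-2 : ℝ) • x‖ ≤ η x * ‖gradient w x‖ + 2 := by
            refine (norm_add_le _ _).trans ?_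
            rw [norm_smul, norm_smul, norm_smul, Real.norm_of_nonneg (hη0 x),
              Real.norm_of_nonneg (hψ0 x), Real.norm_eq_abs, abs_neg, abs_two]
            have : ψ x * (2 * ‖x‖) ≤ 1 * (2 * 1) := by
              have := hψ1 x
              have : ‖x‖ ≤ 1 := by linarith
              gcongr
            linarith
          have h2 := hf1 x
          set y := η x * ‖gradient w x‖ with hy
          have h3 : T.indicator G x = y ^ 2 := by rw [indicator_of_mem hxT, hG, hy]; ring
          have h4 : G x = y ^ 2 := by rw [hG, hy]; ring
          rw [h4]
          have h5 : 8 * L * y ≤ 3 / 16 * l * y ^ 2 + 256 / 3 * (L ^ 2 / l) := by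
            have : 0 ≤ 3 / 16 * l * (y - 64 / 3 * (L / l)) ^ 2 := by positivity
            have e1 : 3 / 16 * l * (y - 64 / 3 * (L / l)) ^ 2 =
                3 / 16 * l * y ^ 2 - 8 * L * y + 256 / 3 * (L ^ 2 / l) := by
              field_simp; ring
            linarith
          have h6 : L ≤ L ^ 2 / l := by rw [le_div_iff₀ hl]; nlinarith
          have h7 : L * (2 * ‖η x • gradient w x + ψ x • (-2 : ℝ) • x‖ + f x) ≤
              L * (2 * (y + 2) + 1) := by gcongr
          linarith
      · have hxT : x ∉ T := fun h => hkw h.2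
        rw [indicator_of_notMem hxT, indicator_of_notMem hxT]
        replace hx5 : gradient ψ x = 0 := hx5.trans (if_neg hkw)
        have : ψ x = 0 := max_eq_right (by linarith [not_lt.1 hkw])
        simp [hf, hx5, this]
    · have hxT : x ∉ T := fun h => hxR (mem_ball_zero_iff.1 h.1)
      have h1 := hηz x (not_lt.1 hxR)
      rw [indicator_of_notMem hxT, indicator_of_notMem hxT, hfz x (not_lt.1 hxR), h1, if_neg hxR]
      simp
  have hVφ := integrable_inner_gradient hφL (hasCompactSupport_of_zero hφz) hVm hVb
  have hgfi := integrable_norm_gradient hfL (hasCompactSupport_of_zero hfz)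
  have hci : Integrable (T.indicator fun _ => 110 * (L ^ 2 / l)) := by
    rw [integrable_indicator_iff hTm]
    exact integrableOn_const hTf
  have hVn : Integrable fun x => -⟪V x, gradient (fun x => η x * f x) x⟫ := hVφ.neg
  have h1 := integral_mono_ae (hGi.const_mul (3 / 8 * l)) (hVn.sub (hXi.const_mul 4))
    (hcalc.mono fun x hx => hx.1)
  have h2 := integral_mono_ae ((((hgfi.const_mul 2).add hfi).const_mul L).const_mul 4)
    ((hGi.const_mul (3 / 16 * l)).add hci) (hcalc.mono fun x hx => hx.2)
  simp only [Pi.sub_apply, Pi.add_apply] at h1 h2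
  rw [integral_const_mul, integral_sub hVn (hXi.const_mul 4), integral_neg, htest,
    integral_const_mul] at h1
  rw [integral_const_mul, integral_const_mul, integral_add (hgfi.const_mul 2) hfi,
    integral_const_mul, integral_add (hGi.const_mul (3 / 16 * l)) hci, integral_const_mul,
    integral_indicator_const _ hTm, smul_eq_mul] at h2
  have hI : ∫ x, T.indicator G x ≤ 600 * (L / l) ^ 2 * volume.real T := by
    have h3 : 3 / 16 * l * ∫ x, T.indicator G x ≤ volume.real T * (110 * (L ^ 2 / l)) := by linarith
    have h4 : 0 ≤ (L / l) ^ 2 * volume.real T := by positivity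
    have e1 : volume.real T * (110 * (L ^ 2 / l)) =
        3 / 16 * l * (110 * 16 / 3 * ((L / l) ^ 2 * volume.real T)) := by field_simp
    rw [e1] at h3
    have := le_of_mul_le_mul_left h3 (by positivity)
    linarith
  have hrR' : 0 < R - r := sub_pos.2 hrR
  rw [div_mul_eq_mul_div, le_div_iff₀ (by positivity), mul_comm]
  refine le_trans ?_ hI
  have hSm : MeasurableSet (ball (0 : En n) r ∩ {x | k < w x}) :=
    measurableSet_ball.inter (measurableSet_lt measurable_const hwL.continuous.measurable)
  rw [← integral_indicator hSm, ← integral_const_mul]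
  refine integral_mono_of_nonneg (Eventually.of_forall fun x => ?_) hGi
    (Eventually.of_forall fun x => ?_)
  · exact mul_nonneg (by positivity) (indicator_nonneg (fun _ _ => by positivity) _)
  · by_cases hx : x ∈ ball (0 : En n) r ∩ {x | k < w x}
    · have hxr := mem_ball_zero_iff.1 hx.1
      have hxT : x ∈ T := ⟨mem_ball_zero_iff.2 (hxr.trans hrR), hx.2⟩
      simp only [indicator_of_mem hx, indicator_of_mem hxT]
      change (R - r) ^ 2 * ‖gradient w x‖ ^ 2 ≤ η x ^ 2 * ‖gradient w x‖ ^ 2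
      refine mul_le_mul_of_nonneg_right (pow_le_pow_left₀ hrR'.le ?_ 2) (by positivity)
      simp only [hQr, min_eq_left (hxr.trans hrR).le]
      nlinarith [norm_nonneg x]
    · simp only [indicator_of_notMem hx, mul_zero]
      exact indicator_nonneg (fun _ _ => by positivity) _

end LowerDichotomy


section InteriorRegularity

variable {n : ℕ} {N : MinkowskiNorm n} {p s : ℝ} {u : En n → ℝ} {K : ℝ≥0}

theorem exists_expansion_of_tendsto {f : ℕ → En n → ℝ} {f₀ B : En n → ℝ} {S : Set (En n)}
    {g : ℕ → En n} {M : ℝ} (hf : ∀ y ∈ S, Tendsto (fun k => f k y) atTop (𝓝 (f₀ y)))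
    (hg : ∀ k, ‖g k‖ ≤ M) (h : ∀ y ∈ S, ∀ᶠ k in atTop, |f k y - ⟪g k, y⟫| ≤ B y) :
    ∃ G : En n, ‖G‖ ≤ M ∧ ∀ y ∈ S, |f₀ y - ⟪G, y⟫| ≤ B y := by
  obtain ⟨G, hG, φ, hφ, hlim⟩ := (isCompact_closedBall (0 : En n) M).tendsto_subseq
    fun k => mem_closedBall_zero_iff.2 (hg k)
  refine ⟨G, mem_closedBall_zero_iff.1 hG, fun y hy => ?_⟩
  exact le_of_tendsto ((((hf y hy).comp hφ.tendsto_atTop)).sub (hlim.inner tendsto_const_nhds)).abs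
    (hφ.tendsto_atTop.eventually (h y hy))

theorem expansion_of_dq {C α ρ : ℝ} (hC : 0 ≤ C) (hρ : 0 < ρ) {g z : En n}
    (h : ∀ e : En n, ‖e‖ = 1 → ∀ t : ℝ, 0 < t → t ≤ ρ / 2 →
      |dq u t e z - ⟪g, e⟫| ≤ C * (t / ρ) ^ α) {y : En n} (hy : ‖y‖ ≤ ρ / 2) :
    |u (z + y) - u z - ⟪g, y⟫| ≤ C / ρ ^ α * ‖y‖ ^ (1 + α) := by
  rcases eq_or_ne y 0 with rfl | hy0
  · simp only [add_zero, sub_self, inner_zero_right, abs_zero, norm_zero]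
    positivity
  have ht := norm_pos_iff.2 hy0
  have h1 := h (‖y‖⁻¹ • y) (by
    rw [norm_smul, norm_inv, norm_norm, inv_mul_cancel₀ ht.ne']) ‖y‖ ht hy
  rw [dq, smul_inv_smul₀ ht.ne', inner_smul_right, ← mul_sub, abs_mul, abs_of_pos (inv_pos.2 ht),
    inv_mul_le_iff₀ ht, Real.div_rpow ht.le hρ.le] at h1
  refine h1.trans_eq ?_
  rw [Real.rpow_add ht, Real.rpow_one]
  ring

theorem dq_le_of_small {t₀ κ : ℝ} (ht₀ : 0 < t₀) {e : En n} {r : ℝ}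
    (h : ∀ t : ℝ, 0 < t → t ≤ t₀ → ∀ x ∈ ball (0 : En n) r, dq u t e x ≤ κ) {t : ℝ} (ht : 0 < t)
    {x : En n} (hx : x ∈ ball (0 : En n) r) (hxt : x + t • e ∈ ball (0 : En n) r) :
    dq u t e x ≤ κ := by
  obtain ⟨m, hm⟩ := pow_unbounded_of_one_lt (t / t₀) (one_lt_two (α := ℝ))
  have hm' : t ≤ 2 ^ m * t₀ := ((div_lt_iff₀ ht₀).1 hm).le
  clear hm
  induction m generalizing t x with
  | zero => exact h t ht (by simpa using hm') x hx
  | succ m ih =>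
    have hmid : x + (t / 2) • e ∈ ball (0 : En n) r := by
      have := (convex_ball (0 : En n) r) hx hxt (a := 1 / 2) (b := 1 / 2) (by norm_num)
        (by norm_num) (by norm_num)
      convert this using 1
      module
    have h2 : t / 2 ≤ 2 ^ m * t₀ := by rw [pow_succ] at hm'; linarith
    have h3 := ih (half_pos ht) hx hmid h2
    have h4 := ih (half_pos ht) hmid (by rwa [add_assoc, ← add_smul, add_halves]) h2
    rw [dq_half]; linarith

theorem interior_dichotomy (N : MinkowskiNorm n) (hn : 2 ≤ n) (hp : 1 < p) :
    ∃ δ C α : ℝ, 0 < δ ∧ δ ≤ 1 / 2 ∧ 0 ≤ C ∧ 0 < α ∧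
    α ≤ 1 ∧ ∀ (s : ℝ) (u : En n → ℝ), s ≠ 0 → LipschitzWith 1 u → WSol N p s u 0 4 →
    (∀ x ∈ ball (0 : En n) (1 / 2), ∀ y ∈ ball (0 : En n) (1 / 2),
      u y - u x ≤ (1 - δ) * ‖y - x‖) ∨
    ∃ g : En n, ‖g‖ ≤ 1 ∧ ∀ y : En n, ‖y‖ ≤ 1 / 16 →
      |u y - u 0 - ⟪g, y⟫| ≤ C * ‖y‖ ^ (1 + α) := by
  obtain ⟨l, L, hl, hL, hE⟩ := flux_ell_cone N p hp
  have hγ : 1 ≤ 600 * (L / l) ^ 2 := by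
    have : 1 ≤ L / l := (one_le_div hl).2 hL
    nlinarith
  obtain ⟨ν, hν, hfirst⟩ := deGiorgi_first hn hγ
  obtain ⟨δ, hδ, hδ1, hgrow⟩ := growth hn hl hL hν
  obtain ⟨C, α, hC, hα, hα1, hX⟩ := exists_dq_expansion_at (N := N) hn hp hl hL
  refine ⟨δ / 32, C / (1 / 8) ^ α, α, by positivity, by linarith, by positivity, hα, hα1,
    fun s u hs hu hw => ?_⟩
  obtain ⟨c, hc, hcone, hbd⟩ := hE s
  obtain ⟨t₀, ht₀, ht₁, happ⟩ := hw.dq_approx hn hp hs hu (ε := 1 / 32) (by norm_num)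
  have hw2 : WSol N p s u 0 2 := fun K φ hφ r hr hz => hw K φ hφ r (by linarith) hz
  have hg1 : ∀ x, ‖gradient u x‖ ≤ 1 := fun x => by simpa using norm_gradient_le hu x
  have hpair : ∀ e : En n, ‖e‖ = 1 → ∀ t : ℝ, 0 < t → t ≤ t₀ → ∀ᵐ x, x ∈ ball (0 : En n) 1 →
      1 / 2 < dq u t e x → PairEll l L (fun ξ => c • flux N p s ξ) (gradient u (x + t • e))
        (gradient u x) := fun e he t ht ht1 => by
    filter_upwards [happ e he t ht ht1] with x hx hb hd
    obtain ⟨h1, h2⟩ := hx hb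
    exact hcone e he _ _ (hg1 _) (hg1 _) (by linarith [(abs_le.1 h2).2])
      (by linarith [(abs_le.1 h1).2])
  by_cases hcase : ∀ e : En n, ‖e‖ = 1 →
      ν ≤ volume.real (ball (0 : En n) (3 / 4) ∩ {x | ⟪gradient u x, e⟫ ≤ 15 / 16})
  · left
    have hsmall : ∀ e : En n, ‖e‖ = 1 → ∀ t : ℝ, 0 < t → t ≤ t₀ →
        ∀ x ∈ ball (0 : En n) (1 / 2), dq u t e x ≤ 1 - δ / 32 := fun e he t ht ht1 x hx => by
      have hsub := subSol_dq hp hu hw2 ht (by linarith) he (a := 32) (k := 31 / 32) (l := l) (L := L)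
        (c := c) (by norm_num) ((hpair e he t ht ht1).mono fun x hx hb hd => hx hb (by linarith))
      have h1 := hgrow _ _ hsub (fun x _ => by linarith [(abs_le.1 (abs_dq_le hu ht he x)).2])
        ((hcase e he).trans (ENNReal.toReal_mono ?_ (measure_mono_ae ?_))) x hx
      · linarith
      · exact (volume_ball_inter_ne_top _ _)
      · filter_upwards [happ e he t ht ht1] with x hx hxm
        obtain ⟨h1, h2⟩ := hxm
        have h3 := (abs_le.1 (hx (ball_subset_ball (by norm_num) h1)).1).2
        have h2' : ⟪gradient u x, e⟫ ≤ 15 / 16 := h2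
        exact ⟨h1, (by linarith : 32 * (dq u t e x - 31 / 32) ≤ 0)⟩
    intro x hx y hy
    rcases eq_or_ne y x with rfl | hne
    · simp
    have ht := norm_pos_iff.2 (sub_ne_zero.2 hne)
    have h1 := dq_le_of_small ht₀ (hsmall (‖y - x‖⁻¹ • (y - x)) (by
      rw [norm_smul, norm_inv, norm_norm, inv_mul_cancel₀ ht.ne'])) ht hx (by
      rwa [smul_inv_smul₀ ht.ne', add_sub_cancel])
    rwa [dq, smul_inv_smul₀ ht.ne', add_sub_cancel, inv_mul_le_iff₀ ht, mul_comm] at h1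
  · right
    push Not at hcase
    obtain ⟨e, he, hlt⟩ := hcase
    have ht2 : t₀ ≤ 1 := by linarith
    obtain ⟨KD, hD⟩ := lipschitz_dq hu t₀ e
    have hlow := hfirst _ _ ((lipschitzWith_smul (8 / 3 : ℝ) (β := ℝ)).comp
      ((LipschitzWith.const (7 / 8 : ℝ)).sub (hD.max_const (1 / 2))))
      (weakCacc_dq hp hu hw2 ht₀ ht2 he hl hL (hpair e he t₀ ht₀ le_rfl) hbd)
      (fun x _ => by
        have := le_max_right (dq u t₀ e x) (1 / 2)
        change 8 / 3 * (7 / 8 - max (dq u t₀ e x) (1 / 2)) ≤ 1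
        linarith) (le_trans (ENNReal.toReal_mono (volume_ball_inter_ne_top _ _)
          (measure_mono_ae ?_)) hlt.le)
    swap
    · filter_upwards [happ e he t₀ ht₀ le_rfl] with x hx hxm
      obtain ⟨h1, h2⟩ := hxm
      have h3 := (abs_le.1 (hx (ball_subset_ball (by norm_num) h1)).1).1
      have h2' : 0 < 8 / 3 * (7 / 8 - max (dq u t₀ e x) (1 / 2)) := h2
      have h4 := le_max_left (dq u t₀ e x) (1 / 2)
      exact ⟨h1, (by linarith : ⟪gradient u x, e⟫ ≤ 15 / 16)⟩
    have hae : ∀ᵐ x, x ∈ ball (0 : En n) (1 / 2) → 1 / 8 ≤ ⟪gradient u x, e⟫ := by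
      filter_upwards [happ e he t₀ ht₀ le_rfl] with x hx hxb
      have h1 : 8 / 3 * (7 / 8 - max (dq u t₀ e x) (1 / 2)) ≤ 1 / 2 := hlow x hxb
      have h3 := (abs_le.1 (hx (ball_subset_ball (by norm_num) hxb)).1).2
      have h4 : max (dq u t₀ e x) (1 / 2) ≤ max (dq u t₀ e x) (11 / 16 - 1 / 16) := by
        gcongr; norm_num
      rcases max_choice (dq u t₀ e x) (11 / 16 - 1 / 16) with h5 | h5 <;> rw [h5] at h4 <;> linarith
    have hz : ∀ k : ℕ, ∃ z : En n, ‖z‖ < 1 / 8 / (k + 1) ∧ DifferentiableAt ℝ u z := fun k => by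
      have := (MeasureTheory.Measure.dense_of_ae (differentiableAt_ae hu)).inter_open_nonempty _
        (isOpen_ball (x := (0 : En n)) (ε := 1 / 8 / (k + 1))) (nonempty_ball.2 (by positivity))
      obtain ⟨z, h1, h2⟩ := this
      exact ⟨z, mem_ball_zero_iff.1 h1, h2⟩
    choose z hz1 hz2 using hz
    have hz0 : Tendsto z atTop (𝓝 0) := by
      refine squeeze_zero_norm (fun k => (hz1 k).le) ?_
      have := (tendsto_one_div_add_atTop_nhds_zero_nat (𝕜 := ℝ)).const_mul (1 / 8)
      simpa [div_eq_mul_inv] using this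
    have hz8 : ∀ k, ‖z k‖ < 1 / 8 := fun k => (hz1 k).trans_le
      (div_le_self (by norm_num) (by linarith [(Nat.cast_nonneg k : (0 : ℝ) ≤ k)]))
    obtain ⟨g, hg, hexp⟩ := exists_expansion_of_tendsto (f := fun k y => u (z k + y) - u (z k))
      (f₀ := fun y => u y - u 0) (S := {y | ‖y‖ ≤ 1 / 16}) (g := fun k => gradient u (z k)) (M := 1)
      (B := fun y => C / (1 / 8) ^ α * ‖y‖ ^ (1 + α)) (fun y _ => by
        have h1 := (hu.continuous.tendsto _).comp (hz0.add_const y)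
        rw [zero_add] at h1
        exact h1.sub ((hu.continuous.tendsto _).comp hz0)) (fun k => hg1 _)
      (fun y hy => Eventually.of_forall fun k => expansion_of_dq hC (by norm_num)
        (fun e' he' t ht ht1 => hX s c 4 (1 / 8) u {ξ | ‖ξ‖ ≤ 1 ∧ 1 / 8 ≤ ⟪ξ, e⟫} (z k) (by norm_num)
          hu hw (by linarith [hz8 k])
          (fun ξ hξ η hη => hcone e he ξ η hξ.1 hη.1 hξ.2 hη.2) (by
            filter_upwards [hae] with x hx hxz
            refine ⟨hg1 x, hx ?_⟩
            have := norm_add_le (x - z k) (z k)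
            rw [sub_add_cancel] at this
            rw [mem_ball_zero_iff]
            linarith [hz8 k]) (hz2 k) e' he' t ht ht1)
        (by have : ‖y‖ ≤ 1 / 16 := hy
            linarith))
    exact ⟨g, hg, hexp⟩

theorem abs_expansion_le_of_norm_ge (hu : LipschitzWith 1 u) {g y : En n} (hg : ‖g‖ ≤ 1) {α : ℝ}
    (hα : 0 < α) (hα1 : α ≤ 1) (hy : 1 / 16 ≤ ‖y‖) (hy1 : ‖y‖ < 1) :
    |u y - u 0 - ⟪g, y⟫| ≤ 32 * ‖y‖ ^ (1 + α) := by
  have h1 := hu.dist_le_mul y 0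
  rw [Real.dist_eq, dist_zero_right, NNReal.coe_one, one_mul] at h1
  have h2 := (abs_real_inner_le_norm g y).trans (mul_le_of_le_one_left (norm_nonneg y) hg)
  have h3 : ‖y‖ ^ (2 : ℝ) ≤ ‖y‖ ^ (1 + α) :=
    Real.rpow_le_rpow_of_exponent_ge (by linarith) hy1.le (by linarith)
  rw [Real.rpow_two] at h3
  refine (abs_sub _ _).trans ?_
  nlinarith

/-- Interior `C^{1,α}` estimate for the regularized equation, uniform in the regularization
parameter, in the form of a first order expansion. -/
theorem exists_expansion (N : MinkowskiNorm n) (hn : 2 ≤ n) (hp : 1 < p) : ∃ C α : ℝ, 0 ≤ C ∧ 0 < α ∧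
    α ≤ 1 ∧ ∀ (s : ℝ) (u : En n → ℝ), s ≠ 0 → LipschitzWith 1 u → WSol N p s u 0 4 →
      ∃ g : En n, ‖g‖ ≤ 1 ∧ ∀ y ∈ ball (0 : En n) 1,
        |u y - u 0 - ⟪g, y⟫| ≤ C * ‖y‖ ^ (1 + α) := by
  obtain ⟨δ, C₀, α₀, hδ, hδ1, hC₀, hα₀, hα₁, hdich⟩ := interior_dichotomy N hn hp
  have hd0 : 0 < 1 - δ := by linarith
  have hlog : 0 < Real.logb 8 (1 / (1 - δ)) :=
    Real.logb_pos (by norm_num) ((one_lt_div hd0).2 (by linarith))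
  set α := min α₀ (Real.logb 8 (1 / (1 - δ))) with hα
  have hα0 : 0 < α := lt_min hα₀ hlog
  have hα1 : α ≤ 1 := (min_le_left _ _).trans hα₁
  have h8 : (8 : ℝ) ^ α * (1 - δ) ≤ 1 := by
    rw [← le_div_iff₀ hd0]
    refine (Real.rpow_le_rpow_of_exponent_le (by norm_num) (min_le_right _ _)).trans_eq ?_
    exact Real.rpow_logb (by norm_num) (by norm_num) (by positivity)
  set C := max C₀ 32 with hC
  have hC0 : 0 ≤ C := hC₀.trans (le_max_left _ _)
  refine ⟨C, α, hC0, hα0, hα1, fun s u hs hu hw => ?_⟩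
  have key : ∀ m : ℕ, ∀ (s : ℝ) (u : En n → ℝ), s ≠ 0 → LipschitzWith 1 u → WSol N p s u 0 4 →
      ∃ g : En n, ‖g‖ ≤ 1 ∧ ∀ y ∈ ball (0 : En n) 1, (1 / 8) ^ m ≤ ‖y‖ →
        |u y - u 0 - ⟪g, y⟫| ≤ C * ‖y‖ ^ (1 + α) := by
    intro m
    induction m with
    | zero =>
      refine fun s u _ _ _ => ⟨0, by simp, fun y hy h => ?_⟩
      rw [mem_ball_zero_iff] at hy
      rw [pow_zero] at h
      linarith
    | succ m ih =>
      intro s u hs hu hw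
      have hlarge : ∀ g : En n, ‖g‖ ≤ 1 → ∀ y ∈ ball (0 : En n) 1, 1 / 16 ≤ ‖y‖ →
          |u y - u 0 - ⟪g, y⟫| ≤ C * ‖y‖ ^ (1 + α) := fun g hg y hy hy1 =>
        (abs_expansion_le_of_norm_ge hu hg hα0 hα1 hy1 (mem_ball_zero_iff.1 hy)).trans
          (mul_le_mul_of_nonneg_right (le_max_right _ _) (by positivity))
      rcases hdich s u hs hu hw with hI | ⟨g, hg, hII⟩
      · have hon : LipschitzOnWith (Real.toNNReal (1 - δ)) u (ball (0 : En n) (1 / 2)) := by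
          refine LipschitzOnWith.of_dist_le_mul fun x hx y hy => ?_
          rw [Real.coe_toNNReal _ hd0.le, Real.dist_eq, dist_eq_norm, abs_le]
          have h1 := hI x hx y hy
          have h2 := hI y hy x hx
          rw [norm_sub_rev] at h1
          constructor <;> linarith
        obtain ⟨v, hv, hvu⟩ := hon.extend_real
        have hwv : WSol N p s v 0 (1 / 2) := by
          refine WSol.congr (u := u) (fun K φ hφ r hr hz => hw K φ hφ r (by linarith) hz)
            fun x hx => (hvu (by simpa using hx)).symm
        have hw1 := hwv.rescale (z' := 0) (ρ := 1 / 8) (R' := 4) (by norm_num) hd0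
          (by norm_num)
        have hLip : LipschitzWith 1 fun x => ((1 - δ) * (1 / 8))⁻¹ * v (0 + (1 / 8 : ℝ) • x) := by
          refine LipschitzWith.of_dist_le_mul fun x y => ?_
          have h1 := (lipschitz_comp_homothety hv 0 (1 / 8)).dist_le_mul x y
          rw [NNReal.coe_mul, Real.coe_toNNReal _ hd0.le, coe_nnnorm,
            Real.norm_of_nonneg (by norm_num)] at h1
          rw [Real.dist_eq, ← mul_sub, abs_mul, abs_of_pos (by positivity),
            inv_mul_le_iff₀ (by positivity)]
          simpa [Real.dist_eq] using h1
        obtain ⟨g, hg, hexp⟩ := ih _ _ (div_ne_zero hs hd0.ne') hLip hw1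
        have hg' : ‖(1 - δ) • g‖ ≤ 1 := by
          rw [norm_smul, Real.norm_of_nonneg hd0.le]
          exact mul_le_one₀ (by linarith) (norm_nonneg _) hg
        refine ⟨(1 - δ) • g, hg', fun y hy hym => ?_⟩
        by_cases hy8 : ‖y‖ < 1 / 8
        · have h8y : ‖(8 : ℝ) • y‖ = 8 * ‖y‖ := by
            rw [norm_smul, Real.norm_of_nonneg (by norm_num)]
          have h1 := hexp ((8 : ℝ) • y) (by rw [mem_ball_zero_iff, h8y]; linarith) (by
            rw [h8y]; rw [pow_succ] at hym; linarith)
          have e1 : (0 : En n) + (1 / 8 : ℝ) • (8 : ℝ) • y = y := by module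
          have e2 : (0 : En n) + (1 / 8 : ℝ) • (0 : En n) = 0 := by simp
          have m1 : y ∈ ball (0 : En n) (1 / 2) := by rw [mem_ball_zero_iff]; linarith
          rw [e1, e2, ← hvu m1, ← hvu (mem_ball_self (by norm_num)), h8y, inner_smul_right,
            Real.mul_rpow (by norm_num) (norm_nonneg _), Real.rpow_add (by norm_num),
            Real.rpow_one] at h1
          have e3 : u y - u 0 - ⟪(1 - δ) • g, y⟫ = (1 - δ) * (1 / 8) *
              (((1 - δ) * (1 / 8))⁻¹ * u y - ((1 - δ) * (1 / 8))⁻¹ * u 0 - 8 * ⟪g, y⟫) := by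
            rw [real_inner_smul_left]; field_simp
          rw [e3, abs_mul, abs_of_pos (by positivity)]
          calc _ ≤ (1 - δ) * (1 / 8) * (C * (8 * 8 ^ α * ‖y‖ ^ (1 + α))) := by gcongr
            _ = (8 ^ α * (1 - δ)) * (C * ‖y‖ ^ (1 + α)) := by ring
            _ ≤ _ := mul_le_of_le_one_left (by positivity) h8
        · exact hlarge _ hg' y hy (by linarith)
      · refine ⟨g, hg, fun y hy _ => ?_⟩
        by_cases hy1 : ‖y‖ ≤ 1 / 16
        · refine (hII y hy1).trans (mul_le_mul (le_max_left _ _) ?_ (by positivity) hC0)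
          rcases eq_or_ne y 0 with rfl | h0
          · rw [norm_zero, Real.zero_rpow (by positivity)]; positivity
          · exact Real.rpow_le_rpow_of_exponent_ge (norm_pos_iff.2 h0)
              (mem_ball_zero_iff.1 hy).le (by linarith [min_le_left α₀ (Real.logb 8 (1 / (1 - δ)))])
        · exact hlarge g hg y hy (by linarith)
  choose g hg hexp using fun m => key m s u hs hu hw
  refine exists_expansion_of_tendsto (f := fun _ y => u y - u 0) (fun y _ => tendsto_const_nhds) hg
    fun y hy => ?_
  rcases eq_or_ne y 0 with rfl | h0
  · refine Eventually.of_forall fun k => ?_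
    simp only [sub_self, inner_zero_right, abs_zero]
    positivity
  · have := (tendsto_pow_atTop_nhds_zero_of_lt_one (r := (1 / 8 : ℝ)) (by norm_num)
      (by norm_num)).eventually (gt_mem_nhds (norm_pos_iff.2 h0))
    filter_upwards [this] with m hm using hexp m y hy hm.le

end InteriorRegularity


section GlobalLimit

variable {n : ℕ} {N : MinkowskiNorm n} {p : ℝ}

theorem hasFDerivWithinAt_of_expansion {u : En n → ℝ} {S : Set (En n)} {x g : En n} {B α r : ℝ}
    (hα : 0 < α) (hr : 0 < r)
    (h : ∀ y ∈ S, ‖y - x‖ < r → |u y - u x - ⟪g, y - x⟫| ≤ B * ‖y - x‖ ^ (1 + α)) :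
    HasFDerivWithinAt u (innerSL ℝ g) S x := by
  rw [hasFDerivWithinAt_iff_isLittleO, Asymptotics.isLittleO_iff]
  intro c hc
  have h1 : Tendsto (fun y => |B| * ‖y - x‖ ^ α) (𝓝[S] x) (𝓝 0) := by
    have h2 : ContinuousAt (fun y => |B| * ‖y - x‖ ^ α) x :=
      continuousAt_const.mul ((by fun_prop : ContinuousAt (fun y => ‖y - x‖) x).rpow_const
        (Or.inr hα.le))
    have h3 := h2.tendsto.mono_left (nhdsWithin_le_nhds (s := S))
    rwa [sub_self, norm_zero, Real.zero_rpow hα.ne', mul_zero] at h3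
  filter_upwards [self_mem_nhdsWithin, mem_nhdsWithin_of_mem_nhds (ball_mem_nhds x hr),
    h1.eventually (gt_mem_nhds hc)] with y hy hyr hyc
  rw [mem_ball, dist_eq_norm] at hyr
  rw [Real.norm_eq_abs, innerSL_apply_apply]
  rcases (norm_nonneg (y - x)).eq_or_lt with h0 | h0
  · have := h y hy hyr
    rwa [← h0, Real.zero_rpow (by linarith), mul_zero, ← mul_zero c, h0] at this
  · refine (h y hy hyr).trans ?_
    rw [Real.rpow_add h0, Real.rpow_one, mul_left_comm, mul_comm]
    gcongr
    exact (mul_le_mul_of_nonneg_right (le_abs_self B) (by positivity)).trans hyc.le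

theorem hasGradientAt_of_expansion {u : En n → ℝ} {x g : En n} {B α r : ℝ}
    (hα : 0 < α) (hr : 0 < r)
    (h : ∀ y, ‖y - x‖ < r → |u y - u x - ⟪g, y - x⟫| ≤ B * ‖y - x‖ ^ (1 + α)) :
    HasGradientAt u g x :=
  hasFDerivWithinAt_univ.1 (hasFDerivWithinAt_of_expansion hα hr fun y _ hy => h y hy)

theorem exists_expansion_ball (N : MinkowskiNorm n) (hn : 2 ≤ n) (hp : 1 < p) (L : ℝ≥0) :
    ∃ C α : ℝ, 0 ≤ C ∧ 0 < α ∧ α ≤ 1 ∧ ∀ (s : ℝ) (u : En n → ℝ) (x : En n) (d : ℝ), s ≠ 0 →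
      LipschitzWith L u → 0 < d → WSol N p s u x d → ∃ g : En n, ‖g‖ ≤ L + 1 ∧
        ∀ y, ‖y - x‖ < d / 4 → |u y - u x - ⟪g, y - x⟫| ≤ C / d ^ α * ‖y - x‖ ^ (1 + α) := by
  obtain ⟨C, α, hC, hα, hα1, h⟩ := exists_expansion N hn hp
  refine ⟨(L + 1) * (4 ^ α * C), α, by positivity, hα, hα1, fun s u x d hs hu hd hw => ?_⟩
  set μ : ℝ := L + 1 with hμ
  have hμ0 : 0 < μ := by positivity
  have hρ : 0 < d / 4 := by positivity
  obtain ⟨g, hg, hexp⟩ := h (s / μ) _ (div_ne_zero hs hμ0.ne')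
    (LipschitzWith.of_dist_le_mul fun a b => by
      have h1 := hu.dist_le_mul (x + (d / 4) • a) (x + (d / 4) • b)
      rw [dist_add_left, dist_smul₀, Real.norm_of_nonneg hρ.le] at h1
      rw [Real.dist_eq, ← mul_sub, abs_mul, abs_of_pos (by positivity), inv_mul_le_iff₀ (by positivity),
        ← Real.dist_eq, NNReal.coe_one, one_mul]
      exact h1.trans (by rw [mul_assoc]; gcongr; linarith))
    (hw.rescale (z' := x) (ρ := d / 4) (R' := 4) hρ hμ0 (by simp))
  refine ⟨μ • g, by rw [norm_smul, Real.norm_of_nonneg hμ0.le]; nlinarith, fun y hy => ?_⟩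
  have h2 := hexp ((d / 4)⁻¹ • (y - x)) (by
    rwa [mem_ball_zero_iff, norm_smul, Real.norm_of_nonneg (by positivity), inv_mul_lt_iff₀ hρ,
      mul_one])
  simp only [smul_inv_smul₀ hρ.ne', add_sub_cancel, smul_zero, add_zero, inner_smul_right,
    norm_smul, Real.norm_of_nonneg (inv_nonneg.2 hρ.le)] at h2
  have e : u y - u x - ⟪μ • g, y - x⟫ = μ * (d / 4) * ((μ * (d / 4))⁻¹ * u y - (μ * (d / 4))⁻¹ * u x
      - (d / 4)⁻¹ * ⟪g, y - x⟫) := by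
    rw [real_inner_smul_left]; field_simp
  rw [e, abs_mul, abs_of_pos (by positivity)]
  refine (mul_le_mul_of_nonneg_left h2 (by positivity)).trans_eq ?_
  rw [Real.mul_rpow (by positivity) (norm_nonneg _), Real.inv_rpow hρ.le, Real.rpow_add hρ,
    Real.rpow_one, Real.div_rpow hd.le (by norm_num)]
  field_simp

theorem tendsto_gradient_of_expansion {u : ℕ → En n → ℝ} {v : En n → ℝ} {g : ℕ → En n} {x : En n}
    {B α r M : ℝ} (hα : 0 < α) (hr : 0 < r) (hu : ∀ y, Tendsto (fun k => u k y) atTop (𝓝 (v y)))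
    (hg : ∀ k, ‖g k‖ ≤ M) (h : ∀ᶠ k in atTop, ∀ y, ‖y - x‖ < r →
      |u k y - u k x - ⟪g k, y - x⟫| ≤ B * ‖y - x‖ ^ (1 + α)) :
    (‖gradient v x‖ ≤ M ∧ ∀ y, ‖y - x‖ < r →
      |v y - v x - ⟪gradient v x, y - x⟫| ≤ B * ‖y - x‖ ^ (1 + α)) ∧ DifferentiableAt ℝ v x ∧
    Tendsto (fun k => gradient (u k) x) atTop (𝓝 (gradient v x)) := by
  have key : ∀ G : En n, MapClusterPt G atTop g → ∀ y, ‖y - x‖ < r →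
      |v y - v x - ⟪G, y - x⟫| ≤ B * ‖y - x‖ ^ (1 + α) := fun G hG y hy => by
    obtain ⟨U, hU, hlim⟩ := mapClusterPt_iff_ultrafilter.1 hG
    exact le_of_tendsto ((((hu y).sub (hu x)).mono_left hU).sub
      (hlim.inner tendsto_const_nhds)).abs ((h.filter_mono hU).mono fun k hk => hk y hy)
  obtain ⟨G, hG, hGc⟩ := (isCompact_closedBall (0 : En n) M).exists_mapClusterPt (f := atTop) (u := g)
    (tendsto_principal.2 (Eventually.of_forall fun k => mem_closedBall_zero_iff.2 (hg k)))
  have hgr := hasGradientAt_of_expansion hα hr (key G hGc)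
  rw [hgr.gradient]
  refine ⟨⟨mem_closedBall_zero_iff.1 hG, key G hGc⟩, hgr.differentiableAt, ?_⟩
  have h1 : Tendsto g atTop (𝓝 G) := (isCompact_closedBall (0 : En n) M).tendsto_nhds_of_unique_mapClusterPt
    (Eventually.of_forall fun k => mem_closedBall_zero_iff.2 (hg k)) fun G' _ hG' =>
      (hasGradientAt_of_expansion hα hr (key G' hG')).unique hgr
  exact h1.congr' (h.mono fun k hk => (hasGradientAt_of_expansion hα hr hk).gradient.symm)

theorem norm_flux_le (N : MinkowskiNorm n) (hp : 1 < p) : ∃ C : ℝ, 0 ≤ C ∧ ∀ s (ξ : En n),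
    ‖flux N p s ξ‖ ≤ C * (N.F ξ ^ 2 + s ^ 2) ^ ((p - 1) / 2) := by
  obtain ⟨Λ, hΛ, h1⟩ := legendre_norm_le (N := N)
  obtain ⟨m, _, hm, _, h2⟩ := F_bounds N
  refine ⟨Λ / m, by positivity, fun s ξ => ?_⟩
  rcases eq_or_ne ξ 0 with rfl | hξ
  · rw [flux_zero, norm_zero]; positivity
  have h3 := N.pos ξ hξ
  have h0 : 0 < N.F ξ ^ 2 + s ^ 2 := by positivity
  rw [flux, norm_smul, Real.norm_of_nonneg (by positivity), (by ring : (p - 1) / 2 = (p - 2) / 2 + 1 / 2),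
    Real.rpow_add h0, ← Real.sqrt_eq_rpow, mul_left_comm]
  gcongr
  calc _ ≤ Λ * ‖ξ‖ := h1 ξ
    _ ≤ Λ / m * N.F ξ := by
      rw [div_mul_eq_mul_div, le_div_iff₀ hm, mul_assoc, mul_comm ‖ξ‖]
      exact mul_le_mul_of_nonneg_left (h2 ξ).1 hΛ.le
    _ ≤ _ := by
      gcongr
      exact Real.le_sqrt_of_sq_le (by nlinarith)

theorem tendsto_flux (hp : 1 < p) {s : ℕ → ℝ} (hs : Tendsto s atTop (𝓝 0)) {ξ : ℕ → En n} {ξ₀ : En n}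
    (hξ : Tendsto ξ atTop (𝓝 ξ₀)) : Tendsto (fun k => flux N p (s k) (ξ k)) atTop (𝓝 (flux N p 0 ξ₀)) := by
  have hb : Tendsto (fun k => N.F (ξ k) ^ 2 + s k ^ 2) atTop (𝓝 (N.F ξ₀ ^ 2 + 0 ^ 2)) :=
    (((continuous_F N).tendsto _).comp hξ |>.pow 2).add (hs.pow 2)
  rcases eq_or_ne ξ₀ 0 with rfl | h
  · obtain ⟨C, -, hC⟩ := norm_flux_le N hp
    rw [flux_zero]
    refine squeeze_zero_norm (fun k => hC _ _) ?_
    have := (hb.rpow_const (p := (p - 1) / 2) (Or.inr (by linarith))).const_mul C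
    rwa [F_zero, zero_pow two_ne_zero, add_zero, Real.zero_rpow (by linarith), mul_zero] at this
  · have := N.pos ξ₀ h
    exact (hb.rpow_const (Or.inl (by positivity))).smul (((continuous_legendre N).tendsto _).comp hξ)

end GlobalLimit


section Decay

variable {n : ℕ} {p : ℝ} {u : En n → ℝ} {K : ℝ≥0}

theorem superlevel_step (hn : 2 ≤ n) (hp : 1 < p) (E : ℝ) : ∃ C : ℝ, 0 < C ∧
    ∀ (u : En n → ℝ) (K : ℝ≥0), LipschitzWith K u → HasCompactSupport u →
      (∫ x, ‖gradient u x‖ ^ p) ≤ E → ∀ t : ℝ, 0 < t → t ^ n * volume.real {x | 2 * t ≤ u x} ^ (n - 1) ≤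
        C * (volume.real {x | t ≤ u x} ^ (1 - 1 / p)) ^ n := by
  obtain ⟨C, hC, hS⟩ := weak_sobolev hn
  refine ⟨(C + 1) * (1 + |E|) ^ n, by positivity, fun u K hu hc hE t ht => ?_⟩
  set f : En n → ℝ := fun x => max (u x - t) 0 - max (u x - 2 * t) 0 with hf
  set A := {x | t ≤ u x} with hA
  have hAm : MeasurableSet A := hu.continuous.measurable measurableSet_Ici
  have hAK : A ⊆ tsupport u := fun x hx => subset_tsupport _ (by
    rw [Function.mem_support]; exact (ht.trans_le hx).ne')
  have hAf : volume A ≠ ⊤ := (measure_mono hAK |>.trans_lt hc.isCompact.measure_lt_top).ne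
  have hL : ∀ c : ℝ, LipschitzWith K fun x => max (u x - c) 0 := fun c => by
    simpa using (hu.sub (LipschitzWith.const c)).max_const 0
  have hfL := (hL t).sub (hL (2 * t))
  have hfc : HasCompactSupport f := hc.comp_left (g := fun r => max (r - t) 0 - max (r - 2 * t) 0) (by
    rw [max_eq_right (by linarith), max_eq_right (by linarith), sub_zero])
  have h1 := hS f _ hfL hfc t ht
  have h2 : volume.real {x | 2 * t ≤ u x} ≤ volume.real {x | t ≤ |f x|} := by
    refine measureReal_mono (fun x (hx : 2 * t ≤ u x) => ?_) ((measure_mono (t := tsupport u)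
      (fun x (hx : t ≤ |f x|) => ?_)).trans_lt hc.isCompact.measure_lt_top).ne
    · change t ≤ |max (u x - t) 0 - max (u x - 2 * t) 0|
      rw [max_eq_left (by linarith), max_eq_left (by linarith), abs_of_nonneg] <;> linarith
    · refine subset_tsupport _ fun h0 => ?_
      simp only [hf, h0, zero_sub] at hx
      rw [max_eq_right (by linarith), max_eq_right (by linarith), sub_zero, abs_zero] at hx
      linarith
  have hgi : Integrable fun x => ‖gradient u x‖ ^ p :=
    (integrable_norm_gradient hu hc).bdd_mul (c := (K : ℝ) ^ (p - 1)) (f := fun x => ‖gradient u x‖ ^ (p - 1))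
      ((measurable_gradient u).norm.pow_const _).aestronglyMeasurable (Eventually.of_forall fun x => by
        rw [Real.norm_of_nonneg (by positivity)]
        exact Real.rpow_le_rpow (norm_nonneg _) (norm_gradient_le hu x) (by linarith)) |>.congr
      (Eventually.of_forall fun x => by
        change ‖gradient u x‖ ^ (p - 1) * ‖gradient u x‖ = _
        rcases (norm_nonneg (gradient u x)).eq_or_lt with h | h
        · simp only [← h, Real.zero_rpow (by linarith : p ≠ 0), mul_zero]
        · rw [← Real.rpow_add_one h.ne']; simp)
  set V := volume.real A with hV
  have hV0 : 0 ≤ V := measureReal_nonneg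
  have h3 : (∫ x, ‖gradient f x‖) ≤ (1 + |E|) * V ^ (1 - 1 / p) := by
    rcases hV0.eq_or_lt with h0 | h0
    · have hA0 : ∀ᵐ x, x ∉ A := measure_eq_zero_iff_ae_notMem.1
        (((ENNReal.toReal_eq_zero_iff _).1 h0.symm).resolve_right hAf)
      rw [integral_eq_zero_of_ae]
      · positivity
      filter_upwards [ae_gradient_max_const hu t, ae_gradient_max_const hu (2 * t), differentiableAt_ae (hL t),
        differentiableAt_ae (hL (2 * t)), hA0] with x h1 h2 d1 d2 hx
      have hx' : u x < t := not_le.1 hx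
      rw [hf, gradient_sub d1 d2, h1, h2, if_neg hx'.not_gt, if_neg (by linarith), sub_self, norm_zero]; rfl
    set μ := V ^ (-(1 / p)) with hμ
    have hμ0 : 0 < μ := by positivity
    have h4 : (∫ x, ‖gradient f x‖) ≤ ∫ x, (A.indicator (fun _ => μ) x + μ ^ (1 - p) * ‖gradient u x‖ ^ p) := by
      refine integral_mono_ae (integrable_norm_gradient hfL hfc) ((integrable_indicator_iff hAm |>.2
        (integrableOn_const hAf)).add (hgi.const_mul _)) ?_
      filter_upwards [ae_gradient_max_const hu t, ae_gradient_max_const hu (2 * t), differentiableAt_ae (hL t),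
        differentiableAt_ae (hL (2 * t))] with x h1 h2 d1 d2
      rw [hf, gradient_sub d1 d2, h1, h2]
      by_cases hx : x ∈ A
      · rw [indicator_of_mem hx]
        have h5 : ‖(if t < u x then gradient u x else 0) - (if 2 * t < u x then gradient u x else 0)‖ ≤
            ‖gradient u x‖ := by
          split_ifs <;> simp
        refine h5.trans ?_
        rcases le_total ‖gradient u x‖ μ with h6 | h6
        · have : 0 ≤ μ ^ (1 - p) * ‖gradient u x‖ ^ p := by positivity
          linarith
        · have h7 : 0 < ‖gradient u x‖ := hμ0.trans_le h6
          have : ‖gradient u x‖ = ‖gradient u x‖ ^ (1 - p) * ‖gradient u x‖ ^ p := by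
            rw [← Real.rpow_add h7]; simp
          have h8 : ‖gradient u x‖ ^ (1 - p) ≤ μ ^ (1 - p) :=
            Real.rpow_le_rpow_of_nonpos hμ0 h6 (by linarith)
          have h9 := mul_le_mul_of_nonneg_right h8 (by positivity : 0 ≤ ‖gradient u x‖ ^ p)
          linarith
      · have hx' : u x < t := not_le.1 hx
        rw [indicator_of_notMem hx, if_neg hx'.not_gt, if_neg (by linarith), sub_self, norm_zero]
        positivity
    rw [integral_add ((integrable_indicator_iff hAm).2 (integrableOn_const hAf)) (hgi.const_mul _),
      integral_indicator_const _ hAm, integral_const_mul, smul_eq_mul, ← hV] at h4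
    have h5 : V * μ = V ^ (1 - 1 / p) := by
      rw [hμ, mul_comm, ← Real.rpow_add_one h0.ne']; ring_nf
    have h6 : μ ^ (1 - p) = V ^ (1 - 1 / p) := by
      rw [hμ, ← Real.rpow_mul h0.le]
      congr 1; field_simp; ring
    rw [h5, h6] at h4
    have : (∫ x, ‖gradient u x‖ ^ p) ≤ |E| := hE.trans (le_abs_self _)
    have := mul_le_mul_of_nonneg_left this (by positivity : 0 ≤ V ^ (1 - 1 / p))
    linarith
  calc _ ≤ t ^ n * volume.real {x | t ≤ |f x|} ^ (n - 1) := by gcongr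
    _ ≤ C * (∫ x, ‖gradient f x‖) ^ n := h1
    _ ≤ C * ((1 + |E|) * V ^ (1 - 1 / p)) ^ n := by
      gcongr
    _ ≤ (C + 1) * ((1 + |E|) * V ^ (1 - 1 / p)) ^ n := by gcongr; linarith
    _ = _ := by rw [mul_pow, mul_assoc]

theorem superlevel_bound (hn : 2 ≤ n) (hp : 1 < p) (hpn : p < n) (E : ℝ) {t : ℝ} (ht : 0 < t) :
    ∃ C : ℝ, ∀ (u : En n → ℝ) (K : ℝ≥0), LipschitzWith K u → HasCompactSupport u →
      (∫ x, ‖gradient u x‖ ^ p) ≤ E → volume.real {x | t ≤ u x} ≤ C := by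
  obtain ⟨C, hC, h⟩ := superlevel_step hn hp E
  have hp0 : 0 < p := by linarith
  have hn1 : ((n - 1 : ℕ) : ℝ) = n - 1 := by rw [Nat.cast_sub (by omega), Nat.cast_one]
  have hnp : 0 < (n : ℝ) - p := by linarith
  set q : ℝ := n * p / (n - p) with hq
  set S : ℝ := (C * 2 ^ (q * (n - 1))) ^ (p / (n - p)) with hS
  have hS0 : 0 < S := by positivity
  have hq0 : 0 < q := by have : (0 : ℝ) < n := by linarith
                         positivity
  have hSp : C * 2 ^ (q * (n - 1)) = S ^ ((n - p) / p) := by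
    rw [hS, ← Real.rpow_mul (by positivity), div_mul_div_comm, mul_comm p, div_self (by positivity),
      Real.rpow_one]
  refine ⟨S * t ^ (-q), fun u K hu hc hE => ?_⟩
  have step : ∀ r : ℝ, 0 < r → volume.real {x | r ≤ u x} ≤ S * r ^ (-q) →
      volume.real {x | 2 * r ≤ u x} ≤ S * (2 * r) ^ (-q) := fun r hr hV => by
    refine le_of_pow_le_pow_left₀ (by omega : n - 1 ≠ 0) (by positivity)
      (le_of_mul_le_mul_left ((h u K hu hc hE r hr).trans ?_) (by positivity : 0 < r ^ n))
    have h1p : 0 ≤ 1 - 1 / p := by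
      rw [sub_nonneg, div_le_one hp0]; exact hp.le
    calc _ ≤ C * ((S * r ^ (-q)) ^ (1 - 1 / p)) ^ n := by gcongr
      _ = _ := by
        have e1 : C = S ^ ((n - p) / p) * 2 ^ (-(q * (n - 1))) := by
          rw [← hSp, mul_assoc, ← Real.rpow_add two_pos, add_neg_cancel, Real.rpow_zero, mul_one]
        rw [← Real.rpow_natCast, ← Real.rpow_natCast, ← Real.rpow_natCast, hn1,
          Real.mul_rpow hS0.le (by positivity), Real.mul_rpow two_pos.le hr.le,
          Real.mul_rpow (by positivity) (by positivity), Real.mul_rpow (by positivity) (by positivity),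
          Real.mul_rpow (by positivity) (by positivity)]
        simp only [← Real.rpow_mul hS0.le, ← Real.rpow_mul hr.le, ← Real.rpow_mul two_pos.le]
        have e2 : S ^ ((n : ℝ) - 1) = S ^ ((n - p) / p) * S ^ ((1 - 1 / p) * n) := by
          rw [← Real.rpow_add hS0]; congr 1; field_simp; ring
        have e3 : r ^ (-q * (1 - 1 / p) * n) = r ^ (n : ℝ) * r ^ (-q * ((n : ℝ) - 1)) := by
          rw [← Real.rpow_add hr]; congr 1; rw [hq]; field_simp; ring
        rw [e2, e3, neg_mul q]
        nth_rewrite 1 [e1]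
        ring
  have hlim : Tendsto (fun j : ℕ => S * (t * (1 / 2) ^ j) ^ (-q)) atTop atTop := by
    refine Tendsto.const_mul_atTop hS0 ((tendsto_rpow_neg_nhdsGT_zero (y := -q) (by linarith)).comp ?_)
    refine tendsto_nhdsWithin_iff.2 ⟨?_, Eventually.of_forall fun j => ?_⟩
    · simpa using (tendsto_pow_atTop_nhds_zero_of_lt_one (r := (1 / 2 : ℝ)) (by norm_num)
        (by norm_num)).const_mul t
    · rw [mem_Ioi]; positivity
  obtain ⟨m, hm⟩ := (hlim.eventually_ge_atTop (volume.real (tsupport u))).exists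
  have hind : ∀ j : ℕ, volume.real {x | 2 ^ j * (t * (1 / 2) ^ m) ≤ u x} ≤
      S * (2 ^ j * (t * (1 / 2) ^ m)) ^ (-q) := by
    intro j
    induction j with
    | zero =>
      rw [pow_zero, one_mul]
      refine (measureReal_mono (fun x hx => subset_tsupport _ ?_) hc.isCompact.measure_lt_top.ne).trans hm
      rw [Function.mem_support]
      exact ((by positivity : 0 < t * (1 / 2) ^ m).trans_le hx).ne'
    | succ j ih => rw [pow_succ', mul_assoc]; exact step _ (by positivity) ih
  have := hind m
  rwa [mul_left_comm, ← mul_pow, mul_one_div_cancel two_ne_zero, one_pow, mul_one] at this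

end Decay


section Capacitary

variable {n : ℕ} {N : MinkowskiNorm n} {p : ℝ}

theorem exists_annulus_lower (N : MinkowskiNorm n) (hp : 1 < p) : ∃ k : ℕ, 1 ≤ k ∧
    ∀ (s ρ₁ ρ₂ τ : ℝ) (y : En n) (W : En n → ℝ) (K : ℝ≥0), 0 < ρ₁ → ρ₁ < ρ₂ → 0 < τ →
      LipschitzWith K W → (∀ x, ‖x - y‖ < ρ₂ → 0 ≤ W x) → (∀ x, ‖x - y‖ ≤ ρ₁ → τ ≤ W x) →
      (∀ (K' : ℝ≥0) (φ : En n → ℝ), LipschitzWith K' φ → (∀ x, ‖x - y‖ ≤ ρ₁ → φ x = 0) →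
        (∀ x, ρ₂ ≤ ‖x - y‖ → φ x = 0) → (∀ x, τ ≤ W x → φ x = 0) →
        ∫ x, ⟪flux N p s (gradient W x), gradient φ x⟫ = 0) →
      ∀ x, ‖x - y‖ < ρ₂ →
        τ * min 1 ((ρ₂ - ‖x - y‖) / ρ₂ / ((ρ₂ / ρ₁) ^ (2 * k) - 1)) ≤ W x := by
  obtain ⟨l, Λ, hl, hlΛ, hE⟩ := fluxMat_bounds N p hp
  obtain ⟨k, hk⟩ := exists_nat_ge (n * Λ / l)
  rw [div_le_iff₀ hl] at hk
  refine ⟨k + 1, by omega, fun s ρ₁ ρ₂ τ y W K h1 h2 hτ hW h0 hin h x hx => ?_⟩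
  have hk1 : 1 ≤ k + 1 := by omega
  refine (mul_le_mul_of_nonneg_left (le_annB hk1 h1 h2 (x - y)) hτ.le).trans ?_
  have hg0 : ∀ x : En n, gradient (fun _ : En n => (0 : ℝ)) x = 0 := fun x => by simp [gradient]
  obtain ⟨C, hC⟩ := lipschitz_annB n hk1 h1 h2
  have hA : LipschitzWith C fun x => annB (k + 1) ρ₁ ρ₂ (x - y) :=
    LipschitzWith.of_dist_le_mul fun x x' => by
      have := hC.dist_le_mul (x - y) (x' - y)
      rwa [dist_sub_right] at this
  have := annulus_lower N p s hp (hE s) (hl.le.trans hlΛ) hk1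
    (by push_cast; nlinarith [(Nat.cast_nonneg k : (0 : ℝ) ≤ k)]) h1 h2 (y := y) hτ.le
    (b := fun _ => 0) (LipschitzWith.const (0 : ℝ)) hW isOpen_univ (fun x _ _ => mem_univ x)
    contDiffOn_const (fun x _ => inCone_zero l Λ x) (fun x _ hxy => by
      rw [hg0, zero_add, gradient_radB hxy, smul_smul]
      refine smul_ne_zero ?_ (sub_ne_zero.2 hxy)
      have := cap_denom_pos hk1 h1 h2
      have := norm_pos_iff.2 (sub_ne_zero.2 hxy)
      have : 0 < ρ₂ := h1.trans h2
      exact mul_ne_zero hτ.ne' (neg_ne_zero.2 (by positivity))) h0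
    (fun x hx => by rw [zero_add]; exact hin x hx)
    (h _ _ ((((lipschitzWith_smul τ).comp hA).sub ((hW.sub (LipschitzWith.const 0)).max_const 0)).max_const 0)
      (fun x hx => by
        have h3 := hin x hx
        simp only [Function.comp, smul_eq_mul]
        rw [annB_eq_one hk1 h1 h2 hx, sub_zero, max_eq_left (hτ.le.trans h3), max_eq_right (by linarith)])
      (fun x hx => by
        simp only [Function.comp, smul_eq_mul]
        rw [annB_eq_zero hk1 h1 h2 hx, mul_zero, zero_sub, max_eq_right]
        linarith [le_max_right (W x - 0) 0])
      (fun x hx => by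
        have := mul_le_of_le_one_right hτ.le (annB_le_one hk1 h1 h2 (x - y))
        simp only [Function.comp, smul_eq_mul]
        rw [max_eq_right]
        linarith [le_max_left (W x - 0) 0])).ge x hx
  simpa using this

theorem tendsto_zero_of_superlevel {v : En n → ℝ} {L : ℝ≥0} (hv : LipschitzWith L v) (h0 : ∀ x, 0 ≤ v x)
    {u : ℕ → En n → ℝ} (hu : ∀ x, Tendsto (fun k => u k x) atTop (𝓝 (v x)))
    (h : ∀ t : ℝ, 0 < t → ∃ C : ℝ, ∀ k, volume {x | t ≤ u k x} ≤ ENNReal.ofReal C) :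
    Tendsto v (cocompact (En n)) (𝓝 0) := by
  rw [Metric.tendsto_nhds]
  intro ε hε
  set t := ε / 4 with ht
  obtain ⟨C, hC⟩ := h t (by positivity)
  set A := {x | 2 * t < v x} with hA
  have hAm : MeasurableSet A := hv.continuous.measurable measurableSet_Ioi
  have hAf : volume A ≤ ENNReal.ofReal C := by
    have hsub : A ⊆ ⋃ m, {x | ∀ j ≥ m, t ≤ u j x} := fun x hx => by
      obtain ⟨m, hm⟩ := eventually_atTop.1 ((hu x).eventually_const_lt hx)
      exact mem_iUnion.2 ⟨m, fun j hj => by linarith [hm j hj]⟩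
    refine (measure_mono hsub).trans ?_
    rw [Monotone.measure_iUnion (s := fun m => {x | ∀ j ≥ m, t ≤ u j x})
      fun a b hab x (hx : ∀ j ≥ a, t ≤ u j x) j hj => hx j (hab.trans hj)]
    exact iSup_le fun m => (measure_mono fun x (hx : ∀ j ≥ m, t ≤ u j x) => hx m le_rfl).trans (hC m)
  set δ : ℝ := min 1 (t / (L + 1)) with hδ
  have hδ0 : 0 < δ := by positivity
  have hlim := tendsto_measure_iInter_atTop (μ := volume) (s := fun k : ℕ => A \ ball (0 : En n) k)
    (fun k => (hAm.diff measurableSet_ball).nullMeasurableSet)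
    (fun a b hab => sdiff_subset_sdiff_right (ball_subset_ball (by exact_mod_cast hab)))
    ⟨0, ((measure_mono sdiff_subset).trans_lt (hAf.trans_lt ENNReal.ofReal_lt_top)).ne⟩
  have hemp : ⋂ k : ℕ, A \ ball (0 : En n) k = ∅ := eq_empty_of_forall_notMem fun x hx => by
    obtain ⟨k, hk⟩ := exists_nat_gt ‖x‖
    exact (mem_iInter.1 hx k).2 (mem_ball_zero_iff.2 hk)
  rw [hemp, measure_empty] at hlim
  obtain ⟨k, hk⟩ := (hlim.eventually_lt_const (measure_ball_pos volume (0 : En n) hδ0)).exists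
  filter_upwards [(isCompact_closedBall (0 : En n) (k + 1)).compl_mem_cocompact] with x hx
  rw [mem_compl_iff, mem_closedBall_zero_iff, not_le] at hx
  rw [Real.dist_eq, sub_zero, abs_of_nonneg (h0 x)]
  by_contra hcon
  rw [← Measure.addHaar_ball_center volume x] at hk
  refine hk.not_ge (measure_mono fun y hy => ⟨?_, fun hy' => ?_⟩)
  · have h1 := hv.dist_le_mul x y
    have h2 : (L : ℝ) * dist x y ≤ t := by
      have h3 : dist x y ≤ t / (L + 1) := by rw [dist_comm]; exact hy.le.trans (min_le_right _ _)
      rw [le_div_iff₀ (by positivity)] at h3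
      nlinarith [dist_nonneg (x := x) (y := y)]
    have h4 := (le_abs_self _).trans ((Real.dist_eq _ _).symm.le.trans h1)
    change 2 * t < v y
    linarith
  · have h1 : ‖y - x‖ < 1 := by rw [← dist_eq_norm]; exact hy.trans_le (min_le_left _ _)
    have h2 := norm_sub_norm_le x y
    rw [norm_sub_rev] at h2
    linarith [mem_ball_zero_iff.1 hy']

theorem norm_rpow_le_energy (N : MinkowskiNorm n) (hp : 1 < p) : ∃ C : ℝ, 0 ≤ C ∧ ∀ s (ξ : En n),
    ‖ξ‖ ^ p ≤ C * energy N p s ξ := by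
  obtain ⟨m, _, hm, _, h⟩ := F_bounds N
  refine ⟨p / m ^ p, by positivity, fun s ξ => ?_⟩
  have h1 : (m * ‖ξ‖) ^ p ≤ (N.F ξ ^ 2 + s ^ 2) ^ (p / 2) := by
    calc _ ≤ N.F ξ ^ p := Real.rpow_le_rpow (by positivity) (h ξ).1 (by linarith)
      _ = (N.F ξ ^ 2) ^ (p / 2) := by
        rw [← Real.rpow_natCast, ← Real.rpow_mul (F_nonneg N ξ)]; congr 1; push_cast; ring
      _ ≤ _ := Real.rpow_le_rpow (by positivity) (by nlinarith) (by linarith)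
  rw [Real.mul_rpow hm.le (norm_nonneg _)] at h1
  rw [energy, div_mul_div_comm, le_div_iff₀ (by positivity)]
  nlinarith

/-- The energy of the approximate solutions is bounded by that of a fixed competitor. -/
theorem energy_bound (N : MinkowskiNorm n) (hp : 1 < p) {w : En n → ℝ} {K : ℝ≥0} (hw : LipschitzWith K w)
    {r : ℝ} (hwr : ∀ x, r ≤ ‖x‖ → w x = 0) : ∃ E : ℝ, ∀ (s R : ℝ) (u : En n → ℝ) (L : ℝ≥0), 0 ≤ s → s ≤ 1 →
      s ^ p * volume.real (ball (0 : En n) R) ≤ 1 → r ≤ R → LipschitzWith L u → (∀ x, R ≤ ‖x‖ → u x = 0) →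
      (∫ x, ⟪flux N p s (gradient u x), gradient (fun y => w y - u y) x⟫ = 0) →
      (∫ x, ‖gradient u x‖ ^ p) ≤ E := by
  obtain ⟨_, M, _, hM, hF⟩ := F_bounds N
  obtain ⟨c, hc, hcE⟩ := norm_rpow_le_energy N hp
  set e : ℝ := ((M * K) ^ 2 + 1) ^ (p / 2) / p with he
  refine ⟨c * (volume.real (ball (0 : En n) r) * e + 1 / p),
    fun s R u L hs0 hs1 hsR hrR hu huR h => ?_⟩
  have hp0 : 0 < p := by linarith
  have hzero : ∀ {f : En n → ℝ} {K' : ℝ≥0}, LipschitzWith K' f → ∀ R' : ℝ, (∀ x, R' ≤ ‖x‖ → f x = 0) →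
      ∀ᵐ x, x ∉ ball (0 : En n) R' → gradient f x = 0 := fun hf R' hR' => by
    filter_upwards [gradient_ae_zero_of_eq_zero hf] with x hx hxb
    exact hx (hR' x (by simpa using hxb))
  have hind : ∀ {f : En n → ℝ} {K' : ℝ≥0}, LipschitzWith K' f → (∀ x, R ≤ ‖x‖ → f x = 0) →
      (∫ x, ⟪(ball 0 R).indicator (fun x => flux N p s (gradient u x)) x, gradient f x⟫) =
        ∫ x, ⟪flux N p s (gradient u x), gradient f x⟫ := fun hf hR' => by
    refine integral_congr_ae ?_
    filter_upwards [hzero hf R hR'] with x hx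
    by_cases hxb : x ∈ ball (0 : En n) R
    · rw [indicator_of_mem hxb]
    · rw [hx hxb, inner_zero_right, inner_zero_right]
  have hwR : ∀ x : En n, R ≤ ‖x‖ → w x = 0 := fun x hx => hwr x (hrR.trans hx)
  have h1 := setIntegral_energy_ge (N := N) (R := R) s hp hu hw
  rw [hind hw hwR, hind hu huR, ← integral_sub
    (integrable_flux_gradient N s hp hu hw (hasCompactSupport_of_zero hwR))
    (integrable_flux_gradient N s hp hu hu (hasCompactSupport_of_zero huR))] at h1
  have h2 : (∫ x, (⟪flux N p s (gradient u x), gradient w x⟫ - ⟪flux N p s (gradient u x), gradient u x⟫)) =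
      0 := by
    rw [← h]
    refine integral_congr_ae ?_
    filter_upwards [differentiableAt_ae hw, differentiableAt_ae hu] with x h3 h4
    rw [gradient_sub h3 h4, inner_sub_right]
  rw [h2, add_zero] at h1
  have hi : IntegrableOn ((ball (0 : En n) r).indicator fun _ => e) (ball 0 R) :=
    (integrable_indicator_iff measurableSet_ball).2 (integrableOn_const (by
      rw [Measure.restrict_apply measurableSet_ball]
      exact ((measure_mono inter_subset_left).trans_lt measure_ball_lt_top).ne))
  have hi' : IntegrableOn (fun _ => s ^ p / p) (ball (0 : En n) R) :=
    integrableOn_const measure_ball_lt_top.ne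
  have h3 : (∫ x in ball 0 R, energy N p s (gradient w x)) ≤ volume.real (ball (0 : En n) r) * e + 1 / p := by
    calc _ ≤ ∫ x in ball (0 : En n) R, ((ball (0 : En n) r).indicator (fun _ => e) x + s ^ p / p) := by
          refine integral_mono_ae (setIntegral_energy_integrable N s hp hw) (hi.add hi') (ae_restrict_of_ae ?_)
          filter_upwards [hzero hw r hwr] with x hx
          by_cases hxb : x ∈ ball (0 : En n) r
          · rw [indicator_of_mem hxb, energy]
            have h5 : N.F (gradient w x) ≤ M * K := (hF _).2.trans (by gcongr; exact norm_gradient_le hw x)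
            have h6 : (N.F (gradient w x) ^ 2 + s ^ 2) ^ (p / 2) / p ≤ e := by
              have := F_nonneg N (gradient w x)
              rw [he]
              gcongr
              nlinarith
            have : 0 ≤ s ^ p / p := by positivity
            linarith
          · rw [indicator_of_notMem hxb, hx hxb, energy, F_zero, zero_pow two_ne_zero, zero_add, zero_add,
              ← Real.rpow_natCast, ← Real.rpow_mul hs0]
            apply le_of_eq; congr 2; push_cast; ring
      _ = volume.real (ball (0 : En n) r) * e + s ^ p / p * volume.real (ball (0 : En n) R) := by
          rw [integral_add hi hi', setIntegral_indicator measurableSet_ball,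
            inter_eq_right.2 (ball_subset_ball hrR), setIntegral_const, setIntegral_const]
          simp only [smul_eq_mul]; ring
      _ ≤ _ := by
          gcongr
          rw [div_mul_eq_mul_div]
          gcongr
  calc (∫ x, ‖gradient u x‖ ^ p) = ∫ x in ball (0 : En n) R, ‖gradient u x‖ ^ p := by
        refine (setIntegral_eq_integral_of_ae_compl_eq_zero ?_).symm
        filter_upwards [hzero hu R huR] with x hx hxb
        rw [hx hxb, norm_zero, Real.zero_rpow hp0.ne']
    _ ≤ ∫ x in ball (0 : En n) R, c * energy N p s (gradient u x) :=
        integral_mono_of_nonneg (Eventually.of_forall fun x => by positivity)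
          ((setIntegral_energy_integrable N s hp hu).const_mul c) (Eventually.of_forall fun x => hcE _ _)
    _ ≤ _ := by
        rw [integral_const_mul]
        gcongr
        exact h1.trans h3

end Capacitary


section ExistsCapacitary

variable {n : ℕ}

/-- A Lipschitz capacitary potential of `P`, with quantitative interior `C^{1,α}` expansions. -/
structure Capacitary (N : MinkowskiNorm n) (p : ℝ) (P : Set (En n)) (L : ℝ≥0) (C α : ℝ)
    (v : En n → ℝ) : Prop where
  lip : LipschitzWith L v
  pos : ∀ x, 0 < v x
  le_one : ∀ x, v x ≤ 1
  one : ∀ x ∈ P, v x = 1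
  tendsto : Tendsto v (cocompact (En n)) (𝓝 0)
  expansion : ∀ (x : En n) (d : ℝ), 0 < d → (∀ y ∈ P, d ≤ ‖y - x‖) → DifferentiableAt ℝ v x ∧
    ∀ y, ‖y - x‖ < d / 4 → |v y - v x - ⟪gradient v x, y - x⟫| ≤ C / d ^ α * ‖y - x‖ ^ (1 + α)
  weak : ∀ (K : ℝ≥0) (φ : En n → ℝ), LipschitzWith K φ → HasCompactSupport φ → (∀ x ∈ P, φ x = 0) →
    ∫ x, ⟪flux N p 0 (gradient v x), gradient φ x⟫ = 0

theorem exists_small_parameter {p : ℝ} (hp : 1 < p) (k : ℕ) (V : ℝ) (hV : 0 ≤ V) :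
    ∃ s : ℝ, 0 < s ∧ s ≤ 1 ∧ s ≤ 1 / (k + 1) ∧ s ^ p * V ≤ 1 := by
  have hk : (0 : ℝ) ≤ k := Nat.cast_nonneg k
  have h1 : (k : ℝ) + 1 ≤ (k + 1) * (V + 1) := by nlinarith
  have h2 : V ≤ (k + 1) * (V + 1) := by nlinarith
  have h3 : 1 / (((k : ℝ) + 1) * (V + 1)) ≤ 1 := by
    rw [div_le_one (by positivity)]; linarith
  refine ⟨1 / ((k + 1) * (V + 1)), by positivity, h3, by gcongr, ?_⟩
  calc _ ≤ (1 / (((k : ℝ) + 1) * (V + 1))) ^ (1 : ℝ) * V := by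
        gcongr ?_ * V
        exact Real.rpow_le_rpow_of_exponent_ge (by positivity) h3 hp.le
    _ ≤ 1 := by rw [Real.rpow_one, div_mul_eq_mul_div, one_mul, div_le_one (by positivity)]; exact h2

set_option maxHeartbeats 1000000 in
theorem exists_capacitary (N : MinkowskiNorm n) {p : ℝ} (hn : 2 ≤ n) (hp : 1 < p) (hpn : p < n)
    {P : Set (En n)} (hP : IsCompact P) (hne : P.Nonempty) {ρ : ℝ} (hρ : 0 < ρ)
    (hball : ∀ x ∈ frontier P, ∃ y, ‖x - y‖ ≤ ρ ∧ closedBall y ρ ⊆ P) :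
    ∃ (v : En n → ℝ) (L : ℝ≥0) (C α : ℝ), 0 ≤ C ∧ 0 < α ∧ α ≤ 1 ∧ Capacitary N p P L C α v := by
  obtain ⟨R₀, hR₀⟩ := hP.isBounded.exists_norm_le
  obtain ⟨y₀, hy₀⟩ := hne
  have hR₀0 : 0 ≤ R₀ := (norm_nonneg _).trans (hR₀ _ hy₀)
  obtain ⟨L, hL⟩ := exists_lipschitz_solution N hp hρ (by linarith : ρ < 2 * ρ)
  set R : ℕ → ℝ := fun k => R₀ + 4 * ρ + k with hR
  have hRk : ∀ k, R₀ + 4 * ρ ≤ R k := fun k => by simp [hR]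
  choose s hs0 hs1 hsk hsV using fun k => exists_small_parameter hp k (volume.real (ball (0 : En n) (R k)))
    measureReal_nonneg
  have hsol : ∀ k, _ := fun k => hL (s k) P {x | R k ≤ ‖x‖} (R k) (fun x hx => Or.inr hx) ⟨y₀, hy₀⟩
    (fun x hx y (hy : R k ≤ ‖y‖) => by
      have := hR₀ x hx
      have := norm_sub_norm_le y x
      rw [norm_sub_rev] at this
      linarith [hRk k])
    (fun x hx => by
      obtain ⟨y, h1, h2⟩ := hball x hx
      refine ⟨y, h1, h2, fun z (hz : R k ≤ ‖z‖) => ?_⟩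
      have := hR₀ y (h2 (mem_closedBall_self hρ.le))
      linarith [hRk k, norm_sub_norm_le z y])
    (fun x hx => by
      have hx' : R k = ‖x‖ := frontier_le_subset_eq continuous_const continuous_norm hx
      have hRp : 0 < R k := by linarith [hRk k]
      have hy : ‖(1 + ρ / R k) • x‖ = R k + ρ := by
        rw [norm_smul, ← hx', Real.norm_of_nonneg (by positivity)]; field_simp
      refine ⟨(1 + ρ / R k) • x, ?_, fun z hz => ?_, fun z hz => ?_⟩
      · rw [add_smul, one_smul, sub_add_cancel_left, norm_neg, norm_smul, ← hx',
          Real.norm_of_nonneg (by positivity), div_mul_cancel₀ _ hRp.ne']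
      · rw [mem_closedBall, dist_comm, dist_eq_norm] at hz
        change R k ≤ ‖z‖
        linarith [norm_sub_norm_le ((1 + ρ / R k) • x) z]
      · have := norm_sub_norm_le ((1 + ρ / R k) • x) z
        rw [norm_sub_rev] at this
        linarith [hR₀ z hz, hRk k])
  choose u hu hu0 hu1 huw using hsol
  have huR : ∀ k x, R k ≤ ‖x‖ → u k x = 0 := fun k x hx => (hu k).zero x hx
  set w : En n → ℝ := cutoff R₀ (R₀ + ρ) with hw
  have hwL := lipschitz_cutoff (n := n) (by linarith : R₀ < R₀ + ρ)
  obtain ⟨E, hE⟩ := energy_bound N hp hwL (fun x hx => cutoff_eq_zero (by linarith : R₀ < R₀ + ρ) hx)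
  have huE : ∀ k, (∫ x, ‖gradient (u k) x‖ ^ p) ≤ E := fun k =>
    hE (s k) (R k) (u k) L (hs0 k).le (hs1 k) (hsV k) (by linarith [hRk k]) (hu k).lip (huR k)
      (huw k _ _ (hwL.sub (hu k).lip) fun x hx => by
        rcases hx with hx | hx
        · rw [(hu k).one x hx, cutoff_eq_one (by linarith) (hR₀ x hx), sub_self]
        · rw [(hu k).zero x hx, cutoff_eq_zero (by linarith) (by linarith [hRk k, hx.out]), sub_self])
  obtain ⟨φ, hφ, v, hv, hlim⟩ := lipschitz_compactness (fun k => (hu k).lip) (M := 1) fun k => by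
    rw [abs_of_nonneg (hu0 k 0)]; exact hu1 k 0
  have hsφ : Tendsto (fun j => s (φ j)) atTop (𝓝 0) :=
    (squeeze_zero (fun k => (hs0 k).le) hsk tendsto_one_div_add_atTop_nhds_zero_nat).comp hφ.tendsto_atTop
  have hRφ : Tendsto (fun j => R (φ j)) atTop atTop :=
    (tendsto_atTop_add_const_left _ _ tendsto_natCast_atTop_atTop).comp hφ.tendsto_atTop
  obtain ⟨C, α, hC, hα, hα1, hexp⟩ := exists_expansion_ball N hn hp L
  have hgrad : ∀ (x : En n) (d : ℝ), 0 < d → (∀ y ∈ P, d ≤ ‖y - x‖) →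
      (‖gradient v x‖ ≤ L + 1 ∧ ∀ y, ‖y - x‖ < d / 4 →
      |v y - v x - ⟪gradient v x, y - x⟫| ≤ C / d ^ α * ‖y - x‖ ^ (1 + α)) ∧ DifferentiableAt ℝ v x ∧
      Tendsto (fun j => gradient (u (φ j)) x) atTop (𝓝 (gradient v x)) := fun x d hd hxP => by
    have : ∀ j, ∃ g : En n, ‖g‖ ≤ L + 1 ∧ (‖x‖ + d ≤ R (φ j) → ∀ y, ‖y - x‖ < d / 4 →
        |u (φ j) y - u (φ j) x - ⟪g, y - x⟫| ≤ C / d ^ α * ‖y - x‖ ^ (1 + α)) := fun j => by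
      by_cases hj : ‖x‖ + d ≤ R (φ j)
      · obtain ⟨g, hg, h⟩ := hexp (s (φ j)) _ x d (hs0 _).ne' (hu (φ j)).lip hd fun K ψ hψ r hr hz =>
          huw (φ j) K ψ hψ fun y hy => hz y (by
            rcases hy with hy | hy
            · exact hr.le.trans (hxP y hy)
            · linarith [hy.out, norm_sub_norm_le y x])
        exact ⟨g, hg, fun _ => h⟩
      · exact ⟨0, by rw [norm_zero]; positivity, fun h => absurd h hj⟩
    choose g hg hge using this
    exact tendsto_gradient_of_expansion hα (by positivity) hlim hg
      ((hRφ.eventually_ge_atTop (‖x‖ + d)).mono hge)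
  have h0 : ∀ x, 0 ≤ v x := fun x => ge_of_tendsto' (hlim x) fun j => hu0 _ _
  have h1P : ∀ x ∈ P, v x = 1 := fun x hx => tendsto_nhds_unique (hlim x) (by
    simp_rw [fun j => (hu (φ j)).one x hx]; exact tendsto_const_nhds)
  have hweak : ∀ (K : ℝ≥0) (ψ : En n → ℝ), LipschitzWith K ψ → HasCompactSupport ψ → (∀ x ∈ P, ψ x = 0) →
      ∫ x, ⟪flux N p 0 (gradient v x), gradient ψ x⟫ = 0 := fun K ψ hψ hψc hψP => by
    obtain ⟨c, hc, hcb⟩ := norm_flux_le N hp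
    obtain ⟨_, M, _, hM, hF⟩ := F_bounds N
    obtain ⟨r, hr⟩ := hψc.isCompact.isBounded.exists_norm_le
    have hz : ∀ᶠ j in atTop, ∫ x, ⟪flux N p (s (φ j)) (gradient (u (φ j)) x), gradient ψ x⟫ = 0 := by
      filter_upwards [hRφ.eventually_gt_atTop r] with j hj
      refine huw (φ j) K ψ hψ fun x hx => ?_
      rcases hx with hx | hx
      · exact hψP x hx
      · by_contra h
        linarith [hx.out, hr x (subset_tsupport _ h)]
    refine tendsto_nhds_unique (tendsto_integral_of_dominated_convergence
      (fun x => c * ((M * L) ^ 2 + 1) ^ ((p - 1) / 2) * ‖gradient ψ x‖)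
      (fun j => ((measurable_flux_gradient N (s (φ j)) hp (u (φ j))).inner
        (measurable_gradient ψ)).aestronglyMeasurable)
      ((integrable_norm_gradient hψ hψc).const_mul _) (fun j => Eventually.of_forall fun x => ?_) ?_)
      (tendsto_const_nhds.congr' (hz.mono fun j hj => hj.symm))
    · refine (norm_inner_le_norm _ _).trans ?_
      gcongr
      refine (hcb _ _).trans ?_
      have h2 := F_nonneg N (gradient (u (φ j)) x)
      have h3 : N.F (gradient (u (φ j)) x) ≤ M * L :=
        (hF _).2.trans (by gcongr; exact norm_gradient_le (hu _).lip x)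
      have := hs0 (φ j)
      have := hs1 (φ j)
      have h4 : N.F (gradient (u (φ j)) x) ^ 2 + s (φ j) ^ 2 ≤ (M * L) ^ 2 + 1 := by nlinarith
      have h5 : 0 ≤ (p - 1) / 2 := by linarith
      gcongr
    · filter_upwards [gradient_ae_zero_of_eq_zero hψ] with x hx
      by_cases hxP : x ∈ P
      · simp only [hx (hψP x hxP), inner_zero_right]; exact tendsto_const_nhds
      · have hd := (hP.isClosed.notMem_iff_infDist_pos ⟨y₀, hy₀⟩).1 hxP
        refine (tendsto_flux hp hsφ (hgrad x _ hd fun y hy => ?_).2.2).inner tendsto_const_nhds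
        rw [← dist_eq_norm, dist_comm]
        exact infDist_le_dist_of_mem hy
  have hfr : (frontier P).Nonempty := by
    by_contra hcon
    rw [not_nonempty_iff_eq_empty, frontier_eq_empty_iff] at hcon
    rcases hcon with h | h
    · exact notMem_empty _ (h ▸ hy₀)
    · have : NoncompactSpace (En n) := by
        have : Nonempty (Fin n) := ⟨⟨0, by omega⟩⟩
        exact NormedSpace.noncompactSpace ℝ _
      exact noncompact_univ _ (h ▸ hP)
  obtain ⟨x₁, hx₁⟩ := hfr
  obtain ⟨y, -, hyP⟩ := hball x₁ hx₁
  obtain ⟨k, hk, hann⟩ := exists_annulus_lower N hp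
  refine ⟨v, L, C, α, hC, hα, hα1, hv, fun x => ?_, fun x => le_of_tendsto' (hlim x) fun j => hu1 _ _, h1P,
    tendsto_zero_of_superlevel hv h0 hlim fun t ht => ?_, fun x d hd hx => ?_, hweak⟩
  · set r₂ := ρ + ‖x - y‖ + 1 with hr₂
    have h2 : ρ < r₂ := by linarith [norm_nonneg (x - y)]
    refine lt_of_lt_of_le ?_ (hann 0 ρ r₂ 1 y v L hρ h2 one_pos hv (fun x _ => h0 x)
      (fun x hx => (h1P x (hyP (by rwa [mem_closedBall, dist_eq_norm]))).ge)
      (fun K ψ hψ _ hψ2 hψ3 => hweak K ψ hψ (HasCompactSupport.of_support_subset_isCompact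
        (isCompact_closedBall y r₂) fun z hz => by
          rw [mem_closedBall, dist_eq_norm]
          by_contra hcon
          exact hz (hψ2 z (not_le.1 hcon).le)) fun z hz => hψ3 z (h1P z hz).ge) x (by linarith))
    have := cap_denom_pos hk hρ h2
    have : 0 < r₂ - ‖x - y‖ := by linarith
    have : 0 < r₂ := by linarith
    positivity
  · obtain ⟨c, hc⟩ := superlevel_bound hn hp hpn E ht
    refine ⟨c, fun j => ?_⟩
    rw [← ofReal_measureReal (h := ?_)]
    · exact ENNReal.ofReal_le_ofReal (hc _ L (hu _).lip (hasCompactSupport_of_zero (huR _)) (huE _))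
    · refine ((measure_mono fun x (hx : t ≤ _) => ?_).trans_lt
        (measure_ball_lt_top (x := (0 : En n)) (r := R (φ j)))).ne
      rw [mem_ball_zero_iff]
      by_contra hcon
      linarith [huR _ x (not_lt.1 hcon)]
  · exact ⟨(hgrad x d hd hx).2.1, (hgrad x d hd hx).1.2⟩

end ExistsCapacitary


section Chart

variable {n : ℕ}

/-- A `C²` function whose positivity set is a nearly flat domain in a ball. -/
structure Chart (h : En n → ℝ) (x₀ ν : En n) (R H : ℝ) : Prop where
  smooth : ContDiff ℝ 2 h
  cpt : HasCompactSupport h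
  pos : 0 < R
  hnn : 0 ≤ H
  unit : ‖ν‖ = 1
  grad : ∀ x ∈ ball x₀ R, ‖gradient h x - ν‖ ≤ 1 / 64
  hess_le : ∀ x ∈ ball x₀ R, ‖hess h x‖ ≤ H
  one : ∀ x ∈ ball x₀ R, ∀ y ∈ ball x₀ R, |h y - h x - ⟪ν, y - x⟫| ≤ 1 / 64 * ‖y - x‖
  two : ∀ x ∈ ball x₀ R, ∀ y ∈ ball x₀ R, |h y - h x - ⟪gradient h x, y - x⟫| ≤ H * ‖y - x‖ ^ 2

theorem abs_sub_inner_le {h : En n → ℝ} (hd : Differentiable ℝ h) {s : Set (En n)} (hs : Convex ℝ s)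
    {ν : En n} {ε : ℝ} (hε : ∀ z ∈ s, ‖gradient h z - ν‖ ≤ ε) {x y : En n} (hx : x ∈ s) (hy : y ∈ s) :
    |h y - h x - ⟪ν, y - x⟫| ≤ ε * ‖y - x‖ :=
  hs.norm_image_sub_le_of_norm_hasFDerivWithin_le' (φ := innerSL ℝ ν)
    (fun z _ => (hd z).hasGradientAt.hasFDerivAt.hasFDerivWithinAt) (fun z hz => by
      change ‖InnerProductSpace.toDual ℝ (En n) (gradient h z) - InnerProductSpace.toDual ℝ (En n) ν‖ ≤ ε
      rw [← map_sub, LinearIsometryEquiv.norm_map]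
      exact hε z hz) hx hy

theorem exists_chart {f : En n → ℝ} (hf : ContDiff ℝ 2 f) {x₀ : En n} (h0 : gradient f x₀ ≠ 0) :
    ∃ (h : En n → ℝ) (ν : En n) (R H c : ℝ), Chart h x₀ ν R H ∧ 0 < c ∧ ∀ x ∈ ball x₀ R, h x = -c * f x := by
  let χ : ContDiffBump x₀ := ⟨1, 2, one_pos, one_lt_two⟩
  set c := ‖gradient f x₀‖⁻¹ with hc
  have hc0 : 0 < c := inv_pos.2 (norm_pos_iff.2 h0)
  set h : En n → ℝ := fun x => χ x * (-c * f x) with hh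
  have hs : ContDiff ℝ 2 h := χ.contDiff.mul (contDiff_const.mul hf)
  have heq : h =ᶠ[𝓝 x₀] fun x => -c * f x := by
    filter_upwards [χ.eventuallyEq_one] with x hx
    simp [hh, hx]
  have hG : Continuous (gradient h) := continuous_iff_continuousAt.2 fun x =>
    (contDiffAt_gradient hs.contDiffAt).continuousAt
  have hHc : Continuous (hess h) := by
    have : ContDiff ℝ 1 (gradient h) := contDiff_iff_contDiffAt.2 fun x => contDiffAt_gradient hs.contDiffAt
    exact this.continuous_fderiv (by simp)
  set H := ‖hess h x₀‖ + 1 with hH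
  obtain ⟨R, hR, hb⟩ := Metric.eventually_nhds_iff_ball.1 (heq.and
    (((hG.sub continuous_const).norm.continuousAt.eventually_lt (continuousAt_const (y := (1 : ℝ) / 64))
      (by simp : ‖gradient h x₀ - gradient h x₀‖ < 1 / 64)).and
    (hHc.norm.continuousAt.eventually_lt (continuousAt_const (y := H)) (by simp [hH]))))
  have hd := hs.differentiable (by simp)
  refine ⟨h, gradient h x₀, R, H, c, ⟨hs, χ.hasCompactSupport.mul_right, hR, by positivity, ?_,
    fun x hx => (hb x hx).2.1.le, fun x hx => (hb x hx).2.2.le, fun x hx y hy =>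
    abs_sub_inner_le hd (convex_ball x₀ R) (fun z hz => (hb z hz).2.1.le) hx hy, fun x hx y hy => ?_⟩,
    hc0, fun x hx => (hb x hx).1⟩
  · rw [heq.gradient_eq, gradient_const_mul, norm_smul, norm_neg, Real.norm_of_nonneg hc0.le]
    exact inv_mul_cancel₀ (norm_ne_zero_iff.2 h0)
  · have := abs_sub_inner_le hd ((convex_ball x₀ R).inter (convex_closedBall x ‖y - x‖))
      (ν := gradient h x) (ε := H * ‖y - x‖) (fun z hz => ?_) ⟨hx, mem_closedBall_self (norm_nonneg _)⟩
      ⟨hy, by rw [mem_closedBall, dist_eq_norm]⟩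
    · rwa [mul_assoc, ← sq] at this
    · refine ((convex_ball x₀ R).norm_image_sub_le_of_norm_fderiv_le (f := gradient h)
        (fun w _ => (hasFDerivAt_gradient hs.contDiffAt).differentiableAt)
        (fun w hw => (hb w hw).2.2.le) hx hz.1).trans ?_
      have := hz.2
      rw [mem_closedBall, dist_eq_norm] at this
      gcongr

variable {h : En n → ℝ} {x₀ ν : En n} {R H : ℝ}

theorem Chart.norm_gradient (hh : Chart h x₀ ν R H) {x : En n} (hx : x ∈ ball x₀ R) :
    63 / 64 ≤ ‖gradient h x‖ ∧ ‖gradient h x‖ ≤ 65 / 64 ∧ 63 / 64 ≤ ⟪ν, gradient h x⟫ := by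
  have h1 := hh.grad x hx
  have h2 := norm_sub_norm_le (gradient h x) ν
  have h3 := norm_sub_norm_le ν (gradient h x)
  have h4 := abs_le.1 ((abs_real_inner_le_norm ν (gradient h x - ν)).trans
    (mul_le_of_le_one_left (norm_nonneg _) hh.unit.le))
  rw [inner_sub_right, real_inner_self_eq_norm_sq, hh.unit] at h4
  rw [norm_sub_rev, hh.unit] at h3
  rw [hh.unit] at h2
  exact ⟨by linarith, by linarith, by linarith⟩

theorem Chart.corkscrew (hh : Chart h x₀ ν R H) {x y : En n} {s : ℝ} (hx : x ∈ ball x₀ R)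
    (hy : y ∈ ball x₀ R) (hs : 0 < s) (hxy : ‖y - (x + s • ν)‖ ≤ s / 2) : h x + s / 4 < h y := by
  have h1 := abs_le.1 (hh.one x hx y hy)
  have e : y - x = s • ν + (y - (x + s • ν)) := by abel
  have h2 : ‖y - x‖ ≤ s + s / 2 := by
    rw [e]
    refine (norm_add_le _ _).trans ?_
    rw [norm_smul, hh.unit, Real.norm_of_nonneg hs.le]
    linarith
  have h3 := abs_le.1 ((abs_real_inner_le_norm ν (y - (x + s • ν))).trans
    (mul_le_of_le_one_left (norm_nonneg _) hh.unit.le))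
  have h4 : ⟪ν, y - x⟫ = s + ⟪ν, y - (x + s • ν)⟫ := by
    rw [e, inner_add_right, inner_smul_right, real_inner_self_eq_norm_sq, hh.unit]; ring_nf
  linarith [h1.1]

/-- The domain contains balls tangent to its boundary. -/
theorem Chart.tangent_ball (hh : Chart h x₀ ν R H) {y x : En n} (hy : y ∈ ball x₀ R) (hx : x ∈ ball x₀ R)
    (hy0 : h y = 0) {t σ : ℝ} (ht : 0 < t) (hσ : |σ| = 1) (htH : 2 * t * H < 1) (hxy : x ≠ y)
    (hb : ‖x - (y + (σ * t) • gradient h y)‖ ≤ t * ‖gradient h y‖) : 0 < σ * h x := by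
  have h1 := hh.two y hy x hx
  have h2 : 0 < ‖x - y‖ ^ 2 := by have := norm_pos_iff.2 (sub_ne_zero.2 hxy); positivity
  have h3 := pow_le_pow_left₀ (norm_nonneg _) hb 2
  have hσ2 : σ ^ 2 = 1 := by rw [← sq_abs, hσ, one_pow]
  rw [← sub_sub, norm_sub_sq_real, norm_smul, inner_smul_right, Real.norm_eq_abs, abs_mul, hσ, mul_pow, mul_pow,
    one_pow, one_mul, sq_abs, real_inner_comm] at h3
  have h4 : |σ * (h x - h y - ⟪gradient h y, x - y⟫)| ≤ H * ‖x - y‖ ^ 2 := by rwa [abs_mul, hσ, one_mul]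
  have h5 := (abs_le.1 h4).1
  rw [hy0] at h5
  have h6 : ‖x - y‖ ^ 2 ≤ 2 * t * (σ * ⟪gradient h y, x - y⟫) := by linarith
  have h7 : 2 * t * (σ * h x) ≥ (1 - 2 * t * H) * ‖x - y‖ ^ 2 := by nlinarith
  have h8 : 0 < 2 * t * (σ * h x) := lt_of_lt_of_le (mul_pos (by linarith) h2) h7
  exact pos_of_mul_pos_right h8 (by linarith)

end Chart


section Krylov

variable {n : ℕ} {p : ℝ}

/-- Lipschitz weak solutions in `U`, tested with functions vanishing off `U`. -/
structure LocalSol (N : MinkowskiNorm n) (p : ℝ) (U : Set (En n)) (L : ℝ≥0) (W : En n → ℝ) : Prop where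
  lip : LipschitzWith L W
  weak : ∀ (K : ℝ≥0) (φ : En n → ℝ), LipschitzWith K φ → HasCompactSupport φ → (∀ x ∉ U, φ x = 0) →
    ∫ x, ⟪flux N p 0 (gradient W x), gradient φ x⟫ = 0

theorem LocalSol.neg {N : MinkowskiNorm n} {U : Set (En n)} {L : ℝ≥0} {W : En n → ℝ} (h : LocalSol N p U L W) :
    LocalSol N p U L fun x => -W x :=
  ⟨h.lip.neg, fun K φ hφ hc h0 => by
    simp_rw [gradient_neg, flux_neg, inner_neg_left, integral_neg, h.weak K φ hφ hc h0, neg_zero]⟩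

theorem hasCompactSupport_of_ball {φ : En n → ℝ} {y : En n} {r : ℝ} (h : ∀ x, r ≤ ‖x - y‖ → φ x = 0) :
    tsupport φ ⊆ closedBall y r ∧ HasCompactSupport φ := by
  have : Function.support φ ⊆ closedBall y r := fun z hz => by
    rw [mem_closedBall, dist_eq_norm]
    by_contra hcon
    exact hz (h z (not_le.1 hcon).le)
  exact ⟨closure_minimal this isClosed_closedBall,
    HasCompactSupport.of_support_subset_isCompact (isCompact_closedBall y r) this⟩

/-- The growth lemma for the difference of a solution and a subsolution with nonzero gradient. -/
theorem growth_flux (N : MinkowskiNorm n) (hn : 2 ≤ n) (hp : 1 < p) {c : ℝ} (hc : 0 < c) (M : ℝ) :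
    ∃ δ : ℝ, 0 < δ ∧ ∀ (z : En n) (r A : ℝ) (W b : En n → ℝ) (K K' : ℝ≥0), 0 < r → 0 < A →
      LipschitzWith K W → LipschitzWith K' b → (K : ℝ) ≤ M →
      (∀ x ∈ ball z r, c ≤ ‖gradient b x‖ ∧ ‖gradient b x‖ ≤ M ∧ DifferentiableAt ℝ b x ∧ b x ≤ W x) →
      (∀ (C : ℝ≥0) (φ : En n → ℝ), LipschitzWith C φ → (∀ x, 0 ≤ φ x) → HasCompactSupport φ →
        tsupport φ ⊆ ball z r → ∫ x, ⟪flux N p 0 (gradient W x), gradient φ x⟫ = 0 ∧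
          ∫ x, ⟪flux N p 0 (gradient b x), gradient φ x⟫ ≤ 0) →
      volume.real (ball (0 : En n) (3 / 4)) / 2 ≤
        volume.real {x ∈ ball (0 : En n) (3 / 4) | A ≤ W (z + r • x) - b (z + r • x)} →
      ∀ x ∈ ball z (r / 2), b x + δ * A ≤ W x := by
  obtain ⟨l, Λ, hl, hlΛ, hE⟩ := flux_ell_of_norm_ge N p hp hc M
  have hν : 0 < volume.real (ball (0 : En n) (3 / 4)) / 2 :=
    half_pos (ENNReal.toReal_pos (measure_ball_pos _ _ (by norm_num)).ne' measure_ball_lt_top.ne)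
  obtain ⟨δ, hδ, -, hg⟩ := growth hn hl hlΛ hν
  refine ⟨δ, hδ, fun z r A W b K K' hr hA hW hb hKM hx hweak hm x hxz => ?_⟩
  set D : En n → ℝ := fun x => W x - b x with hD
  have hDL : LipschitzWith (K + K') D := hW.sub hb
  set w : En n → ℝ := fun x => 1 - A⁻¹ * D (z + r • x) with hw
  set X : En n → En n := fun x => flux N p 0 (gradient W x) - flux N p 0 (gradient b x) with hX
  set V : En n → En n := fun x => -(r / A) • X (z + r • x) with hV
  have hmeas : Measurable X := (measurable_flux_gradient N 0 hp W).sub (measurable_flux_gradient N 0 hp b)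
  have hgw : ∀ x, gradient w x = -(r / A) • gradient D (z + r • x) := fun x => by
    simp only [hw]
    rw [gradient_const_sub, gradient_const_mul, gradient_comp_smul D r z x, smul_smul, ← neg_smul]
    congr 1
    ring
  have hin : ∀ x ∈ ball (0 : En n) 1, z + r • x ∈ ball z r := fun x hx => by
    rw [mem_ball_iff_norm, add_sub_cancel_left, norm_smul, Real.norm_of_nonneg hr.le]
    exact mul_lt_of_lt_one_right hr (mem_ball_zero_iff.1 hx)
  have hsub : SubSol l Λ w V := by
    refine ⟨⟨_, (LipschitzWith.const 1).sub ((lipschitzWith_smul A⁻¹).comp (lipschitz_comp_homothety hDL z r))⟩,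
      (hmeas.comp ((by fun_prop : Continuous fun x => z + r • x).measurable)).const_smul (-(r / A)), ?_, ?_, ?_⟩
    · obtain ⟨C₁, h1⟩ := exists_flux_bound N 0 hp K
      obtain ⟨C₂, h2⟩ := exists_flux_bound N 0 hp K'
      refine ⟨|r / A| * (C₁ + C₂), fun x => ?_⟩
      rw [hV, norm_smul, norm_neg, Real.norm_eq_abs]
      gcongr
      exact (norm_sub_le _ _).trans (add_le_add (h1.2 _ (norm_gradient_le hW _)) (h2.2 _ (norm_gradient_le hb _)))
    · filter_upwards [ae_comp_homothety (differentiableAt_ae hW) z hr.ne'] with x hWx hx1 _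
      obtain ⟨h1, h2, h3, -⟩ := hx _ (hin x hx1)
      obtain ⟨e1, e2⟩ := hE (gradient W (z + r • x)) _ ((norm_gradient_le hW _).trans hKM) h2 h1
      have hgD : gradient D (z + r • x) = gradient W (z + r • x) - gradient b (z + r • x) :=
        gradient_sub hWx h3
      have hrA : 0 ≤ r / A := by positivity
      rw [hgw, hgD]
      simp only [hV, hX]
      rw [norm_smul, norm_smul, inner_smul_left, inner_smul_right, norm_neg, Real.norm_of_nonneg hrA]
      simp only [conj_trivial]
      refine ⟨?_, ?_⟩
      · have := mul_le_mul_of_nonneg_left e1 (mul_nonneg hrA hrA)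
        linarith
      · have := mul_le_mul_of_nonneg_left e2 hrA
        linarith
    · intro φ C hφ h0 r' hr' hz
      have hφL := lipschitz_comp_homothety hφ (-(r⁻¹ • z)) r⁻¹
      have hfe : ∀ y, -(r⁻¹ • z) + r⁻¹ • y = r⁻¹ • (y - z) := fun y => by rw [smul_sub]; abel
      obtain ⟨hs, hcs⟩ := hasCompactSupport_of_ball (φ := fun y => φ (-(r⁻¹ • z) + r⁻¹ • y)) (y := z)
        (r := r' * r) fun y hy => hz _ (by
          rwa [hfe, norm_smul, norm_inv, Real.norm_of_nonneg hr.le, inv_mul_eq_div, le_div_iff₀ hr])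
      obtain ⟨i1, i2⟩ := hweak _ _ hφL (fun y => h0 _) hcs
        (hs.trans (closedBall_subset_ball (by nlinarith)))
      simp only [hV]
      simp_rw [inner_smul_left, conj_trivial]
      rw [integral_const_mul, integral_inner_rescale z hr.ne']
      simp only [hX]
      simp_rw [inner_sub_left]
      rw [integral_sub (integrable_flux_gradient N 0 hp hW hφL hcs)
        (integrable_flux_gradient N 0 hp hb hφL hcs), i1, zero_sub, neg_mul, neg_nonpos]
      have : 0 ≤ r / A := by positivity
      exact mul_nonneg this (mul_nonneg (abs_nonneg _) (mul_nonneg hr.le (by linarith)))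
  have := hg w V hsub (fun x hx1 => by
    have h1 : 0 ≤ A⁻¹ * D (z + r • x) := mul_nonneg (inv_pos.2 hA).le (sub_nonneg.2 (hx _ (hin x hx1)).2.2.2)
    simp only [hw]; linarith) (hm.trans (measureReal_mono (fun x hx => ⟨hx.1, by
      have : 1 ≤ A⁻¹ * D (z + r • x) := by rw [inv_mul_eq_div, le_div_iff₀ hA, one_mul]; exact hx.2
      change 1 - A⁻¹ * D (z + r • x) ≤ 0
      linarith⟩) ((measure_mono (sep_subset _ _)).trans_lt measure_ball_lt_top).ne)) (r⁻¹ • (x - z)) (by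
      rw [mem_ball_zero_iff, norm_smul, norm_inv, Real.norm_of_nonneg hr.le, inv_mul_eq_div, div_lt_iff₀ hr]
      rw [mem_ball_iff_norm] at hxz
      linarith)
  simp only [hw] at this
  rw [smul_inv_smul₀ hr.ne', add_sub_cancel] at this
  have h2 : δ ≤ A⁻¹ * D x := by linarith
  rw [inv_mul_eq_div, le_div_iff₀ hA] at h2
  linarith

variable {h : En n → ℝ} {x₀ ν : En n} {R H : ℝ}

theorem Chart.abs_le_norm (hh : Chart h x₀ ν R H) {q x : En n} (hq : q ∈ ball x₀ R) (hq0 : h q = 0)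
    (hx : x ∈ ball x₀ R) : |h x| ≤ 65 / 64 * ‖x - q‖ := by
  have h1 := hh.one q hq x hx
  have h2 := abs_real_inner_le_norm ν (x - q)
  rw [hh.unit, one_mul] at h2
  rw [hq0, sub_zero] at h1
  linarith [abs_sub_abs_le_abs_sub (h x) ⟪ν, x - q⟫]

theorem Chart.exists_zero (hh : Chart h x₀ ν R H) {x : En n} (hx0 : 0 < h x) {s : ℝ} (hs : 64 * h x ≤ 63 * s)
    (hm : ∀ t : ℝ, 0 ≤ t → t ≤ s → x - t • ν ∈ ball x₀ R) :
    ∃ t : ℝ, 0 < t ∧ t ≤ s ∧ h (x - t • ν) = 0 ∧ -(t / 64) ≤ 0 - h x + t ∧ 0 - h x + t ≤ t / 64 := by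
  have hs0 : 0 ≤ s := by linarith
  have hlin : ∀ t : ℝ, 0 ≤ t → t ≤ s → |h (x - t • ν) - h x + t| ≤ t / 64 := fun t ht ht' => by
    have := hh.one x (by simpa using hm 0 le_rfl hs0) _ (hm t ht ht')
    rw [sub_sub_cancel_left, inner_neg_right, inner_smul_right, real_inner_self_eq_norm_sq, hh.unit, norm_neg,
      norm_smul, hh.unit, Real.norm_of_nonneg ht] at this
    convert this using 2 <;> ring
  obtain ⟨t, ⟨ht0, ht1⟩, ht⟩ := intermediate_value_Icc' hs0 (f := fun t : ℝ => h (x - t • ν))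
    (hh.smooth.continuous.comp (by fun_prop)).continuousOn (show (0 : ℝ) ∈ Icc _ _ from ⟨by
      linarith [(abs_le.1 (hlin s hs0 le_rfl)).2], by simpa using hx0.le⟩)
  have hhx := abs_le.1 (hlin t ht0 ht1)
  simp only at ht
  rw [ht] at hhx
  exact ⟨t, by linarith, ht1, ht, hhx⟩

theorem Chart.exists_ball (hh : Chart h x₀ ν R H) {q : En n} (hq : q ∈ ball x₀ (R / 2)) (hq0 : h q = 0)
    {r : ℝ} (hr : 0 < r) (hrR : 4 * r ≤ R) (hrH : r * H ≤ 1) {x : En n} (hx : x ∈ ball q (r / 128))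
    (hx0 : 0 < h x) : ∃ (y : En n) (ρ : ℝ), r / 8 ≤ ρ ∧ ρ ≤ r / 2 ∧
      closedBall y (ρ / 16) ⊆ ball (q + (r / 4) • ν) (r / 16) ∧ (∀ w, ‖w - y‖ < ρ → w ∈ ball q r ∧ 0 < h w) ∧
      closedBall y ρ ⊆ ball q (2 * r) ∧ ‖x - y‖ < ρ ∧ h x / (4 * r) ≤ (ρ - ‖x - y‖) / ρ := by
  have hqR : ∀ {w : En n} {s : ℝ}, w ∈ ball q s → s ≤ 2 * r → w ∈ ball x₀ R := fun {w s} hw hs => by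
    rw [mem_ball] at hw hq ⊢
    linarith [dist_triangle w q x₀]
  have hxR := hqR hx (by linarith)
  have hnorm : ∀ t : ℝ, 0 ≤ t → ‖t • ν‖ = t := fun t ht => by
    rw [norm_smul, hh.unit, Real.norm_of_nonneg ht, mul_one]
  have hxq : ‖x - q‖ < r / 128 := by rwa [mem_ball, dist_eq_norm] at hx
  have hmem : ∀ t : ℝ, 0 ≤ t → t ≤ r / 64 → x - t • ν ∈ ball q (r / 32) := fun t ht ht' => by
    rw [mem_ball, dist_eq_norm, sub_right_comm]
    linarith [norm_sub_le (x - q) (t • ν), hnorm t ht]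
  have hqx : h x ≤ 65 / 64 * (r / 128) := by
    have := hh.abs_le_norm (hqR (mem_ball_self (half_pos hr)) (by linarith)) hq0 hxR
    linarith [le_abs_self (h x)]
  obtain ⟨t, ht0', ht1, ht, hhx⟩ := hh.exists_zero hx0 (s := r / 64) (by linarith) fun t ht0 ht1 =>
    hqR (hmem t ht0 ht1) (by linarith)
  have ht0 := ht0'.le
  set q' := x - t • ν with hq'
  have hq'R := hqR (hmem t ht0 ht1) (by linarith)
  obtain ⟨g1, g2, g3⟩ := hh.norm_gradient hq'R
  set G := gradient h q' with hG
  set y := q' + (r / 4) • G with hy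
  have hq'q : ‖q' - q‖ < r / 32 := by rw [← dist_eq_norm]; exact hmem t ht0 ht1
  have hyq : ‖y - (q + (r / 4) • ν)‖ < r / 32 + r / 4 * (1 / 64) := by
    have e : y - (q + (r / 4) • ν) = (q' - q) + (r / 4) • (G - ν) := by rw [hy, smul_sub]; abel
    rw [e]
    refine (norm_add_le _ _).trans_lt (add_lt_add_of_lt_of_le hq'q ?_)
    rw [norm_smul, Real.norm_of_nonneg (by positivity)]
    gcongr
    exact hh.grad _ hq'R
  have hyq' : ‖y - q‖ < r / 4 + r / 16 := by
    have e : y - q = (y - (q + (r / 4) • ν)) + (r / 4) • ν := by abel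
    rw [e]
    linarith [norm_add_le (y - (q + (r / 4) • ν)) ((r / 4) • ν), hnorm (r / 4) (by positivity)]
  have hwq : ∀ w, ‖w - q‖ ≤ ‖w - y‖ + ‖y - q‖ := fun w => norm_sub_le_norm_sub_add_norm_sub w y q
  set ρ := r / 4 * ‖G‖ with hρ
  have hρ1 : r / 4 * (63 / 64) ≤ ρ := mul_le_mul_of_nonneg_left g1 (by positivity)
  have hρ2 : ρ ≤ r / 4 * (65 / 64) := mul_le_mul_of_nonneg_left g2 (by positivity)
  have hxy : ‖x - y‖ ^ 2 ≤ ρ ^ 2 - t * (r / 4) := by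
    have e : x - y = t • ν - (r / 4) • G := by rw [hy, hq']; abel
    rw [e, norm_sub_sq_real, inner_smul_left, inner_smul_right, hnorm t ht0, norm_smul,
      Real.norm_of_nonneg (by positivity)]
    simp only [conj_trivial]
    have h1 : t * (r / 4) * (63 / 64) ≤ t * (r / 4) * ⟪ν, G⟫ := by gcongr
    have h2 : t * t ≤ t * (r / 64) := by gcongr
    nlinarith
  have hxy' : ‖x - y‖ < ρ := lt_of_pow_lt_pow_left₀ 2 (by positivity) (by nlinarith)
  refine ⟨y, ρ, by linarith, by linarith, fun w hw => ?_, fun w hw => ?_, fun w hw => ?_, hxy', ?_⟩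
  · rw [mem_closedBall, dist_eq_norm] at hw
    rw [mem_ball, dist_eq_norm]
    linarith [norm_sub_le_norm_sub_add_norm_sub w y (q + (r / 4) • ν)]
  · have hwq' : w ∈ ball q r := by
      rw [mem_ball, dist_eq_norm]; linarith [hwq w]
    refine ⟨hwq', ?_⟩
    have := hh.tangent_ball (σ := 1) (t := r / 4) hq'R (hqR hwq' (by linarith)) ht (by positivity) (by simp) (by linarith)
      (fun e => by
        rw [e, hy, sub_add_cancel_left, norm_neg, norm_smul, Real.norm_of_nonneg (by positivity)] at hw
        exact lt_irrefl _ hw) (by rw [one_mul]; exact hw.le)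
    rwa [one_mul] at this
  · rw [mem_closedBall, dist_eq_norm] at hw
    rw [mem_ball, dist_eq_norm]; linarith [hwq w]
  · have hρ0 : 0 < ρ := by linarith
    rw [div_le_div_iff₀ (by positivity) hρ0]
    have h3 : t * (r / 4) ≤ (ρ - ‖x - y‖) * (2 * ρ) := by nlinarith [norm_nonneg (x - y)]
    have h4 : t * (r / 4) ≤ (ρ - ‖x - y‖) * (65 / 32) * (r / 4) := h3.trans (by
      have := mul_le_mul_of_nonneg_left hρ2 (sub_nonneg.2 hxy'.le)
      linarith)
    have h5 := le_of_mul_le_mul_right h4 (by positivity)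
    have h6 : h x * ρ ≤ 65 / 64 * ((ρ - ‖x - y‖) * (65 / 32)) * (r / 4 * (65 / 64)) := by
      gcongr
      linarith
    have := mul_nonneg (sub_nonneg.2 hxy'.le) hr.le
    linarith

end Krylov


section Step

variable {n : ℕ} {p : ℝ} {h : En n → ℝ} {x₀ ν : En n} {R H : ℝ}

theorem Chart.barrier (hh : Chart h x₀ ν R H) {l Λ K m σ : ℝ} (hl : 0 < l) (hΛ : 0 ≤ Λ) (hK0 : 0 ≤ K)
    (hK : K * l = n * Λ * H) (hm : 0 < m) (hσ : |σ| = 1) {x : En n} (hx : x ∈ ball x₀ R)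
    (hhx : K * |h x| ≤ 1 / 4) : InCone l Λ (fun y => m * (σ * h y + K * h y ^ 2)) x ∧
      m / 4 ≤ ‖gradient (fun y => m * (σ * h y + K * h y ^ 2)) x‖ ∧
      ‖gradient (fun y => m * (σ * h y + K * h y ^ 2)) x‖ ≤ 2 * m := by
  have hω : ∀ t, HasDerivAt (fun t => m * (σ * t + K * t ^ 2)) (m * (σ + 2 * K * t)) t := fun t =>
    ((((hasDerivAt_id' t).const_mul σ).add ((hasDerivAt_pow 2 t).const_mul K)).const_mul m).congr_deriv (by
      push_cast
      ring)
  have hω₁ : HasDerivAt (fun t => m * (σ + 2 * K * t)) (2 * m * K) (h x) :=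
    ((((hasDerivAt_id' (h x)).const_mul (2 * K)).const_add σ).const_mul m).congr_deriv (by ring)
  obtain ⟨g1, g2, -⟩ := hh.norm_gradient hx
  have ha : |2 * K * h x| ≤ 1 / 2 := by
    rw [abs_mul, abs_of_nonneg (by positivity)]; linarith
  have h1 : |σ + 2 * K * h x| ≤ 3 / 2 := (abs_add_le _ _).trans (by linarith)
  have h2 : 1 / 2 ≤ |σ + 2 * K * h x| := by
    have := abs_sub_abs_le_abs_sub σ (-(2 * K * h x))
    rw [abs_neg, sub_neg_eq_add] at this
    linarith
  have hg := gradient_comp (hh.smooth.differentiable (by simp) x) (hω (h x))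
  refine ⟨inCone_comp (g := h) (ω := fun t => m * (σ * t + K * t ^ 2)) hΛ hh.smooth.contDiffAt (.of_forall hω) hω₁ (by positivity) ?_, ?_⟩
  · rw [abs_mul, abs_of_pos hm]
    calc m * |σ + 2 * K * h x| * (n * (Λ * ‖hess h x‖)) ≤ m * (3 / 2) * (n * (Λ * H)) := by
          gcongr
          exact hh.hess_le x hx
      _ = m * (K * l) * (3 / 2) := by rw [hK]; ring
      _ ≤ m * (K * l) * (2 * (63 / 64) ^ 2) := by gcongr; norm_num
      _ ≤ m * (K * l) * (2 * ‖gradient h x‖ ^ 2) := by gcongr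
      _ = _ := by ring
  · rw [hg, norm_smul, Real.norm_eq_abs, abs_mul, abs_of_pos hm]
    constructor <;> nlinarith [mul_le_mul h2 g1 (by norm_num) (by positivity),
      mul_le_mul h1 g2 (by positivity) (by norm_num)]

theorem le_min_annulus {k : ℕ} (hk : 1 ≤ k) {u ρ : ℝ} (hρ : 0 < ρ) (hu : 0 ≤ u) {x : En n}
    (h : u ≤ (ρ - ‖x‖) / ρ) :
    u / 16 ^ (2 * k) ≤ min 1 ((ρ - ‖x‖) / ρ / ((ρ / (ρ / 16)) ^ (2 * k) - 1)) := by
  have hD := cap_denom_pos hk (by positivity : 0 < ρ / 16) (by linarith : ρ / 16 < ρ)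
  rw [div_div_cancel₀ hρ.ne'] at hD ⊢
  refine le_min ((div_le_self hu (one_le_pow₀ (by norm_num))).trans (h.trans ?_))
    (div_le_div₀ (hu.trans h) h hD (by linarith))
  rw [div_le_one hρ]
  linarith [norm_nonneg x]

set_option maxHeartbeats 1000000 in
/-- One step of Krylov's boundary iteration. -/
theorem Chart.step (N : MinkowskiNorm n) (hn : 2 ≤ n) (hp : 1 < p) (hh : Chart h x₀ ν R H) {c₀ C₁ : ℝ}
    (hc : 0 < c₀) (hC : 0 < C₁) : ∃ K η r₁ : ℝ, 0 ≤ K ∧ 0 < η ∧ η ≤ 1 ∧ 0 < r₁ ∧ 4 * r₁ ≤ R ∧ 16 * K * r₁ ≤ 1 ∧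
      ∀ (σ m r A : ℝ) (q : En n) (W : En n → ℝ) (L : ℝ≥0), |σ| = 1 → c₀ ≤ m → m ≤ C₁ → q ∈ ball x₀ (R / 2) →
      h q = 0 → 0 < r → r ≤ r₁ → 0 < A → A ≤ C₁ * r → LocalSol N p {x ∈ ball x₀ R | 0 < h x} L W → L ≤ C₁ →
      (∀ x ∈ ball q r, 0 < h x → m * (σ * h x + K * h x ^ 2) ≤ W x) →
      volume.real (ball (0 : En n) (3 / 4)) / 2 ≤ volume.real {x ∈ ball (0 : En n) (3 / 4) |
        A ≤ W (q + (r / 4) • ν + (r / 8) • x) - m * (σ * h (q + (r / 4) • ν + (r / 8) • x) +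
          K * h (q + (r / 4) • ν + (r / 8) • x) ^ 2)} →
      ∀ x ∈ ball q (r / 128), 0 < h x → (m + σ * (η * (A / r))) * (σ * h x + K * h x ^ 2) ≤ W x := by
  obtain ⟨l, Λ, hl, hlΛ, hE⟩ := fluxMat_bounds N p hp
  have hΛ : 0 ≤ Λ := hl.le.trans hlΛ
  have hR := hh.pos
  have hH := hh.hnn
  obtain ⟨k, hk⟩ := exists_nat_ge (n * Λ / l)
  rw [div_le_iff₀ hl] at hk
  have hk1 : 1 ≤ k + 1 := by omega
  obtain ⟨δ, hδ, hg⟩ := growth_flux N hn hp (c := c₀ / 4) (by positivity) (2 * C₁)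
  set K := n * Λ * H / l with hK
  have hK0 : 0 ≤ K := by positivity
  set D : ℝ := 16 ^ (2 * (k + 1)) with hD
  have hD1 : 1 ≤ D := one_le_pow₀ (by norm_num)
  set T : ℝ := 512 * (k + 1) * 32 ^ (2 * (k + 1)) with hT
  have hT0 : 0 < T := by positivity
  set η := min (min 1 δ) (c₀ / (8 * C₁ * T)) with hη
  have hη0 : 0 < η := by positivity
  refine ⟨K, η / (8 * D), min (R / 4) (1 / (H + 16 * K + 1)), hK0, by positivity, ?_, by positivity, by
    linarith [min_le_left (R / 4) (1 / (H + 16 * K + 1))], ?_, fun σ m r A q W L hσ hm hmC hq hq0 hr hr1 hA hAC hW hL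
      hb hvol x hx hx0 => ?_⟩
  · rw [div_le_one (by positivity)]
    linarith [(min_le_left (min 1 δ) (c₀ / (8 * C₁ * T))).trans (min_le_left 1 δ)]
  · refine (mul_le_mul_of_nonneg_left (min_le_right _ _) (by positivity)).trans ?_
    rw [mul_one_div, div_le_one (by positivity)]
    linarith
  have hrR : 4 * r ≤ R := by linarith [hr1.trans (min_le_left _ _)]
  have hr2 := hr1.trans (min_le_right _ _)
  rw [le_div_iff₀ (by positivity)] at hr2
  have hKr : 0 ≤ K * r := by positivity
  have hHr : 0 ≤ r * H := by positivity
  have hqR : ∀ {w : En n}, w ∈ ball q (2 * r) → w ∈ ball x₀ R := fun {w} hw => by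
    rw [mem_ball] at hw hq ⊢
    linarith [dist_triangle w q x₀]
  have hqr : ball q r ⊆ ball q (2 * r) := ball_subset_ball (by linarith)
  have hqR' := hqR (mem_ball_self (by positivity))
  have hsm : ∀ w ∈ ball q (2 * r), |h w| ≤ 65 / 64 * (2 * r) := fun w hw => by
    have := hh.abs_le_norm hqR' hq0 (hqR hw)
    rw [mem_ball, dist_eq_norm] at hw
    linarith
  have hKs : ∀ w ∈ ball q (2 * r), K * |h w| ≤ 1 / 4 := fun w hw => by
    linarith [mul_le_mul_of_nonneg_left (hsm w hw) hK0]
  have hm0 : 0 < m := hc.trans_le hm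
  set b : En n → ℝ := fun y => m * (σ * h y + K * h y ^ 2) with hbd
  have hbar := fun w hw => hh.barrier hl hΛ hK0 (div_mul_cancel₀ _ hl.ne') hm0 hσ (hqR hw) (hKs w hw)
  have hbs : ContDiff ℝ 2 b := contDiff_const.mul ((contDiff_const.mul hh.smooth).add
    (contDiff_const.mul (hh.smooth.pow 2)))
  obtain ⟨Kb, hbL⟩ := ContDiff.lipschitzWith_of_hasCompactSupport
    (hh.cpt.mono' fun y hy => by
      contrapose! hy
      simp [hbd, image_eq_zero_of_notMem_tsupport hy]) hbs (by simp)
  set z := q + (r / 4) • ν with hz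
  have hzb : ball z (r / 8) ⊆ ball q r := fun w hw => by
    rw [mem_ball, dist_eq_norm] at hw ⊢
    have e : w - q = (w - z) + (r / 4) • ν := by rw [hz]; abel
    rw [e]
    refine (norm_add_le _ _).trans_lt ?_
    rw [norm_smul, hh.unit, Real.norm_of_nonneg (by positivity)]
    linarith
  have hzh : ∀ w ∈ ball z (r / 8), 0 < h w := fun w hw => by
    have := hh.corkscrew hqR' (hqR (hqr (hzb hw))) (s := r / 4) (by positivity)
      (by rw [mem_ball, dist_eq_norm] at hw; linarith)
    linarith
  have hgr := hg z (r / 8) A W b L Kb (by positivity) hA hW.lip hbL (by linarith) (fun w hw => by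
      obtain ⟨-, e1, e2⟩ := hbar w (hqr (hzb hw))
      exact ⟨by linarith, by linarith, hbs.differentiable (by simp) w, hb w (hzb hw) (hzh w hw)⟩)
    (fun C φ hφ h0 hcs hs => ⟨hW.weak C φ hφ hcs fun w hw => image_eq_zero_of_notMem_tsupport fun hw' =>
      hw ⟨hqR (hqr (hzb (hs hw'))), hzh w (hs hw')⟩,
      (integral_flux_gradient_nonpos N p 0 (hE 0) isOpen_ball hbs.contDiffOn (fun w hw => norm_pos_iff.1 (by
        have := (hbar w (hqr (hzb hw))).2.1
        linarith)) (fun w hw => (hbar w (hqr (hzb hw))).1) hφ hcs hs h0).2⟩) hvol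
  obtain ⟨y, ρ, hρ1, hρ2, hyz, hyh, hyq, hxy, hxh⟩ := hh.exists_ball hq hq0 hr hrR (by linarith) hx hx0
  have hρ0 : 0 < ρ := by linarith
  have h12 : ρ / 16 < ρ := by linarith
  set Q := (ρ / (ρ / 16)) ^ (2 * (k + 1)) - 1 with hQ
  have hQ1 : 1 ≤ Q := by
    have : (16 : ℝ) ^ 1 ≤ 16 ^ (2 * (k + 1)) := pow_le_pow_right₀ (by norm_num) (by omega)
    rw [hQ, div_div_cancel₀ hρ0.ne']
    linarith
  obtain ⟨C, hCl⟩ := lipschitz_annB n hk1 (by positivity : 0 < ρ / 16) h12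
  have hτ : 0 < η * A := by positivity
  have hAl : LipschitzWith C fun x => annB (k + 1) (ρ / 16) ρ (x - y) :=
    LipschitzWith.of_dist_le_mul fun x x' => by
      have := hCl.dist_le_mul (x - y) (x' - y)
      rwa [dist_sub_right] at this
  have hz0 : ∀ w, ρ ≤ ‖w - y‖ → max (η * A * annB (k + 1) (ρ / 16) ρ (w - y) - max (W w - b w) 0) 0 = 0 :=
    fun w hw => by
      rw [annB_eq_zero hk1 (by positivity) h12 hw, mul_zero, zero_sub, max_eq_right]
      linarith [le_max_right (W w - b w) 0]
  have key := annulus_lower N p 0 hp (hE 0) hΛ hk1 (by push_cast; nlinarith [(Nat.cast_nonneg k : (0 : ℝ) ≤ k)])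
    (by positivity) h12 (y := y) hτ.le hbL hW.lip (isOpen_ball.inter (isOpen_lt continuous_const (by fun_prop)) :
      IsOpen (ball q (2 * r) ∩ {w | ρ / 32 < ‖w - y‖})) (fun w hw1 hw2 => ⟨hyq (by rwa [mem_closedBall, dist_eq_norm]),
      (by linarith : ρ / 32 < ‖w - y‖)⟩) hbs.contDiffOn (fun w hw => (hbar w hw.1).1) (fun w hw hwy h0 => by
      have hw2 : ρ / 32 < ‖w - y‖ := hw.2
      have e1 := (hbar w hw.1).2.1
      rw [eq_neg_of_add_eq_zero_left h0, norm_neg, norm_smul, gradient_radB hwy, norm_smul, norm_neg, ← hQ,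
        Real.norm_of_nonneg hτ.le, Real.norm_of_nonneg (by positivity)] at e1
      have e2 : 2 * ((k + 1 : ℕ) : ℝ) * (ρ / ‖w - y‖) ^ (2 * (k + 1)) / Q / ‖w - y‖ ^ 2 * ‖w - y‖ ≤ T / r := by
        have hw0 : 0 < ‖w - y‖ := by linarith
        have e3 : ρ / ‖w - y‖ ≤ 32 := by rw [div_le_iff₀ hw0]; linarith
        have e4 : 1 / ‖w - y‖ ≤ 256 / r := by rw [div_le_div_iff₀ hw0 hr]; linarith
        calc _ = 2 * (k + 1) * (ρ / ‖w - y‖) ^ (2 * (k + 1)) / Q * (1 / ‖w - y‖) := by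
              push_cast; field_simp
          _ ≤ 2 * (k + 1) * 32 ^ (2 * (k + 1)) / 1 * (256 / r) := by gcongr
          _ = T / r := by rw [hT]; ring
      have e5 : η * A * (T / r) ≤ c₀ / 8 := by
        calc η * A * (T / r) ≤ c₀ / (8 * C₁ * T) * (C₁ * r) * (T / r) := by
              gcongr
              exact min_le_right _ _
          _ = c₀ / 8 := by field_simp
      linarith [mul_le_mul_of_nonneg_left e2 hτ.le]) (fun w hw => hb w (hyh w hw).1 (hyh w hw).2)
    (fun w hw => by
      have := hgr w (ball_subset_ball (by linarith) (hyz (by rwa [mem_closedBall, dist_eq_norm])))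
      have e : η * A ≤ δ * A := by
        gcongr
        exact (min_le_left _ _).trans (min_le_right _ _)
      linarith)
    (hW.weak _ _ ((((lipschitzWith_smul (η * A)).comp hAl).sub ((hW.lip.sub hbL).max_const 0)).max_const 0)
      (hasCompactSupport_of_ball hz0).2 fun w hw => hz0 w (not_lt.1 fun hwy =>
        hw ⟨hqR (hqr (hyh w hwy).1), (hyh w hwy).2⟩)).ge x hxy
  have hKx : K * h x ≤ 1 := by
    have := hKs x (ball_subset_ball (by linarith) hx)
    rw [abs_of_pos hx0] at this
    linarith
  have hlow := (le_min_annulus hk1 hρ0 (by positivity : 0 ≤ h x / (4 * r)) hxh).trans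
    (le_annB hk1 (by positivity) h12 (x - y))
  have e6 : η * A * (h x / (4 * r) / D) = 2 * (η / (8 * D) * (A / r)) * h x := by field_simp; ring
  have e7 := mul_le_mul_of_nonneg_left hlow hτ.le
  set τ := η / (8 * D) * (A / r) with hτd
  have hτ0 : 0 ≤ τ := by positivity
  have hσ2 : σ * σ = 1 := by rw [← abs_mul_abs_self, hσ, one_mul]
  have e8 : σ * (K * h x) ≤ 1 := (le_abs_self _).trans (by
    rw [abs_mul, hσ, one_mul, abs_of_nonneg (by positivity)]; exact hKx)
  have e9 := mul_le_mul_of_nonneg_left e8 (mul_nonneg hτ0 hx0.le)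
  simp only [hbd] at key
  calc _ = m * (σ * h x + K * h x ^ 2) + τ * h x * (σ * σ) + τ * h x * (σ * (K * h x)) := by ring
    _ ≤ _ := by rw [hσ2]; linarith

end Step


section Hopf

variable {n : ℕ} {p C α : ℝ} {N : MinkowskiNorm n} {P : Set (En n)} {L : ℝ≥0} {v : En n → ℝ}

theorem Capacitary.localSol (hv : Capacitary N p P L C α v) {U : Set (En n)} (hU : ∀ x ∈ U, x ∉ P) :
    LocalSol N p U L fun x => 1 - v x := by
  refine ⟨by simpa using (LipschitzWith.const (1 : ℝ)).sub hv.lip, fun K φ hφ hc h0 => ?_⟩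
  simp_rw [gradient_const_sub, flux_neg, inner_neg_left, integral_neg,
    hv.weak K φ hφ hc fun x hx => h0 x fun hxU => hU x hxU hx, neg_zero]

theorem Capacitary.exists_lower (hv : Capacitary N p P L C α v) (hp : 1 < p) : ∃ D : ℝ, 0 < D ∧
    ∀ (y : En n) (ρ τ : ℝ), 0 < ρ → 0 < τ → (∀ x, ‖x - y‖ < ρ → x ∉ P) →
      (∀ x ∈ closedBall y (ρ / 16), τ ≤ 1 - v x) → ∀ (x : En n) (u : ℝ), 0 ≤ u → u ≤ (ρ - ‖x - y‖) / ρ →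
      ‖x - y‖ < ρ → τ * (u / D) ≤ 1 - v x := by
  obtain ⟨k, hk, h⟩ := exists_annulus_lower N hp
  refine ⟨16 ^ (2 * k), by positivity, fun y ρ τ hρ hτ hP hin x u hu hux hxy =>
    (mul_le_mul_of_nonneg_left (le_min_annulus hk hρ hu hux) hτ.le).trans ?_⟩
  have hs := hv.localSol (U := Pᶜ) fun _ h => h
  exact h 0 (ρ / 16) ρ τ y _ L (by positivity) (by linarith) hτ hs.lip (fun x _ => sub_nonneg.2 (hv.le_one x))
    (fun x hx => hin x (by rwa [mem_closedBall, dist_eq_norm])) (fun K φ hφ _ h0 _ => hs.weak K φ hφ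
      (hasCompactSupport_of_ball h0).2 fun x hx => h0 x (not_lt.1 fun hxy => hP x hxy (not_not.1 hx))) x hxy

/-- The strong maximum principle. -/
theorem Capacitary.eq_one_of_near (hv : Capacitary N p P L C α v) (hp : 1 < p) {z : En n} (hz : v z = 1)
    {d : ℝ} (hd : ∀ y ∈ P, d ≤ ‖y - z‖) {x : En n} (hx : ‖x - z‖ < d / 3) : v x = 1 := by
  by_contra hx1
  obtain ⟨w, hw, hwx⟩ := (isClosed_eq hv.lip.continuous continuous_const : IsClosed {x | v x = 1}).exists_infDist_eq_dist
    ⟨z, hz⟩ x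
  have hmin : ∀ y, v y = 1 → dist x w ≤ ‖y - x‖ := fun y hy => by
    rw [← hwx, ← dist_eq_norm, dist_comm]
    exact infDist_le_dist_of_mem hy
  set ρ := dist x w with hρd
  have hρ : 0 < ρ := dist_pos.2 fun e => hx1 (e ▸ hw)
  have hw1 : v w = 1 := hw
  have hwx' : ‖x - w‖ = ρ := (dist_eq_norm x w).symm
  have hρd3 : ρ < d / 3 := (hmin z hz).trans_lt (by rwa [norm_sub_rev])
  obtain ⟨m, hm, hmax⟩ := (isCompact_closedBall x (ρ / 16)).exists_isMaxOn ⟨x, mem_closedBall_self (by positivity)⟩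
    hv.lip.continuous.continuousOn
  have hτ : 0 < 1 - v m := sub_pos.2 ((hv.le_one m).lt_of_ne fun e => by
    have := hmin m e
    rw [mem_closedBall, dist_eq_norm] at hm
    linarith)
  obtain ⟨D, hD, hlow⟩ := hv.exists_lower hp
  have hw0 := (hv.expansion w (d / 3) (hρ.trans hρd3) fun y hy => by
    have h1 := hd y hy
    have h2 := norm_sub_le_norm_sub_add_norm_sub y w z
    have h3 := norm_sub_le_norm_sub_add_norm_sub w x z
    rw [norm_sub_rev w x] at h3
    linarith).1
  have hg : gradient v w = 0 := by
    rw [gradient, IsLocalMax.fderiv_eq_zero (.of_forall fun y => (hv.le_one y).trans hw1.ge), map_zero]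
  have ho := (hasGradientAt_iff_isLittleO.1 (hg ▸ hw0.hasGradientAt)).def
    (by positivity : 0 < (1 - v m) / (2 * D * ρ))
  have ht : Tendsto (fun t : ℝ => w + t • (x - w)) (𝓝[>] 0) (𝓝 w) :=
    (Continuous.tendsto' (by fun_prop) _ _ (by simp)).mono_left nhdsWithin_le_nhds
  obtain ⟨t, ht, ht0, ht1⟩ := ((ht.eventually ho).and (Ioo_mem_nhdsGT one_pos)).exists
  have e1 : ‖w + t • (x - w) - x‖ = (1 - t) * ρ := by
    rw [show w + t • (x - w) - x = -((1 - t) • (x - w)) by module, norm_neg, norm_smul, hwx',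
      Real.norm_of_nonneg (by linarith)]
  have := hlow x ρ (1 - v m) hρ hτ (fun y hy hyP => (hmin y (hv.one y hyP)).not_gt hy)
    (fun y hy => sub_le_sub_left (hmax hy) 1) (w + t • (x - w)) t ht0.le (by
      rw [e1, le_div_iff₀ hρ]; linarith) (by rw [e1]; nlinarith)
  rw [inner_zero_left, sub_zero, hw1, Real.norm_eq_abs, add_sub_cancel_left, norm_smul, hwx',
    Real.norm_of_nonneg ht0.le] at ht
  have e2 : (1 - v m) / (2 * D * ρ) * (t * ρ) = (1 - v m) * (t / D) / 2 := by field_simp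
  have : 0 < (1 - v m) * (t / D) := by positivity
  linarith [(abs_le.1 ht).1]

theorem Capacitary.dichotomy (hv : Capacitary N p P L C α v) (hp : 1 < p) (hP : IsClosed P) {S : Set (En n)}
    (hS : IsPreconnected S) (hSP : ∀ x ∈ S, x ∉ P) : (∀ x ∈ S, v x = 1) ∨ ∀ x ∈ S, v x < 1 := by
  refine hS.subset_or_subset (u := {x | x ∉ P ∧ v x = 1}) (v := {x | v x < 1})
    (Metric.isOpen_iff.2 fun z hz => ?_) (isOpen_lt hv.lip.continuous continuous_const)
    (disjoint_left.2 fun x hx hx' => hx'.ne hx.2) (fun x hx => (hv.le_one x).eq_or_lt.imp (fun h => ⟨hSP x hx, h⟩) id)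
    |>.imp (fun h x hx => (h hx).2) fun h x hx => h hx
  obtain ⟨d, hd, hdP⟩ := Metric.isOpen_iff.1 hP.isOpen_compl z hz.1
  refine ⟨d / 3, by positivity, fun x hx => ⟨hdP (ball_subset_ball (by linarith) hx), hv.eq_one_of_near hp hz.2
    (fun y hy => not_lt.1 fun h => hdP (mem_ball_iff_norm.2 h) hy) (mem_ball_iff_norm.1 hx)⟩⟩

variable {h : En n → ℝ} {x₀ ν : En n} {R H : ℝ}

/-- Near a boundary point the solution is trivial or satisfies Hopf's inequality. -/
theorem Capacitary.hopf (hv : Capacitary N p P L C α v) (hp : 1 < p) (hP : IsClosed P)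
    (hh : Chart h x₀ ν R H) (hhP : ∀ x ∈ ball x₀ R, 0 < h x → x ∉ P) (h0 : h x₀ = 0) :
    ∃ r c : ℝ, 0 < r ∧ r ≤ R ∧ ((∀ x ∈ ball x₀ r, 0 < h x → v x = 1) ∨
      (0 < c ∧ ∀ x ∈ ball x₀ r, 0 < h x → c * h x ≤ 1 - v x)) := by
  have hR := hh.pos
  have hH := hh.hnn
  set r := min (R / 4) (1 / (H + 1)) with hr
  have hr0 : 0 < r := by positivity
  have hrR : 4 * r ≤ R := by linarith [min_le_left (R / 4) (1 / (H + 1))]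
  have hrH : r * H ≤ 1 := by
    have := min_le_right (R / 4) (1 / (H + 1))
    rw [← hr, le_div_iff₀ (by positivity)] at this
    linarith
  set z := x₀ + (r / 4) • ν with hz
  have hin : ∀ x ∈ ball x₀ (r / 128), ∀ s : ℝ, 0 < s → s ≤ r / 4 → ∀ y, ‖y - (x + s • ν)‖ ≤ s / 2 →
      y ∈ ball x₀ R ∧ h x < h y := fun x hx s hs hsr y hy => by
    have hyR : y ∈ ball x₀ R := by
      rw [mem_ball_iff_norm] at hx ⊢
      have e : y - x₀ = (y - (x + s • ν)) + s • ν + (x - x₀) := by abel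
      have := norm_add₃_le (a := y - (x + s • ν)) (b := s • ν) (c := x - x₀)
      rw [norm_smul, hh.unit, Real.norm_of_nonneg hs.le] at this
      rw [e]
      linarith
    exact ⟨hyR, by linarith [hh.corkscrew (ball_subset_ball (by linarith) hx) hyR hs hy]⟩
  have hB : ∀ y ∈ closedBall z (r / 8), y ∉ P := fun y hy => by
    obtain ⟨h1, h2⟩ := hin x₀ (mem_ball_self (by positivity)) (r / 4) (by positivity) le_rfl y (by
      rw [mem_closedBall, dist_eq_norm] at hy; linarith)
    exact hhP y h1 (h0 ▸ h2)
  have hsub : closedBall z (r / 16) ⊆ closedBall z (r / 8) := closedBall_subset_closedBall (by linarith)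
  rcases hv.dichotomy hp hP (convex_closedBall z (r / 8)).isPreconnected hB with hB1 | hB1
  · refine ⟨r / 128, 0, by positivity, by linarith, .inl fun x hx hx0 => ?_⟩
    refine ((hv.dichotomy hp hP (convex_segment x (x + (r / 4) • ν)).isPreconnected fun y hy => ?_).resolve_right
      fun hc => (hc _ (right_mem_segment ..)).ne (hB1 _ ?_)) x (left_mem_segment ..)
    · rw [segment_eq_image'] at hy
      obtain ⟨t, ⟨ht0, ht1⟩, rfl⟩ := hy
      rcases ht0.eq_or_lt with rfl | ht0
      · simpa using hhP x (ball_subset_ball (by linarith) hx) hx0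
      · obtain ⟨h1, h2⟩ := hin x hx (t * (r / 4)) (by positivity) (by nlinarith) (x + t • (x + (r / 4) • ν - x)) (by
          rw [add_sub_cancel_left, smul_smul, sub_self, norm_zero]; positivity)
        exact hhP _ h1 (hx0.trans h2)
    · rw [mem_closedBall, dist_eq_norm, hz, add_sub_add_right_eq_sub]
      rw [mem_ball_iff_norm] at hx
      linarith
  · obtain ⟨m, hm, hmax⟩ := (isCompact_closedBall z (r / 16)).exists_isMaxOn
      ⟨z, mem_closedBall_self (by positivity)⟩ hv.lip.continuous.continuousOn
    obtain ⟨D, hD, hlow⟩ := hv.exists_lower hp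
    have hτ := sub_pos.2 (hB1 m (hsub hm))
    refine ⟨r / 128, (1 - v m) / (4 * r * D), by positivity, by linarith, .inr ⟨by positivity, fun x hx hx0 => ?_⟩⟩
    obtain ⟨y, ρ, hρ1, hρ2, hyz, hyh, hyq, hxy, hxh⟩ :=
      hh.exists_ball (mem_ball_self (half_pos hR)) h0 hr0 hrR hrH hx hx0
    have := hlow y ρ (1 - v m) (by linarith) hτ (fun w hw => hhP w (ball_subset_ball (by linarith) (hyh w hw).1)
      (hyh w hw).2) (fun w hw => sub_le_sub_left (hmax (ball_subset_closedBall (hyz hw))) 1) x _ (by positivity) hxh hxy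
    refine le_of_eq_of_le ?_ this
    field_simp

end Hopf


section Krylov

variable {n : ℕ} {p : ℝ} {h : En n → ℝ} {x₀ ν : En n} {R H : ℝ}

theorem exists_exponent {μ : ℝ} (h0 : 1 / 2 ≤ μ) (h1 : μ < 1) : ∃ β : ℝ, 0 < β ∧ β ≤ 1 ∧
    ∀ t : ℝ, 0 < t → t ≤ 1 → ∃ k : ℕ, t ≤ (1 / 128) ^ k ∧ μ ^ k ≤ 2 * t ^ β := by
  have hμ : 0 < μ := by linarith
  have hl : Real.log (1 / 128) < 0 := Real.log_neg (by norm_num) (by norm_num)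
  set β := Real.log μ / Real.log (1 / 128) with hβ
  have hb : 0 < β := div_pos_of_neg_of_neg (Real.log_neg hμ h1) hl
  have he : (1 / 128 : ℝ) ^ β = μ := by
    rw [Real.rpow_def_of_pos (by norm_num), hβ, mul_div_cancel₀ _ hl.ne, Real.exp_log hμ]
  refine ⟨β, hb, ?_, fun t ht ht1 => ?_⟩
  · rw [hβ, div_le_one_of_neg hl]
    exact Real.log_le_log (by norm_num) (by linarith)
  · obtain ⟨k, hk1, hk2⟩ := exists_nat_pow_near_of_lt_one ht ht1 (y := (1 / 128 : ℝ)) (by norm_num) (by norm_num)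
    refine ⟨k, hk2, ?_⟩
    have := Real.rpow_le_rpow (by positivity) hk1.le hb.le
    rw [← Real.rpow_natCast, ← Real.rpow_mul (by norm_num), mul_comm _ β, Real.rpow_mul (by norm_num), he, Real.rpow_natCast, pow_succ] at this
    nlinarith [pow_pos hμ k]

theorem exists_iterate {S : ℕ → ℝ → Prop} {m₀ D μ : ℝ} (hD : 0 ≤ D) (hμ : 0 ≤ μ) (h0 : S 0 m₀)
    (hS : ∀ k m, S k m → ∃ m', S (k + 1) m' ∧ m ≤ m' ∧ m' + D * μ ^ (k + 1) ≤ m + D * μ ^ k) :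
    ∃ κ, ∀ k, ∃ m, S k m ∧ m ≤ κ ∧ κ ≤ m + D * μ ^ k := by
  choose! f hf using hS
  let a : ℕ → ℝ := fun k => Nat.rec m₀ f k
  have ha : ∀ k, S k (a k) := fun k => by
    induction k with
    | zero => exact h0
    | succ k ih => exact (hf k _ ih).1
  have := Monotone.ciSup_mem_iInter_Icc_of_antitone (f := a) (g := fun k => a k + D * μ ^ k)
    (monotone_nat_of_le_succ fun k => (hf k _ (ha k)).2.1)
    (antitone_nat_of_succ_le fun k => (hf k _ (ha k)).2.2) (fun k => le_add_of_nonneg_right (by positivity))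
  exact ⟨_, fun k => ⟨a k, ha k, Set.mem_iInter.1 this k⟩⟩

theorem half_le_or {B S T : Set (En n)} (hB : MeasurableSet B) (hB' : volume B ≠ ⊤) (h : B ⊆ S ∪ T) (hS : S ⊆ B) (hT : T ⊆ B) :
    volume.real B / 2 ≤ volume.real S ∨ volume.real B / 2 ≤ volume.real T := by
  by_contra! hc
  have h1 := (measureReal_mono h (measure_ne_top_of_subset (union_subset hS hT) hB')).trans
    (measureReal_union_le (μ := volume) S T)
  linarith

set_option maxHeartbeats 1000000 in
theorem Chart.krylov (N : MinkowskiNorm n) (hn : 2 ≤ n) (hp : 1 < p) (hh : Chart h x₀ ν R H) {c₀ C₁ r' : ℝ}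
    (hc : 0 < c₀) (hcC : c₀ + 1 ≤ C₁) {L : ℝ≥0} {W : En n → ℝ}
    (hW : LocalSol N p {x ∈ ball x₀ R | 0 < h x} L W) (hL : L ≤ C₁) (hr' : 0 < r')
    (hlow : ∀ x ∈ ball x₀ r', 0 < h x → 5 / 4 * c₀ * h x ≤ W x)
    (hup : ∀ x ∈ ball x₀ r', 0 < h x → W x ≤ 3 / 4 * C₁ * h x) :
    ∃ ρ B β : ℝ, 0 < ρ ∧ 0 ≤ B ∧ 0 < β ∧ β ≤ 1 ∧ ∀ q ∈ ball x₀ ρ, h q = 0 → ∃ κ : ℝ, 0 ≤ κ ∧ κ ≤ C₁ ∧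
      ∀ y ∈ ball q ρ, 0 < h y → |W y - κ * h y| ≤ B * ‖y - q‖ ^ (1 + β) := by
  have hC : 0 < C₁ := by linarith
  obtain ⟨K, η, r₁, hK, hη, hη1, hr₁, hR, hKr, hst⟩ := hh.step N hn hp hc hC
  set D := C₁ - c₀ with hD
  set μ := 1 - η / 64 with hμ
  obtain ⟨β, hβ, hβ1, hβk⟩ := exists_exponent (μ := μ) (by linarith) (by linarith)
  obtain ⟨r₀, hr₀, hr₀1, hr₀2, hr₀3⟩ : ∃ r₀ : ℝ, 0 < r₀ ∧ r₀ ≤ r₁ ∧ r₀ ≤ r' / 2 ∧ 5 * C₁ * K * r₀ ≤ 1 := by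
    refine ⟨min (min r₁ (r' / 2)) (1 / (5 * C₁ * K + 1)), by positivity, (min_le_left _ _).trans (min_le_left _ _),
      (min_le_left _ _).trans (min_le_right _ _), ?_⟩
    calc _ ≤ 5 * C₁ * K * (1 / (5 * C₁ * K + 1)) := by gcongr; exact min_le_right _ _
      _ ≤ 1 := by rw [mul_one_div, div_le_one (by positivity)]; linarith
  refine ⟨r₀ / 2, D * 4 * (2 / r₀) ^ β, β, by positivity, by have : 0 ≤ D := by linarith
                                                             positivity, hβ, hβ1, fun q hq hq0 => ?_⟩
  rw [mem_ball] at hq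
  have hqR : q ∈ ball x₀ (R / 2) := mem_ball.2 (by linarith)
  have hqR' : q ∈ ball x₀ R := mem_ball.2 (by linarith)
  have hbR : ∀ {x : En n} {r : ℝ}, r ≤ r₀ → x ∈ ball q r → x ∈ ball x₀ R ∧ x ∈ ball x₀ r' := fun {x r} hr hx => by
    rw [mem_ball] at hx
    constructor <;> rw [mem_ball] <;> linarith [dist_triangle x q x₀]
  have hle : ∀ {x : En n} {r : ℝ}, r ≤ r₀ → x ∈ ball q r → h x ≤ 65 / 64 * ‖x - q‖ := fun hr hx =>
    (le_abs_self _).trans (hh.abs_le_norm hqR' hq0 (hbR hr hx).1)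
  let S : ℝ → ℝ → ℝ → Prop := fun r m M => ∀ x ∈ ball q r, 0 < h x →
    m * (h x + K * h x ^ 2) ≤ W x ∧ W x ≤ M * (h x - K * h x ^ 2)
  have one : ∀ r m M : ℝ, 0 < r → r ≤ r₀ → c₀ ≤ m → m ≤ M → M ≤ C₁ → 5 * C₁ * K * r ≤ M - m → 0 < M - m → S r m M →
      ∃ m' M', c₀ ≤ m' ∧ m ≤ m' ∧ M' ≤ M ∧ M' - m' = μ * (M - m) ∧ S (r / 128) m' M' := by
    intro r m M hr hrr hm hmM hM hKΔ hΔ hS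
    set A := (M - m) * r / 64 with hA
    have hA0 : 0 < A := by positivity
    have hAC : A ≤ C₁ * r := by rw [hA]; nlinarith
    have hAr : η * (A / r) = η / 64 * (M - m) := by rw [hA]; field_simp
    have hsub : ball q (r / 128) ⊆ ball q r := ball_subset_ball (by linarith)
    have hor := half_le_or (B := ball (0 : En n) (3 / 4))
      (S := {x ∈ ball 0 (3 / 4) | A ≤ W (q + (r / 4) • ν + (r / 8) • x) - m * (1 * h (q + (r / 4) • ν + (r / 8) • x) + K * h (q + (r / 4) • ν + (r / 8) • x) ^ 2)})
      (T := {x ∈ ball 0 (3 / 4) | A ≤ -W (q + (r / 4) • ν + (r / 8) • x) - M * (-1 * h (q + (r / 4) • ν + (r / 8) • x) + K * h (q + (r / 4) • ν + (r / 8) • x) ^ 2)})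
      measurableSet_ball measure_ball_lt_top.ne (fun x hx => ?_) (sep_subset _ _) (sep_subset _ _)
    · rcases hor with hor | hor
      · have := hst 1 m r A q W L (by simp) hm (by linarith) hqR hq0 hr (by linarith) hA0 hAC hW hL
          (fun x hx hx0 => by rw [one_mul]; exact (hS x hx hx0).1) hor
        rw [hAr] at this
        refine ⟨m + η / 64 * (M - m), M, by nlinarith, by nlinarith, le_rfl, by rw [hμ]; ring, fun x hx hx0 =>
          ⟨by simpa using this x hx hx0, (hS x (hsub hx) hx0).2⟩⟩
      · have := hst (-1) M r A q (fun x => -W x) L (by simp) (by linarith) hM hqR hq0 hr (by linarith) hA0 hAC hW.neg hL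
          (fun x hx hx0 => by linarith [(hS x hx hx0).2]) hor
        rw [hAr] at this
        exact ⟨m, M - η / 64 * (M - m), hm, le_rfl, by nlinarith, by rw [hμ]; ring, fun x hx hx0 =>
          ⟨(hS x (hsub hx) hx0).1, by linarith [this x hx hx0]⟩⟩
    · set y := q + (r / 4) • ν + (r / 8) • x with hy
      rw [mem_ball_zero_iff] at hx
      have e1 : ‖y - (q + (r / 4) • ν)‖ ≤ 3 / 32 * r := by
        rw [hy, add_sub_cancel_left, norm_smul, Real.norm_of_nonneg (by positivity)]; nlinarith
      have e2 : ‖y - q‖ < r / 2 := by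
        have := norm_add_le ((r / 4) • ν) (y - (q + (r / 4) • ν))
        rw [norm_smul, hh.unit, Real.norm_of_nonneg (by positivity), show (r / 4) • ν + (y - (q + (r / 4) • ν)) = y - q by abel] at this
        linarith
      have hyr : y ∈ ball q r := by rw [mem_ball, dist_eq_norm]; linarith
      have e3 := hh.corkscrew (s := r / 4) hqR' (hbR hrr hyr).1 (by positivity) (by linarith)
      have e4 := hle hrr hyr
      rw [hq0, zero_add] at e3
      have e5 := hS y hyr (by linarith)
      have e6 : (m + M) * K * h y ≤ (M - m) / 4 := by
        calc (m + M) * K * h y ≤ (2 * C₁) * K * (65 / 128 * r) := by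
              have : 0 ≤ m + M := by linarith
              gcongr
              · linarith
              · linarith
              · linarith
          _ ≤ _ := by nlinarith [mul_nonneg (mul_nonneg hC.le hK) hr.le]
      by_contra hcon
      have e7 := mul_le_mul_of_nonneg_right e6 (show 0 ≤ h y by linarith)
      have e8 := not_le.1 fun g => hcon (Or.inl ⟨mem_ball_zero_iff.2 hx, g⟩)
      have e9 := not_le.1 fun g => hcon (Or.inr ⟨mem_ball_zero_iff.2 hx, g⟩)
      rw [← hy] at e8 e9
      linarith [mul_pos hΔ (sub_pos.2 e3)]
  obtain ⟨κ, hκ⟩ := exists_iterate (D := D) (μ := μ) (m₀ := c₀) (S := fun k m => c₀ ≤ m ∧ m + D * μ ^ k ≤ C₁ ∧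
      S (r₀ / 128 ^ k) m (m + D * μ ^ k)) (by linarith) (by linarith)
    ⟨le_rfl, by simp [hD], fun x hx hx0 => by
      rw [pow_zero, div_one] at hx
      have h1 := hle le_rfl hx
      have h2 := (hbR le_rfl hx).2
      rw [mem_ball, dist_eq_norm] at hx
      have h3 : K * h x ≤ 1 / 4 := by nlinarith
      have h4 : K * h x ^ 2 ≤ 1 / 4 * h x := by nlinarith
      constructor
      · nlinarith [hlow x h2 hx0]
      · rw [pow_zero, mul_one, hD, add_sub_cancel]
        nlinarith [hup x h2 hx0]⟩ (fun k m ⟨h1, h2, h3⟩ => by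
      have hμk : 0 < D * μ ^ k := mul_pos (by linarith) (pow_pos (by linarith) k)
      obtain ⟨m', M', g1, g2, g3, g4, g5⟩ := one (r₀ / 128 ^ k) m (m + D * μ ^ k) (by positivity)
        (div_le_self hr₀.le (one_le_pow₀ (by norm_num))) h1 (by linarith) h2 (by
          rw [← mul_div_assoc, div_le_iff₀ (by positivity), add_sub_cancel_left, mul_assoc D, ← mul_pow]
          have : (1 : ℝ) ≤ (μ * 128) ^ k := one_le_pow₀ (by linarith)
          nlinarith) (by linarith) h3
      have e : M' = m' + D * μ ^ (k + 1) := by rw [pow_succ]; linarith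
      rw [div_div, ← pow_succ] at g5
      subst e
      exact ⟨m', ⟨g1, by linarith, g5⟩, g2, g3⟩)
  obtain ⟨m, ⟨k1, k2, -⟩, k3, k4⟩ := hκ 0
  refine ⟨κ, by linarith, by linarith, fun y hy hy0 => ?_⟩
  rw [mem_ball, dist_eq_norm] at hy
  have hyq : 0 < ‖y - q‖ := by
    refine norm_pos_iff.2 (sub_ne_zero.2 fun e => ?_)
    rw [e, hq0] at hy0
    exact hy0.false
  obtain ⟨k, hk1, hk2⟩ := hβk (‖y - q‖ * (2 / r₀)) (by positivity) (by
    rw [← mul_div_assoc, div_le_one hr₀]; linarith)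
  obtain ⟨m, ⟨h2, -, hS⟩, h3, h4⟩ := hκ k
  have hyr : ‖y - q‖ < r₀ / 128 ^ k := by
    rw [one_div_pow, ← mul_div_assoc, div_le_div_iff₀ hr₀ (by positivity)] at hk1
    rw [lt_div_iff₀ (by positivity)]
    linarith
  obtain ⟨h5, h6⟩ := hS y (by rwa [mem_ball, dist_eq_norm]) hy0
  have h7 := hle (r := r₀) le_rfl (mem_ball.2 (by rw [dist_eq_norm]; linarith))
  have hμk : 0 ≤ D * μ ^ k := mul_nonneg (by linarith) (pow_nonneg (by linarith) k)
  have h8 : |W y - κ * h y| ≤ D * μ ^ k * h y := by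
    have g1 : 0 ≤ K * h y ^ 2 := by positivity
    have g2 : 0 ≤ m := by linarith
    rw [abs_le]
    constructor <;> nlinarith [mul_nonneg g2 g1, mul_nonneg hμk g1]
  calc _ ≤ D * (2 * (‖y - q‖ * (2 / r₀)) ^ β) * (2 * ‖y - q‖) := by
        refine h8.trans (mul_le_mul (mul_le_mul_of_nonneg_left hk2 (by linarith)) (by linarith) hy0.le ?_)
        have : 0 ≤ D := by linarith
        positivity
    _ = _ := by rw [Real.mul_rpow hyq.le (by positivity), Real.rpow_add hyq, Real.rpow_one]; ring
end Krylov


section BoundaryExpansion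

variable {n : ℕ} {N : MinkowskiNorm n} {p : ℝ} {P : Set (En n)} {L : ℝ≥0} {C α : ℝ} {v h : En n → ℝ}
  {x₀ ν : En n} {R H : ℝ}

theorem Capacitary.upper (hv : Capacitary N p P L C α v) (hh : Chart h x₀ ν R H)
    (hhP : ∀ x ∈ ball x₀ R, h x = 0 → x ∈ P) {x : En n} (h0 : h x₀ = 0) (hx : x ∈ ball x₀ (R / 8)) (hx0 : 0 < h x) :
    1 - v x ≤ 3 / 2 * L * h x := by
  have hR := hh.pos
  have h1 := hh.abs_le_norm (mem_ball_self hR) h0 (ball_subset_ball (by linarith) hx)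
  rw [mem_ball, dist_eq_norm] at hx
  have hm : ∀ t : ℝ, 0 ≤ t → t ≤ R / 4 → x - t • ν ∈ ball x₀ R := fun t ht ht' => by
    have := norm_sub_le (x - x₀) (t • ν)
    rw [norm_smul, hh.unit, Real.norm_of_nonneg ht] at this
    rw [mem_ball, dist_eq_norm, sub_right_comm]
    linarith
  obtain ⟨t, ht, ht', ht0, ht1, ht2⟩ := hh.exists_zero hx0 (s := R / 4) (by linarith [le_abs_self (h x)]) hm
  have h2 := hv.lip.dist_le_mul (x - t • ν) x
  rw [hv.one _ (hhP _ (hm t ht.le ht') ht0), Real.dist_eq, dist_eq_norm, sub_sub_cancel_left, norm_neg, norm_smul,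
    hh.unit, Real.norm_of_nonneg ht.le] at h2
  have h3 : (L : ℝ) * t ≤ L * (3 / 2 * h x) := by gcongr; linarith
  linarith [le_abs_self (1 - v x)]

theorem Capacitary.boundary (hv : Capacitary N p P L C α v) (hn : 2 ≤ n) (hp : 1 < p) (hP : IsClosed P)
    (hh : Chart h x₀ ν R H) (hhP : ∀ x ∈ ball x₀ R, x ∈ P ↔ h x ≤ 0) (h0 : h x₀ = 0) :
    ∃ ρ B β : ℝ, 0 < ρ ∧ 0 ≤ B ∧ 0 < β ∧ β ≤ 1 ∧ ∀ q ∈ ball x₀ ρ, h q = 0 → ∃ g : En n,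
      ∀ y ∈ ball q ρ, 0 ≤ h y → |v y - 1 - ⟪g, y - q⟫| ≤ B * ‖y - q‖ ^ (1 + β) := by
  have hR := hh.pos
  have hpos : ∀ x ∈ ball x₀ R, 0 < h x → x ∉ P := fun x hx hx0 hxP => hx0.not_ge ((hhP x hx).1 hxP)
  have hz : ∀ x ∈ ball x₀ R, h x = 0 → v x = 1 := fun x hx hx0 => hv.one x ((hhP x hx).2 hx0.le)
  have hqy : ∀ {r : ℝ} {q y : En n}, q ∈ ball x₀ (r / 2) → y ∈ ball q (r / 2) → y ∈ ball x₀ r := fun {r q y} hq hy => by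
    rw [mem_ball] at *
    linarith [dist_triangle y q x₀]
  obtain ⟨r, c, hr, hrR, hd | ⟨hc, hl⟩⟩ := hv.hopf hp hP hh hpos h0
  · refine ⟨r / 2, 0, 1, by positivity, le_rfl, one_pos, le_rfl, fun q hq hq0 => ⟨0, fun y hy hy0 => ?_⟩⟩
    have : v y = 1 := hy0.eq_or_lt.elim (fun e => hz y (ball_subset_ball hrR (hqy hq hy)) e.symm) (hd y (hqy hq hy))
    simp [this]
  · set c₀ := 4 / 5 * c with hc₀
    set C₁ := 2 * L + c₀ + 1 with hC₁
    have hL : (0 : ℝ) ≤ L := L.2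
    obtain ⟨ρ, B, β, hρ, hB, hβ, hβ1, hk⟩ := hh.krylov N hn hp (c₀ := c₀) (C₁ := C₁) (r' := min r (R / 8)) (by positivity)
      (by linarith) (hv.localSol (U := {x ∈ ball x₀ R | 0 < h x}) fun x hx => hpos x hx.1 hx.2) (by linarith)
      (by positivity) (fun x hx hx0 => by
        rw [hc₀, ← mul_assoc]
        norm_num
        exact hl x (ball_subset_ball (min_le_left _ _) hx) hx0) (fun x hx hx0 => by
        refine (hv.upper hh (fun x hx hx0 => (hhP x hx).2 hx0.le) h0 (ball_subset_ball (min_le_right _ _) hx) hx0).trans ?_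
        exact mul_le_mul_of_nonneg_right (by linarith) hx0.le)
    refine ⟨min (min ρ (R / 2)) 1, B + C₁ * H, β, by positivity, by have := hh.hnn; positivity, hβ, hβ1, fun q hq hq0 => ?_⟩
    have hq1 : q ∈ ball x₀ ρ := ball_subset_ball ((min_le_left _ _).trans (min_le_left _ _)) hq
    have hq2 : q ∈ ball x₀ (R / 2) := ball_subset_ball ((min_le_left _ _).trans (min_le_right _ _)) hq
    obtain ⟨κ, hκ0, hκ, hκy⟩ := hk q hq1 hq0
    refine ⟨-(κ • gradient h q), fun y hy hy0 => ?_⟩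
    have hyR := hqy hq2 (ball_subset_ball ((min_le_left _ _).trans (min_le_right _ _)) hy)
    have h1 : |1 - v y - κ * h y| ≤ B * ‖y - q‖ ^ (1 + β) := by
      rcases hy0.eq_or_lt with e | e
      · rw [hz y hyR e.symm, ← e]
        simp only [sub_self, mul_zero, abs_zero]
        positivity
      · exact hκy y (ball_subset_ball ((min_le_left _ _).trans (min_le_left _ _)) hy) e
    have h2 := hh.two q (ball_subset_ball (by linarith) hq2) y hyR
    have h3 := ball_subset_ball (min_le_right _ _) hy
    rw [mem_ball, dist_eq_norm] at h3
    have h4 : ‖y - q‖ ^ 2 ≤ ‖y - q‖ ^ (1 + β) := by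
      rw [← Real.rpow_natCast]
      exact Real.rpow_le_rpow_of_exponent_ge_of_imp (norm_nonneg _) h3.le (by push_cast; linarith) (fun _ h => by norm_num at h)
    have h5 : |κ * (h y - h q - ⟪gradient h q, y - q⟫)| ≤ C₁ * (H * ‖y - q‖ ^ (1 + β)) := by
      rw [abs_mul, abs_of_nonneg hκ0]
      exact mul_le_mul hκ (h2.trans (mul_le_mul_of_nonneg_left h4 hh.hnn)) (abs_nonneg _) (by linarith)
    rw [hq0, sub_zero] at h5
    rw [inner_neg_left, real_inner_smul_left, ← abs_neg]
    refine (le_of_eq ?_).trans ((abs_add_le _ _).trans ((add_le_add h1 h5).trans (by linarith)))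
    congr 1; ring

end BoundaryExpansion


section Global

variable {n : ℕ} {N : MinkowskiNorm n} {p : ℝ} {P : Set (En n)} {f : En n → ℝ}

theorem exists_uniform {K : Set (En n)} (hK : IsCompact K) {Q : ℝ → En n → Prop}
    (hQ : ∀ (ρ ρ' : ℝ) (x : En n), 0 < ρ' → ρ' ≤ ρ → ρ ≤ 1 → Q ρ x → Q ρ' x)
    (h : ∀ x ∈ K, ∃ ρ r : ℝ, 0 < ρ ∧ ρ ≤ 1 ∧ 0 < r ∧ ∀ y ∈ K, y ∈ ball x r → Q ρ y) :
    ∃ ρ : ℝ, 0 < ρ ∧ ρ ≤ 1 ∧ ∀ x ∈ K, Q ρ x := by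
  refine hK.induction_on (p := fun s => ∃ ρ : ℝ, 0 < ρ ∧ ρ ≤ 1 ∧ ∀ x ∈ s, Q ρ x)
    ⟨1, one_pos, le_rfl, fun x hx => hx.elim⟩ (fun s t hst ⟨ρ, h1, h2, h3⟩ => ⟨ρ, h1, h2, fun x hx => h3 x (hst hx)⟩)
    (fun s t ⟨ρ, h1, h2, h3⟩ ⟨ρ', h1', h2', h3'⟩ => ⟨min ρ ρ', lt_min h1 h1', (min_le_left _ _).trans h2, fun x hx =>
      hx.elim (fun hx => hQ _ _ x (lt_min h1 h1') (min_le_left _ _) h2 (h3 x hx)) fun hx =>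
        hQ _ _ x (lt_min h1 h1') (min_le_right _ _) h2' (h3' x hx)⟩) fun x hx => ?_
  obtain ⟨ρ, r, h1, h2, h3, h4⟩ := h x hx
  exact ⟨_, inter_mem self_mem_nhdsWithin (mem_nhdsWithin_of_mem_nhds (ball_mem_nhds x h3)), ρ, h1, h2,
    fun y hy => h4 y hy.1 hy.2⟩

theorem exists_frontier_chart (hf : ContDiff ℝ 2 f) (hP : P = {x | 0 ≤ f x})
    (hg : ∀ x ∈ frontier P, gradient f x ≠ 0) {x₀ : En n} (hx₀ : x₀ ∈ frontier P) :
    ∃ (h : En n → ℝ) (ν : En n) (R H : ℝ), Chart h x₀ ν R H ∧ (∀ x ∈ ball x₀ R, x ∈ P ↔ h x ≤ 0) ∧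
      (∀ x ∈ frontier P, x ∈ ball x₀ R → h x = 0) ∧ ∀ x ∈ closure Pᶜ, x ∈ ball x₀ R → 0 ≤ h x := by
  obtain ⟨h, ν, R, H, c, hh, hc, he⟩ := exists_chart hf (hg x₀ hx₀)
  refine ⟨h, ν, R, H, hh, fun x hx => ?_, fun x hx hxR => ?_, fun x hx hxR => ?_⟩
  · rw [hP, he x hx, mem_ofPred_eq, neg_mul, neg_nonpos, mul_nonneg_iff_of_pos_left hc]
  · rw [hP] at hx
    rw [he x hxR, ← frontier_le_subset_eq continuous_const hf.continuous hx, mul_zero]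
  · have : f x ≤ 0 := closure_lt_subset_le hf.continuous continuous_const (by
      simpa [hP, compl_ofPred] using hx)
    rw [he x hxR]
    nlinarith

theorem exists_interior_ball (hf : ContDiff ℝ 2 f) (hP : P = {x | 0 ≤ f x}) (hPc : IsCompact P)
    (hg : ∀ x ∈ frontier P, gradient f x ≠ 0) :
    ∃ ρ : ℝ, 0 < ρ ∧ ∀ x ∈ frontier P, ∃ y, ‖x - y‖ ≤ ρ ∧ closedBall y ρ ⊆ P := by
  obtain ⟨ρ, hρ, -, h⟩ := exists_uniform (hPc.of_isClosed_subset isClosed_frontier hPc.isClosed.frontier_subset)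
    (Q := fun ρ x => ∀ ρ' : ℝ, 0 < ρ' → ρ' ≤ ρ → ∃ y, ‖x - y‖ ≤ ρ' ∧ closedBall y ρ' ⊆ P)
    (fun ρ ρ' x _ h2 _ h a ha ha' => h a ha (ha'.trans h2)) fun x₀ hx₀ => by
    obtain ⟨h, ν, R, H, hh, h1, h2, -⟩ := exists_frontier_chart hf hP hg hx₀
    have hR := hh.pos
    have hH := hh.hnn
    refine ⟨min (min (R / 8) (1 / (4 * (H + 1)))) 1, R / 2, by positivity, min_le_right _ _, by positivity,
      fun x hx hxR a ha ha' => ?_⟩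
    have hxR' := ball_subset_ball (by linarith) hxR (ε₂ := R)
    obtain ⟨g1, g2, -⟩ := hh.norm_gradient hxR'
    have g0 : 0 < ‖gradient h x‖ := by linarith
    have ha1 : a ≤ R / 8 := ha'.trans ((min_le_left _ _).trans (min_le_left _ _))
    have ha2 : a ≤ 1 / (4 * (H + 1)) := ha'.trans ((min_le_left _ _).trans (min_le_right _ _))
    rw [le_div_iff₀ (by positivity)] at ha2
    set y := x + (-1 * (a / ‖gradient h x‖)) • gradient h x with hy
    have hxy : ‖x - y‖ = a := by
      rw [hy, sub_add_cancel_left, norm_neg, norm_smul, norm_mul, norm_neg, norm_one, one_mul, norm_div, norm_norm,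
        div_mul_cancel₀ _ g0.ne', Real.norm_of_nonneg ha.le]
    refine ⟨y, hxy.le, fun z hz => ?_⟩
    have hzx : z ∈ ball x₀ R := by
      rw [mem_closedBall] at hz
      rw [mem_ball] at hxR ⊢
      rw [← dist_eq_norm, dist_comm] at hxy
      linarith [dist_triangle4 z y x x₀]
    refine (h1 z hzx).2 ?_
    by_cases hzx' : z = x
    · rw [hzx', h2 x hx hxR']
    · rw [mem_closedBall, dist_eq_norm] at hz
      have := hh.tangent_ball hxR' hzx (h2 x hx hxR') (t := a / ‖gradient h x‖) (σ := -1) (by positivity) (by simp) (by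
        rw [mul_div_assoc', div_mul_eq_mul_div, div_lt_one g0]
        linarith) hzx' (by rwa [div_mul_cancel₀ _ g0.ne'])
      linarith
  exact ⟨ρ, hρ, fun x hx => h x hx ρ hρ le_rfl⟩

/-- First-order data of `v` along the boundary of the obstacle `P`, with exterior corkscrew balls. -/
structure BoundaryData (P : Set (En n)) (v : En n → ℝ) (β : ℝ) (G : En n → En n) : Prop where
  pos : 0 < β
  le_one : β ≤ 1
  expansion : ∀ q ∈ frontier P, ∀ y ∈ closure Pᶜ, ‖y - q‖ < β → |v y - 1 - ⟪G q, y - q⟫| ≤ β⁻¹ * ‖y - q‖ ^ (1 + β)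
  corkscrew : ∀ q ∈ frontier P, ∀ s : ℝ, 0 < s → s ≤ β → ∃ z, ∀ y, ‖y - z‖ < s / 2 → y ∉ P ∧ ‖y - q‖ < 2 * s

theorem Capacitary.boundaryData {L : ℝ≥0} {C α : ℝ} {v : En n → ℝ} (hv : Capacitary N p P L C α v) (hn : 2 ≤ n) (hp : 1 < p)
    (hf : ContDiff ℝ 2 f) (hP : P = {x | 0 ≤ f x}) (hPc : IsCompact P)
    (hg : ∀ x ∈ frontier P, gradient f x ≠ 0) : ∃ β G, BoundaryData P v β G := by
  obtain ⟨β, hβ, hβ1, h⟩ := exists_uniform (hPc.of_isClosed_subset isClosed_frontier hPc.isClosed.frontier_subset)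
    (Q := fun β q => (∃ g : En n, ∀ y ∈ closure Pᶜ, ‖y - q‖ < β → |v y - 1 - ⟪g, y - q⟫| ≤ β⁻¹ * ‖y - q‖ ^ (1 + β)) ∧
      ∀ s : ℝ, 0 < s → s ≤ β → ∃ z, ∀ y, ‖y - z‖ < s / 2 → y ∉ P ∧ ‖y - q‖ < 2 * s) (fun β b q hb hbβ hβ1 ⟨⟨g, hg⟩, h⟩ =>
      ⟨⟨g, fun y hy hyq => (hg y hy (hyq.trans_le hbβ)).trans (by
        gcongr ?_ * ?_
        · exact inv_anti₀ hb hbβ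
        · exact Real.rpow_le_rpow_of_exponent_ge_of_imp (norm_nonneg _) (by linarith) (by linarith)
            (fun _ h => by linarith))⟩, fun s hs hsb => h s hs (hsb.trans hbβ)⟩) fun x₀ hx₀ => by
    obtain ⟨h, ν, R, H, hh, h1, h2, h3⟩ := exists_frontier_chart hf hP hg hx₀
    have hR := hh.pos
    obtain ⟨ρ, B, β, hρ, hB, hβ, hβ1, hk⟩ := hv.boundary hn hp hPc.isClosed hh h1 (h2 x₀ hx₀ (mem_ball_self hR))
    set b := min (min (min ρ (R / 4)) β) (B + 1)⁻¹ with hb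
    have hb0 : 0 < b := by positivity
    have hbρ : b ≤ ρ := (min_le_left _ _).trans ((min_le_left _ _).trans (min_le_left _ _))
    have hbR : b ≤ R / 4 := (min_le_left _ _).trans ((min_le_left _ _).trans (min_le_right _ _))
    have hbβ : b ≤ β := (min_le_left _ _).trans (min_le_right _ _)
    have hbB : B + 1 ≤ b⁻¹ := le_inv_of_le_inv₀ hb0 (min_le_right _ _)
    refine ⟨b, b, hb0, hbβ.trans hβ1, hb0, fun q hq hqb => ?_⟩
    rw [mem_ball] at hqb
    have hqR : q ∈ ball x₀ R := mem_ball.2 (by linarith)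
    have hyR : ∀ y : En n, ‖y - q‖ < 2 * b → y ∈ ball x₀ R := fun y hy => by
      rw [← dist_eq_norm] at hy
      exact mem_ball.2 (by linarith [dist_triangle y q x₀])
    obtain ⟨g, hg⟩ := hk q (mem_ball.2 (by linarith)) (h2 q hq hqR)
    refine ⟨⟨g, fun y hy hyq => (hg y (mem_ball.2 (by rw [dist_eq_norm]; linarith)) (h3 y hy (hyR y (by linarith)))).trans ?_⟩,
      fun s hs hsb => ⟨q + s • ν, fun y hy => ?_⟩⟩
    · gcongr ?_ * ?_
      · linarith
      · exact Real.rpow_le_rpow_of_exponent_ge_of_imp (norm_nonneg _) (by linarith) (by linarith)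
          (fun _ h => by linarith)
    · have := norm_add_le (y - (q + s • ν)) (s • ν)
      rw [norm_smul, hh.unit, Real.norm_of_nonneg hs.le, show y - (q + s • ν) + s • ν = y - q by abel] at this
      have hy' := hyR y (by linarith)
      have := hh.corkscrew hqR hy' hs hy.le
      rw [h2 q hq hqR] at this
      exact ⟨fun hyP => by linarith [(h1 y hy').1 hyP], by linarith⟩
  choose! G hG using fun q hq => (h q hq).1
  exact ⟨β, G, hβ, hβ1, hG, fun q hq => (h q hq).2⟩

end Global


section Whitney

variable {n : ℕ} {N : MinkowskiNorm n} {p : ℝ} {P : Set (En n)} {L : ℝ≥0} {C α β : ℝ} {v : En n → ℝ}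
  {G : En n → En n}

theorem norm_mul_le_of_affine {a z : En n} {s b E : ℝ} (hs : 0 < s) (h : ∀ y, ‖y - z‖ < s → |⟪a, y⟫ + b| ≤ E) :
    ‖a‖ * s ≤ 4 * E := by
  have h0 := h z (by simpa using hs)
  rcases (norm_nonneg a).eq_or_lt with e | e
  · rw [← e]; linarith [abs_nonneg (⟪a, z⟫ + b)]
  · have h1 := h (z + (s / 2 / ‖a‖) • a) (by
      rw [add_sub_cancel_left, norm_smul, Real.norm_of_nonneg (by positivity), div_mul_cancel₀ _ e.ne']; linarith)
    rw [inner_add_right, inner_smul_right, real_inner_self_eq_norm_sq, show s / 2 / ‖a‖ * ‖a‖ ^ 2 = ‖a‖ * s / 2 by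
      field_simp] at h1
    linarith [(abs_le.1 h0).1, (abs_le.1 h1).2]

theorem exists_nearest (hP : IsClosed P) (hne : P.Nonempty) {x : En n} (hx : x ∉ P) :
    ∃ d : ℝ, 0 < d ∧ ∃ q ∈ frontier P, ‖x - q‖ ≤ d ∧ ∀ y ∈ P, d ≤ ‖y - x‖ := by
  obtain ⟨y, hy, hxy⟩ := hP.exists_infDist_eq_dist hne x
  obtain ⟨q, hq, h⟩ := exists_frontier_norm_sub_le hy hx
  refine ⟨infDist x P, (hP.notMem_iff_infDist_pos hne).1 hx, q, hq, by rwa [hxy, dist_eq_norm], fun z hz => ?_⟩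
  rw [norm_sub_rev, ← dist_eq_norm]
  exact infDist_le_dist_of_mem hz

theorem mem_frontier_of_mem (hP : IsClosed P) {x : En n} (hx : x ∈ closure Pᶜ) (hxP : x ∈ P) : x ∈ frontier P := by
  rw [frontier_eq_closure_inter_closure, hP.closure_eq]
  exact ⟨hxP, hx⟩

theorem BoundaryData.exists_ball (bd : BoundaryData P v β G) (hP : IsClosed P) (hne : P.Nonempty) {x : En n}
    (hx : x ∈ closure Pᶜ) {s : ℝ} (hs : 0 < s) (hsβ : s ≤ β) : ∃ z, ∀ y, ‖y - z‖ < s / 2 → y ∉ P ∧ ‖y - x‖ < 3 * s := by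
  by_cases hxP : x ∈ P
  · obtain ⟨z, hz⟩ := bd.corkscrew x (mem_frontier_of_mem hP hx hxP) s hs hsβ
    exact ⟨z, fun y hy => ⟨(hz y hy).1, by linarith [(hz y hy).2]⟩⟩
  · obtain ⟨d, hd, q, hq, hxq, hdP⟩ := exists_nearest hP hne hxP
    by_cases hds : s / 2 ≤ d
    · exact ⟨x, fun y hy => ⟨fun hyP => by linarith [hdP y hyP], by linarith⟩⟩
    · obtain ⟨z, hz⟩ := bd.corkscrew q hq s hs hsβ
      refine ⟨z, fun y hy => ⟨(hz y hy).1, ?_⟩⟩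
      rw [norm_sub_rev] at hxq
      linarith [(hz y hy).2, norm_sub_le_norm_sub_add_norm_sub y q x]

theorem Capacitary.gradient_sub_le (hv : Capacitary N p P L C α v) (bd : BoundaryData P v β G) (hC : 0 ≤ C) (hα : 0 < α)
    (hα1 : α ≤ 1) {x q : En n} {d : ℝ} (hd : 0 < d) (hq : q ∈ frontier P) (hxq : ‖x - q‖ ≤ d) (hdP : ∀ y ∈ P, d ≤ ‖y - x‖)
    (hdβ : 2 * d < β) : ‖G q - gradient v x‖ ≤ (4 * C + 160 / β) * d ^ (β / 2 * α) := by
  have hβ := bd.pos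
  have hβ1 := bd.le_one
  have hd1 : d ≤ 1 := by linarith
  set s := d ^ (1 + β / 2) / 8 with hs
  have hs0 : 0 < s := by positivity
  have hsd : s ≤ d * d ^ (β / 2) := by rw [hs, Real.rpow_add hd, Real.rpow_one]; linarith [show 0 < d * d ^ (β / 2) by positivity]
  have hd2 : d ^ (β / 2) ≤ 1 := Real.rpow_le_one hd.le hd1 (by positivity)
  have hsd' : s ≤ d / 8 := by rw [hs, Real.rpow_add hd, Real.rpow_one]; nlinarith
  have hmem : ∀ y : En n, ‖y - x‖ < d → y ∈ closure Pᶜ := fun y hy => subset_closure fun hyP => (hdP y hyP).not_gt hy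
  have hdε : d ^ (1 + β) ≤ 8 * s * d ^ (β / 2 * α) := by
    rw [hs, mul_div_cancel₀ _ (by norm_num), ← Real.rpow_add hd]
    exact Real.rpow_le_rpow_of_exponent_ge hd hd1 (by nlinarith)
  have hx := bd.expansion q hq x (hmem x (by simpa using hd)) (by linarith)
  have hx' : ‖x - q‖ ^ (1 + β) ≤ d ^ (1 + β) := by gcongr
  have key := norm_mul_le_of_affine (a := G q - gradient v x) (z := x) (s := s) (b := -⟪G q - gradient v x, x⟫)
    (E := C * s * d ^ (β / 2 * α) + β⁻¹ * 5 * d ^ (1 + β)) hs0 fun y hy => by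
      have h1 := (hv.expansion x d hd hdP).2 y (by linarith)
      have hyq : ‖y - q‖ ≤ 2 * d := by linarith [norm_sub_le_norm_sub_add_norm_sub y x q]
      have h2 := bd.expansion q hq y (hmem y (by linarith)) (by linarith)
      have h3 : ‖y - q‖ ^ (1 + β) ≤ 4 * d ^ (1 + β) := by
        refine (Real.rpow_le_rpow (norm_nonneg _) hyq (by linarith)).trans ?_
        rw [Real.mul_rpow two_pos.le hd.le]
        gcongr
        refine (Real.rpow_le_rpow_of_exponent_le one_le_two (by linarith : 1 + β ≤ 2)).trans (by norm_num)
      have h4 : C / d ^ α * ‖y - x‖ ^ (1 + α) ≤ C * s * d ^ (β / 2 * α) := by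
        calc _ ≤ C / d ^ α * (s * (d * d ^ (β / 2)) ^ α) := by
              gcongr
              rw [Real.rpow_add_of_nonneg (norm_nonneg _) zero_le_one hα.le, Real.rpow_one]
              gcongr
              linarith
          _ = _ := by
              rw [Real.mul_rpow hd.le (by positivity), ← Real.rpow_mul hd.le]
              field_simp
      have h5 : ⟪G q - gradient v x, y⟫ + -⟪G q - gradient v x, x⟫ = (v y - v x - ⟪gradient v x, y - x⟫) -
          (v y - 1 - ⟪G q, y - q⟫) + (v x - 1 - ⟪G q, x - q⟫) := by
        simp only [inner_sub_left, inner_sub_right]; ring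
      rw [h5]
      refine (abs_add_le _ _).trans ((add_le_add_left (abs_sub _ _) _).trans ?_)
      have := mul_le_mul_of_nonneg_left (add_le_add hx' h3) (inv_pos.2 hβ).le
      linarith
  refine le_of_mul_le_mul_right (key.trans ?_) hs0
  have := mul_le_mul_of_nonneg_left hdε (inv_pos.2 hβ).le
  rw [div_eq_mul_inv 160]
  linarith

theorem Capacitary.expansion_all (hv : Capacitary N p P L C α v) (bd : BoundaryData P v β G) (hP : IsClosed P)
    (hne : P.Nonempty) (hC : 0 ≤ C) (hα : 0 < α) (hα1 : α ≤ 1) : ∃ t₀ C' γ : ℝ, 0 < t₀ ∧ 0 ≤ C' ∧ 0 < γ ∧ γ ≤ 1 ∧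
      ∀ x ∉ P, ∀ y ∈ closure Pᶜ, ‖y - x‖ < t₀ → |v y - v x - ⟪gradient v x, y - x⟫| ≤ C' * ‖y - x‖ ^ (1 + γ) := by
  have hβ := bd.pos
  have hβ1 := bd.le_one
  refine ⟨(β / 32) ^ (1 + β / 2), C + 200 / β + 8 * (4 * C + 160 / β), β / 2 * α / (1 + β / 2), by positivity, by positivity,
    by positivity, by rw [div_le_one (by positivity)]; nlinarith, fun x hx y hy hxy => ?_⟩
  obtain ⟨d, hd, q, hq, hxq, hdP⟩ := exists_nearest hP hne hx
  rcases (norm_nonneg (y - x)).eq_or_lt with e | ht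
  · rw [norm_eq_zero.1 e.symm, sub_eq_zero.1 (norm_eq_zero.1 e.symm), sub_self, inner_zero_right, sub_zero, abs_zero]
    positivity
  set t := ‖y - x‖ with htdef
  set T := t ^ (1 + β / 2)⁻¹ with hT
  have hT0 : 0 < T := by positivity
  have htT : t = T ^ (1 + β / 2) := by rw [hT, Real.rpow_inv_rpow ht.le (by positivity)]
  have hT1 : T < β / 32 := by rw [htT] at hxy; exact (Real.rpow_lt_rpow_iff hT0.le (by positivity) (by positivity)).1 hxy
  have htT' : t = T * T ^ (β / 2) := by rw [htT, Real.rpow_add hT0, Real.rpow_one]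
  have hTβ : T ^ (β / 2) ≤ 1 := Real.rpow_le_one hT0.le (by linarith) (by positivity)
  have htle : t ≤ T := by rw [htT']; nlinarith
  have hgoal : t ^ (1 + β / 2 * α / (1 + β / 2)) = t * T ^ (β / 2 * α) := by
    rw [Real.rpow_add ht, Real.rpow_one]
    congr 1
    rw [hT, ← Real.rpow_mul ht.le]
    congr 1; field_simp
  rw [hgoal]
  have hX : 0 < t * T ^ (β / 2 * α) := by positivity
  by_cases hc : 8 * T ≤ d
  · refine ((hv.expansion x d hd hdP).2 y (by linarith)).trans ?_
    calc _ ≤ C / T ^ α * (t * (T * T ^ (β / 2)) ^ α) := by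
          rw [← htdef, Real.rpow_add ht, Real.rpow_one, ← htT']
          gcongr
          linarith
      _ = C * (t * T ^ (β / 2 * α)) := by
          rw [Real.mul_rpow hT0.le (by positivity), ← Real.rpow_mul hT0.le]
          field_simp
      _ ≤ _ := by
          gcongr
          have : 0 ≤ 200 / β + 8 * (4 * C + 160 / β) := by positivity
          linarith
  · push Not at hc
    have h1 := hv.gradient_sub_le bd hC hα hα1 hd hq hxq hdP (by linarith)
    have hyq : ‖y - q‖ ≤ 9 * T := by linarith [norm_sub_le_norm_sub_add_norm_sub y x q]
    have hxq' : ‖x - q‖ ≤ 9 * T := by linarith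
    have h9 : ∀ z : En n, ‖z - q‖ ≤ 9 * T → ‖z - q‖ ^ (1 + β) ≤ 100 * (t * T ^ (β / 2 * α)) := fun z hz => by
      refine (Real.rpow_le_rpow (norm_nonneg _) hz (by linarith)).trans ?_
      rw [Real.mul_rpow (by norm_num) hT0.le, htT, ← Real.rpow_add hT0]
      gcongr ?_ * ?_
      · exact (Real.rpow_le_rpow_of_exponent_le (by norm_num) (by linarith : 1 + β ≤ 2)).trans (by norm_num)
      · exact Real.rpow_le_rpow_of_exponent_ge hT0 (by linarith) (by nlinarith)
    have h2 := (bd.expansion q hq y hy (by linarith)).trans (mul_le_mul_of_nonneg_left (h9 y hyq) (inv_pos.2 hβ).le)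
    have h3 := (bd.expansion q hq x (subset_closure hx) (by linarith)).trans
      (mul_le_mul_of_nonneg_left (h9 x hxq') (inv_pos.2 hβ).le)
    have h4 : |⟪G q - gradient v x, y - x⟫| ≤ (4 * C + 160 / β) * (8 * T ^ (β / 2 * α)) * t := by
      refine (abs_real_inner_le_norm _ _).trans (mul_le_mul_of_nonneg_right (h1.trans ?_) ht.le)
      gcongr
      refine (Real.rpow_le_rpow hd.le hc.le (by positivity)).trans ?_
      rw [Real.mul_rpow (by norm_num) hT0.le]
      gcongr
      exact (Real.rpow_le_rpow_of_exponent_le (by norm_num) (by nlinarith : β / 2 * α ≤ 1)).trans (by norm_num)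
    have h5 : v y - v x - ⟪gradient v x, y - x⟫ = (v y - 1 - ⟪G q, y - q⟫) - (v x - 1 - ⟪G q, x - q⟫) +
        ⟪G q - gradient v x, y - x⟫ := by
      simp only [inner_sub_left, inner_sub_right]; ring
    rw [h5]
    refine (abs_add_le _ _).trans ((add_le_add_left (abs_sub _ _) _).trans ?_)
    have : 0 ≤ C * (t * T ^ (β / 2 * α)) := by positivity
    rw [div_eq_mul_inv 160] at *
    rw [div_eq_mul_inv 200]
    linarith

end Whitney


section Uniqueness

variable {n : ℕ} {N : MinkowskiNorm n} {p : ℝ} {Ω : Set (En n)} {v w : En n → ℝ}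

theorem setIntegral_flux_eq (hp : 1 < p) {f ψ : En n → ℝ} (hψ : tsupport ψ ⊆ Ω)
    (h : ∀ x ∈ tsupport ψ, gradient f x = gradient w x) :
    ∫ x in Ω, N.F (gradient w x) ^ (p - 1) * ⟪gradient N.F (gradient w x), gradient ψ x⟫ =
      ∫ x, ⟪flux N p 0 (gradient f x), gradient ψ x⟫ := by
  simp_rw [F_rpow_mul_gradient N p hp]
  rw [setIntegral_eq_integral_of_forall_compl_eq_zero fun x hx => by
    rw [gradient_eq_zero_of_notMem_tsupport fun h => hx (hψ h), inner_zero_right]]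
  congr 1 with x
  by_cases hx : x ∈ tsupport ψ
  · rw [h x hx]
  · rw [gradient_eq_zero_of_notMem_tsupport hx, inner_zero_right, inner_zero_right]

theorem integral_flux_eq_zero (hw : IsWeakPHarmonic N Ω p w) (hp : 1 < p) {f φ : En n → ℝ} {L K : ℝ≥0}
    (hf : LipschitzWith L f) (hφ : LipschitzWith K φ) (hc : HasCompactSupport φ) {U : Set (En n)} (hU : IsOpen U)
    (hφU : tsupport φ ⊆ U) (hUΩ : U ⊆ Ω) (heq : ∀ x ∈ U, gradient f x = gradient w x) :
    ∫ x, ⟪flux N p 0 (gradient f x), gradient φ x⟫ = 0 := by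
  obtain ⟨δ, hδ, hδU⟩ := hc.isCompact.exists_cthickening_subset_open hU hφU
  obtain ⟨C, hC0, hC⟩ := exists_flux_bound N 0 hp L
  have hcpt := hc.isCompact.cthickening (r := 1)
  have hlim : Tendsto (fun k => ∫ x, ⟪flux N p 0 (gradient f x), gradient (mollify φ k) x⟫) atTop
      (𝓝 (∫ x, ⟪flux N p 0 (gradient f x), gradient φ x⟫)) := by
    refine tendsto_integral_of_dominated_convergence ((cthickening 1 (tsupport φ)).indicator fun _ => C * K)
      (fun k => ((measurable_flux_gradient N 0 hp f).inner (measurable_gradient _)).aestronglyMeasurable)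
      ((integrable_indicator_iff isClosed_cthickening.measurableSet).2
        (integrableOn_const hcpt.measure_lt_top.ne)) (fun k => Eventually.of_forall fun x => ?_)
      ((ae_tendsto_gradient_mollify hφ).mono fun x hx => tendsto_const_nhds.inner hx)
    by_cases hx : x ∈ cthickening 1 (tsupport φ)
    · rw [indicator_of_mem hx]
      exact (norm_inner_le_norm _ _).trans (mul_le_mul (hC _ (norm_gradient_le hf x))
        (norm_gradient_le (lipschitz_mollify hφ k) x) (norm_nonneg _) hC0)
    · rw [indicator_of_notMem hx, gradient_eq_zero_of_notMem_tsupport fun h => hx (cthickening_mono (by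
        rw [div_le_one (by positivity)]; linarith [show (0 : ℝ) ≤ k by positivity]) _ (tsupport_mollify φ k h)),
        inner_zero_right, norm_zero]
  refine tendsto_nhds_unique hlim (tendsto_const_nhds.congr' ?_)
  filter_upwards [tendsto_one_div_add_atTop_nhds_zero_nat.eventually (ge_mem_nhds hδ)] with k hk
  have hs : tsupport (mollify φ k) ⊆ U := (tsupport_mollify φ k).trans ((cthickening_mono hk _).trans hδU)
  rw [← setIntegral_flux_eq hp (hs.trans hUΩ) fun x hx => heq x (hs hx)]
  exact (hw _ ⟨contDiff_mollify hφ.continuous k, hasCompactSupport_mollify hc k, hs.trans hUΩ⟩).symm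

theorem le_of_isWeakPHarmonic (hp : 1 < p) (hΩ : IsOpen Ω) (hne : Ωᶜ.Nonempty) (hv : ContDiffOn ℝ 1 v (closure Ω))
    (hw : ContDiffOn ℝ 1 w (closure Ω)) (hvw : IsWeakPHarmonic N Ω p v) (hww : IsWeakPHarmonic N Ω p w)
    (hb : ∀ x ∈ frontier Ω, w x = v x) (hv0 : Tendsto v (cocompact (En n)) (𝓝 0))
    (hw0 : Tendsto w (cocompact (En n)) (𝓝 0)) {x : En n} (hx : x ∈ closure Ω) : w x ≤ v x := by
  refine le_of_forall_pos_le_add fun δ hδ => ?_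
  set E := {x ∈ closure Ω | δ ≤ w x - v x} with hE
  have hEc : IsCompact E := by
    have hcl : IsClosed E := (hw.continuousOn.sub hv.continuousOn).preimage_isClosed_of_isClosed isClosed_closure isClosed_Ici
    have h0 : ∀ᶠ x in cocompact (En n), w x - v x < δ := by
      have := hw0.sub hv0
      rw [sub_zero] at this
      exact this.eventually (gt_mem_nhds hδ)
    obtain ⟨K, hK, hKE⟩ := mem_cocompact.1 h0
    exact hK.of_isClosed_subset hcl fun x hx => by
      by_contra hxK
      exact (not_lt.2 hx.2) (hKE hxK)
  have hEΩ : E ⊆ Ω := fun x hx => by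
    by_contra hxΩ
    have := hx.2
    rw [hb x (by rw [hΩ.frontier_eq]; exact ⟨hx.1, hxΩ⟩), sub_self] at this
    exact this.not_gt hδ
  obtain ⟨χ, hχ, hχc, hχΩ, hχ1, hχ01⟩ := exists_smooth_cutoff hEc hΩ hEΩ
  have hlip : ∀ u : En n → ℝ, ContDiffOn ℝ 1 u (closure Ω) → ∃ L, LipschitzWith L fun x => χ x * u x := fun u hu => by
    have hs : ContDiff ℝ 1 fun x => χ x * u x := contDiff_iff_contDiffAt.2 fun x => ?_
    · exact ContDiff.lipschitzWith_of_hasCompactSupport (HasCompactSupport.mul_right hχc) hs one_ne_zero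
    by_cases hxΩ : x ∈ tsupport χ
    · exact hχ.contDiffAt.mul (hu.contDiffAt (mem_of_superset (hΩ.mem_nhds (hχΩ hxΩ)) subset_closure))
    · refine contDiffAt_const (c := (0 : ℝ)) |>.congr_of_eventuallyEq ?_
      filter_upwards [notMem_tsupport_iff_eventuallyEq.1 hxΩ] with y hy
      rw [hy, Pi.zero_apply, zero_mul]
  obtain ⟨Lw, hLw⟩ := hlip w hw
  obtain ⟨Lv, hLv⟩ := hlip v hv
  set φ : En n → ℝ := fun x => max (χ x * w x - χ x * v x - δ) 0 with hφ
  have hφL : LipschitzWith (Lw + Lv) φ := (by simpa using (hLw.sub hLv).sub (LipschitzWith.const δ) :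
    LipschitzWith (Lw + Lv) fun x => χ x * w x - χ x * v x - δ).max_const 0
  have hφE : Function.support φ ⊆ E := fun y hy => by
    have h1 : δ < χ y * (w y - v y) := by
      by_contra hcon
      exact hy (max_eq_right (by linarith))
    have hyΩ : y ∈ tsupport χ := subset_tsupport χ fun h => by rw [h, zero_mul] at h1; linarith
    have h2 := hχ01 y
    exact ⟨subset_closure (hχΩ hyΩ), by nlinarith [h2.1, h2.2]⟩
  have hφE' : tsupport φ ⊆ E := closure_minimal hφE hEc.isClosed
  have hφc : HasCompactSupport φ := HasCompactSupport.of_support_subset_isCompact hEc hφE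
  have hgrad : ∀ (u : En n → ℝ), ∀ x ∈ interior {y | χ y = 1}, gradient (fun x => χ x * u x) x = gradient u x :=
    fun u x hx => by
      refine Filter.EventuallyEq.gradient_eq ?_
      filter_upwards [mem_interior_iff_mem_nhds.1 hx] with y hy
      rw [show χ y = 1 from hy, one_mul]
  have hint : interior {y | χ y = 1} ⊆ Ω := fun y hy => hχΩ (subset_tsupport χ (by
    have h1 : y ∈ {y | χ y = 1} := interior_subset hy
    exact (show χ y = 1 from h1).trans_ne one_ne_zero))
  have hsub : tsupport φ ⊆ interior {y | χ y = 1} := fun y hy => mem_interior_iff_mem_nhds.2 (hχ1 y (hφE' hy))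
  have hI : ∀ (u : En n → ℝ) (L : ℝ≥0), IsWeakPHarmonic N Ω p u → LipschitzWith L (fun x => χ x * u x) →
      ∫ x, ⟪flux N p 0 (gradient (fun x => χ x * u x) x), gradient φ x⟫ = 0 := fun u L hu hL =>
    integral_flux_eq_zero hu hp hL hφL hφc isOpen_interior hsub hint (hgrad u)
  obtain ⟨z, hz⟩ := hne
  have hφz : φ z = 0 := by
    by_contra h
    exact hz (hEΩ (hφE h))
  have h0 := posPart_eq_zero N 0 hp hLw hLv (fun x => rfl) hφc hφz (hI v Lv hvw hLv).ge (hI w Lw hww hLw).le x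
  by_contra! hcon
  have hxE : x ∈ E := ⟨hx, by linarith⟩
  simp only [(hχ1 x hxE).self_of_nhds, one_mul] at h0
  linarith [le_max_left (w x - v x - δ) 0]

end Uniqueness


section Existence

variable {n : ℕ} {N : MinkowskiNorm n} {p : ℝ} {P S : Set (En n)} {v : En n → ℝ} {g G : En n → En n}

theorem exists_extension (hS : IsClosed S) (hne : S.Nonempty) {t C γ : ℝ} (ht : 0 < t) (hC : 0 ≤ C) (hγ : 0 < γ)
    (h : ∀ x ∈ S, ∀ y ∈ S, ‖y - x‖ < t → |v y - v x - ⟪g x, y - x⟫| ≤ C * ‖y - x‖ ^ (1 + γ))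
    (hg : ∀ x ∈ S, ∀ y ∈ S, ‖y - x‖ < t → ‖g y - g x‖ ≤ C * ‖y - x‖ ^ γ) :
    ∃ u : En n → ℝ, (∀ x ∈ S, u x = v x) ∧ ∀ x ∈ S, HasGradientAt u (g x) x := by
  choose π hπ hd using fun y => hS.exists_infDist_eq_dist hne y
  have hle : ∀ y, ∀ x ∈ S, ‖y - π y‖ ≤ ‖y - x‖ := fun y x hx => by
    rw [← dist_eq_norm, ← dist_eq_norm, ← hd]
    exact infDist_le_dist_of_mem hx
  have hfix : ∀ x ∈ S, π x = x := fun x hx => by simpa [sub_eq_zero, eq_comm] using hle x x hx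
  refine ⟨fun y => v (π y) + ⟪g (π y), y - π y⟫, fun x hx => by simp [hfix x hx], fun x hx => ?_⟩
  refine hasGradientAt_of_expansion hγ (half_pos ht) (B := 2 * C * 2 ^ (1 + γ)) fun y hy => ?_
  have h1 := hle y x hx
  have h2 : ‖π y - x‖ ≤ 2 * ‖y - x‖ := by
    linarith [norm_sub_le_norm_sub_add_norm_sub (π y) y x, norm_sub_rev (π y) y]
  have h3 := h x hx (π y) (hπ y) (by linarith)
  have h4 := hg x hx (π y) (hπ y) (by linarith)
  have h5 := norm_nonneg (y - x)
  have e : v (π y) + ⟪g (π y), y - π y⟫ - (v (π x) + ⟪g (π x), x - π x⟫) - ⟪g x, y - x⟫ =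
      v (π y) - v x - ⟪g x, π y - x⟫ + ⟪g (π y) - g x, y - π y⟫ := by
    rw [hfix x hx, sub_self, inner_zero_right, inner_sub_left, ← sub_add_sub_cancel y (π y) x, inner_add_right]
    ring
  have h6 : ‖π y - x‖ ^ (1 + γ) ≤ (2 * ‖y - x‖) ^ (1 + γ) := Real.rpow_le_rpow (norm_nonneg _) h2 (by positivity)
  have h7 : ‖π y - x‖ ^ γ ≤ (2 * ‖y - x‖) ^ γ := Real.rpow_le_rpow (norm_nonneg _) h2 hγ.le
  have h8 : (2 * ‖y - x‖) ^ (1 + γ) = 2 * ‖y - x‖ * (2 * ‖y - x‖) ^ γ := by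
    rw [Real.rpow_add' (by positivity) (by positivity), Real.rpow_one]
  rw [e, mul_assoc, ← Real.mul_rpow (by positivity) h5]
  have h9 : |⟪g (π y) - g x, y - π y⟫| ≤ C * (2 * ‖y - x‖) ^ γ * ‖y - x‖ :=
    (abs_real_inner_le_norm _ _).trans (mul_le_mul (h4.trans (by gcongr)) h1 (norm_nonneg _) (by positivity))
  have h10 : 0 ≤ C * (‖y - x‖ * (2 * ‖y - x‖) ^ γ) := by positivity
  have h11 := mul_le_mul_of_nonneg_left h6 hC
  rw [h8] at h11 ⊢
  linarith [abs_add_le (v (π y) - v x - ⟪g x, π y - x⟫) ⟪g (π y) - g x, y - π y⟫]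

theorem BoundaryData.norm_gradient_sub_le {β : ℝ} (bd : BoundaryData P v β G) (hP : IsClosed P) (hne : P.Nonempty)
    {t C γ : ℝ} (hC : 0 ≤ C) (hγ : 0 ≤ γ) (hγ1 : γ ≤ 1) (htβ : t ≤ β)
    (h : ∀ x ∈ closure Pᶜ, ∀ y ∈ closure Pᶜ, ‖y - x‖ < t → |v y - v x - ⟪g x, y - x⟫| ≤ C * ‖y - x‖ ^ (1 + γ))
    {x y : En n} (hx : x ∈ closure Pᶜ) (hy : y ∈ closure Pᶜ) (hxy : ‖y - x‖ < t / 4) :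
    ‖g y - g x‖ ≤ 256 * C * ‖y - x‖ ^ γ := by
  rcases (norm_nonneg (y - x)).eq_or_lt with e | e
  · rw [sub_eq_zero.1 (norm_eq_zero.1 e.symm), sub_self, norm_zero]
    positivity
  set r := ‖y - x‖
  obtain ⟨z, hz⟩ := bd.exists_ball hP hne hx e (by linarith)
  have hr : (4 * r) ^ (1 + γ) ≤ 16 * (r * r ^ γ) := by
    rw [Real.mul_rpow (by norm_num) e.le, ← Real.rpow_one_add' e.le (by positivity)]
    gcongr
    exact (Real.rpow_le_rpow_of_exponent_le (by norm_num) (show 1 + γ ≤ 2 by linarith)).trans (by norm_num)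
  have h1 := norm_mul_le_of_affine (a := g y - g x) (z := z) (half_pos e)
    (b := v y - v x - ⟪g y, y⟫ + ⟪g x, x⟫) (E := 2 * (C * (16 * (r * r ^ γ)))) fun w hw => ?_
  · refine le_of_mul_le_mul_right (h1.trans (le_of_eq ?_)) (half_pos e)
    ring
  obtain ⟨hwP, hwx⟩ := hz w hw
  have hwS : w ∈ closure Pᶜ := subset_closure hwP
  have hwy : ‖w - y‖ < 4 * r := by
    have := norm_sub_le_norm_sub_add_norm_sub w x y
    rw [norm_sub_rev x y] at this
    linarith
  have h2 := (h x hx w hwS (by linarith)).trans (mul_le_mul_of_nonneg_left ((Real.rpow_le_rpow (norm_nonneg _)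
    (show ‖w - x‖ ≤ 4 * r by linarith) (by positivity)).trans hr) hC)
  have h3 := (h y hy w hwS (by linarith)).trans (mul_le_mul_of_nonneg_left ((Real.rpow_le_rpow (norm_nonneg _)
    hwy.le (by positivity)).trans hr) hC)
  rw [inner_sub_right] at h2 h3
  rw [inner_sub_left]
  rw [abs_le] at *
  constructor <;> linarith [h2.1, h2.2, h3.1, h3.2]

theorem Capacitary.exists_gradient_extension {L : ℝ≥0} {C α β : ℝ} (hv : Capacitary N p P L C α v)
    (bd : BoundaryData P v β G) (hP : IsClosed P) (hne : P.Nonempty) (hS : (closure Pᶜ).Nonempty) (hC : 0 ≤ C) (hα : 0 < α)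
    (hα1 : α ≤ 1) : ∃ u : En n → ℝ, (∀ x ∈ closure Pᶜ, u x = v x) ∧ C1LocHolderOn u (closure Pᶜ) := by
  classical
  obtain ⟨t, C', γ, ht, hC', hγ, hγ1, h⟩ := hv.expansion_all bd hP hne hC hα hα1
  have hβ := bd.pos
  set g : En n → En n := fun x => if x ∈ P then G x else gradient v x with hg
  set τ := min (min t β) 1 with hτ
  have hτt : τ ≤ t := (min_le_left _ _).trans (min_le_left _ _)
  have hτβ : τ ≤ β := (min_le_left _ _).trans (min_le_right _ _)
  have hτ1 : τ ≤ 1 := min_le_right _ _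
  have hτ0 : 0 < τ := lt_min (lt_min ht hβ) one_pos
  set D := C' + β⁻¹ with hD
  set σ := min γ β with hσ
  have hσ0 : 0 < σ := lt_min hγ hβ
  have hD0 : 0 ≤ D := by positivity
  have hpow : ∀ {r e c : ℝ}, 0 ≤ r → r < τ → σ ≤ e → 0 ≤ c → c ≤ D → c * r ^ (1 + e) ≤ D * r ^ (1 + σ) :=
    fun hr hrτ he hc hcD => mul_le_mul hcD (Real.rpow_le_rpow_of_exponent_ge' hr (by linarith) (by positivity)
      (by linarith)) (by positivity) hD0
  have hexp : ∀ x ∈ closure Pᶜ, ∀ y ∈ closure Pᶜ, ‖y - x‖ < τ →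
      |v y - v x - ⟪g x, y - x⟫| ≤ D * ‖y - x‖ ^ (1 + σ) := fun x hx y hy hxy => by
    by_cases hxP : x ∈ P
    · simp only [hg, if_pos hxP, hv.one x hxP]
      exact (bd.expansion x (mem_frontier_of_mem hP hx hxP) y hy (by linarith)).trans
        (hpow (norm_nonneg _) hxy (min_le_right _ _) (by positivity) (by linarith))
    · simp only [hg, if_neg hxP]
      exact (h x hxP y hy (by linarith)).trans
        (hpow (norm_nonneg _) hxy (min_le_left _ _) hC' (by rw [hD]; linarith [inv_pos.2 hβ]))
  have hhol : ∀ x ∈ closure Pᶜ, ∀ y ∈ closure Pᶜ, ‖y - x‖ < τ / 4 → ‖g y - g x‖ ≤ 256 * D * ‖y - x‖ ^ σ :=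
    fun x hx y hy hxy => bd.norm_gradient_sub_le hP hne hD0 hσ0.le ((min_le_left _ _).trans hγ1) hτβ hexp hx hy hxy
  obtain ⟨u, huv, hu⟩ := exists_extension (v := v) (g := g) isClosed_closure hS (t := τ / 4) (C := 256 * D) (by positivity)
    (by positivity) hσ0 (fun x hx y hy hxy => (hexp x hx y hy (by linarith)).trans
      (mul_le_mul_of_nonneg_right (by linarith) (by positivity))) hhol
  have hH : ∀ x, HolderOnWith (256 * D).toNNReal σ.toNNReal g (closure Pᶜ ∩ ball x (τ / 8)) := fun x y hy z hz => by
    have hyz : ‖y - z‖ < τ / 4 := by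
      rw [← dist_eq_norm]
      linarith [dist_triangle_right y z x, mem_ball.1 hy.2, mem_ball.1 hz.2]
    rw [edist_dist, edist_dist, dist_eq_norm, dist_eq_norm, ENNReal.ofReal_rpow_of_nonneg (norm_nonneg _) (by positivity),
      Real.coe_toNNReal _ hσ0.le, ← ENNReal.ofReal_coe_nnreal, Real.coe_toNNReal _ (by positivity),
      ← ENNReal.ofReal_mul (by positivity)]
    exact ENNReal.ofReal_le_ofReal (hhol z hz.1 y hy.1 hyz)
  have hnhds : ∀ x, closure Pᶜ ∩ ball x (τ / 8) ∈ 𝓝[closure Pᶜ] x := fun x =>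
    inter_mem_nhdsWithin _ (ball_mem_nhds x (by positivity))
  have hgc : ContinuousOn g (closure Pᶜ) := fun x hx =>
    (((hH x).continuousOn (Real.toNNReal_pos.2 hσ0)) x ⟨hx, mem_ball_self (by positivity)⟩).mono_of_mem_nhdsWithin (hnhds x)
  refine ⟨u, huv, ?_, fun x hx => ⟨σ.toNNReal, (256 * D).toNNReal, Real.toNNReal_pos.2 hσ0, by
    rw [Real.coe_toNNReal _ hσ0.le]; exact (min_le_left _ _).trans hγ1, _, hnhds x, fun y hy z hz => ?_⟩⟩
  · rw [show (1 : WithTop ℕ∞) = 0 + 1 by rfl]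
    refine (contDiffOn_succ_iff_hasFDerivWithinAt (by simp)).2 fun x hx => ⟨closure Pᶜ, by
      rw [insert_eq_of_mem hx]; exact self_mem_nhdsWithin, by simp, fun y => innerSL ℝ (g y), fun y hy =>
        ((hu y hy).hasFDerivAt).hasFDerivWithinAt, contDiffOn_zero.2 ((innerSL ℝ).continuous.comp_continuousOn hgc)⟩
  · simp only [(hu y hy.1).gradient, (hu z hz.1).gradient]
    exact hH x y hy z hz

theorem Capacitary.isWeakPHarmonic {L : ℝ≥0} {C α : ℝ} (hv : Capacitary N p P L C α v) (hp : 1 < p) (hP : IsClosed P)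
    {u : En n → ℝ} (huv : ∀ x ∉ P, u x = v x) : IsWeakPHarmonic N Pᶜ p u := fun ψ hψ => by
  obtain ⟨K, hK⟩ := ContDiff.lipschitzWith_of_hasCompactSupport hψ.2.1 hψ.1 (by simp)
  rw [setIntegral_flux_eq hp hψ.2.2 (f := v) fun x hx => Filter.EventuallyEq.gradient_eq (by
    filter_upwards [hP.isOpen_compl.mem_nhds (hψ.2.2 hx)] with y hy using (huv y hy).symm)]
  exact hv.weak K ψ hK hψ.2.1 fun x hx => image_eq_zero_of_notMem_tsupport fun h => hψ.2.2 h hx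

end Existence

end PCapacity

open PCapacity in
/-- For a Minkowski norm `F`, an open set `Ω` with smooth boundary and
bounded nonempty complement, and `1 < p < n`, there exists a unique positive
`C^{1,α}_loc` weak solution of `div(F(∇v)^{p-1} F_ξ(∇v)) = 0` in `Ω`, `v = 1` on `∂Ω`,
`v → 0` at infinity. -/
theorem statement5 (n : ℕ) (N : MinkowskiNorm n)
    (Ω : Set (En n)) (hΩ : IsOpen Ω) (hsb : HasSmoothBoundary Ω)
    (hbd : Bornology.IsBounded Ωᶜ) (hne : Ωᶜ.Nonempty)
    (p : ℝ) (hp1 : 1 < p) (hpn : p < n) :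
    ∃ v : En n → ℝ,
      ((∀ x ∈ closure Ω, 0 < v x) ∧ C1LocHolderOn v (closure Ω) ∧
        IsWeakPHarmonic N Ω p v ∧ (∀ x ∈ frontier Ω, v x = 1) ∧
        Tendsto v (cocompact (En n)) (𝓝 0)) ∧
      ∀ w : En n → ℝ,
        ((∀ x ∈ closure Ω, 0 < w x) ∧ C1LocHolderOn w (closure Ω) ∧
          IsWeakPHarmonic N Ω p w ∧ (∀ x ∈ frontier Ω, w x = 1) ∧
          Tendsto w (cocompact (En n)) (𝓝 0)) →
        ∀ x ∈ closure Ω, w x = v x := by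
  have huniq : ∀ v w : En n → ℝ, C1LocHolderOn v (closure Ω) → C1LocHolderOn w (closure Ω) → IsWeakPHarmonic N Ω p v →
      IsWeakPHarmonic N Ω p w → (∀ x ∈ frontier Ω, v x = 1) → (∀ x ∈ frontier Ω, w x = 1) →
      Tendsto v (cocompact (En n)) (𝓝 0) → Tendsto w (cocompact (En n)) (𝓝 0) → ∀ x ∈ closure Ω, w x ≤ v x :=
    fun v w hv hw hvw hww hv1 hw1 hv0 hw0 x hx => le_of_isWeakPHarmonic hp1 hΩ hne hv.1 hw.1 hvw hww
      (fun y hy => by rw [hv1 y hy, hw1 y hy]) hv0 hw0 hx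
  suffices h : ∃ v : En n → ℝ, (∀ x ∈ closure Ω, 0 < v x) ∧ C1LocHolderOn v (closure Ω) ∧
      IsWeakPHarmonic N Ω p v ∧ (∀ x ∈ frontier Ω, v x = 1) ∧ Tendsto v (cocompact (En n)) (𝓝 0) by
    obtain ⟨v, hv⟩ := h
    refine ⟨v, hv, fun w hw x hx => le_antisymm ?_ ?_⟩
    · exact huniq v w hv.2.1 hw.2.1 hv.2.2.1 hw.2.2.1 hv.2.2.2.1 hw.2.2.2.1 hv.2.2.2.2 hw.2.2.2.2 x hx
    · exact huniq w v hw.2.1 hv.2.1 hw.2.2.1 hv.2.2.1 hw.2.2.2.1 hv.2.2.2.1 hw.2.2.2.2 hv.2.2.2.2 x hx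
  have hn : 2 ≤ n := by
    have : (1 : ℝ) < n := hp1.trans hpn
    exact_mod_cast this
  obtain ⟨f, hf, hfΩ, hfg⟩ := hsb
  obtain ⟨P, rfl⟩ : ∃ P, Ω = Pᶜ := ⟨Ωᶜ, (compl_compl Ω).symm⟩
  rw [compl_compl] at hbd hne
  have hPcl : IsClosed P := isOpen_compl_iff.1 hΩ
  have hPc : IsCompact P := isCompact_of_isClosed_isBounded hPcl hbd
  have hP : P = {x | 0 ≤ f x} := by
    rw [← compl_compl P, hfΩ]
    ext x
    simp
  rw [frontier_compl] at hfg ⊢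
  have hg : ∀ x ∈ frontier P, gradient f x ≠ 0 := fun x hx h => hfg x hx (by
    rw [← norm_eq_zero, ← norm_gradient_eq, h, norm_zero])
  have hf2 : ContDiff ℝ 2 f := contDiff_infty.1 hf 2
  obtain ⟨ρ, hρ, hball⟩ := exists_interior_ball hf2 hP hPc hg
  obtain ⟨v, L, C, α, hC, hα, hα1, hv⟩ := exists_capacitary N hn hp1 hpn hPc hne hρ hball
  obtain ⟨β, G, bd⟩ := hv.boundaryData hn hp1 hf2 hP hPc hg
  have : Nontrivial (En n) := by
    have : Nonempty (Fin n) := ⟨⟨0, by omega⟩⟩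
    infer_instance
  have hS : (closure Pᶜ).Nonempty := by
    refine (nonempty_compl.2 fun h => ?_).closure
    exact NormedSpace.unbounded_univ ℝ (En n) (h ▸ hbd)
  obtain ⟨u, huv, hu⟩ := hv.exists_gradient_extension bd hPcl hne hS hC hα hα1
  refine ⟨u, fun x hx => by rw [huv x hx]; exact hv.pos x, hu,
    hv.isWeakPHarmonic hp1 hPcl fun x hx => huv x (subset_closure hx), fun x hx => ?_, hv.tendsto.congr' ?_⟩
  · rw [huv x (frontier_compl P ▸ frontier_subset_closure <| frontier_compl P ▸ hx), hv.one x (hPcl.frontier_subset hx)]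
  · filter_upwards [hPc.compl_mem_cocompact] with x hx using (huv x (subset_closure hx)).symm
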